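/- Let T be a universal theory in a first-order language L that is κ-unique for some uncountable cardinal κ. Then T is λ-unique for every uncountable cardinal λ; moreover, for every cardinal μ > max(|L|, ℵ₀), T has a model of cardinality μ and any two models of T of cardinality μ are isomorphic. -/

import Mathlib

open FirstOrder Language Cardinal

universe u

/-- `X` generates the `L`-structure `M`: the substructure generated by `X` is all of `M`. -/
def Generates (L : FirstOrder.Language.{u, u}) (M : Type u) [L.Structure M] (X : Set M) : Prop :=
  Substructure.closure L X = ⊤

/-- `M` is `μ`-generated: it is generated by a set of cardinality `μ`. -/
def IsGenerated (L : FirstOrder.Language.{u, u}) (M : Type u) [L.Structure M]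
    (μ : Cardinal.{u}) : Prop :=
  ∃ X : Set M, #X = μ ∧ Generates L M X

/-- `M` is strictly `μ`-generated: it is `μ`-generated but not `ν`-generated for any `ν < μ`. -/
def StrictlyGenerated (L : FirstOrder.Language.{u, u}) (M : Type u) [L.Structure M]
    (μ : Cardinal.{u}) : Prop :=
  IsGenerated L M μ ∧ ∀ ν < μ, ¬ IsGenerated L M ν

/-- A theory `T` is `κ`-unique: it has a strictly `κ`-generated model, and any two strictly
`κ`-generated models of `T` are isomorphic. -/
def KUnique {L : FirstOrder.Language.{u, u}} (T : L.Theory) (κ : Cardinal.{u}) : Prop :=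
  (∃ (M : Type u) (_ : L.Structure M), M ⊨ T ∧ StrictlyGenerated L M κ) ∧
  (∀ (M N : Type u) (_ : L.Structure M) (_ : L.Structure N),
    M ⊨ T → N ⊨ T → StrictlyGenerated L M κ → StrictlyGenerated L N κ →
      Nonempty (M ≃[L] N))

/-- A sentence is universal if it is of the form `∀ x₁ … ∀ xₙ, φ` with `φ` quantifier-free. -/
def IsUniversalSentence {L : FirstOrder.Language.{u, u}} (φ : L.Sentence) : Prop :=
  ∃ (n : ℕ) (ψ : L.BoundedFormula Empty n), ψ.IsQF ∧ φ = ψ.alls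

/-- A theory is universal if every sentence of it is universal. -/
def IsUniversalTheory {L : FirstOrder.Language.{u, u}} (T : L.Theory) : Prop :=
  ∀ φ ∈ T, IsUniversalSentence φ

set_option linter.unusedSectionVars false
set_option linter.unusedVariables false

namespace QFree

/-! ### Quantifier-free definable sets, semantically -/

section Calculus

variable (L : FirstOrder.Language.{u, u}) {M : Type u} [L.Structure M]

/-- The closure of a set under the functions of the structure. -/
def clos (P : Set M) : Set M := (Substructure.closure L P : Set M)

/-- Functions `(β → M) → M` given by terms with parameters from `P`. -/
inductive TF (P : Set M) (β : Type*) : ((β → M) → M) → Prop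
  | const (p : M) (hp : p ∈ P) : TF P β (fun _ => p)
  | var (i : β) : TF P β (fun x => x i)
  | func {n : ℕ} (f : L.Functions n) (g : Fin n → (β → M) → M) (hg : ∀ i, TF P β (g i)) :
      TF P β (fun x => Structure.funMap f (fun i => g i x))

/-- Subsets of `β → M` defined by quantifier-free formulas with parameters from `P`. -/
inductive QF (P : Set M) (β : Type*) : Set (β → M) → Prop
  | univ : QF P β Set.univ
  | eq (f g : (β → M) → M) (hf : TF L P β f) (hg : TF L P β g) : QF P β {x | f x = g x}
  | rel {n : ℕ} (R : L.Relations n) (g : Fin n → (β → M) → M) (hg : ∀ i, TF L P β (g i)) :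
      QF P β {x | Structure.RelMap R (fun i => g i x)}
  | compl (A : Set (β → M)) (hA : QF P β A) : QF P β Aᶜ
  | inter (A B : Set (β → M)) (hA : QF P β A) (hB : QF P β B) : QF P β (A ∩ B)

local notation "cl" => clos L

variable {L}

theorem subset_cl (P : Set M) : P ⊆ cl P := Substructure.subset_closure

theorem cl_mono {P Q : Set M} (h : P ⊆ Q) : cl P ⊆ cl Q := Substructure.closure_mono h

theorem cl_le {P Q : Set M} (h : P ⊆ cl Q) : cl P ⊆ cl Q :=
  Substructure.closure_le.2 h

@[simp] theorem cl_cl (P : Set M) : cl (cl P) = cl P :=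
  (cl_le subset_rfl).antisymm (subset_cl _)

theorem mem_cl {P : Set M} {x : M} (h : x ∈ P) : x ∈ cl P := subset_cl P h

variable {α β γ : Type*} {P Q : Set M}

theorem TF.mono (h : P ⊆ Q) {f : (β → M) → M} (hf : TF L P β f) : TF L Q β f := by
  induction hf with
  | const p hp => exact .const p (h hp)
  | var i => exact .var i
  | func f g _ ih => exact .func f g ih

theorem TF.const_cl {p : M} (hp : p ∈ cl P) : TF L P β (fun _ => p) := by
  refine Substructure.closure_induction (p := fun p => TF L P β (fun _ => p)) hp (fun x hx => .const x hx) ?_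
  intro n f x hx
  exact .func f (fun i _ => x i) hx

theorem TF.of_le (h : P ⊆ cl Q) {f : (β → M) → M} (hf : TF L P β f) : TF L Q β f := by
  induction hf with
  | const p hp => exact .const_cl (h hp)
  | var i => exact .var i
  | func f g _ ih => exact .func f g ih

theorem TF.comp {f : (α → M) → M} (hf : TF L P α f) {g : α → (β → M) → M}
    (hg : ∀ i, TF L P β (g i)) : TF L P β (fun x => f (fun i => g i x)) := by
  induction hf with
  | const p hp => exact .const p hp
  | var i => exact hg i
  | func f g _ ih => exact .func f _ ih

theorem funMap_mem_cl {n : ℕ} (f : L.Functions n) {x : Fin n → M} (hx : ∀ i, x i ∈ cl P) :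
    Structure.funMap f x ∈ cl P :=
  (Substructure.closure L P).fun_mem f x hx

theorem TF.mem_cl {f : (β → M) → M} (hf : TF L P β f) {x : β → M} (hPQ : P ⊆ cl Q)
    (hx : ∀ i, x i ∈ cl Q) : f x ∈ cl Q := by
  induction hf with
  | const p hp => exact hPQ hp
  | var i => exact hx i
  | func f g _ ih => exact funMap_mem_cl f ih

theorem exists_TF {c : γ → M} {y : M} (hy : y ∈ cl (P ∪ Set.range c)) :
    ∃ f, TF L P γ f ∧ f c = y := by
  refine Substructure.closure_induction (p := fun y => ∃ f, TF L P γ f ∧ f c = y) hy ?_ ?_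
  · rintro x (hx | ⟨i, rfl⟩)
    · exact ⟨_, .const x hx, rfl⟩
    · exact ⟨_, .var i, rfl⟩
  · intro n f x hx
    choose g hg hgx using hx
    refine ⟨_, .func f g hg, ?_⟩
    simp [hgx]

theorem TF.abs {c : γ → M} {f : (β → M) → M} (hf : TF L (P ∪ Set.range c) β f) :
    ∃ g, TF L P (γ ⊕ β) g ∧ ∀ x, f x = g (Sum.elim c x) := by
  induction hf with
  | const p hp =>
    rcases hp with hp | ⟨i, rfl⟩
    · exact ⟨_, .const p hp, fun _ => rfl⟩
    · exact ⟨_, .var (Sum.inl i), fun _ => rfl⟩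
  | var i => exact ⟨_, .var (Sum.inr i), fun _ => rfl⟩
  | func f g _ ih =>
    choose g' hg' h using ih
    exact ⟨_, .func f g' hg', fun x => by simp [h]⟩

theorem QF.mono (h : P ⊆ Q) {A : Set (β → M)} (hA : QF L P β A) : QF L Q β A := by
  induction hA with
  | univ => exact .univ
  | eq f g hf hg => exact .eq f g (hf.mono h) (hg.mono h)
  | rel R g hg => exact .rel R g fun i => (hg i).mono h
  | compl A _ ih => exact .compl A ih
  | inter A B _ _ ih ih' => exact .inter A B ih ih'

theorem QF.of_le (h : P ⊆ cl Q) {A : Set (β → M)} (hA : QF L P β A) : QF L Q β A := by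
  induction hA with
  | univ => exact .univ
  | eq f g hf hg => exact .eq f g (hf.of_le h) (hg.of_le h)
  | rel R g hg => exact .rel R g fun i => (hg i).of_le h
  | compl A _ ih => exact .compl A ih
  | inter A B _ _ ih ih' => exact .inter A B ih ih'

theorem QF.preimage {A : Set (α → M)} (hA : QF L P α A) {g : α → (β → M) → M}
    (hg : ∀ i, TF L P β (g i)) : QF L P β {x | (fun i => g i x) ∈ A} := by
  induction hA with
  | univ => exact .univ
  | eq f g hf hg' => exact .eq _ _ (hf.comp hg) (hg'.comp hg)
  | rel R g hg' => exact .rel R _ fun i => (hg' i).comp hg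
  | compl A _ ih => exact .compl _ ih
  | inter A B _ _ ih ih' => exact .inter _ _ ih ih'

theorem QF.reindex {A : Set (α → M)} (hA : QF L P α A) (σ : α → β) :
    QF L P β {x | (fun i => x (σ i)) ∈ A} :=
  hA.preimage fun i => .var (σ i)

theorem QF.abs {c : γ → M} {A : Set (β → M)} (hA : QF L (P ∪ Set.range c) β A) :
    ∃ B, QF L P (γ ⊕ β) B ∧ ∀ x, x ∈ A ↔ Sum.elim c x ∈ B := by
  induction hA with
  | univ => exact ⟨_, .univ, fun _ => by simp⟩
  | eq f g hf hg =>
    obtain ⟨f', hf', h⟩ := hf.abs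
    obtain ⟨g', hg', h'⟩ := hg.abs
    exact ⟨_, .eq f' g' hf' hg', fun x => by simp [h, h']⟩
  | rel R g hg =>
    choose g' hg' h using fun i => (hg i).abs
    exact ⟨_, .rel R g' hg', fun x => by simp [h]⟩
  | compl A _ ih =>
    obtain ⟨B, hB, h⟩ := ih
    exact ⟨_, .compl B hB, fun x => by simp [h]⟩
  | inter A B _ _ ih ih' =>
    obtain ⟨B, hB, h⟩ := ih
    obtain ⟨B', hB', h'⟩ := ih'
    exact ⟨_, .inter B B' hB hB', fun x => by simp [h, h']⟩

/-- Plugging in values for some of the variables. -/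
theorem QF.inst {A : Set (γ ⊕ β → M)} (hA : QF L P (γ ⊕ β) A) {c : γ → M}
    (hc : ∀ i, c i ∈ cl P) : QF L P β {x | Sum.elim c x ∈ A} := by
  have : QF L P β {x | (fun i => (Sum.elim (fun i _ => c i) (fun j x => x j) :
      γ ⊕ β → (β → M) → M) i x) ∈ A} := by
    refine hA.preimage ?_
    rintro (i | j)
    · exact .const_cl (hc i)
    · exact .var j
  refine (congrArg (QF L P β) (Set.ext fun x => ?_)).mp this
  have : (fun i => (Sum.elim (fun i _ => c i) (fun j x => x j) : γ ⊕ β → (β → M) → M) i x) =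
      Sum.elim c x := by funext i; cases i <;> rfl
  exact Iff.of_eq (congrArg (· ∈ A) this)

theorem QF.union {A B : Set (β → M)} (hA : QF L P β A) (hB : QF L P β B) :
    QF L P β (A ∪ B) := by
  have := (hA.compl.inter _ _ hB.compl).compl
  simpa [Set.compl_inter] using this

theorem QF.diff {A B : Set (β → M)} (hA : QF L P β A) (hB : QF L P β B) :
    QF L P β (A \ B) := hA.inter _ _ hB.compl

theorem QF.empty : QF L P β (∅ : Set (β → M)) := by
  simpa using (QF.univ : QF L P β _).compl

theorem QF.biInter {ι : Type*} (s : Set ι) (hs : s.Finite) {A : ι → Set (β → M)}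
    (hA : ∀ i ∈ s, QF L P β (A i)) : QF L P β (⋂ i ∈ s, A i) := by
  induction s, hs using Set.Finite.induction_on with
  | empty => simpa using QF.univ
  | insert ha _ ih =>
    rw [Set.biInter_insert]
    exact .inter _ _ (hA _ (by simp)) (ih fun i hi => hA i (by simp [hi]))

theorem QF.sInter {F : Set (Set (β → M))} (hF : F.Finite) (h : ∀ A ∈ F, QF L P β A) :
    QF L P β (⋂₀ F) := by
  rw [Set.sInter_eq_biInter]
  exact QF.biInter F hF h

theorem TF.support {f : (β → M) → M} (hf : TF L P β f) :
    ∃ (P₀ : Set M) (s : Set β), P₀ ⊆ P ∧ P₀.Finite ∧ s.Finite ∧ TF L P₀ β f ∧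
      ∀ x y : β → M, (∀ i ∈ s, x i = y i) → f x = f y := by
  induction hf with
  | const p hp => exact ⟨{p}, ∅, by simpa, by simp, by simp, .const p rfl, fun _ _ _ => rfl⟩
  | var i => exact ⟨∅, {i}, by simp, by simp, by simp, .var i, fun _ _ h => h i rfl⟩
  | func f g _ ih =>
    choose P₀ s h1 h2 h3 h4 h5 using ih
    refine ⟨⋃ i, P₀ i, ⋃ i, s i, Set.iUnion_subset h1, Set.finite_iUnion h2, Set.finite_iUnion h3,
      .func f g fun i => (h4 i).mono (Set.subset_iUnion _ i), fun x y h => ?_⟩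
    refine congrArg (Structure.funMap f) (funext fun i => ?_)
    exact h5 i x y fun j hj => h j (Set.mem_iUnion.2 ⟨i, hj⟩)

theorem QF.support {A : Set (β → M)} (hA : QF L P β A) :
    ∃ (P₀ : Set M) (s : Set β), P₀ ⊆ P ∧ P₀.Finite ∧ s.Finite ∧ QF L P₀ β A ∧
      ∀ x y : β → M, (∀ i ∈ s, x i = y i) → (x ∈ A ↔ y ∈ A) := by
  induction hA with
  | univ => exact ⟨∅, ∅, by simp, by simp, by simp, .univ, fun _ _ _ => by simp⟩
  | eq f g hf hg =>
    obtain ⟨P₁, s₁, h1, h2, h3, h4, h5⟩ := hf.support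
    obtain ⟨P₂, s₂, k1, k2, k3, k4, k5⟩ := hg.support
    refine ⟨P₁ ∪ P₂, s₁ ∪ s₂, Set.union_subset h1 k1, h2.union k2, h3.union k3,
      .eq _ _ (h4.mono Set.subset_union_left) (k4.mono Set.subset_union_right), fun x y h => ?_⟩
    rw [Set.mem_ofPred_eq, Set.mem_ofPred_eq, h5 x y fun i hi => h i (.inl hi),
      k5 x y fun i hi => h i (.inr hi)]
  | rel R g hg =>
    choose P₀ s h1 h2 h3 h4 h5 using fun i => (hg i).support
    refine ⟨⋃ i, P₀ i, ⋃ i, s i, Set.iUnion_subset h1, Set.finite_iUnion h2, Set.finite_iUnion h3,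
      .rel R g fun i => (h4 i).mono (Set.subset_iUnion _ i), fun x y h => ?_⟩
    have : (fun i => g i x) = fun i => g i y := by
      funext i
      exact h5 i x y fun j hj => h j (Set.mem_iUnion.2 ⟨i, hj⟩)
    rw [Set.mem_ofPred_eq, Set.mem_ofPred_eq, this]
  | compl A _ ih =>
    obtain ⟨P₁, s₁, h1, h2, h3, h4, h5⟩ := ih
    exact ⟨P₁, s₁, h1, h2, h3, h4.compl, fun x y h => not_congr (h5 x y h)⟩
  | inter A B _ _ ih ih' =>
    obtain ⟨P₁, s₁, h1, h2, h3, h4, h5⟩ := ih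
    obtain ⟨P₂, s₂, k1, k2, k3, k4, k5⟩ := ih'
    exact ⟨P₁ ∪ P₂, s₁ ∪ s₂, Set.union_subset h1 k1, h2.union k2, h3.union k3,
      .inter _ _ (h4.mono Set.subset_union_left) (k4.mono Set.subset_union_right), fun x y h =>
      and_congr (h5 x y fun i hi => h i (.inl hi)) (k5 x y fun i hi => h i (.inr hi))⟩

/-- A definable set with finitely many relevant variables, as a definable set of tuples
indexed by these variables. -/
theorem QF.restrict {A : Set (β → M)} (hA : QF L P β A) {s : Set β}
    (hs : ∀ x y : β → M, (∀ i ∈ s, x i = y i) → (x ∈ A ↔ y ∈ A)) [Nonempty M] :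
    ∃ B, QF L P s B ∧ ∀ x, x ∈ A ↔ (fun i : s => x i) ∈ B := by
  classical
  rcases s.eq_empty_or_nonempty with rfl | ⟨i₀, hi₀⟩
  · by_cases h : A.Nonempty
    · obtain ⟨x, hx⟩ := h
      exact ⟨_, .univ, fun y => by simpa using (hs x y (by simp)).1 hx⟩
    · exact ⟨_, .empty, fun y => by
        simpa using fun hy => h ⟨y, hy⟩⟩
  · refine ⟨_, hA.reindex (fun i => if h : i ∈ s then ⟨i, h⟩ else ⟨i₀, hi₀⟩), fun x => hs _ _ ?_⟩
    intro i hi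
    simp [hi]

theorem cl_finite {y : M} (hy : y ∈ cl P) : ∃ F ⊆ P, F.Finite ∧ y ∈ cl F := by
  obtain ⟨f, hf, rfl⟩ := exists_TF (P := P) (L := L) (c := (Empty.elim : Empty → M)) (y := y) (by rw [Set.range_eq_empty]; simpa using hy)
  obtain ⟨P₀, s, h1, h2, h3, h4, h5⟩ := hf.support
  exact ⟨P₀, h1, h2, h4.mem_cl (subset_cl _) (by simp)⟩

theorem cl_finite_set {Y : Set M} (hY : Y.Finite) (h : Y ⊆ cl P) :
    ∃ F ⊆ P, F.Finite ∧ Y ⊆ cl F := by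
  choose! F h1 h2 h3 using fun y (hy : y ∈ Y) => cl_finite (h hy)
  exact ⟨⋃ y ∈ Y, F y, Set.iUnion₂_subset h1, hY.biUnion h2,
    fun y hy => cl_mono (Set.subset_biUnion_of_mem hy) (h3 y hy)⟩

theorem cl_finite_union {Y N : Set M} (hY : Y.Finite) (h : Y ⊆ cl (N ∪ P)) :
    ∃ F ⊆ P, F.Finite ∧ Y ⊆ cl (N ∪ F) := by
  obtain ⟨F, h1, h2, h3⟩ := cl_finite_set hY h
  refine ⟨F ∩ P, Set.inter_subset_right, h2.inter_of_left _, h3.trans (cl_mono ?_)⟩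
  intro x hx
  rcases h1 hx with h | h
  · exact .inl h
  · exact .inr ⟨hx, h⟩

end Calculus

end QFree

namespace QFree

section Types

variable (L : FirstOrder.Language.{u, u}) {M : Type u} [L.Structure M]

/-- Two tuples have the same quantifier-free type over `P`. -/
def EqT (P : Set M) {ι : Type*} (w w' : ι → M) : Prop :=
  ∀ A, QF L P ι A → w ∈ A → w' ∈ A

/-- `g` restricted to `S` is a partial embedding. -/
def PE (S : Set M) (g : M → M) : Prop :=
  EqT L ∅ (fun x : S => (x : M)) (fun x : S => g x)

/-- The type of (an enumeration of) `Y` over `P` is finitely satisfiable in the closure of `N`. -/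
def FS (Y P N : Set M) : Prop :=
  ∀ A, QF L P Y A → (fun y : Y => (y : M)) ∈ A → ∃ u ∈ A, ∀ i, u i ∈ clos L N

/-- The closure of `N` is existentially closed in `M`. -/
def EC (N : Set M) : Prop :=
  ∀ (n : ℕ) (A : Set (Fin n → M)), QF L N (Fin n) A → A.Nonempty → ∃ x ∈ A, ∀ i, x i ∈ clos L N

local notation "cl" => clos L

variable {L}
variable {ι α β γ : Type*} {P Q N S : Set M}

theorem EqT.refl (w : ι → M) : EqT L P w w := fun _ _ h => h

theorem EqT.symm {w w' : ι → M} (h : EqT L P w w') : EqT L P w' w := by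
  intro A hA hw
  by_contra hn
  exact h _ hA.compl hn hw

theorem EqT.trans {w w' w'' : ι → M} (h : EqT L P w w') (h' : EqT L P w' w'') : EqT L P w w'' :=
  fun A hA hw => h' A hA (h A hA hw)

theorem EqT.iff {w w' : ι → M} (h : EqT L P w w') {A} (hA : QF L P ι A) : w ∈ A ↔ w' ∈ A :=
  ⟨h A hA, h.symm A hA⟩

theorem EqT.mono {w w' : ι → M} (h : EqT L Q w w') (hPQ : P ⊆ cl Q) : EqT L P w w' :=
  fun A hA hw => h A (hA.of_le hPQ) hw

theorem EqT.comp {w w' : ι → M} (h : EqT L P w w') {f : α → (ι → M) → M}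
    (hf : ∀ i, TF L P ι (f i)) : EqT L P (fun i => f i w) (fun i => f i w') :=
  fun _ hA hw => h _ (hA.preimage hf) hw

theorem EqT.reindex {w w' : ι → M} (h : EqT L P w w') (σ : α → ι) :
    EqT L P (fun i => w (σ i)) (fun i => w' (σ i)) :=
  h.comp (f := fun i x => x (σ i)) fun i => .var (σ i)

theorem EqT.tf_eq {w w' : ι → M} (h : EqT L P w w') {f g : (ι → M) → M} (hf : TF L P ι f)
    (hg : TF L P ι g) (e : f w = g w) : f w' = g w' :=
  h _ (.eq f g hf hg) e

theorem eqT_abs {c : γ → M} {w w' : ι → M} :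
    EqT L (P ∪ Set.range c) w w' ↔ EqT L P (Sum.elim c w) (Sum.elim c w') := by
  constructor
  · intro h A hA hw
    refine h _ ((hA.mono Set.subset_union_left).inst (c := c) fun i => mem_cl (.inr ⟨i, rfl⟩)) hw
  · intro h A hA hw
    obtain ⟨B, hB, hAB⟩ := hA.abs
    rw [hAB] at hw ⊢
    exact h B hB hw

theorem EqT.of_finite {w w' : ι → M}
    (h : ∀ s : Set ι, s.Finite → ∀ P₀ ⊆ P, P₀.Finite →
      EqT L P₀ (fun i : s => w i) (fun i : s => w' i)) : EqT L P w w' := by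
  intro A hA hw
  obtain ⟨P₀, s, h1, h2, h3, h4, h5⟩ := hA.support
  by_cases hM : Nonempty M
  · obtain ⟨B, hB, hAB⟩ := h4.restrict h5
    rw [hAB] at hw ⊢
    exact h s h3 P₀ h1 h2 B hB hw
  · have : w = w' := funext fun i => (hM ⟨w i⟩).elim
    exact this ▸ hw

theorem EqT.mem_cl {w w' : ι → M} (h : EqT L P w w') {J : Set ι} {i : ι}
    (hi : w i ∈ cl (P ∪ w '' J)) : w' i ∈ cl (P ∪ w' '' J) := by
  have e : w '' J = Set.range (fun j : J => w j) := by rw [Set.image_eq_range]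
  rw [e] at hi
  obtain ⟨f, hf, hfi⟩ := exists_TF hi
  have h1 := h.tf_eq (f := fun x => f (fun j : J => x j)) (g := fun x => x i)
    (hf.comp fun j => .var (j : ι)) (.var i) hfi
  rw [← h1]
  refine hf.mem_cl ((Set.subset_union_left).trans (subset_cl _)) fun j => ?_
  exact QFree.mem_cl (.inr ⟨j, j.2, rfl⟩)

/-! #### Partial embeddings -/

theorem pe_iff_family {e e' : ι → M} {g : M → M} (hg : ∀ i, g (e i) = e' i) :
    PE L (Set.range e) g ↔ EqT L ∅ e e' := by
  constructor
  · intro h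
    have := h.reindex (fun i => (⟨e i, i, rfl⟩ : Set.range e))
    simpa only [hg] using this
  · intro h
    have h1 : ∀ x : Set.range e, ∃ i, e i = x := fun x => x.2
    choose σ hσ using h1
    have := h.reindex σ
    refine fun A hA hw => ?_
    have := this A hA (by simpa only [hσ] using hw)
    simpa only [← hg, hσ] using this

theorem PE.eqT {g : M → M} (h : PE L S g) {w : ι → M} (hw : ∀ i, w i ∈ S) :
    EqT L ∅ w (fun i => g (w i)) :=
  h.reindex (fun i => (⟨w i, hw i⟩ : S))

theorem PE.mono {g : M → M} {S' : Set M} (h : PE L S g) (hS : S' ⊆ S) : PE L S' g :=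
  h.eqT (w := fun x : S' => (x : M)) fun x => hS x.2

theorem PE.congr {g g' : M → M} (h : PE L S g) (hg : ∀ x ∈ S, g x = g' x) : PE L S g' := by
  have : (fun x : S => g x) = fun x : S => g' x := funext fun x => hg x x.2
  unfold PE at h ⊢
  rwa [← this]

theorem PE.id : PE L S id := EqT.refl _

theorem PE.exists_cl {g : M → M} (h : PE L S g) :
    ∃ g', PE L (cl S) g' ∧ ∀ x ∈ S, g' x = g x := by
  classical
  have h1 : ∀ x : M, ∃ f : (S → M) → M, x ∈ cl S → TF L ∅ S f ∧ f (fun x => x) = x := by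
    intro x
    by_cases hx : x ∈ cl S
    · obtain ⟨f, hf⟩ := exists_TF (P := ∅) (c := fun x : S => (x : M)) (y := x)
        (by simpa using hx)
      exact ⟨f, fun _ => hf⟩
    · exact ⟨fun _ => x, fun h => (hx h).elim⟩
  choose F hF using h1
  refine ⟨fun x => F x (fun y => g y), ?_, ?_⟩
  · have := h.comp (α := cl S) (f := fun x => F x) fun x => (hF x x.2).1
    refine fun A hA hw => this A hA ?_
    have e : (fun i : cl S => F i (fun x : S => (x : M))) = fun i : cl S => (i : M) :=
      funext fun i => (hF i i.2).2
    rw [e]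
    exact hw
  · intro x hx
    exact h.tf_eq (hF x (subset_cl _ hx)).1 (.var ⟨x, hx⟩) (hF x (subset_cl _ hx)).2

theorem EqT.exists_pe {e e' : ι → M} (h : EqT L P e e') :
    ∃ g, PE L (cl (P ∪ Set.range e)) g ∧ (∀ x ∈ P, g x = x) ∧ ∀ i, g (e i) = e' i := by
  classical
  have h0 : EqT L ∅ (Sum.elim (fun x : P => (x : M)) e) (Sum.elim (fun x : P => (x : M)) e') := by
    rw [← eqT_abs]
    simpa using h
  set v := Sum.elim (fun x : P => (x : M)) e
  set v' := Sum.elim (fun x : P => (x : M)) e'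
  have hr : Set.range v = P ∪ Set.range e := by simp [v]
  have h1 : ∀ x : M, ∃ y, ∀ i, v i = x → v' i = y := by
    intro x
    by_cases hx : ∃ i, v i = x
    · obtain ⟨i, rfl⟩ := hx
      exact ⟨v' i, fun j hj => h0.tf_eq (.var j) (.var i) hj⟩
    · exact ⟨x, fun i hi => (hx ⟨i, hi⟩).elim⟩
  choose g hg using h1
  have h2 : PE L (Set.range v) g := (pe_iff_family fun i => (hg _ i rfl).symm).2 h0
  obtain ⟨g', h3, h4⟩ := h2.exists_cl
  rw [hr] at h3 h4
  refine ⟨g', h3, fun x hx => ?_, fun i => ?_⟩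
  · rw [h4 x (.inl hx)]
    exact (hg x (Sum.inl ⟨x, hx⟩) rfl).symm
  · rw [h4 _ (.inr ⟨i, rfl⟩)]
    exact (hg _ (Sum.inr i) rfl).symm

theorem PE.qf {g : M → M} (h : PE L S g) (hP : P ⊆ S) {A : Set (ι → M)} (hA : QF L P ι A) :
    ∃ A', QF L (g '' P) ι A' ∧ ∀ w : ι → M, (∀ i, w i ∈ S) → (w ∈ A ↔ (fun i => g (w i)) ∈ A') := by
  obtain ⟨B, hB, hAB⟩ := QF.abs (P := ∅) (c := fun x : P => (x : M)) (A := A) (by simpa using hA)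
  refine ⟨{x | Sum.elim (fun x : P => g x) x ∈ B}, (hB.mono (Set.empty_subset _)).inst
    fun i => QFree.mem_cl ⟨i, i.2, rfl⟩, fun w hw => ?_⟩
  rw [hAB]
  have := (h.eqT (w := Sum.elim (fun x : P => (x : M)) w)
    (by rintro (i | i); exacts [hP i.2, hw i])).iff hB
  rw [this]
  refine Iff.of_eq (congrArg (· ∈ B) ?_)
  funext i
  cases i <;> rfl

theorem PE.mem_cl {g : M → M} (h : PE L S g) (hP : P ⊆ S) {x : M} (hx : x ∈ S)
    (hxP : x ∈ cl P) : g x ∈ cl (g '' P) := by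
  have := (h.eqT (w := fun i : S => (i : M)) fun i => i.2).mem_cl (i := ⟨x, hx⟩)
    (J := Subtype.val ⁻¹' P) (by
      simpa [Set.inter_eq_right.2 hP] using hxP)
  refine cl_mono ?_ this
  rw [Set.empty_union]
  rintro _ ⟨i, hi, rfl⟩
  exact ⟨i, hi, rfl⟩

theorem PE.injOn {g : M → M} (h : PE L S g) : Set.InjOn g S := by
  intro x hx y hy e
  exact h.symm.tf_eq (.var ⟨x, hx⟩) (.var ⟨y, hy⟩) e

theorem PE.comp {g g' : M → M} (h : PE L S g) (h' : PE L (g '' S) g') : PE L S (g' ∘ g) :=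
  EqT.trans h (h'.eqT (w := fun x : S => g x) fun x => ⟨x, x.2, rfl⟩)

theorem PE.exists_inv {g : M → M} (h : PE L S g) :
    ∃ g', PE L (g '' S) g' ∧ (∀ x ∈ S, g' (g x) = x) ∧ g' '' (g '' S) = S := by
  classical
  have h1 : ∀ y : M, ∃ x, y ∈ g '' S → x ∈ S ∧ g x = y := by
    intro y
    by_cases hy : y ∈ g '' S
    · obtain ⟨x, hx⟩ := hy
      exact ⟨x, fun _ => hx⟩
    · exact ⟨y, fun h => (hy h).elim⟩
  choose g' hg' using h1
  have h2 : ∀ x ∈ S, g' (g x) = x := fun x hx =>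
    h.injOn (hg' _ ⟨x, hx, rfl⟩).1 hx (hg' _ ⟨x, hx, rfl⟩).2
  refine ⟨g', ?_, h2, ?_⟩
  · have := h.symm
    rw [Set.image_eq_range]
    exact (pe_iff_family fun i : S => h2 i i.2).2 this
  · ext x
    constructor
    · rintro ⟨_, ⟨y, hy, rfl⟩, rfl⟩
      rwa [h2 y hy]
    · intro hx
      exact ⟨_, ⟨x, hx, rfl⟩, h2 x hx⟩

theorem PE.mem_cl_iff {g : M → M} (h : PE L S g) (hP : P ⊆ S) {x : M} (hx : x ∈ S) :
    g x ∈ cl (g '' P) ↔ x ∈ cl P := by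
  refine ⟨fun hg => ?_, h.mem_cl hP hx⟩
  obtain ⟨g', h1, h2, h3⟩ := h.exists_inv
  have := h1.mem_cl (Set.image_mono hP) ⟨x, hx, rfl⟩ hg
  rw [h2 x hx] at this
  refine cl_mono ?_ this
  rintro _ ⟨_, ⟨y, hy, rfl⟩, rfl⟩
  rwa [h2 y (hP hy)]

theorem PE.image_cl {g : M → M} (h : PE L (cl P) g) : g '' cl P = cl (g '' P) := by
  apply subset_antisymm
  · rintro _ ⟨x, hx, rfl⟩
    exact h.mem_cl (subset_cl P) hx hx
  · intro y hy
    obtain ⟨f, hf, rfl⟩ := exists_TF (P := ∅) (c := fun x : P => g x) (y := y)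
      (by rw [Set.empty_union, ← Set.image_eq_range]; exact hy)
    have hm : f (fun x : P => (x : M)) ∈ cl P :=
      hf.mem_cl (Set.empty_subset _) fun i => QFree.mem_cl i.2
    refine ⟨f (fun x : P => (x : M)), hm, ?_⟩
    have := (h.eqT (w := Sum.elim (fun _ : Unit => f (fun x : P => (x : M))) (fun x : P => (x : M)))
      (by rintro (i | i); exacts [hm, QFree.mem_cl i.2])).tf_eq (.var (Sum.inl ()))
      (hf.comp (g := fun i x => x (Sum.inr i)) fun i => .var _) rfl
    exact this

theorem PE.eqT_image {g : M → M} (h : PE L S g) (hP : P ⊆ S) {w w' : ι → M}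
    (hw : ∀ i, w i ∈ S) (hw' : ∀ i, w' i ∈ S) (he : EqT L P w w') :
    EqT L (g '' P) (fun i => g (w i)) (fun i => g (w' i)) := by
  obtain ⟨g', h1, h2, h3⟩ := h.exists_inv
  intro A hA hA'
  obtain ⟨B, hB, hAB⟩ := h1.qf (Set.image_mono hP) hA
  rw [hAB _ fun i => ⟨_, hw' i, rfl⟩]
  rw [hAB _ fun i => ⟨_, hw i, rfl⟩] at hA'
  simp only [h2 _ (hw _), h2 _ (hw' _)] at hA' ⊢
  refine he B (hB.mono ?_) hA'
  rintro _ ⟨_, ⟨y, hy, rfl⟩, rfl⟩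
  rwa [h2 y (hP hy)]

theorem PE.eqT_self {g : M → M} (h : PE L S g) (hP : P ⊆ S) (hg : ∀ x ∈ P, g x = x) {w : ι → M}
    (hw : ∀ i, w i ∈ S) : EqT L P w (fun i => g (w i)) := by
  have h0 := h.eqT (w := Sum.elim (fun x : P => (x : M)) w)
    (by rintro (i | i); exacts [hP i.2, hw i])
  have h1 : EqT L ∅ (Sum.elim (fun x : P => (x : M)) w)
      (Sum.elim (fun x : P => (x : M)) (fun i => g (w i))) := by
    refine fun A hA hx => ?_
    have := h0 A hA hx
    refine (congrArg (· ∈ A) ?_).mp this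
    funext i
    rcases i with i | i
    exacts [hg i i.2, rfl]
  rw [← eqT_abs] at h1
  simpa using h1

end Types

end QFree

namespace QFree

section Coheir

variable {L : FirstOrder.Language.{u, u}} {M : Type u} [L.Structure M]

local notation "cl" => clos L

variable {ι α β γ : Type*} {P Q N S Y Z : Set M}

theorem FS.fam (h : FS L Y P N) (hN : N ⊆ cl P) {w : ι → M} (hw : ∀ i, w i ∈ cl (N ∪ Y))
    {A : Set (ι → M)} (hA : QF L P ι A) (hwA : w ∈ A) : ∃ u ∈ A, ∀ i, u i ∈ cl N := by
  have h1 : ∀ i, ∃ f, TF L N Y f ∧ f (fun y : Y => (y : M)) = w i := fun i =>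
    exists_TF (by simpa using hw i)
  choose f hf hfw using h1
  obtain ⟨u, hu, hu'⟩ := h _ (hA.preimage (g := f) fun i => (hf i).of_le hN)
    ((congrArg (· ∈ A) (funext hfw)).mpr hwA)
  exact ⟨_, hu, fun i => (hf i).mem_cl (subset_cl N) hu'⟩

theorem FS.of_fam {w : ι → M}
    (h : ∀ A, QF L P ι A → w ∈ A → ∃ u ∈ A, ∀ i, u i ∈ cl N) : FS L (Set.range w) P N := by
  intro A hA hw
  have h1 : ∀ x : Set.range w, ∃ i, w i = x := fun x => x.2
  choose σ hσ using h1
  obtain ⟨u, hu, hu'⟩ := h _ (hA.preimage (g := fun x (v : ι → M) => v (σ x)) fun x => .var _)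
    ((congrArg (· ∈ A) (funext hσ)).mpr hw)
  exact ⟨_, hu, fun x => hu' _⟩

theorem FS.of_finite (h : ∀ Y₀ ⊆ Y, Y₀.Finite → FS L Y₀ P N) (hn : (cl N).Nonempty) :
    FS L Y P N := by
  intro A hA hw
  classical
  obtain ⟨P₀, s, h1, h2, h3, h4, h5⟩ := hA.support
  obtain ⟨n₀, hn₀⟩ := hn
  have : Nonempty M := ⟨n₀⟩
  obtain ⟨B, hB, hAB⟩ := h4.restrict h5
  have hs : (Subtype.val '' s : Set M) ⊆ Y := by
    rintro _ ⟨y, _, rfl⟩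
    exact y.2
  have h6 := h _ hs (h3.image _)
  obtain ⟨u, hu, hu'⟩ := h6 _ ((hB.mono h1).reindex
    (fun i => (⟨i.1, i.1, i.2, rfl⟩ : (Subtype.val '' s : Set M)))) ((hAB _).1 hw)
  refine ⟨fun y => if hy : (y : M) ∈ (Subtype.val '' s : Set M) then u ⟨y, hy⟩ else n₀, ?_, ?_⟩
  · rw [hAB]
    refine (congrArg (· ∈ B) (funext fun i => ?_)).mp hu
    have : (i.1 : M) ∈ (Subtype.val '' s : Set M) := ⟨i.1, i.2, rfl⟩
    simp [this]
  · intro y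
    dsimp only
    split_ifs
    exacts [hu' _, hn₀]

theorem FS.mono (h : FS L Y P N) (hN : N ⊆ cl P) {Y' P' N' : Set M} (hY : Y' ⊆ cl (N ∪ Y))
    (hP : P' ⊆ cl P) (hN' : N ⊆ cl N') : FS L Y' P' N' := by
  intro A hA hw
  obtain ⟨u, hu, hu'⟩ := h.fam hN (w := fun y : Y' => (y : M)) (fun i => hY i.2) (hA.of_le hP) hw
  exact ⟨u, hu, fun i => cl_le hN' (hu' i)⟩

theorem FS.left (h : FS L Y P N) (hN : N ⊆ cl P) {Y' : Set M} (hY : Y' ⊆ cl (N ∪ Y)) :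
    FS L Y' P N := h.mono hN hY (subset_cl P) (subset_cl N)

theorem FS.right (h : FS L Y P N) {P' : Set M} (hP : P' ⊆ cl P) : FS L Y P' N :=
  fun A hA hw => h A (hA.of_le hP) hw

theorem FS.base (h : FS L Y P N) {N' : Set M} (hN : N ⊆ cl N') : FS L Y P N' := by
  intro A hA hw
  obtain ⟨u, hu, hu'⟩ := h A hA hw
  exact ⟨u, hu, fun i => cl_le hN (hu' i)⟩

theorem FS.of_subset (h : Y ⊆ cl N) : FS L Y P N := fun _ _ hw => ⟨_, hw, fun i => h i.2⟩

theorem FS.mem (h : FS L Y P N) (hN : N ⊆ cl P) {x : M} (hx : x ∈ cl (N ∪ Y)) (hxP : x ∈ cl P) :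
    x ∈ cl N := by
  obtain ⟨u, hu, hu'⟩ := h.fam hN (w := fun _ : Unit => x) (fun _ => hx)
    (.eq (fun v => v ()) (fun _ => x) (.var ()) (.const_cl hxP)) rfl
  have : u () = x := hu
  rw [← this]
  exact hu' ()

theorem FS.union (h : FS L Y P N) (hN : N ⊆ cl P) (h' : FS L Z (P ∪ Y) (N ∪ Y)) :
    FS L (Y ∪ Z) P N := by
  have hr : Set.range (Sum.elim (fun y : Y => (y : M)) (fun z : Z => (z : M))) = Y ∪ Z := by simp
  rw [← hr]
  refine FS.of_fam fun A hA hw => ?_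
  obtain ⟨u, hu, hu'⟩ := h' _ ((hA.mono Set.subset_union_left).inst (c := fun y : Y => (y : M))
    fun i => mem_cl (.inr i.2)) hw
  have h1 : ∀ i, ∃ f, TF L N Y f ∧ f (fun y : Y => (y : M)) = u i := fun i =>
    exists_TF (by simpa using hu' i)
  choose f hf hfw using h1
  obtain ⟨v, hv, hv'⟩ := h _ (hA.preimage (β := Y) (g := Sum.elim (fun y x => x y) f) (by
      rintro (y | z); exacts [.var y, (hf z).of_le hN])) (by
      refine (congrArg (· ∈ A) (funext fun i => ?_)).mpr hu
      rcases i with i | i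
      exacts [rfl, hfw i])
  refine ⟨_, hv, ?_⟩
  rintro (y | z)
  exacts [hv' y, (hf z).mem_cl (subset_cl N) hv']

theorem FS.eqT {w w' : ι → M} (h : FS L (Set.range w) P N) (hN : N ⊆ cl P) (he : EqT L P w w') :
    FS L (Set.range w') P N :=
  FS.of_fam fun A hA hw => h.fam hN (w := w) (fun i => mem_cl (.inr ⟨i, rfl⟩)) hA (he.symm A hA hw)

theorem FS.pe (h : FS L Y P N) {g : M → M} (hg : PE L S g) (hY : Y ⊆ S)
    (hP : P ⊆ S) (hNS : cl N ⊆ S) : FS L (g '' Y) (g '' P) (g '' N) := by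
  rw [Set.image_eq_range g Y]
  refine FS.of_fam fun A hA hw => ?_
  obtain ⟨g', h1, h2, h3⟩ := hg.exists_inv
  obtain ⟨B, hB, hAB⟩ := h1.qf (Set.image_mono hP) hA
  have hPP : g' '' (g '' P) ⊆ P := by
    rintro _ ⟨_, ⟨y, hy, rfl⟩, rfl⟩
    rwa [h2 y (hP hy)]
  rw [hAB _ fun i => ⟨_, hY i.2, rfl⟩] at hw
  simp only [h2 _ (hY (Subtype.prop _))] at hw
  obtain ⟨u, hu, hu'⟩ := h B (hB.mono hPP) hw
  refine ⟨fun i => g (u i), ?_, fun i => hg.mem_cl ((subset_cl N).trans hNS) (hNS (hu' i)) (hu' i)⟩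
  rw [hAB _ fun i => ⟨_, hNS (hu' i), rfl⟩]
  simpa only [h2 _ (hNS (hu' _))] using hu

theorem EC.point (h : EC L N) {A : Set (ι → M)} (hA : QF L N ι A) (hne : A.Nonempty)
    (hn : (cl N).Nonempty) : ∃ x ∈ A, ∀ i, x i ∈ cl N := by
  classical
  obtain ⟨n₀, hn₀⟩ := hn
  have : Nonempty M := ⟨n₀⟩
  obtain ⟨P₀, s, h1, h2, h3, h4, h5⟩ := hA.support
  obtain ⟨B, hB, hAB⟩ := (h4.mono h1).restrict h5
  let _ := h3.fintype
  let e := Fintype.equivFin s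
  obtain ⟨x, hx⟩ := hne
  obtain ⟨y, hy, hy'⟩ := h _ _ (hB.reindex e) ⟨fun j => x (e.symm j), by
    refine (congrArg (· ∈ B) (funext fun i => ?_)).mpr ((hAB x).1 hx)
    simp⟩
  refine ⟨fun i => if hi : i ∈ s then y (e ⟨i, hi⟩) else n₀, ?_, ?_⟩
  · rw [hAB]
    refine (congrArg (· ∈ B) (funext fun i => ?_)).mp hy
    simp
  · intro i
    dsimp only
    split_ifs
    exacts [hy' _, hn₀]

theorem EC.congr (h : EC L N) (h1 : N ⊆ cl Q) (h2 : Q ⊆ cl N) : EC L Q := by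
  intro n A hA hne
  obtain ⟨x, hx, hx'⟩ := h n A (hA.of_le h2) hne
  exact ⟨x, hx, fun i => cl_le h1 (hx' i)⟩

theorem EC.cl (h : EC L N) : EC L (cl N) := h.congr ((subset_cl N).trans (subset_cl _)) subset_rfl

/-- Over an existentially closed set, types are finitely satisfiable in it. -/
theorem EC.fs (h : EC L N) (hn : (clos L N).Nonempty) (Y : Set M) : FS L Y N N :=
  fun _ hA hw => h.point hA ⟨_, hw⟩ hn

theorem finite_subset_directed {X I : Type*} [Nonempty I] {F : I → Set X}
    (hF : Directed (· ⊆ ·) F) {s : Set X} (hs : s.Finite) (h : s ⊆ ⋃ i, F i) : ∃ i, s ⊆ F i := by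
  induction s, hs using Set.Finite.induction_on with
  | empty => exact ⟨Classical.arbitrary I, Set.empty_subset _⟩
  | @insert a s _ _ ih =>
    obtain ⟨i, hi⟩ := ih ((Set.subset_insert _ _).trans h)
    obtain ⟨j, hj⟩ := Set.mem_iUnion.1 (h (Set.mem_insert _ _))
    obtain ⟨k, hk, hk'⟩ := hF i j
    exact ⟨k, Set.insert_subset (hk' hj) (hi.trans hk)⟩

theorem EC.of_iUnion {I : Type*} [Nonempty I] {F : I → Set M} (hF : Directed (· ⊆ ·) F)
    (h : ∀ i, ∃ j, F i ⊆ F j ∧ EC L (F j)) : EC L (⋃ i, F i) := by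
  intro n A hA hne
  obtain ⟨P₀, s, h1, h2, h3, h4, h5⟩ := hA.support
  obtain ⟨i, hi⟩ := finite_subset_directed hF h2 h1
  obtain ⟨j, hj, hj'⟩ := h i
  obtain ⟨x, hx, hx'⟩ := hj' n A (h4.mono (hi.trans hj)) hne
  exact ⟨x, hx, fun k => cl_mono (Set.subset_iUnion F j) (hx' k)⟩

end Coheir

/-- Recursive construction along a well-founded relation. -/
theorem exists_wf_rec {Ω : Type*} {X : Type*} [Nonempty X] (r : Ω → Ω → Prop)
    (hr : WellFounded r) (R : Ω → (Ω → X) → X → Prop)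
    (hdep : ∀ ν f f' x, (∀ ν', r ν' ν → f ν' = f' ν') → R ν f x → R ν f' x)
    (h : ∀ ν f, (∀ ν', r ν' ν → R ν' f (f ν')) → ∃ x, R ν f x) :
    ∃ g : Ω → X, ∀ ν, R ν g (g ν) := by
  classical
  let x₀ : X := Classical.arbitrary X
  let F : (ν : Ω) → ((ν' : Ω) → r ν' ν → X) → X := fun ν f =>
    let f' : Ω → X := fun ν' => if h : r ν' ν then f ν' h else x₀
    if h : ∃ x, R ν f' x then h.choose else x₀
  let g : Ω → X := hr.fix F
  refine ⟨g, fun ν => ?_⟩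
  induction ν using hr.induction with
  | _ ν ih =>
    have h1 : g ν = F ν fun ν' _ => g ν' := hr.fix_eq F ν
    let f' : Ω → X := fun ν' => if r ν' ν then g ν' else x₀
    have hf : ∀ ν', r ν' ν → f' ν' = g ν' := fun ν' hν' => by simp [f', hν']
    obtain ⟨x, hx⟩ := h ν g ih
    have h2 : ∃ x, R ν f' x := ⟨x, hdep ν g f' x (fun ν' hν' => (hf ν' hν').symm) hx⟩
    have h3 : g ν = h2.choose := by
      rw [h1]
      simp only [F]
      exact dif_pos h2
    have h4 := h2.choose_spec
    rw [← h3] at h4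
    exact hdep ν f' g _ hf h4

end QFree

namespace QFree

section Monster

variable (L : FirstOrder.Language.{u, u}) {M : Type u} [L.Structure M]

/-- `N` is strictly `lam`-generated. -/
def SG (lam : Cardinal.{u}) (N : Set M) : Prop :=
  (∃ Y : Set M, #Y ≤ lam ∧ clos L Y = N) ∧ ∀ Y : Set M, clos L Y = N → lam ≤ #Y

variable (M) in
/-- A sufficiently saturated structure in which strictly `κ`-generated substructures are unique. -/
structure Mon (κ μ : Cardinal.{u}) : Prop where
  hκ : ℵ₀ < κ
  hμ : κ ≤ μ
  hL : L.card ≤ μ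
  inf : Infinite M
  comp : ∀ (ι : Type u), #ι ≤ μ → ∀ P : Set M, #P ≤ μ → ∀ F : Set (Set (ι → M)),
    (∀ A ∈ F, QF L P ι A) → (∀ G ⊆ F, G.Finite → (⋂₀ G).Nonempty) → (⋂₀ F).Nonempty
  ext : ∀ (S : Set M) (g : M → M), #S ≤ μ → PE L S g → EC L (g '' S) → ∀ W : Set M, #W ≤ μ →
    ∃ g', PE L (S ∪ W) g' ∧ ∀ x ∈ S, g' x = g x
  uniq : ∀ N N' : Set M, clos L N = N → clos L N' = N' → SG L κ N → SG L κ N' →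
    ∃ g, PE L N g ∧ g '' N = N'

/-- `w` realizes the restriction of the ultrafilter `V` to `P`. -/
def Realizes {ι : Type*} (V : Ultrafilter (ι → M)) (P : Set M) (w : ι → M) : Prop :=
  ∀ A, QF L P ι A → (w ∈ A ↔ A ∈ V)

/-- The tuples with entries in the closure of `N`. -/
def tuples (ι : Type*) (N : Set M) : Set (ι → M) := {u | ∀ i, u i ∈ clos L N}

variable {L}

local notation "cl" => clos L

theorem Mon.nonempty {κ μ : Cardinal.{u}} (H : Mon L M κ μ) : Nonempty M :=
  by
  have := H.inf
  infer_instance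

section Small

variable {κ μ : Cardinal.{u}} (H : Mon L M κ μ)
include H

theorem Mon.aleph0_le : ℵ₀ ≤ μ := H.hκ.le.trans H.hμ

theorem Mon.small_union {P Q : Set M} (hP : #P ≤ μ) (hQ : #Q ≤ μ) : #(P ∪ Q : Set M) ≤ μ :=
  (mk_union_le P Q).trans (add_le_of_le H.aleph0_le hP hQ)

theorem Mon.small_countable {P : Set M} (hP : P.Countable) : #P ≤ μ :=
  (le_aleph0_iff_set_countable.2 hP).trans H.aleph0_le

theorem Mon.small_finite {P : Set M} (hP : P.Finite) : #P ≤ μ := H.small_countable hP.countable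

theorem Mon.small_range {ι : Type u} (hι : #ι ≤ μ) (f : ι → M) : #(Set.range f) ≤ μ :=
  mk_range_le.trans hι

theorem Mon.small_image {P : Set M} (hP : #P ≤ μ) (f : M → M) : #(f '' P) ≤ μ :=
  mk_image_le.trans hP

theorem Mon.small_subset {P Q : Set M} (hP : P ⊆ Q) (hQ : #Q ≤ μ) : #P ≤ μ :=
  (mk_le_mk_of_subset hP).trans hQ

theorem Mon.small_cl {P : Set M} (hP : #P ≤ μ) : #(cl P) ≤ μ := by
  have h := Substructure.lift_card_closure_le (L := L) (s := P)
  rw [Cardinal.lift_id] at h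
  refine h.trans (max_le H.aleph0_le ?_)
  rw [Cardinal.lift_id, Cardinal.lift_id]
  refine add_le_of_le H.aleph0_le hP (le_trans ?_ H.hL)
  rw [Language.card, mk_sum]
  simp

theorem Mon.small_fin {ι : Type u} [Finite ι] : #ι ≤ μ := (mk_le_aleph0).trans H.aleph0_le

theorem Mon.realize {ι : Type u} (hι : #ι ≤ μ) (V : Ultrafilter (ι → M)) {P : Set M}
    (hP : #P ≤ μ) : ∃ w, Realizes L V P w := by
  obtain ⟨w, hw⟩ := H.comp ι hι P hP {A | QF L P ι A ∧ A ∈ V} (fun A hA => hA.1) (by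
    intro G hG hGf
    have : ⋂₀ G ∈ V := (Filter.sInter_mem hGf).2 fun A hA => (hG hA).2
    exact V.nonempty_of_mem this)
  refine ⟨w, fun A hA => ⟨fun hwA => ?_, fun hV => hw A ⟨hA, hV⟩⟩⟩
  by_contra hn
  exact hw Aᶜ ⟨hA.compl, Ultrafilter.compl_mem_iff_notMem.2 hn⟩ hwA

end Small

variable {ι : Type*} {V : Ultrafilter (ι → M)} {P Q N X₀ : Set M}

theorem Realizes.mono {w : ι → M} (h : Realizes L V Q w) (hP : P ⊆ cl Q) : Realizes L V P w :=
  fun A hA => h A (hA.of_le hP)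

theorem Realizes.fs {w : ι → M} (h : Realizes L V P w) (hV : tuples L ι N ∈ V) :
    FS L (Set.range w) P N := by
  refine FS.of_fam fun A hA hw => ?_
  obtain ⟨u, hu⟩ := V.nonempty_of_mem (Filter.inter_mem ((h A hA).1 hw) hV)
  exact ⟨u, hu.1, hu.2⟩

theorem Realizes.eqT {w w' : ι → M} (h : Realizes L V P w) (h' : Realizes L V P w') :
    EqT L P w w' := fun A hA hw => (h' A hA).2 ((h A hA).1 hw)

/-- The type of a tuple over an existentially closed set is the restriction of an ultrafilter. -/
theorem exists_ultrafilter_of_fs {w : ι → M} (h : FS L (Set.range w) N N) :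
    ∃ V : Ultrafilter (ι → M), tuples L ι N ∈ V ∧ Realizes L V N w := by
  let B : Set (Set (ι → M)) := {C | ∃ A, QF L N ι A ∧ w ∈ A ∧ C = A ∩ tuples L ι N}
  have h1 : ∃ V : Ultrafilter (ι → M), B ⊆ V.sets := by
    refine Ultrafilter.exists_ultrafilter_of_finite_inter_nonempty B fun T hT => ?_
    choose! A hA hw hAT using hT
    obtain ⟨u, hu, hu'⟩ := h.fam (subset_cl N) (w := w) (fun i => mem_cl (.inr ⟨i, rfl⟩))
      (QF.biInter (T : Set (Set (ι → M))) T.finite_toSet (A := A) fun C hC => hA hC)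
      (Set.mem_iInter₂.2 fun C hC => hw hC)
    refine ⟨u, fun C hC => ?_⟩
    rw [hAT hC]
    exact ⟨Set.mem_iInter₂.1 hu C hC, hu'⟩
  obtain ⟨V, hV⟩ := h1
  have h2 : ∀ A, QF L N ι A → w ∈ A → A ∈ V := fun A hA hw =>
    Filter.mem_of_superset (hV ⟨A, hA, hw, rfl⟩) Set.inter_subset_left
  refine ⟨V, Filter.mem_of_superset (hV ⟨_, .univ, Set.mem_univ w, rfl⟩) Set.inter_subset_right,
    fun A hA => ⟨h2 A hA, fun hAV => ?_⟩⟩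
  by_contra hn
  exact Ultrafilter.compl_mem_iff_notMem.1 (h2 _ hA.compl hn) hAV

theorem Mon.exists_coheir {κ μ : Cardinal.{u}} (H : Mon L M κ μ) {ι : Type u} (hι : #ι ≤ μ)
    {w : ι → M} (h : FS L (Set.range w) N N) (hN : #N ≤ μ) (hP : #P ≤ μ) :
    ∃ w', EqT L N w w' ∧ FS L (Set.range w') (P ∪ N) N := by
  obtain ⟨V, h1, h2⟩ := exists_ultrafilter_of_fs h
  obtain ⟨w', hw'⟩ := H.realize hι V (H.small_union hP hN)
  exact ⟨w', h2.eqT (hw'.mono (Set.subset_union_right.trans (subset_cl _))), hw'.fs h1⟩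

/-! #### Sequences generated by an ultrafilter -/

/-- The entries of the tuples `a j` for `j ∈ D`. -/
def im {I ι : Type*} (a : I → ι → M) (D : Set I) : Set M := ⋃ j ∈ D, Set.range (a j)

theorem mem_im {I ι : Type*} {a : I → ι → M} {D : Set I} {j : I} (hj : j ∈ D) (k : ι) :
    a j k ∈ im a D := Set.mem_biUnion hj ⟨k, rfl⟩

theorem im_mono {I ι : Type*} {a : I → ι → M} {D D' : Set I} (h : D ⊆ D') : im a D ⊆ im a D' :=
  Set.biUnion_subset_biUnion_left h

variable (L) in
/-- A sequence whose members realize `V` over `P` and the preceding members. -/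
def GS {I : Type*} [LT I] (V : Ultrafilter (ι → M)) (P : Set M) (a : I → ι → M) : Prop :=
  ∀ i, Realizes L V (P ∪ im a {j | j < i}) (a i)

theorem GS.mono {I : Type*} [LT I] {a : I → ι → M} (h : GS L V Q a) (hP : P ⊆ cl Q) :
    GS L V P a := fun i => (h i).mono
  (Set.union_subset (hP.trans (cl_mono Set.subset_union_left))
    (Set.subset_union_right.trans (subset_cl _)))

variable {I I' J : Type*} [LinearOrder I] [LinearOrder I'] [LinearOrder J]

theorem GS.unique_fin {a : I → ι → M} {a' : I' → ι → M} (h : GS L V P a) (h' : GS L V P a')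
    (hV : tuples L ι X₀ ∈ V) (hX : X₀ ⊆ cl P) (n : ℕ) {σ : Fin n → I} {σ' : Fin n → I'}
    (hσ : StrictMono σ) (hσ' : StrictMono σ') :
    EqT L P (fun p : Fin n × ι => a (σ p.1) p.2) (fun p : Fin n × ι => a' (σ' p.1) p.2) := by
  induction n with
  | zero =>
    have : (fun p : Fin 0 × ι => a (σ p.1) p.2) = (fun p : Fin 0 × ι => a' (σ' p.1) p.2) :=
      funext fun p => p.1.elim0
    rw [this]
    exact EqT.refl _
  | succ n ih =>
    have ih' := ih (σ := fun i => σ i.castSucc) (σ' := fun i => σ' i.castSucc)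
      (fun i j hij => hσ (by simpa using hij)) (fun i j hij => hσ' (by simpa using hij))
    let ρ : Fin (n + 1) × ι → (Fin n × ι) ⊕ ι := fun p =>
      Fin.lastCases (motive := fun _ => (Fin n × ι) ⊕ ι) (Sum.inr p.2)
        (fun j => Sum.inl (j, p.2)) p.1
    have key : ∀ {I : Type _} [LinearOrder I] (a : I → ι → M) (σ : Fin (n + 1) → I),
        (fun p => Sum.elim (fun p : Fin n × ι => a (σ p.1.castSucc) p.2) (a (σ (Fin.last n))) (ρ p))
          = fun p : Fin (n + 1) × ι => a (σ p.1) p.2 := by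
      intro I _ a σ
      funext ⟨i, k⟩
      refine Fin.lastCases ?_ (fun j => ?_) i
      · simp [ρ]
      · simp [ρ]
    have key' : (fun p => Sum.elim (fun p : Fin n × ι => a' (σ' p.1.castSucc) p.2)
        (a' (σ' (Fin.last n))) (ρ p)) = fun p : Fin (n + 1) × ι => a' (σ' p.1) p.2 := by
      funext ⟨i, k⟩
      refine Fin.lastCases ?_ (fun j => ?_) i
      · simp [ρ]
      · simp [ρ]
    intro A hA hw
    have hB := hA.reindex ρ
    rw [← key] at hw
    rw [← key']
    have hin : ∀ p : Fin n × ι, a (σ p.1.castSucc) p.2 ∈ cl (P ∪ im a {j | j < σ (Fin.last n)}) :=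
      fun p => mem_cl (.inr (mem_im (a := a) (D := {j | j < σ (Fin.last n)})
        (j := σ p.1.castSucc) (hσ (Fin.castSucc_lt_last p.1)) p.2))
    have hin' : ∀ p : Fin n × ι, a' (σ' p.1.castSucc) p.2 ∈
        cl (P ∪ im a' {j | j < σ' (Fin.last n)}) :=
      fun p => mem_cl (.inr (mem_im (a := a') (D := {j | j < σ' (Fin.last n)})
        (j := σ' p.1.castSucc) (hσ' (Fin.castSucc_lt_last p.1)) p.2))
    have hq := (hB.mono (Set.subset_union_left (t := im a {j | j < σ (Fin.last n)}))).inst hin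
    have h1 := (h (σ (Fin.last n)) _ hq).1 hw
    by_contra hn
    have hq' := ((hB.mono (Set.subset_union_left
      (t := im a' {j | j < σ' (Fin.last n)}))).inst hin').compl
    have h2 := (h' (σ' (Fin.last n)) _ hq').1 hn
    obtain ⟨u, ⟨hu1, hu2⟩, hu3⟩ := V.nonempty_of_mem
      (Filter.inter_mem (Filter.inter_mem h1 h2) hV)
    have hu4 : ∀ i, u i ∈ cl P := fun i => cl_le hX (hu3 i)
    have hC := hB.preimage (β := Fin n × ι) (g := Sum.elim (fun p z => z p) (fun k _ => u k))
      (by rintro (p | k); exacts [.var p, .const_cl (hu4 k)])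
    have e : ∀ z : Fin n × ι → M, (fun i => (Sum.elim (fun p z => z p) (fun k _ => u k) :
        (Fin n × ι) ⊕ ι → (Fin n × ι → M) → M) i z) = Sum.elim z u := by
      intro z
      funext i
      cases i <;> rfl
    have e' : ∀ z : Fin n × ι → M, z ∈ {x : Fin n × ι → M | (fun i => (Sum.elim (fun p z => z p)
        (fun k _ => u k) : (Fin n × ι) ⊕ ι → (Fin n × ι → M) → M) i x) ∈
          {x : (Fin n × ι) ⊕ ι → M | (fun i => x (ρ i)) ∈ A}} ↔
        (fun i => Sum.elim z u (ρ i)) ∈ A := fun z => by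
      rw [← e z]; rfl
    exact hu2 ((e' _).1 (ih' _ hC ((e' _).2 hu1)))

theorem GS.unique {a : I → ι → M} {a' : I' → ι → M} (h : GS L V P a) (h' : GS L V P a')
    (hV : tuples L ι X₀ ∈ V) (hX : X₀ ⊆ cl P) {σ : J → I} {σ' : J → I'}
    (hσ : StrictMono σ) (hσ' : StrictMono σ') :
    EqT L P (fun p : J × ι => a (σ p.1) p.2) (fun p : J × ι => a' (σ' p.1) p.2) := by
  classical
  refine EqT.of_finite fun s hs P₀ hP₀ _ => ?_
  refine EqT.mono ?_ (hP₀.trans (subset_cl P))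
  let t : Finset J := hs.toFinset.image Prod.fst
  have ht : ∀ p : s, p.1.1 ∈ t := fun p => by
    simp only [t, Finset.mem_image, Set.Finite.mem_toFinset]
    exact ⟨p.1, p.2, rfl⟩
  let e := t.orderIsoOfFin rfl
  have h1 := h.unique_fin h' hV hX _ (σ := fun i => σ (e i)) (σ' := fun i => σ' (e i))
    (fun i j hij => hσ (by simpa using hij)) (fun i j hij => hσ' (by simpa using hij))
  have h2 := h1.reindex (fun p : s => (e.symm ⟨p.1.1, ht p⟩, p.1.2))
  simpa using h2

/-- Beyond an initial segment, the sequence is finitely satisfiable in `X₀`. -/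
theorem GS.fs {a : I → ι → M} (h : GS L V P a)
    (hV : tuples L ι X₀ ∈ V) (hX : X₀ ⊆ cl P) (hne : (cl X₀).Nonempty) {D : Set I}
    {E : Set I} (hDE : ∀ i ∈ D, ∀ j ∈ E, i < j) :
    FS L (im a E) (P ∪ im a D) X₀ := by
  classical
  have h1 : ∀ s : Finset I, (s : Set I) ⊆ E → FS L (im a s) (P ∪ im a D) X₀ := by
    intro s
    induction s using Finset.induction_on_max with
    | empty =>
      intro _
      refine FS.of_subset ?_
      simp [im]
    | insert m s hm ih =>
      intro hs
      have h2 := ih ((Finset.coe_subset.2 (Finset.subset_insert _ _)).trans hs)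
      have h3 : FS L (Set.range (a m)) (P ∪ im a D ∪ im a s) X₀ := by
        refine ((h m).fs hV).right ((Set.union_subset (Set.union_subset Set.subset_union_left ?_)
          ?_).trans (subset_cl _))
        · exact (im_mono fun i hi => hDE i hi m (hs (by simp))).trans Set.subset_union_right
        · exact (im_mono fun i hi => hm i (by simpa using hi)).trans Set.subset_union_right
      have h4 := h2.union (hX.trans (cl_mono Set.subset_union_left))
        (h3.base (Set.subset_union_left.trans (subset_cl _)))
      refine h4.left (hX.trans (cl_mono Set.subset_union_left)) ?_
      refine subset_trans ?_ (Set.subset_union_right.trans (subset_cl _))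
      simp [im, Set.union_comm]
  refine FS.of_finite (fun Y hY hYf => ?_) hne
  have h5 : ∀ y ∈ Y, ∃ j ∈ E, y ∈ Set.range (a j) := fun y hy => by
    simpa [im] using hY hy
  by_cases hI : Nonempty I
  swap
  · refine FS.of_subset fun y hy => ?_
    exact (hI ⟨(h5 y hy).choose⟩).elim
  choose! j hj hyj using h5
  refine (h1 (hYf.toFinset.image j) ?_).left (hX.trans (cl_mono Set.subset_union_left)) ?_
  · intro i hi
    simp only [Finset.coe_image, Set.Finite.coe_toFinset, Set.mem_image] at hi
    obtain ⟨y, hy, rfl⟩ := hi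
    exact hj y hy
  · intro y hy
    obtain ⟨k, hk⟩ := hyj y hy
    refine mem_cl (.inr ?_)
    rw [← hk]
    refine mem_im ?_ k
    simp only [Finset.coe_image, Set.Finite.coe_toFinset, Set.mem_image]
    exact ⟨y, hy, rfl⟩

end Monster

end QFree

namespace QFree

section Sequences

variable {L : FirstOrder.Language.{u, u}} {M : Type u} [L.Structure M]

local notation "cl" => clos L

variable {κ μ : Cardinal.{u}}

theorem exists_strictMonoOn {I : Type*} [LinearOrder I] (s : Finset I) :
    ∃ τ : I → ℕ, StrictMonoOn τ s ∧ ∀ i ∈ s, ∀ j < i, τ j < τ i := by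
  classical
  have key : ∀ i ∈ s, ∀ j < i, 2 * (s.filter (· < j)).card + (if j ∈ s then 1 else 0) <
      2 * (s.filter (· < i)).card + (if i ∈ s then 1 else 0) := by
    intro i hi j hj
    rw [if_pos hi]
    by_cases hjs : j ∈ s
    · rw [if_pos hjs]
      have : (s.filter (· < j)).card < (s.filter (· < i)).card := by
        refine Finset.card_lt_card ⟨?_, ?_⟩
        · intro k hk
          simp only [Finset.mem_filter] at hk ⊢
          exact ⟨hk.1, hk.2.trans hj⟩
        · intro h
          have := h (x := j) (by simp [hjs, hj])
          simp at this
      omega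
    · rw [if_neg hjs]
      have : (s.filter (· < j)).card ≤ (s.filter (· < i)).card := by
        refine Finset.card_le_card ?_
        intro k hk
        simp only [Finset.mem_filter] at hk ⊢
        exact ⟨hk.1, hk.2.trans hj⟩
      omega
  exact ⟨fun j => 2 * (s.filter (· < j)).card + (if j ∈ s then 1 else 0),
    fun j _ i hi hj => key i hi j hj, key⟩

variable {ι : Type u} {V : Ultrafilter (ι → M)} {P X₀ : Set M}

theorem GS.shift {a : ℕ → ι → M} (h : GS L V P a) (hV : tuples L ι X₀ ∈ V) (hX : X₀ ⊆ cl P)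
    {I : Type u} [LinearOrder I] {s : Finset I} {τ τ' : I → ℕ} (hτ : StrictMonoOn τ s)
    (hτ' : StrictMonoOn τ' s) [Nonempty M] {A : Set (I × ι → M)} (hA : QF L P (I × ι) A)
    (hs : ∀ x y : I × ι → M, (∀ p : I × ι, p.1 ∈ s → x p = y p) → (x ∈ A ↔ y ∈ A))
    (hw : (fun p : I × ι => a (τ p.1) p.2) ∈ A) : (fun p : I × ι => a (τ' p.1) p.2) ∈ A := by
  obtain ⟨B, hB, hAB⟩ := hA.restrict (s := {p | p.1 ∈ s}) fun x y hxy => hs x y fun p hp => hxy p hp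
  rw [hAB] at hw ⊢
  have h1 := h.unique h hV hX (J := s) (σ := fun j => τ j) (σ' := fun j => τ' j)
    (fun i j hij => hτ i.2 j.2 hij) (fun i j hij => hτ' i.2 j.2 hij)
  exact h1.reindex (fun p : {p : I × ι | p.1 ∈ s} => ((⟨p.1.1, p.2⟩ : s), p.1.2)) B hB hw

theorem Mon.exists_GS (H : Mon L M κ μ) (hι : #ι ≤ μ) {I : Type u} [LinearOrder I] (hI : #I ≤ μ)
    (hP : #P ≤ μ) (hV : tuples L ι X₀ ∈ V) (hX : X₀ ⊆ cl P) : ∃ a : I → ι → M, GS L V P a := by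
  classical
  have : Nonempty M := H.nonempty
  obtain ⟨b, hb⟩ : ∃ b : ℕ → ι → M, GS L V P b := by
    refine exists_wf_rec (· < ·) wellFounded_lt
      (fun n f x => Realizes L V (P ∪ im f {j | j < n}) x) ?_ ?_
    · intro n f f' x hf hx
      have : im f {j | j < n} = im f' {j | j < n} := by
        refine Set.iUnion₂_congr fun j hj => ?_
        rw [hf j hj]
      rwa [← this]
    · intro n f _
      refine H.realize hι V (H.small_union hP (H.small_subset (Q := Set.range
        (fun p : ULift.{u} ℕ × ι => f p.1.down p.2)) ?_ (H.small_range ?_ _)))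
      · intro x hx
        simp only [im, Set.mem_iUnion] at hx
        obtain ⟨j, _, k, rfl⟩ := hx
        exact ⟨(⟨j⟩, k), rfl⟩
      · rw [mk_prod, lift_id, lift_id]
        exact (mul_le_mul' (mk_le_aleph0.trans H.aleph0_le) hι).trans (mul_eq_self H.aleph0_le).le
  have hIι : #(I × ι) ≤ μ := by
    rw [mk_prod, lift_id, lift_id]
    exact (mul_le_mul' hI hι).trans (mul_eq_self H.aleph0_le).le
  obtain ⟨a, ha⟩ := H.comp (I × ι) hIι P hP
    {A | QF L P (I × ι) A ∧ ∃ s : Finset I, ∀ τ : I → ℕ, StrictMonoOn τ s →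
      (fun p : I × ι => b (τ p.1) p.2) ∈ A} (fun A hA => hA.1) (by
    intro G hG hGf
    choose! hA s hs using hG
    obtain ⟨τ, hτ, -⟩ := exists_strictMonoOn (hGf.toFinset.biUnion s)
    refine ⟨_, fun A hAG => hs hAG τ (hτ.mono ?_)⟩
    intro i hi
    simp only [Finset.coe_biUnion, Set.mem_iUnion]
    exact ⟨A, by simpa using hAG, hi⟩)
  have key : ∀ (s : Finset I) (τ : I → ℕ), StrictMonoOn τ s → ∀ A : Set (I × ι → M),
      QF L P (I × ι) A →
      (∀ x y : I × ι → M, (∀ p : I × ι, p.1 ∈ s → x p = y p) → (x ∈ A ↔ y ∈ A)) →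
      a ∈ A → (fun p : I × ι => b (τ p.1) p.2) ∈ A := by
    intro s τ hτ A hA hs haA
    by_contra hn
    refine ha Aᶜ ⟨hA.compl, s, fun τ' hτ' => ?_⟩ haA
    exact hb.shift hV hX hτ hτ' hA.compl (fun x y hxy => not_congr (hs x y hxy)) hn
  refine ⟨fun i k => a (i, k), fun i => ?_⟩
  have main : ∀ A, QF L (P ∪ im (fun i k => a (i, k)) {j | j < i}) ι A →
      (fun k => a (i, k)) ∈ A → A ∈ V := by
    intro A hA haA
    have e : im (fun i k => a (i, k)) {j | j < i} =
        Set.range (fun p : {j // j < i} × ι => a (p.1.1, p.2)) := by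
      ext x
      simp [im]
    rw [e] at hA
    obtain ⟨B, hB, hAB⟩ := hA.abs
    by_contra hn
    have hn' := Ultrafilter.compl_mem_iff_notMem.2 hn
    obtain ⟨-, s₀, -, -, hs₀, -, hsB⟩ := hB.support
    let s : Finset I := insert i (hs₀.toFinset.image (Sum.elim (fun p => p.1.1) (fun _ => i)))
    have hsi : i ∈ s := by simp [s]
    have hsj : ∀ p, Sum.inl p ∈ s₀ → (p.1.1 : I) ∈ s := by
      intro p hp
      simp only [s, Finset.mem_insert, Finset.mem_image]
      exact .inr ⟨Sum.inl p, by simpa using hp, rfl⟩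
    obtain ⟨τ, hτ, hτ'⟩ := exists_strictMonoOn s
    have h1 := key s τ hτ _ (hB.reindex
      (Sum.elim (fun p : {j // j < i} × ι => (p.1.1, p.2)) (fun k => (i, k)))) (by
        intro x y hxy
        refine hsB _ _ ?_
        rintro (p | k) hp
        · exact hxy _ (hsj p hp)
        · exact hxy _ hsi) (by
        refine (congrArg (· ∈ B) (funext fun p => ?_)).mp ((hAB _).1 haA)
        rcases p with p | p <;> rfl)
    let c : {j // j < i} × ι → M := fun p => b (τ p.1.1) p.2
    have hc : ∀ p, c p ∈ cl (P ∪ im b {j | j < τ i}) := fun p =>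
      mem_cl (.inr (mem_im (a := b) (D := {j | j < τ i}) (hτ' i hsi p.1.1 p.1.2) p.2))
    have hBc := (hB.mono (Set.subset_union_left (t := im b {j | j < τ i}))).inst hc
    have h2 := (hb (τ i) _ hBc).1 (by
        refine (congrArg (· ∈ B) (funext fun p => ?_)).mp h1
        rcases p with p | p <;> rfl)
    obtain ⟨u, ⟨hu1, hu2⟩, hu3⟩ := V.nonempty_of_mem
      (Filter.inter_mem (Filter.inter_mem h2 hn') hV)
    have hu4 : ∀ k, u k ∈ cl P := fun k => cl_le hX (hu3 k)
    have hA3 := hB.preimage (β := I × ι)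
      (g := Sum.elim (fun (p : {j // j < i} × ι) z => z (p.1.1, p.2)) (fun k _ => u k))
      (by rintro (p | k); exacts [.var _, .const_cl (hu4 k)])
    have h3 := key s τ hτ _ hA3.compl (by
        intro x y hxy
        refine not_congr (hsB _ _ ?_)
        rintro (p | k) hp
        · exact hxy _ (hsj p hp)
        · rfl) (by
        intro h
        refine hu2 ((hAB u).2 ((congrArg (· ∈ B) (funext fun p => ?_)).mp h))
        rcases p with p | p <;> rfl)
    refine h3 ((congrArg (· ∈ B) (funext fun p => ?_)).mp hu1)
    rcases p with p | p <;> rfl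
  refine fun A hA => ⟨main A hA, fun hAV => ?_⟩
  by_contra hn
  exact Ultrafilter.compl_mem_iff_notMem.1 (main _ hA.compl hn) hAV

end Sequences

end QFree

namespace QFree

section Independence

variable {L : FirstOrder.Language.{u, u}} {M : Type u} [L.Structure M]

local notation "cl" => clos L

variable {κ μ lam : Cardinal.{u}}

variable (L) in
/-- `B` is irredundant over `P`. -/
def Indep (P B : Set M) : Prop := ∀ b ∈ B, b ∉ cl (P ∪ B \ {b})

theorem Indep.mono {P B P' B' : Set M} (h : Indep L P B) (hB : B' ⊆ B) (hP : P' ⊆ cl P) :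
    Indep L P' B' := by
  intro b hb hb'
  refine h b (hB hb) (cl_le (Set.union_subset ?_ ?_) hb')
  · exact hP.trans (cl_mono Set.subset_union_left)
  · exact (Set.sdiff_subset_sdiff_left hB).trans (Set.subset_union_right.trans (subset_cl _))

theorem mk_biUnion_finite_lt {X : Type u} {Y : Set X} (hlam : ℵ₀ < lam) (hY : #Y < lam)
    {F : X → Set X} (hF : ∀ y ∈ Y, (F y).Finite) : #(⋃ y ∈ Y, F y : Set X) < lam := by
  rw [Set.biUnion_eq_iUnion]
  refine (mk_iUnion_le _).trans_lt ?_
  have : ⨆ i : Y, #(F i) ≤ ℵ₀ := ciSup_le' fun i => (hF i i.2).countable.le_aleph0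
  refine (mul_le_mul' le_rfl this).trans_lt ?_
  exact mul_lt_of_lt hlam.le hY hlam

theorem Indep.exists_notMem {P B Y : Set M} (h : Indep L P B) (hlam : ℵ₀ < lam) (hB : lam ≤ #B)
    (hY : #Y < lam) (hYB : Y ⊆ cl (P ∪ B)) : ∃ b ∈ B, b ∉ cl (P ∪ Y) := by
  have h1 : ∀ y ∈ Y, ∃ F ⊆ B, F.Finite ∧ y ∈ cl (P ∪ F) := by
    intro y hy
    obtain ⟨F, h1, h2, h3⟩ := cl_finite_union (Set.finite_singleton y)
      (Set.singleton_subset_iff.2 (hYB hy))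
    exact ⟨F, h1, h2, h3 rfl⟩
  choose! F hFB hF hyF using h1
  have h2 := mk_biUnion_finite_lt hlam hY hF
  have h3 : ∃ b ∈ B, b ∉ ⋃ y ∈ Y, F y := by
    by_contra! hn
    exact (hB.trans (mk_le_mk_of_subset hn)).not_gt h2
  obtain ⟨b, hb, hb'⟩ := h3
  refine ⟨b, hb, fun hbY => h b hb (cl_le (Set.union_subset ?_ ?_) hbY)⟩
  · exact Set.subset_union_left.trans (subset_cl _)
  · intro y hy
    refine cl_mono (Set.union_subset_union_right _ ?_) (hyF y hy)
    intro x hx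
    refine ⟨hFB y hy hx, ?_⟩
    rintro rfl
    exact hb' (Set.mem_biUnion hy hx)

theorem Indep.sg {P B : Set M} (h : Indep L P B) (hlam : ℵ₀ < lam) (hB : #B = lam)
    (hP : #P ≤ lam) : SG L lam (cl (P ∪ B)) := by
  refine ⟨⟨P ∪ B, (mk_union_le _ _).trans (add_le_of_le hlam.le hP hB.le), rfl⟩, fun Y hY => ?_⟩
  by_contra! hn
  obtain ⟨b, hb, hb'⟩ := h.exists_notMem hlam hB.ge hn (by rw [← hY]; exact subset_cl Y)
  refine hb' (cl_mono Set.subset_union_right ?_)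
  rw [hY]
  exact mem_cl (.inr hb)

/-- Sequences of elements generated by an ultrafilter. -/
def single {I : Type*} (a : I → M) : I → PUnit.{u + 1} → M := fun i _ => a i

theorem im_single {I : Type*} (a : I → M) (D : Set I) : im (single a) D = a '' D := by
  ext x
  simp [im, single, eq_comm]

/-- The ultrafilter of one-element tuples is nonprincipal. -/
def NP (V : Ultrafilter (PUnit.{u + 1} → M)) : Prop :=
  ∀ m : M, {x : PUnit.{u + 1} → M | x ⟨⟩ = m} ∉ V

theorem exists_NP {X₀ : Set M} (hX : (cl X₀).Infinite) :
    ∃ V : Ultrafilter (PUnit.{u + 1} → M), tuples L PUnit.{u + 1} X₀ ∈ V ∧ NP V := by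
  have : Infinite (cl X₀) := hX.to_subtype
  refine ⟨(Filter.hyperfilter (cl X₀)).map (fun (x : cl X₀) _ => (x : M)), ?_, fun m hm => ?_⟩
  · rw [Ultrafilter.mem_map]
    exact Filter.mem_of_superset Filter.univ_mem fun (x : cl X₀) _ i => x.2
  · rw [Ultrafilter.mem_map] at hm
    have hf : ((fun (x : cl X₀) (_ : PUnit.{u + 1}) => (x : M)) ⁻¹'
        {x : PUnit.{u + 1} → M | x ⟨⟩ = m}).Finite := by
      refine Set.Subsingleton.finite ?_
      intro x hx y hy
      have hx' : (x : M) = m := hx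
      have hy' : (y : M) = m := hy
      exact Subtype.ext (hx'.trans hy'.symm)
    exact Filter.notMem_hyperfilter_of_finite hf hm

theorem NP.of_realizes {V : Ultrafilter (PUnit.{u + 1} → M)} {N : Set M} {b : M}
    (hV : tuples L PUnit.{u + 1} N ∈ V) (hb : Realizes L V N (fun _ => b)) (hbN : b ∉ cl N) :
    NP V := by
  intro m hm
  obtain ⟨u, hu, hu'⟩ := V.nonempty_of_mem (Filter.inter_mem hm hV)
  have hu : u ⟨⟩ = m := hu
  have hmN : m ∈ cl N := hu ▸ hu' ⟨⟩
  have : b = m := (hb _ (.eq (fun x => x ⟨⟩) (fun _ => m) (.var _) (.const_cl hmN))).2 hm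
  exact hbN (this ▸ hmN)

theorem NP.notMem {V : Ultrafilter (PUnit.{u + 1} → M)} (h : NP V) {P : Set M} {w}
    (hw : Realizes L V P w) : w ⟨⟩ ∉ cl P := by
  intro hwP
  exact h (w ⟨⟩) ((hw _ (.eq (fun x : PUnit.{u + 1} → M => x PUnit.unit) (fun _ => w PUnit.unit)
    (.var PUnit.unit) (.const_cl hwP))).1 rfl)

variable {I : Type*} [LinearOrder I]

theorem GS.notMem {V : Ultrafilter (PUnit.{u + 1} → M)} (h : NP V) {P X₀ : Set M} {a : I → M}
    (ha : GS L V P (single a)) (hV : tuples L PUnit.{u + 1} X₀ ∈ V) (hX : X₀ ⊆ cl P) (i : I) :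
    a i ∉ cl (P ∪ a '' {j | j ≠ i}) := by
  intro hi
  have hne : (cl X₀).Nonempty := by
    obtain ⟨u, hu⟩ := V.nonempty_of_mem hV
    exact ⟨_, hu ⟨⟩⟩
  have h1 := ha.fs hV hX hne (D := {j | j ≤ i}) (E := {j | i < j}) fun j hj k hk =>
    lt_of_le_of_lt hj hk
  rw [im_single, im_single] at h1
  have h2 : a i ∉ cl (P ∪ a '' {j | j < i}) := by
    have := h.notMem (ha i)
    rwa [im_single] at this
  have h3 := (h1.base (N' := P ∪ a '' {j | j < i})
    (hX.trans (cl_mono Set.subset_union_left))).mem (x := a i)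
    ((Set.union_subset_union_right P (Set.image_mono fun j hj => le_of_lt hj)).trans (subset_cl _))
    (by
      refine cl_mono ?_ hi
      rw [Set.union_assoc, ← Set.image_union]
      refine Set.union_subset_union_right P (Set.image_mono fun j hj => ?_)
      exact lt_or_gt_of_ne hj) (mem_cl (.inr ⟨i, le_refl i, rfl⟩))
  exact h2 h3

theorem GS.injective {V : Ultrafilter (PUnit.{u + 1} → M)} (h : NP V) {P X₀ : Set M} {a : I → M}
    (ha : GS L V P (single a)) (hV : tuples L PUnit.{u + 1} X₀ ∈ V) (hX : X₀ ⊆ cl P) :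
    Function.Injective a := by
  intro i j hij
  by_contra hn
  exact ha.notMem h hV hX j (mem_cl (.inr ⟨i, hn, hij⟩))

theorem GS.indep {V : Ultrafilter (PUnit.{u + 1} → M)} (h : NP V) {P X₀ : Set M} {a : I → M}
    (ha : GS L V P (single a)) (hV : tuples L PUnit.{u + 1} X₀ ∈ V) (hX : X₀ ⊆ cl P) :
    Indep L P (Set.range a) := by
  rintro _ ⟨i, rfl⟩ hi
  refine ha.notMem h hV hX i (cl_mono (Set.union_subset_union_right P ?_) hi)
  rintro _ ⟨⟨j, rfl⟩, hj⟩
  exact ⟨j, fun e => hj (e ▸ rfl), rfl⟩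

end Independence

end QFree

namespace QFree

/-- The first uncountable ordinal. -/
abbrev Om : Type u := (Cardinal.aleph 1 : Cardinal.{u}).ord.ToType

theorem mk_Om : #Om.{u} = Cardinal.aleph 1 := mk_ord_toType _

theorem Om.countable_Iio (ν : Om.{u}) : (Set.Iio ν).Countable := by
  rw [← le_aleph0_iff_set_countable, ← lt_aleph_one_iff]
  simpa using mk_Iio_lt ν

theorem Om.countable_Iic (ν : Om.{u}) : (Set.Iic ν).Countable := by
  rw [← Set.Iio_union_right]
  exact (Om.countable_Iio ν).union (Set.countable_singleton ν)

theorem Om.exists_notMem {s : Set Om.{u}} (hs : s.Countable) : ∃ ν, ν ∉ s := by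
  by_contra! h
  have h1 : s = Set.univ := Set.eq_univ_of_forall h
  have h2 := le_aleph0_iff_set_countable.2 hs
  rw [h1, mk_univ, mk_Om] at h2
  exact (aleph_one_le_iff.1 le_rfl).not_ge h2

theorem Om.exists_gt (ν : Om.{u}) : ∃ ν', ν < ν' := by
  obtain ⟨ν', h⟩ := Om.exists_notMem (Om.countable_Iic ν)
  exact ⟨ν', not_le.1 h⟩

instance : Nonempty Om.{u} := (Om.exists_notMem Set.countable_empty).nonempty

theorem Om.exists_eq_Iio {D : Set Om.{u}} (hD : D.Countable) (h : ∀ ν ∈ D, ∀ ν' < ν, ν' ∈ D) :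
    ∃ δ, D = Set.Iio δ := by
  have hne : (Dᶜ : Set Om.{u}).Nonempty := Om.exists_notMem hD
  refine ⟨WellFounded.min wellFounded_lt Dᶜ hne, Set.ext fun ν => ⟨fun hν => ?_, fun hν => ?_⟩⟩
  · have hm := WellFounded.min_mem wellFounded_lt Dᶜ hne
    rw [Set.mem_Iio]
    by_contra hn
    rcases (not_lt.1 hn).eq_or_lt with e | e
    · exact hm (e ▸ hν)
    · exact hm (h ν hν _ e)
  · by_contra hn
    exact WellFounded.not_lt_min wellFounded_lt Dᶜ hn hν

theorem exists_finite_image {X Y : Type*} {f : X → Y} {s : Set X} {F : Set Y} (hF : F.Finite)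
    (h : F ⊆ f '' s) : ∃ E ⊆ s, E.Finite ∧ f '' E = F := by
  have h' : ∀ y : F, ∃ x ∈ s, f x = y := fun y => h y.2
  choose g h1 h2 using h'
  have := hF.to_subtype
  refine ⟨Set.range g, ?_, Set.finite_range g, ?_⟩
  · rintro _ ⟨y, rfl⟩
    exact h1 y
  · rw [← Set.range_comp]
    ext y
    constructor
    · rintro ⟨x, rfl⟩
      rw [Function.comp_apply, h2 x]
      exact x.2
    · exact fun hy => ⟨⟨y, hy⟩, h2 _⟩

theorem exists_finite_image' {X Y : Type*} {f : X → Y} {F : Set Y} (hF : F.Finite)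
    (h : F ⊆ Set.range f) : ∃ E : Set X, E.Finite ∧ f '' E = F := by
  rw [← Set.image_univ] at h
  obtain ⟨E, -, h1, h2⟩ := exists_finite_image hF h
  exact ⟨E, h1, h2⟩

theorem exists_countable_closed {X : Type*} (Φ : X → Set X) (hΦ : ∀ x, (Φ x).Countable)
    {s : Set X} (hs : s.Countable) : ∃ D, s ⊆ D ∧ D.Countable ∧ ∀ x ∈ D, Φ x ⊆ D := by
  let F : ℕ → Set X := fun n => Nat.rec s (fun _ D => ⋃ x ∈ D, Φ x) n
  have hF : ∀ n, (F n).Countable := by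
    intro n
    induction n with
    | zero => exact hs
    | succ n ih => exact ih.biUnion fun x _ => hΦ x
  refine ⟨⋃ n, F n, Set.subset_iUnion F 0, Set.countable_iUnion hF, fun x hx => ?_⟩
  obtain ⟨n, hn⟩ := Set.mem_iUnion.1 hx
  exact (Set.subset_biUnion_of_mem (u := fun x => Φ x) hn).trans (Set.subset_iUnion F (n + 1))

section Club

variable {L : FirstOrder.Language.{u, u}} {M : Type u} [L.Structure M]

local notation "cl" => clos L

variable {κ μ : Cardinal.{u}}

/-- Countably supported closure. -/
theorem cl_countable_union {Y N : Set M} {I : Type*} {a : I → M} (hY : Y.Countable)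
    (h : Y ⊆ cl (N ∪ Set.range a)) : ∃ F : Set I, F.Countable ∧ Y ⊆ cl (N ∪ a '' F) := by
  have h1 : ∀ y ∈ Y, ∃ F : Set I, F.Countable ∧ y ∈ cl (N ∪ a '' F) := by
    intro y hy
    obtain ⟨F, h1, h2, h3⟩ := cl_finite_union (Set.finite_singleton y)
      (Set.singleton_subset_iff.2 (h hy))
    obtain ⟨F', hF', e⟩ := exists_finite_image' h2 h1
    exact ⟨F', hF'.countable, by rw [e]; exact h3 rfl⟩
  choose! F h2 h3 using h1
  exact ⟨⋃ y ∈ Y, F y, hY.biUnion h2, fun y hy => cl_mono (Set.union_subset_union_right _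
    (Set.image_mono (Set.subset_biUnion_of_mem (u := fun y => F y) hy))) (h3 y hy)⟩

/-- Stages of a chain. -/
def Nn (X₀ : Set M) (G : Om.{u} → Set M) (δ : Om.{u}) : Set M := X₀ ∪ ⋃ ν ∈ Set.Iio δ, G ν

/-- The union of a chain. -/
def Nall (X₀ : Set M) (G : Om.{u} → Set M) : Set M := X₀ ∪ ⋃ ν, G ν

section

variable {X₀ : Set M} {G : Om.{u} → Set M}

theorem subset_Nn {δ} : X₀ ⊆ Nn X₀ G δ := Set.subset_union_left

theorem subset_Nn_of_lt {ν δ : Om.{u}} (h : ν < δ) : G ν ⊆ Nn X₀ G δ :=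
  (Set.subset_biUnion_of_mem (u := fun ν => G ν) (Set.mem_Iio.2 h)).trans Set.subset_union_right

theorem Nn_mono {δ δ' : Om.{u}} (h : δ ≤ δ') : Nn X₀ G δ ⊆ Nn X₀ G δ' :=
  Set.union_subset_union_right _ (Set.biUnion_subset_biUnion_left (Set.Iio_subset_Iio h))

theorem Nn_subset_Nall {δ} : Nn X₀ G δ ⊆ Nall X₀ G :=
  Set.union_subset_union_right _ (Set.iUnion₂_subset fun ν _ => Set.subset_iUnion G ν)

theorem subset_Nall (ν) : G ν ⊆ Nall X₀ G :=
  (Set.subset_iUnion G ν).trans Set.subset_union_right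

theorem Nn_countable (hX : X₀.Countable) (hG : ∀ ν, (G ν).Countable) (δ) :
    (Nn X₀ G δ).Countable := hX.union ((Om.countable_Iio δ).biUnion fun ν _ => hG ν)

theorem mk_Nall (hX : X₀.Countable) (hG : ∀ ν, (G ν).Countable) : #(Nall X₀ G) ≤ aleph 1 := by
  refine (mk_union_le _ _).trans (add_le_of_le (aleph0_le_aleph 1) ?_ ?_)
  · exact (le_aleph0_iff_set_countable.2 hX).trans (aleph0_le_aleph 1)
  · refine (mk_iUnion_le G).trans (mul_le_of_le (aleph0_le_aleph 1) mk_Om.le (ciSup_le' fun ν => ?_))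
    exact (le_aleph0_iff_set_countable.2 (hG ν)).trans (aleph0_le_aleph 1)

theorem Nn_finite_subset {δ : Om.{u}} (hδ : ∃ α, α < δ) (hδ' : ∀ α < δ, ∃ α' < δ, α < α')
    {F : Set M} (hF : F.Finite) (h : F ⊆ Nn X₀ G δ) : ∃ α < δ, F ⊆ Nn X₀ G α := by
  induction F, hF using Set.Finite.induction_on with
  | empty => exact hδ.imp fun α hα => ⟨hα, Set.empty_subset _⟩
  | @insert x F _ _ ih =>
    obtain ⟨α, hα, hF⟩ := ih ((Set.subset_insert _ _).trans h)
    rcases h (Set.mem_insert _ _) with hx | hx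
    · exact ⟨α, hα, Set.insert_subset (.inl hx) hF⟩
    · obtain ⟨ν, hν, hx⟩ := Set.mem_iUnion₂.1 hx
      obtain ⟨ν', hν', h1⟩ := hδ' ν hν
      refine ⟨max α ν', max_lt hα hν', Set.insert_subset ?_ (hF.trans (Nn_mono (le_max_left _ _)))⟩
      exact Nn_mono (le_max_right _ _) (subset_Nn_of_lt h1 hx)

end

/-- Blocks of the index set. -/
abbrev KK (κ : Cardinal.{u}) : Type u := WithTop κ.ord.ToType

/-- The index set of the sequences. -/
abbrev II (κ : Cardinal.{u}) : Type u := Lex ((KK κ)ᵒᵈ × ℕ)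

/-- The block of an index. -/
def blk (i : II κ) : KK κ := OrderDual.ofDual (ofLex i).1

/-- The set of indices with block in `K`. -/
def blks (K : Set (KK κ)) : Set (II κ) := {i | blk i ∈ K}

/-- The index at a given place of a block. -/
def mkI (β : KK κ) (n : ℕ) : II κ := toLex (OrderDual.toDual β, n)

theorem lt_II {i j : II κ} : i < j ↔ blk j < blk i ∨ blk i = blk j ∧ (ofLex i).2 < (ofLex j).2 := by
  rw [Prod.Lex.lt_iff]
  rfl

theorem mk_II (hκ : ℵ₀ ≤ κ) : #(II κ) = κ := by
  have h1 : #(KK κ) = κ := by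
    have h : #(Option κ.ord.ToType) = κ := by
      rw [mk_option, mk_ord_toType, add_one_eq hκ]
    exact h
  have h2 : #(II κ) = #((KK κ) × ULift.{u} ℕ) :=
    mk_congr (ofLex.trans (Equiv.prodCongr OrderDual.ofDual Equiv.ulift.symm))
  rw [h2, mk_prod, lift_id, lift_id, h1, mk_uLift, mk_nat, lift_aleph0, mul_aleph0_eq hκ]

/-- A finite family of blocks controls a finite subset of the closure. -/
theorem GS.exists_blocks (hV' : Nonempty M) {V : Ultrafilter (PUnit.{u + 1} → M)} {X₀ : Set M}
    {a : II κ → M} (ha : GS L V X₀ (single a)) (hV : tuples L PUnit.{u + 1} X₀ ∈ V)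
    {K : Set (KK κ)} (hK : ⊤ ∈ K) {Y : Set M} (hY : Y.Finite) (hYa : Y ⊆ cl (X₀ ∪ Set.range a)) :
    ∃ G ⊆ K, G.Finite ∧ FS L Y (X₀ ∪ a '' blks K) (X₀ ∪ a '' blks G) := by
  classical
  have hρ : ∀ β : KK κ, ∃ γ ∈ K, β ≤ γ ∧ ∀ γ' ∈ K, β ≤ γ' → γ ≤ γ' := by
    intro β
    have hne : {γ | γ ∈ K ∧ β ≤ γ}.Nonempty := ⟨⊤, hK, le_top⟩
    refine ⟨WellFounded.min wellFounded_lt _ hne, (WellFounded.min_mem wellFounded_lt _ hne).1,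
      (WellFounded.min_mem wellFounded_lt _ hne).2, fun γ' h1 h2 => ?_⟩
    have h3 : γ' ∈ {γ | γ ∈ K ∧ β ≤ γ} := ⟨h1, h2⟩
    exact not_lt.1 (WellFounded.not_lt_min wellFounded_lt _ h3)
  choose ρ hρK hρle hρmin using hρ
  have hρmono : ∀ {β β'}, β ≤ β' → ρ β ≤ ρ β' := fun h => hρmin _ _ (hρK _) (h.trans (hρle _))
  have hρid : ∀ {β}, β ∈ K → ρ β = β := fun h => (hρmin _ _ h le_rfl).antisymm (hρle _)
  obtain ⟨F₁, h1, h2, h3⟩ := cl_finite_union hY hYa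
  obtain ⟨F, hF, rfl⟩ := exists_finite_image' h2 h1
  refine ⟨ρ '' (blk '' F), ?_, (hF.image _).image _, ?_⟩
  · rintro _ ⟨β, _, rfl⟩
    exact hρK β
  suffices hs : FS L (Set.range fun i : F => a i) (X₀ ∪ a '' blks K)
      (X₀ ∪ a '' blks (ρ '' (blk '' F))) by
    refine hs.left ?_ ?_
    · refine Set.union_subset (Set.subset_union_left.trans (subset_cl _)) ?_
      rintro _ ⟨i, ⟨β, hβ, e⟩, rfl⟩
      refine QFree.mem_cl (.inr ⟨i, ?_, rfl⟩)
      change blk i ∈ K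
      rw [← e]
      exact hρK β
    · refine h3.trans (cl_mono (Set.union_subset ?_ ?_))
      · exact Set.subset_union_left.trans Set.subset_union_left
      · rw [Set.image_eq_range]
        exact Set.subset_union_right
  refine FS.of_fam fun A hA hw => ?_
  obtain ⟨P₀, s, h4, h5, h6, h7, h8⟩ := hA.support
  obtain ⟨F', hF'P, hF', hP₀⟩ : ∃ F' ⊆ blks K, F'.Finite ∧ P₀ ⊆ X₀ ∪ a '' F' := by
    obtain ⟨F', hF'K, hF', e⟩ := exists_finite_image (F := P₀ ∩ a '' blks K)
      (h5.inter_of_left _) Set.inter_subset_right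
    refine ⟨F', hF'K, hF', fun p hp => ?_⟩
    rw [e]
    exact (h4 hp).imp id fun h => ⟨hp, h⟩
  have h9 : QF L (X₀ ∪ Set.range fun i : F' => a i) F A := by
    refine h7.mono ?_
    rwa [← Set.image_eq_range]
  obtain ⟨B, hB, hAB⟩ := h9.abs
  obtain ⟨m, hm⟩ : ∃ m : ℕ, ∀ i ∈ F ∪ F', (ofLex i).2 < m := by
    obtain ⟨m, hm⟩ := ((hF.union hF').image fun i : II κ => (ofLex i).2).bddAbove
    exact ⟨m + 1, fun i hi => Nat.lt_succ_of_le (hm ⟨i, hi, rfl⟩)⟩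
  let rk : II κ → ℕ := fun i => {j ∈ F | j < i}.ncard
  have hrk : ∀ i ∈ F, ∀ j, i < j → rk i < rk j := by
    intro i hi j hij
    refine Set.ncard_lt_ncard ?_ (hF.subset fun _ h => h.1)
    refine ⟨fun k hk => ⟨hk.1, hk.2.trans hij⟩, fun h => ?_⟩
    exact lt_irrefl i (h ⟨hi, hij⟩).2
  let τ : II κ → II κ := fun i => if blk i ∈ K then i else mkI (ρ (blk i)) (m + rk i)
  have hτ : StrictMono fun i : (F ∪ F' : Set (II κ)) => τ i := by
    rintro ⟨i, hi⟩ ⟨j, hj⟩ hij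
    have hij : i < j := hij
    have hblk : blk j ≤ blk i := by
      rcases lt_II.1 hij with h | h
      exacts [h.le, h.1.ge]
    change (if blk i ∈ K then i else mkI (ρ (blk i)) (m + rk i)) <
      (if blk j ∈ K then j else mkI (ρ (blk j)) (m + rk j))
    split_ifs with hiK hjK hjK
    · exact hij
    · rw [lt_II]
      change ρ (blk j) < blk i ∨ blk i = ρ (blk j) ∧ (ofLex i).2 < m + rk j
      rcases (hρmin _ _ hiK hblk).lt_or_eq with h | h
      · exact .inl h
      · exact .inr ⟨h.symm, (hm i hi).trans_le (Nat.le_add_right _ _)⟩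
    · rw [lt_II]
      change blk j < ρ (blk i) ∨ _
      refine .inl (lt_of_lt_of_le (lt_of_le_of_ne hblk ?_) (hρle _))
      rintro e
      exact hiK (e ▸ hjK)
    · rw [lt_II]
      change ρ (blk j) < ρ (blk i) ∨ ρ (blk i) = ρ (blk j) ∧ m + rk i < m + rk j
      rcases (hρmono hblk).lt_or_eq with h | h
      · exact .inl h
      · refine .inr ⟨h.symm, Nat.add_lt_add_left (hrk i ?_ j hij) m⟩
        rcases hi with hi | hi
        · exact hi
        · exact (hiK (hF'P hi)).elim
  have h10 := ha.unique ha hV (subset_cl X₀) (J := (F ∪ F' : Set (II κ))) (σ := fun i => i)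
    (σ' := fun i => τ i) (fun i j h => h) hτ
  have h11 := h10.reindex (Sum.elim (fun i : F' => ((⟨i, .inr i.2⟩ : (F ∪ F' : Set (II κ))), PUnit.unit.{u + 1}))
    (fun i : F => ((⟨i, .inl i.2⟩ : (F ∪ F' : Set (II κ))), PUnit.unit)))
  refine ⟨fun i => a (τ i), ?_, ?_⟩
  · rw [hAB] at hw ⊢
    refine (congrArg (· ∈ B) (funext ?_)).mp (h11 B hB ((congrArg (· ∈ B) (funext ?_)).mp hw))
    · rintro (i | i)
      · have : blk (i : II κ) ∈ K := hF'P i.2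
        simp [single, τ, this]
      · rfl
    · rintro (i | i) <;> rfl
  · rintro ⟨i, hi⟩
    refine QFree.mem_cl (.inr ⟨τ i, ?_, rfl⟩)
    change blk (if blk i ∈ K then i else mkI (ρ (blk i)) (m + rk i)) ∈ ρ '' (blk '' F)
    split_ifs with h
    · exact ⟨blk i, ⟨i, hi, rfl⟩, hρid h⟩
    · exact ⟨blk i, ⟨i, hi, rfl⟩, rfl⟩

theorem blks_mono {K K' : Set (KK κ)} (h : K ⊆ K') : blks K ⊆ blks K' := fun _ hi => h hi

theorem countable_blks (β : KK κ) : (blks {β}).Countable := by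
  have : blks {β} = Set.range (mkI β) := by
    ext i
    constructor
    · intro h
      exact ⟨(ofLex i).2, by rw [← show blk i = β from h]; rfl⟩
    · rintro ⟨n, rfl⟩
      rfl
  rw [this]
  exact Set.countable_range _

theorem exists_stage {X₀ S' : Set M} {G : Om.{u} → Set M} {a e : II κ → M}
    (hS : S'.Countable) (h2 : S' ∪ Set.range e ⊆ cl (Nall X₀ G ∪ Set.range a)) (γ : KK κ) :
    ∃ (α : Om.{u}) (F : Set (KK κ)), F.Countable ∧
      S' ∪ e '' blks {γ} ⊆ cl (Nn X₀ G α ∪ a '' blks F) := by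
  have hc : (S' ∪ e '' blks {γ}).Countable := hS.union ((countable_blks γ).image e)
  obtain ⟨F, hF, hYF⟩ := cl_countable_union hc
    ((Set.union_subset_union_right S' (Set.image_subset_range e _)).trans h2)
  have h3 : ∀ y ∈ S' ∪ e '' blks {γ}, ∃ α : Om.{u}, y ∈ cl (Nn X₀ G α ∪ a '' F) := by
    intro y hy
    obtain ⟨E, hE, hEf, hyE⟩ := cl_finite_union (P := Nall X₀ G) (N := a '' F)
      (Set.finite_singleton y) (Set.singleton_subset_iff.2 (by rw [Set.union_comm]; exact hYF hy))
    have h4 : ∃ α, E ⊆ Nn X₀ G α := by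
      clear hyE
      induction E, hEf using Set.Finite.induction_on with
      | empty => exact ⟨Classical.arbitrary _, Set.empty_subset _⟩
      | @insert x F _ _ ih =>
        obtain ⟨α, hα⟩ := ih ((Set.subset_insert _ _).trans hE)
        rcases hE (Set.mem_insert _ _) with hx | hx
        · exact ⟨α, Set.insert_subset (.inl hx) hα⟩
        · obtain ⟨ν, hx⟩ := Set.mem_iUnion.1 hx
          obtain ⟨ν', hν⟩ := ν.exists_gt
          exact ⟨max α ν', Set.insert_subset (Nn_mono (le_max_right _ _) (subset_Nn_of_lt hν hx))
            (hα.trans (Nn_mono (le_max_left _ _)))⟩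
    obtain ⟨α, hα⟩ := h4
    refine ⟨α, cl_mono ?_ (hyE rfl)⟩
    rw [Set.union_comm]
    exact Set.union_subset_union_left _ hα
  choose! f hf using h3
  have h5 : ∃ α, ∀ y ∈ S' ∪ e '' blks {γ}, f y ≤ α := by
    obtain ⟨α, hα⟩ := Om.exists_notMem (s := ⋃ y ∈ S' ∪ e '' blks {γ}, Set.Iic (f y))
      (hc.biUnion fun y _ => Om.countable_Iic _)
    refine ⟨α, fun y hy => ?_⟩
    by_contra hn
    exact hα (Set.mem_biUnion hy (not_le.1 hn).le)
  obtain ⟨α, hα⟩ := h5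
  refine ⟨α, blk '' F, hF.image _, fun y hy => ?_⟩
  exact cl_mono (Set.union_subset_union (Nn_mono (hα y hy))
    (Set.image_mono (Set.subset_preimage_image blk F))) (hf y hy)

theorem exists_closed_stage {X₀ S' : Set M} {G : Om.{u} → Set M} {a e : II κ → M}
    (hX : X₀.Countable) (hG : ∀ ν, (G ν).Countable) (hS : S'.Countable)
    (h1 : Nall X₀ G ∪ Set.range a ⊆ cl (S' ∪ Set.range e))
    (h2 : S' ∪ Set.range e ⊆ cl (Nall X₀ G ∪ Set.range a)) :
    ∃ (δ : Om.{u}) (K₁ K₂ : Set (KK κ)), K₁.Countable ∧ K₂.Countable ∧ ⊤ ∈ K₂ ∧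
      (∃ α, α < δ) ∧ (∀ α < δ, ∃ α' < δ, α < α') ∧
      Nn X₀ G δ ∪ a '' blks K₁ ⊆ cl (S' ∪ e '' blks K₂) ∧
      ∀ γ ∈ K₂, ∃ α < δ, S' ∪ e '' blks {γ} ⊆ cl (Nn X₀ G α ∪ a '' blks K₁) := by
  have key1 : ∀ Y : Set M, Y.Countable → Y ⊆ cl (S' ∪ Set.range e) →
      ∃ F : Set (KK κ), F.Countable ∧ Y ⊆ cl (S' ∪ e '' blks F) := by
    intro Y hY hYe
    obtain ⟨F, hF, hYF⟩ := cl_countable_union hY hYe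
    exact ⟨blk '' F, hF.image _, hYF.trans (cl_mono (Set.union_subset_union_right _
      (Set.image_mono (Set.subset_preimage_image blk F))))⟩
  choose α F₃ hF₃ hα using exists_stage (L := L) (κ := κ) hS h2
  choose F₁ hF₁ hGF using fun ν => key1 (G ν) (hG ν)
    ((subset_Nall ν).trans (Set.subset_union_left.trans h1))
  choose F₂ hF₂ haF using fun β : KK κ => key1 (a '' blks {β}) ((countable_blks β).image a)
    ((Set.image_subset_range a _).trans (Set.subset_union_right.trans h1))
  obtain ⟨F₀, hF₀, hXF⟩ := key1 X₀ hX
    (Set.subset_union_left.trans (Set.subset_union_left.trans h1))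
  choose sc hsc using Om.exists_gt.{u}
  let Φ : Om.{u} ⊕ (KK κ ⊕ KK κ) → Set (Om.{u} ⊕ (KK κ ⊕ KK κ)) := fun x => Sum.elim
    (fun ν => Sum.inl '' Set.Iic (sc ν) ∪ (Sum.inr ∘ Sum.inr) '' F₁ ν)
    (Sum.elim (fun β => (Sum.inr ∘ Sum.inr) '' F₂ β)
      (fun γ => Sum.inl '' {α γ} ∪ (Sum.inr ∘ Sum.inl) '' F₃ γ)) x
  have hΦ : ∀ x, (Φ x).Countable := by
    rintro (ν | β | γ)
    · exact ((Om.countable_Iic _).image _).union ((hF₁ ν).image _)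
    · exact (hF₂ β).image _
    · exact ((Set.countable_singleton _).image _).union ((hF₃ γ).image _)
  obtain ⟨D, hD0, hDc, hD⟩ := exists_countable_closed Φ hΦ
    (s := (Sum.inr ∘ Sum.inr) '' (insert ⊤ F₀)) ((hF₀.insert ⊤).image _)
  have hdc : ∀ ν, (Sum.inl ν : Om.{u} ⊕ (KK κ ⊕ KK κ)) ∈ D → ∀ ν' ≤ sc ν, Sum.inl ν' ∈ D :=
    fun ν hν ν' h => hD _ hν (.inl ⟨ν', h, rfl⟩)
  obtain ⟨δ, hδ⟩ := Om.exists_eq_Iio (D := Sum.inl ⁻¹' D) (hDc.preimage Sum.inl_injective)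
    (fun ν hν ν' h => hdc ν hν ν' (h.trans (hsc ν)).le)
  have hδ' : ∀ ν, ν < δ ↔ Sum.inl ν ∈ D := fun ν => by
    rw [← Set.mem_Iio, ← hδ]
    rfl
  have htop : (Sum.inr (Sum.inr ⊤) : Om.{u} ⊕ (KK κ ⊕ KK κ)) ∈ D := hD0 ⟨⊤, Set.mem_insert _ _, rfl⟩
  obtain ⟨K₁, hK₁⟩ : ∃ K₁ : Set (KK κ), K₁ = (Sum.inr ∘ Sum.inl) ⁻¹' D := ⟨_, rfl⟩
  obtain ⟨K₂, hK₂⟩ : ∃ K₂ : Set (KK κ), K₂ = (Sum.inr ∘ Sum.inr) ⁻¹' D := ⟨_, rfl⟩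
  have c1 : K₁.Countable := hK₁ ▸ hDc.preimage (Sum.inr_injective.comp Sum.inl_injective)
  have c2 : K₂.Countable := hK₂ ▸ hDc.preimage (Sum.inr_injective.comp Sum.inr_injective)
  have f0 : F₀ ⊆ K₂ := fun x hx => by
    rw [hK₂]
    exact hD0 ⟨x, Set.mem_insert_of_mem _ hx, rfl⟩
  have f1 : ∀ ν < δ, F₁ ν ⊆ K₂ := fun ν hν x hx => by
    rw [hK₂]
    exact hD _ ((hδ' ν).1 hν) (.inr ⟨x, hx, rfl⟩)
  have f2 : ∀ β ∈ K₁, F₂ β ⊆ K₂ := fun β hβ x hx => by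
    rw [hK₁] at hβ
    rw [hK₂]
    exact hD _ hβ ⟨x, hx, rfl⟩
  have f3 : ∀ γ ∈ K₂, F₃ γ ⊆ K₁ := fun γ hγ x hx => by
    rw [hK₂] at hγ
    rw [hK₁]
    exact hD _ hγ (.inr ⟨x, hx, rfl⟩)
  have f4 : ∀ γ ∈ K₂, α γ < δ := fun γ hγ => by
    rw [hK₂] at hγ
    exact (hδ' _).2 (hD _ hγ (.inl ⟨_, rfl, rfl⟩))
  have f5 : ⊤ ∈ K₂ := by
    rw [hK₂]
    exact htop
  have f6 : ∀ ν < δ, sc ν < δ := fun ν hν => (hδ' _).2 (hdc ν ((hδ' ν).1 hν) _ le_rfl)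
  clear_value Φ
  clear hD hD0 hδ hδ' htop hdc hK₁ hK₂ hDc hΦ
  refine ⟨δ, K₁, K₂, c1, c2, f5, ⟨α ⊤, f4 _ f5⟩, fun ν hν => ⟨sc ν, f6 ν hν, hsc ν⟩, ?_, ?_⟩
  · refine Set.union_subset (Set.union_subset ?_ ?_) ?_
    · exact hXF.trans (cl_mono (Set.union_subset_union_right _ (Set.image_mono (blks_mono f0))))
    · exact Set.iUnion₂_subset fun ν hν => (hGF ν).trans (cl_mono (Set.union_subset_union_right _
        (Set.image_mono (blks_mono (f1 ν hν)))))
    · rintro _ ⟨i, hi, rfl⟩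
      have h3 : a i ∈ cl (S' ∪ e '' blks (F₂ (blk i))) :=
        haF (blk i) ⟨i, Set.mem_singleton (blk i), rfl⟩
      exact cl_mono (Set.union_subset_union_right _ (Set.image_mono (blks_mono (f2 _ hi)))) h3
  · intro γ hγ
    exact ⟨α γ, f4 γ hγ, (hα γ).trans (cl_mono
      (Set.union_subset_union_right _ (Set.image_mono (blks_mono (f3 γ hγ)))))⟩

/-- A closed stage of a chain, compared with a stage of a sequence over a countable set. -/
structure ClubStage (V : Ultrafilter (PUnit.{u + 1} → M)) (κ : Cardinal.{u}) (X₀ : Set M)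
    (G : Om.{u} → Set M) (a a' : II κ → M) (h : M → M) (δ : Om.{u}) (K₁ K₂ : Set (KK κ)) :
    Prop where
  gs : GS L V (Nall X₀ G) (single a)
  gs' : GS L V X₀ (single a')
  pe : PE L (cl (X₀ ∪ Set.range a')) h
  img : h '' cl (X₀ ∪ Set.range a') = cl (Nall X₀ G ∪ Set.range a)
  cK₁ : K₁.Countable
  cK₂ : K₂.Countable
  top : ⊤ ∈ K₂
  ne : ∃ α, α < δ
  lim : ∀ α < δ, ∃ α' < δ, α < α'
  sub : Nn X₀ G δ ∪ a '' blks K₁ ⊆ cl (h '' (X₀ ∪ a' '' blks K₂))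
  sup : ∀ K ⊆ K₂, K.Finite → ∃ α < δ, h '' (X₀ ∪ a' '' blks K) ⊆ cl (Nn X₀ G α ∪ a '' blks K₁)

theorem Mon.exists_clubStage (H : Mon L M κ μ) {X₀ : Set M} (hX : X₀.Countable)
    {V : Ultrafilter (PUnit.{u + 1} → M)} (hV : tuples L PUnit.{u + 1} X₀ ∈ V) (hNP : NP V)
    {G : Om.{u} → Set M} (hG : ∀ ν, (G ν).Countable) :
    ∃ a a' h δ K₁ K₂, ClubStage (L := L) V κ X₀ G a a' h δ K₁ K₂ := by
  have hκ1 : aleph 1 ≤ κ := aleph_one_le_iff.2 H.hκ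
  have hN : #(Nall X₀ G) ≤ κ := (mk_Nall hX hG).trans hκ1
  have hXs : #X₀ ≤ κ := (le_aleph0_iff_set_countable.2 hX).trans H.hκ.le
  have hXN : X₀ ⊆ cl (Nall X₀ G) := Set.subset_union_left.trans (subset_cl _)
  have hI : #(II κ) ≤ μ := (mk_II H.hκ.le).le.trans H.hμ
  have sng : ∀ b : II κ → PUnit.{u + 1} → M, single (fun i => b i ⟨⟩) = b := fun b => rfl
  obtain ⟨a₀, ha⟩ := H.exists_GS H.small_fin (I := II κ) hI (hN.trans H.hμ) hV hXN
  obtain ⟨a₁, ha'⟩ := H.exists_GS H.small_fin (I := II κ) hI (hXs.trans H.hμ) hV (subset_cl X₀)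
  rw [← sng a₀] at ha
  rw [← sng a₁] at ha'
  set a : II κ → M := fun i => a₀ i ⟨⟩
  set a' : II κ → M := fun i => a₁ i ⟨⟩
  have hinj := ha.injective hNP hV hXN
  have hinj' := ha'.injective hNP hV (subset_cl X₀)
  have hsg := (ha.indep hNP hV hXN).sg H.hκ ((mk_range_eq a hinj).trans (mk_II H.hκ.le)) hN
  have hsg' := (ha'.indep hNP hV (subset_cl X₀)).sg H.hκ
    ((mk_range_eq a' hinj').trans (mk_II H.hκ.le)) hXs
  obtain ⟨h, hpe, himg⟩ := H.uniq _ _ (cl_cl _) (cl_cl _) hsg' hsg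
  have himg' : cl (h '' (X₀ ∪ Set.range a')) = cl (Nall X₀ G ∪ Set.range a) := by
    rw [← himg, hpe.image_cl]
  have hr : h '' (X₀ ∪ Set.range a') = h '' X₀ ∪ Set.range fun i => h (a' i) := by
    rw [Set.image_union, ← Set.range_comp]
    rfl
  rw [hr] at himg'
  obtain ⟨δ, K₁, K₂, h1, h2, h3, h4, h5, h6, h7⟩ := exists_closed_stage (L := L) (κ := κ)
    (S' := h '' X₀) (a := a) (e := fun i => h (a' i)) hX hG (hX.image h)
    (by rw [himg']; exact subset_cl _) (by rw [← himg']; exact subset_cl _)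
  have him : ∀ K : Set (KK κ), h '' (X₀ ∪ a' '' blks K) =
      h '' X₀ ∪ (fun i => h (a' i)) '' blks K := by
    intro K
    rw [Set.image_union, Set.image_image]
  refine ⟨a, a', h, δ, K₁, K₂, ha, ha', hpe, himg, h1, h2, h3, h4, h5, ?_, ?_⟩
  · rw [him]
    exact h6
  · intro K hK hKf
    rw [him]
    induction K, hKf using Set.Finite.induction_on with
    | empty =>
      obtain ⟨α, hα, h8⟩ := h7 ⊤ h3
      refine ⟨α, hα, Set.union_subset (Set.subset_union_left.trans h8) ?_⟩
      rintro _ ⟨i, hi, rfl⟩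
      exact hi.elim
    | @insert γ K _ _ ih =>
      obtain ⟨α, hα, h8⟩ := h7 γ (hK (Set.mem_insert _ _))
      obtain ⟨α', hα', h9⟩ := ih ((Set.subset_insert _ _).trans hK)
      refine ⟨max α α', max_lt hα hα', Set.union_subset (Set.subset_union_left.trans
        (h8.trans (cl_mono (Set.union_subset_union_left _ (Nn_mono (le_max_left _ _)))))) ?_⟩
      rintro _ ⟨i, hi, rfl⟩
      rcases hi with hi | hi
      · exact cl_mono (Set.union_subset_union_left _ (Nn_mono (le_max_left _ _)))
          (h8 (.inr ⟨i, hi, rfl⟩))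
      · exact cl_mono (Set.union_subset_union_left _ (Nn_mono (le_max_right _ _)))
          (h9 (.inr ⟨i, hi, rfl⟩))

theorem ClubStage.fs (hM : Nonempty M) {V : Ultrafilter (PUnit.{u + 1} → M)} {X₀ : Set M}
    (hV : tuples L PUnit.{u + 1} X₀ ∈ V)
    {G : Om.{u} → Set M} {a a' : II κ → M} {h : M → M} {δ : Om.{u}} {K₁ K₂ : Set (KK κ)}
    (C : ClubStage (L := L) V κ X₀ G a a' h δ K₁ K₂) {Y : Set M} (hY : Y.Finite)
    (hYN : Y ⊆ cl (Nall X₀ G)) : ∃ α < δ, FS L Y (Nn X₀ G δ) (Nn X₀ G α) := by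
  have h1 : Y ⊆ h '' cl (X₀ ∪ Set.range a') := by
    rw [C.img]
    exact hYN.trans (cl_mono Set.subset_union_left)
  obtain ⟨Y', hY'c, hY', rfl⟩ := exists_finite_image hY h1
  obtain ⟨K, hK, hKf, h2⟩ := C.gs'.exists_blocks hM hV C.top hY' hY'c
  have hsub : ∀ K, X₀ ∪ a' '' blks K ⊆ cl (X₀ ∪ Set.range a') := fun K =>
    (Set.union_subset_union_right _ (Set.image_subset_range _ _)).trans (subset_cl _)
  have h3 := h2.pe C.pe hY'c (hsub _) (cl_le (hsub _))
  obtain ⟨α, hα, h4⟩ := C.sup K hK hKf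
  refine ⟨α, hα, ?_⟩
  have h5 : FS L (h '' Y') (Nn X₀ G δ ∪ a '' blks K₁) (Nn X₀ G α ∪ a '' blks K₁) :=
    (h3.base h4).right C.sub
  have hne : (cl X₀).Nonempty := by
    obtain ⟨u, hu⟩ := V.nonempty_of_mem hV
    exact ⟨_, hu ⟨⟩⟩
  have h6 := C.gs.fs hV (Set.subset_union_left.trans (subset_cl _)) hne
    (D := ∅) (E := blks K₁) (by simp)
  rw [im_single, im_single, Set.image_empty, Set.union_empty] at h6
  have h7 : FS L (a '' blks K₁) (Nn X₀ G δ) (Nn X₀ G α) :=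
    (h6.right (Nn_subset_Nall.trans (subset_cl _))).base (subset_Nn.trans (subset_cl _))
  have hαδ : Nn X₀ G α ⊆ cl (Nn X₀ G δ) := (Nn_mono hα.le).trans (subset_cl _)
  exact (h7.union hαδ h5).left hαδ (Set.subset_union_right.trans
    (Set.subset_union_right.trans (subset_cl _)))

theorem Mon.club (H : Mon L M κ μ) {X₀ : Set M} (hX : X₀.Countable) (hXi : (cl X₀).Infinite)
    {G : Om.{u} → Set M} (hG : ∀ ν, (G ν).Countable) :
    ∃ δ, (∃ α, α < δ) ∧ (∀ α < δ, ∃ α' < δ, α < α') ∧ ∀ Y : Set M, Y.Finite →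
      Y ⊆ cl (Nall X₀ G) → ∃ α < δ, FS L Y (Nn X₀ G δ) (Nn X₀ G α) := by
  obtain ⟨V, hV, hNP⟩ := exists_NP hXi
  obtain ⟨a, a', h, δ, K₁, K₂, C⟩ := H.exists_clubStage hX hV hNP hG
  exact ⟨δ, C.ne, C.lim, fun Y hY hYN => C.fs H.nonempty hV hY hYN⟩

end Club

end QFree

namespace QFree

section Closed

variable {L : FirstOrder.Language.{u, u}} {M : Type u} [L.Structure M]

local notation "cl" => clos L

variable {κ μ : Cardinal.{u}} {ι : Type u} {P Q N S X₀ : Set M}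

theorem Nn_congr {G G' : Om.{u} → Set M} {δ : Om.{u}} (h : ∀ ν < δ, G ν = G' ν) :
    Nn X₀ G δ = Nn X₀ G' δ := by
  unfold Nn
  congr 1
  exact Set.iUnion₂_congr fun ν hν => h ν hν

/-- A chain of countable sets built recursively inside `E`, together with a closed stage. -/
theorem Mon.club_rec (H : Mon L M κ μ) (hX : X₀.Countable) (hXi : (cl X₀).Infinite) {E : Set M}
    (hXE : X₀ ⊆ E) (R : Set M → Set M → Prop)
    (hR : ∀ N, N.Countable → X₀ ⊆ N → N ⊆ E → ∃ G, G.Countable ∧ G ⊆ E ∧ R N G) :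
    ∃ G : Om.{u} → Set M, (∀ ν, (G ν).Countable) ∧ (∀ ν, G ν ⊆ E) ∧
      (∀ ν, R (Nn X₀ G ν) (G ν)) ∧
      ∃ δ, (∃ α, α < δ) ∧ (∀ α < δ, ∃ α' < δ, α < α') ∧ ∀ Y : Set M, Y.Finite →
      Y ⊆ cl (Nall X₀ G) → ∃ α < δ, FS L Y (Nn X₀ G δ) (Nn X₀ G α) := by
  obtain ⟨G, hG⟩ : ∃ G : Om.{u} → Set M, ∀ ν, (G ν).Countable ∧ G ν ⊆ E ∧
      R (Nn X₀ G ν) (G ν) := by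
    refine exists_wf_rec (· < ·) wellFounded_lt
      (fun ν G x => x.Countable ∧ x ⊆ E ∧ R (Nn X₀ G ν) x) ?_ ?_
    · intro ν f f' x hf hx
      rwa [← Nn_congr hf]
    · intro ν f hf
      refine hR _ ?_ subset_Nn (Set.union_subset hXE (Set.iUnion₂_subset fun ν' h => (hf ν' h).2.1))
      exact hX.union ((Om.countable_Iio ν).biUnion fun ν' h => (hf ν' h).1)
  exact ⟨G, fun ν => (hG ν).1, fun ν => (hG ν).2.1, fun ν => (hG ν).2.2,
    H.club hX hXi fun ν => (hG ν).1⟩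

/-- Reflection to a countable set. -/
theorem Mon.exists_fs (H : Mon L M κ μ) (hX : X₀.Countable) (hXi : (cl X₀).Infinite) {E : Set M}
    (hXE : X₀ ⊆ E) : ∃ N, N.Countable ∧ X₀ ⊆ N ∧ N ⊆ E ∧ ∀ Y ⊆ E, Y.Finite → FS L Y N N := by
  by_contra! hn
  obtain ⟨G, hG, hGE, hGR, δ, ⟨α, hα⟩, -, hδ⟩ := H.club_rec hX hXi hXE
    (fun N G => G.Finite ∧ ¬ FS L G N N) fun N h1 h2 h3 => by
      obtain ⟨Y, h4, h5, h6⟩ := hn N h1 h2 h3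
      exact ⟨Y, h5.countable, h4, h5, h6⟩
  obtain ⟨α, hα, h⟩ := hδ (G δ) (hGR δ).1 ((subset_Nall δ).trans (subset_cl _))
  exact (hGR δ).2 (h.base ((Nn_mono hα.le).trans (subset_cl _)))

/-- Existentially closed sets have enough countable existentially closed subsets. -/
theorem Mon.exists_EC_countable (H : Mon L M κ μ) {E : Set M} (hE : EC L E) (hX : X₀.Countable)
    (hXi : (cl X₀).Infinite) (hXE : X₀ ⊆ cl E) :
    ∃ Z, Z.Countable ∧ X₀ ⊆ Z ∧ Z ⊆ cl E ∧ EC L Z := by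
  obtain ⟨Z, h1, h2, h3, h4⟩ := H.exists_fs hX hXi hXE
  refine ⟨Z, h1, h2, h3, fun n A hA hne => ?_⟩
  obtain ⟨x, hx, hx'⟩ := hE n A (hA.of_le h3) hne
  exact (h4 (Set.range x) (by rintro _ ⟨i, rfl⟩; exact hx' i) (Set.finite_range x)).fam (subset_cl _)
    (w := x) (fun i => mem_cl (.inr ⟨i, rfl⟩)) hA hx

theorem EC_univ : EC L (Set.univ : Set M) := fun _ _ _ ⟨x, hx⟩ => ⟨x, hx, fun i => mem_cl trivial⟩

theorem mk_finset_le (X : Type u) : #(Finset X) ≤ max #X ℵ₀ := by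
  rcases finite_or_infinite X with h | h
  · exact (mk_le_aleph0).trans (le_max_right _ _)
  · rw [mk_finset_of_infinite]
    exact le_max_left _ _

theorem Mon.exists_hull (H : Mon L M κ μ) (X : Set M) :
    ∃ Y, X ⊆ Y ∧ #Y ≤ max #X ℵ₀ ∧ EC L Y := by
  classical
  have := H.inf
  obtain ⟨X₁, hX₁, hX₁'⟩ : ∃ X₁ : Set M, X₁.Countable ∧ X₁.Infinite := by
    obtain ⟨f⟩ := Infinite.natEmbedding M |> Nonempty.intro
    exact ⟨Set.range f, Set.countable_range f, Set.infinite_range_of_injective f.injective⟩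
  have h1 : ∀ F : Set M, F.Finite → ∃ Z : Set M, Z.Countable ∧ F ⊆ Z ∧ EC L Z := by
    intro F hF
    obtain ⟨Z, h1, h2, h3, h4⟩ := H.exists_EC_countable (X₀ := X₁ ∪ F) EC_univ
      (hX₁.union hF.countable) ((hX₁'.mono Set.subset_union_left).mono (subset_cl _))
      (fun _ _ => mem_cl trivial)
    exact ⟨Z, h1, Set.subset_union_right.trans h2, h4⟩
  choose! Z hZ hFZ hZE using h1
  let next : Set M → Set M := fun D => ⋃ s : Finset (Subtype (· ∈ D)), Z (Subtype.val '' (s : Set (Subtype (· ∈ D))))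
  let F : ℕ → Set M := fun n => Nat.rec X (fun _ D => next D) n
  have hF : ∀ n, F (n + 1) = next (F n) := fun n => rfl
  have hsub : ∀ n, ∀ s : Set M, s.Finite → s ⊆ F n → ∃ Z', Z' ⊆ F (n + 1) ∧ s ⊆ Z' ∧ EC L Z' := by
    intro n s hs h
    refine ⟨Z s, ?_, hFZ s hs, hZE s hs⟩
    rw [hF]
    obtain ⟨t, ht⟩ : ∃ t : Finset (Subtype (· ∈ F n)),
        Subtype.val '' (t : Set (Subtype (· ∈ F n))) = s := by
      refine ⟨(hs.preimage Subtype.val_injective.injOn).toFinset, ?_⟩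
      rw [Set.Finite.coe_toFinset, Set.image_preimage_eq_of_subset]
      intro x hx
      exact ⟨⟨x, h hx⟩, rfl⟩
    exact (congrArg Z ht).symm.subset.trans (Set.subset_iUnion (fun s : Finset (Subtype (· ∈ F n)) =>
      Z (Subtype.val '' (s : Set (Subtype (· ∈ F n))))) t)
  have hmono : Monotone F := by
    refine monotone_nat_of_le_succ fun n x hx => ?_
    obtain ⟨Z', h1, h2, h3⟩ := hsub n {x} (Set.finite_singleton x) (by simpa using hx)
    exact h1 (h2 rfl)
  have hcard : ∀ n : ℕ, #(Subtype (· ∈ F n)) ≤ max #X ℵ₀ := by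
    intro n
    induction n with
    | zero => exact le_max_left _ _
    | succ n ih =>
      rw [hF]
      refine (mk_iUnion_le _).trans (mul_le_of_le (le_max_right _ _) ?_ (ciSup_le' fun s => ?_))
      · exact (mk_finset_le _).trans (max_le ih (le_max_right _ _))
      · exact (hZ _ (s.finite_toSet.image _)).le_aleph0.trans (le_max_right _ _)
  refine ⟨⋃ n, F n, Set.subset_iUnion F 0, ?_, ?_⟩
  · have e : (⋃ n, F n) = ⋃ n : ULift.{u} ℕ, F n.down := by
      ext x; simp [ULift.exists]
    rw [e]
    refine (mk_iUnion_le _).trans (mul_le_of_le (le_max_right _ _) ?_ (ciSup_le' fun n => hcard _))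
    exact mk_le_aleph0.trans (le_max_right _ _)
  · intro n A hA hne
    obtain ⟨P₀, s, h1, h2, h3, h4, h5⟩ := hA.support
    obtain ⟨i, hi⟩ := finite_subset_directed hmono.directed_le h2 h1
    obtain ⟨Z', h6, h7, h8⟩ := hsub i P₀ h2 hi
    obtain ⟨x, hx, hx'⟩ := h8 n A (h4.mono h7) hne
    exact ⟨x, hx, fun k => cl_mono (subset_trans h6 (Set.subset_iUnion F (i + 1))) (hx' k)⟩

/-- Concatenation of finitely satisfiable types along a linear order. -/
theorem FS.iUnion_lt {I : Type*} [LinearOrder I] {w : I → Set M} {D : Set I} (hN : N ⊆ cl P)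
    (hne : (cl N).Nonempty) (h : ∀ i ∈ D, FS L (w i) (P ∪ ⋃ j ∈ {j ∈ D | j < i}, w j) N) :
    FS L (⋃ i ∈ D, w i) P N := by
  classical
  have h1 : ∀ s : Finset I, (s : Set I) ⊆ D → FS L (⋃ i ∈ s, w i) P N := by
    intro s
    induction s using Finset.induction_on_max with
    | empty =>
      intro _
      refine FS.of_subset ?_
      simp
    | insert m s hm ih =>
      intro hs
      have h2 := ih ((Finset.coe_subset.2 (Finset.subset_insert _ _)).trans hs)
      have h3 : FS L (w m) (P ∪ ⋃ i ∈ s, w i) N := by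
        refine (h m (hs (by simp))).right (subset_trans (Set.union_subset_union_right _ ?_)
          (subset_cl _))
        exact Set.iUnion₂_subset fun i hi => Set.subset_biUnion_of_mem (u := fun i => w i)
          (show i ∈ {j ∈ D | j < m} from ⟨hs (by simp [hi]), hm i hi⟩)
      have h4 := h2.union hN (h3.base (Set.subset_union_left.trans (subset_cl _)))
      refine h4.left hN (subset_trans ?_ (Set.subset_union_right.trans (subset_cl _)))
      rw [Finset.set_biUnion_insert, Set.union_comm]
  refine FS.of_finite (fun Y hY hYf => ?_) hne
  have h5 : ∀ y ∈ Y, ∃ j ∈ D, y ∈ w j := fun y hy => by simpa using hY hy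
  by_cases hI : Nonempty I
  swap
  · refine FS.of_subset fun y hy => ?_
    exact (hI ⟨(h5 y hy).choose⟩).elim
  choose! j hj hyj using h5
  refine (h1 (hYf.toFinset.image j) ?_).left hN ?_
  · intro i hi
    obtain ⟨y, hy, rfl⟩ : ∃ y ∈ Y, j y = i := by simpa using hi
    exact hj y hy
  · intro y hy
    refine mem_cl (.inr ?_)
    refine Set.mem_biUnion (x := j y) ?_ (hyj y hy)
    simpa using ⟨y, hy, rfl⟩

end Closed

end QFree

namespace QFree

section Closed

variable {L : FirstOrder.Language.{u, u}} {M : Type u} [L.Structure M]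

local notation "cl" => clos L

variable {κ μ : Cardinal.{u}} {ι : Type u} {P Q N S X₀ : Set M}

theorem exists_strictMono_Om {I : Type u} [LinearOrder I] [WellFoundedLT I] {J : Set I}
    (hJ : ¬ J.Countable) : ∃ j : Om.{u} → I, StrictMono j ∧ ∀ ν, j ν ∈ J := by
  have h1 : Ordinal.type ((· < ·) : Om.{u} → Om.{u} → Prop) ≤
      Ordinal.type ((· < ·) : J → J → Prop) := by
    rw [Ordinal.type_toType, Cardinal.ord_le, Ordinal.card_type, aleph_one_le_iff]
    rwa [← le_aleph0_iff_set_countable, not_le] at hJ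
  obtain ⟨f⟩ := Ordinal.type_le_iff'.1 h1
  exact ⟨fun ν => f ν, fun a b h => f.map_rel_iff.2 h, fun ν => (f ν).2⟩

theorem Mon.exists_notMem_cl (H : Mon L M κ μ) (hP : #P ≤ μ) : ∃ x, x ∉ cl P := by
  have := H.inf
  obtain ⟨V, -, hV⟩ := exists_NP (L := L) (X₀ := (Set.univ : Set M))
    (Set.infinite_univ.mono (subset_cl Set.univ))
  obtain ⟨w, hw⟩ := H.realize H.small_fin V hP
  exact ⟨_, hV.notMem hw⟩

/-- A continuous chain of existentially closed sets. -/
theorem Mon.exists_chain (H : Mon L M κ μ) (hX : X₀.Countable) :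
    ∃ (Y : κ.ord.ToType → Set M) (a : κ.ord.ToType → M), ∀ i, X₀ ⊆ Y i ∧ EC L (Y i) ∧ (∀ j < i, Y j ⊆ Y i ∧ a j ∈ Y i) ∧ a i ∉ cl (Y i) ∧
      #(Y i) ≤ max #(Set.Iio i) ℵ₀ := by
  have hne := H.nonempty
  obtain ⟨g, hg⟩ : ∃ g : κ.ord.ToType → Set M × M, ∀ i, X₀ ⊆ (g i).1 ∧ EC L (g i).1 ∧
      (∀ j < i, (g j).1 ⊆ (g i).1 ∧ (g j).2 ∈ (g i).1) ∧ (g i).2 ∉ cl (g i).1 ∧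
      #(g i).1 ≤ max #(Set.Iio i) ℵ₀ := by
    refine exists_wf_rec (· < ·) wellFounded_lt
      (fun i (g : κ.ord.ToType → Set M × M) (x : Set M × M) => X₀ ⊆ x.1 ∧ EC L x.1 ∧ (∀ j < i, (g j).1 ⊆ x.1 ∧ (g j).2 ∈ x.1) ∧ x.2 ∉ cl x.1 ∧
        #x.1 ≤ max #(Set.Iio i) ℵ₀) ?_ ?_
    · intro i f f' x hf hx
      refine ⟨hx.1, hx.2.1, fun j hj => ?_, hx.2.2.2⟩
      rw [← hf j hj]
      exact hx.2.2.1 j hj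
    · intro i f hf
      obtain ⟨Y, h1, h2, h3⟩ := H.exists_hull (X₀ ∪ ⋃ j : Set.Iio i, insert (f j).2 (f j).1)
      have h4 : #(X₀ ∪ ⋃ j : Set.Iio i, insert (f j).2 (f j).1 : Set M) ≤ max #(Set.Iio i) ℵ₀ := by
        refine (mk_union_le _ _).trans (add_le_of_le (le_max_right _ _) (hX.le_aleph0.trans
          (le_max_right _ _)) ?_)
        refine (mk_iUnion_le _).trans (mul_le_of_le (le_max_right _ _) (le_max_left _ _)
          (ciSup_le' fun j => ?_))
        refine (mk_insert_le).trans (add_le_of_le (le_max_right _ _) ?_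
          (one_le_aleph0.trans (le_max_right _ _)))
        refine (hf j j.2).2.2.2.2.trans (max_le_max_right _ (mk_le_mk_of_subset ?_))
        exact Set.Iio_subset_Iio (le_of_lt j.2)
      have h5 : #Y ≤ max #(Set.Iio i) ℵ₀ := h2.trans (max_le h4 (le_max_right _ _))
      have h6 : #Y ≤ μ := by
        refine h5.trans (max_le ?_ H.aleph0_le)
        refine le_trans (le_of_lt ?_) H.hμ
        simpa using mk_Iio_lt i
      obtain ⟨x, hx⟩ := H.exists_notMem_cl h6
      refine ⟨(Y, x), Set.subset_union_left.trans h1, h3, fun j hj => ?_, hx, h5⟩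
      have h7 := (Set.subset_iUnion (fun j : Set.Iio i => insert (f j).2 (f j).1) ⟨j, hj⟩).trans (Set.subset_union_right.trans h1)
      exact ⟨(Set.subset_insert _ _).trans h7, h7 (Set.mem_insert _ _)⟩
  exact ⟨fun i => (g i).1, fun i => (g i).2, hg⟩

/-- The key step: no finite set spans uncountably many of the `a j`. -/
theorem Mon.chain_aux (H : Mon L M κ μ) {Y : Om.{u} → Set M} {a : Om.{u} → M}
    (hE : ∀ i, EC L (Y i)) (hY : ∀ i, ∀ j < i, Y j ⊆ Y i ∧ a j ∈ Y i) (ha : ∀ i, a i ∉ cl (Y i))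
    {X₁ : Set M} (hX₁ : X₁.Countable) (hX₁i : (cl X₁).Infinite) (hXY : ∀ i, X₁ ⊆ cl (Y i))
    {y : Set M} (hy : y.Finite) : ∃ i, a i ∉ cl y := by
  by_contra! hay
  obtain ⟨Z, hZ⟩ : ∃ Z : Om.{u} → Set M, ∀ i, (Z i).Countable ∧ X₁ ⊆ Z i ∧ Z i ⊆ cl (Y i) ∧
      EC L (Z i) ∧ ∀ j < i, Z j ⊆ Z i ∧ a j ∈ Z i := by
    refine exists_wf_rec (· < ·) wellFounded_lt (fun i Z x => x.Countable ∧ X₁ ⊆ x ∧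
      x ⊆ cl (Y i) ∧ EC L x ∧ ∀ j < i, Z j ⊆ x ∧ a j ∈ x) ?_ ?_
    · intro i f f' x hf hx
      refine ⟨hx.1, hx.2.1, hx.2.2.1, hx.2.2.2.1, fun j hj => ?_⟩
      rw [← hf j hj]
      exact hx.2.2.2.2 j hj
    · intro i f hf
      have h1 : (X₁ ∪ ⋃ j ∈ Set.Iio i, insert (a j) (f j)).Countable :=
        hX₁.union ((Om.countable_Iio i).biUnion fun j hj => (hf j hj).1.insert _)
      obtain ⟨Z, h2, h3, h4, h5⟩ := H.exists_EC_countable (hE i) h1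
        (hX₁i.mono (cl_mono Set.subset_union_left)) (Set.union_subset (hXY i)
          (Set.iUnion₂_subset fun j hj => Set.insert_subset (mem_cl (hY i j hj).2)
            ((hf j hj).2.2.1.trans (cl_mono (hY i j hj).1))))
      refine ⟨Z, h2, Set.subset_union_left.trans h3, h4, h5, fun j hj => ?_⟩
      have h6 : insert (a j) (f j) ⊆ Z := ((Set.subset_biUnion_of_mem
        (u := fun j => insert (a j) (f j)) (Set.mem_Iio.2 hj)).trans Set.subset_union_right).trans h3
      exact ⟨(Set.subset_insert _ _).trans h6, h6 (Set.mem_insert _ _)⟩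
  choose hZc hXZ hZY hZE hZZ using hZ
  have hZs : #(⋃ i, Z i : Set M) ≤ μ := by
    refine (mk_iUnion_le Z).trans (mul_le_of_le H.aleph0_le ?_ (ciSup_le' fun i => ?_))
    · rw [mk_Om]
      exact (aleph_one_le_iff.2 H.hκ).trans H.hμ
    · exact H.small_countable (hZc i)
  have hne : ∀ i, (cl (Z i)).Nonempty := fun i => hX₁i.nonempty.mono (cl_mono (hXZ i))
  obtain ⟨w, hw⟩ : ∃ w : Om.{u} → y → M, ∀ i, EqT L (Z i) (fun x : y => (x : M)) (w i) ∧
      FS L (Set.range (w i)) ((⋃ i, Z i) ∪ ⋃ j ∈ Set.Iio i, Set.range (w j)) (Z i) := by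
    have : Nonempty (y → M) := ⟨fun x => x⟩
    refine exists_wf_rec (· < ·) wellFounded_lt (fun i w x =>
      EqT L (Z i) (fun x : y => (x : M)) x ∧
      FS L (Set.range x) ((⋃ i, Z i) ∪ ⋃ j ∈ Set.Iio i, Set.range (w j)) (Z i)) ?_ ?_
    · intro i f f' x hf hx
      refine ⟨hx.1, ?_⟩
      have e : (⋃ j ∈ Set.Iio i, Set.range (f j)) = ⋃ j ∈ Set.Iio i, Set.range (f' j) :=
        Set.iUnion₂_congr fun j hj => congrArg Set.range (hf j hj)
      rw [← e]
      exact hx.2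
    · intro i f hf
      have := hy.to_subtype
      have h1 : #((⋃ i, Z i) ∪ ⋃ j ∈ Set.Iio i, Set.range (f j) : Set M) ≤ μ := by
        refine H.small_union hZs (H.small_countable ?_)
        exact (Om.countable_Iio i).biUnion fun j hj => Set.countable_range _
      obtain ⟨x, h2, h3⟩ := H.exists_coheir H.small_fin
        (w := fun x : y => (x : M)) ((hZE i).fs (hne i) _) (H.small_countable (hZc i)) h1
      exact ⟨x, h2, h3.right (Set.subset_union_left.trans (subset_cl _))⟩
  choose hwE hwF using hw
  have hycl : ∀ i j, j < i → a j ∈ cl (Set.range (w i)) := by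
    intro i j hj
    have h1 := hay j
    obtain ⟨f, hf, hfa⟩ := exists_TF (P := ∅) (c := fun x : y => (x : M)) (y := a j) (by simpa using h1)
    have h2 := (hwE i).tf_eq (hf.mono (Set.empty_subset _)) (.const_cl (mem_cl (hZZ i j hj).2)) hfa
    rw [← h2]
    exact hf.mem_cl (Set.empty_subset _) fun x => mem_cl ⟨x, rfl⟩
  have := hy.to_subtype
  obtain ⟨δ, ⟨α₀, hα₀⟩, hlim, hδ⟩ := H.club hX₁ hX₁i (G := fun i => Z i ∪ Set.range (w i))
    fun i => (hZc i).union (Set.countable_range _)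
  obtain ⟨α, hα, hF⟩ := hδ (Set.range (w δ)) (Set.finite_range _)
    ((Set.subset_union_right.trans
      (subset_Nall (G := fun i => Z i ∪ Set.range (w i)) δ)).trans (subset_cl _))
  obtain ⟨α', hα', hαα'⟩ := hlim α hα
  have h1 : a α ∈ cl (Nn X₁ (fun i => Z i ∪ Set.range (w i)) α) := by
    refine hF.mem ((Nn_mono hα.le).trans (subset_cl _)) (cl_mono Set.subset_union_right
      (hycl δ α hα)) (mem_cl (subset_Nn_of_lt hα' (.inl (hZZ α' α hαα').2)))
  have h2 : FS L (⋃ j ∈ Set.Iio α, Set.range (w j)) (⋃ i, Z i) (Z α) := by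
    refine FS.iUnion_lt ((Set.subset_iUnion Z α).trans (subset_cl _)) (hne α) fun i hi => ?_
    refine ((hwF i).base ((hZZ α i hi).1.trans (subset_cl _))).right (subset_trans
      (Set.union_subset_union_right _ ?_) (subset_cl _))
    exact Set.biUnion_subset_biUnion_left fun j hj => hj.2
  have h3 : a α ∈ cl (Z α) := by
    refine h2.mem ((Set.subset_iUnion Z α).trans (subset_cl _)) (cl_mono ?_ h1)
      (mem_cl (Set.mem_iUnion.2 ⟨α', (hZZ α' α hαα').2⟩))
    refine Set.union_subset ((hXZ α).trans Set.subset_union_left) (Set.iUnion₂_subset fun i hi => ?_)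
    exact Set.union_subset_union (hZZ α i hi).1
      (Set.subset_biUnion_of_mem (u := fun j => Set.range (w j)) hi)
  exact ha α (cl_le (hZY α) h3)

theorem Mon.exists_EC_SG (H : Mon L M κ μ) : ∃ N : Set M, clos L N = N ∧ EC L N ∧ SG L κ N := by
  have := H.inf
  obtain ⟨X₁, hX₁, hX₁'⟩ : ∃ X₁ : Set M, X₁.Countable ∧ X₁.Infinite := by
    obtain ⟨f⟩ := Infinite.natEmbedding M |> Nonempty.intro
    exact ⟨Set.range f, Set.countable_range f, Set.infinite_range_of_injective f.injective⟩
  obtain ⟨Y, a, hY⟩ := H.exists_chain hX₁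
  have hE := fun i => (hY i).2.1
  have hYY := fun i => (hY i).2.2.1
  have ha := fun i => (hY i).2.2.2.1
  have hc := fun i => (hY i).2.2.2.2
  have hκ0 := H.hκ
  have hlim : ∀ i : κ.ord.ToType, ∃ j, i < j := by
    intro i
    by_contra! hn
    have h1 : Set.Iic i = Set.univ := Set.eq_univ_of_forall hn
    have h2 : #(Set.Iio i) < κ := by simpa using mk_Iio_lt i
    have h3 : #(Set.Iic i) = κ := by rw [h1, mk_univ]; simp
    rw [← Set.Iio_union_right] at h3
    have h4 := (mk_union_le (Set.Iio i) {i}).trans_lt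
      (add_lt_of_lt hκ0.le h2 (by simpa using (one_lt_aleph0.trans hκ0)))
    exact h4.ne h3
  have hmono : Monotone Y := by
    intro i j hij
    rcases hij.eq_or_lt with rfl | h
    · exact subset_rfl
    · exact (hYY j i h).1
  have hne : Nonempty κ.ord.ToType := by
    rw [← mk_ne_zero_iff]
    simpa using (aleph0_pos.trans hκ0).ne'
  refine ⟨cl (⋃ i, Y i), cl_cl _, (EC.of_iUnion hmono.directed_le fun i => ⟨i, subset_rfl, hE i⟩).cl,
    ⟨⟨_, ?_, rfl⟩, fun Y' hY' => ?_⟩⟩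
  · refine (mk_iUnion_le Y).trans (mul_le_of_le hκ0.le (by simp) (ciSup_le' fun i => ?_))
    refine (hc i).trans (max_le (le_of_lt ?_) hκ0.le)
    simpa using mk_Iio_lt i
  · by_contra! hn
    have h1 : ∀ i, ∃ F : Finset Y', a i ∈ cl (Subtype.val '' (F : Set Y')) := by
      intro i
      obtain ⟨j, hj⟩ := hlim i
      have h2 : a i ∈ cl Y' := by
        rw [hY']
        exact mem_cl (Set.mem_iUnion.2 ⟨j, (hYY j i hj).2⟩)
      obtain ⟨F, h3, h4, h5⟩ := cl_finite h2
      refine ⟨(h4.preimage Subtype.val_injective.injOn).toFinset, ?_⟩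
      rwa [Set.Finite.coe_toFinset, Subtype.image_preimage_coe, Set.inter_eq_right.2 h3]
    choose F hF using h1
    have h2 : ∃ s : Finset Y', ¬ (F ⁻¹' {s}).Countable := by
      by_contra! hn'
      have h3 : (Set.univ : Set κ.ord.ToType) = ⋃ s : Finset Y', F ⁻¹' {s} := by
        ext i; simp
      have h4 : #(Set.univ : Set κ.ord.ToType) = κ := by simp
      have h5 : #(⋃ s : Finset Y', F ⁻¹' {s} : Set κ.ord.ToType) < κ := by
        refine (mk_iUnion_le _).trans_lt ?_
        refine (mul_le_mul' le_rfl (ciSup_le' fun s => (hn' s).le_aleph0)).trans_lt ?_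
        exact mul_lt_of_lt hκ0.le ((mk_finset_le _).trans_lt (max_lt hn hκ0)) hκ0
      rw [← h3, h4] at h5
      exact h5.false
    obtain ⟨s, hs⟩ := h2
    obtain ⟨j, hj, hjs⟩ := exists_strictMono_Om hs
    obtain ⟨ν, hν⟩ := H.chain_aux (Y := fun ν => Y (j ν)) (a := fun ν => a (j ν))
      (fun ν => hE _) (fun ν ν' h => hYY _ _ (hj h)) (fun ν => ha _) hX₁
      (hX₁'.mono (subset_cl _)) (fun ν => (hY _).1.trans (subset_cl _))
      (y := Subtype.val '' (s : Set Y')) (s.finite_toSet.image _)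
    refine hν ?_
    have h3 : F (j ν) = s := hjs ν
    rw [← h3]
    exact hF _

/-! #### Homogeneity -/

theorem Mon.EC_of_image (H : Mon L M κ μ) {g : M → M} (hS : #S ≤ μ) (hg : PE L S g)
    (h : EC L (g '' S)) : EC L S := by
  intro n A hA ⟨x, hx⟩
  obtain ⟨g₀, h0, h0'⟩ := H.ext S g hS hg h (Set.range x) (H.small_finite (Set.finite_range x))
  obtain ⟨g', h1, h1'⟩ := h0.exists_cl
  have h2 : ∀ y ∈ S, g' y = g y := fun y hy => (h1' y (.inl hy)).trans (h0' y hy)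
  have hSc : S ⊆ cl (S ∪ Set.range x) := Set.subset_union_left.trans (subset_cl _)
  have hSc' : cl S ⊆ cl (S ∪ Set.range x) := cl_mono Set.subset_union_left
  obtain ⟨B, hB, hAB⟩ := h1.qf hSc hA
  have hgS : g' '' S = g '' S := Set.image_congr h2
  rw [hgS] at hB
  obtain ⟨u, hu, hu'⟩ := h n B hB ⟨_, (hAB x fun i => mem_cl (.inr ⟨i, rfl⟩)).1 hx⟩
  have h5 : ∀ i, ∃ v ∈ cl S, g' v = u i := by
    intro i
    have := hu' i
    rw [← hgS, ← (h1.mono hSc').image_cl] at this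
    exact this
  choose v hv hvu using h5
  refine ⟨v, ?_, hv⟩
  rw [hAB v fun i => hSc' (hv i)]
  exact (congrArg (· ∈ B) (funext hvu)).mpr hu

/-- Sets with infinite closure are existentially closed. -/
theorem Mon.EC_of_infinite (H : Mon L M κ μ) {N : Set M} (hN : (cl N).Infinite) : EC L N := by
  have key : ∀ N : Set M, N.Countable → (cl N).Infinite → EC L N := by
    intro N hNc hN
    obtain ⟨V, hV, hNP⟩ := exists_NP hN
    have hI : #κ.ord.ToType = κ := by simp
    have hNμ := H.small_countable hNc
    obtain ⟨b, hb⟩ := H.exists_GS H.small_fin (I := κ.ord.ToType) (hI.trans_le H.hμ) hNμ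
      hV (subset_cl N)
    obtain ⟨a, rfl⟩ : ∃ a, b = single a :=
      ⟨fun i => b i ⟨⟩, funext fun i => funext fun j => rfl⟩
    have hr : #(Set.range a) = κ := by
      rw [mk_range_eq a (hb.injective hNP hV (subset_cl N)), hI]
    have hSG := (hb.indep hNP hV (subset_cl N)).sg H.hκ hr (hNc.le_aleph0.trans H.hκ.le)
    obtain ⟨N', h1, h2, h3⟩ := H.exists_EC_SG
    obtain ⟨g, hg, hgN⟩ := H.uniq _ _ (cl_cl _) h1 hSG h3
    have h4 : #(cl (N ∪ Set.range a)) ≤ μ := H.small_cl (H.small_union hNμ (hr.trans_le H.hμ))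
    have h5 : EC L (N ∪ Set.range a) :=
      (H.EC_of_image h4 hg (by rwa [hgN])).congr subset_rfl ((subset_cl _).trans (subset_cl _))
    have h6 := hb.fs hV (subset_cl N) hN.nonempty (D := ∅) (E := Set.univ) (by simp)
    rw [im_single, im_single, Set.image_univ, Set.image_empty, Set.union_empty] at h6
    intro n A hA hne
    obtain ⟨x, hx, hx'⟩ := h5 n A (hA.mono Set.subset_union_left) hne
    exact h6.fam (subset_cl N) hx' hA hx
  obtain ⟨X₁, hX₁, hX₁'⟩ : ∃ X₁ ⊆ cl N, X₁.Countable ∧ X₁.Infinite := by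
    have := hN.to_subtype
    obtain ⟨f⟩ := Infinite.natEmbedding (cl N) |> Nonempty.intro
    refine ⟨Set.range fun n => (f n : M), ?_, Set.countable_range _,
      Set.infinite_range_of_injective (Subtype.val_injective.comp f.injective)⟩
    rintro _ ⟨n, rfl⟩
    exact (f n).2
  intro n A hA hne
  obtain ⟨P₀, s, h1, h2, h3, h4, h5⟩ := hA.support
  obtain ⟨x, hx, hx'⟩ := key (P₀ ∪ X₁) (h2.countable.union hX₁'.1)
    ((hX₁'.2.mono Set.subset_union_right).mono (subset_cl _)) n A (h4.mono Set.subset_union_left) hne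
  exact ⟨x, hx, fun i => cl_le (Set.union_subset (h1.trans (subset_cl N)) hX₁) (hx' i)⟩

/-- Homogeneity. -/
theorem Mon.extend (H : Mon L M κ μ) {g : M → M} (hS : #S ≤ μ) (hSi : (cl S).Infinite)
    (hg : PE L S g) {W : Set M} (hW : #W ≤ μ) :
    ∃ g', PE L (S ∪ W) g' ∧ ∀ x ∈ S, g' x = g x := by
  refine H.ext S g hS hg (H.EC_of_infinite ?_) W hW
  obtain ⟨g', h1, h2⟩ := hg.exists_cl
  have h3 : g '' S = g' '' S := Set.image_congr fun x hx => (h2 x hx).symm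
  rw [h3, ← h1.image_cl]
  exact hSi.image h1.injOn

end Closed

end QFree

namespace QFree

section Stab

variable {L : FirstOrder.Language.{u, u}} {M : Type u} [L.Structure M]

local notation "cl" => clos L

variable {κ μ : Cardinal.{u}} {ι ι' γ : Type u} {P Q N N' S X₀ : Set M}

theorem QF.inst_right {β γ : Type*} {A : Set (β ⊕ γ → M)} (hA : QF L P (β ⊕ γ) A) {c : γ → M}
    (hc : ∀ i, c i ∈ cl P) : QF L P β {x | Sum.elim x c ∈ A} := by
  have h := QF.inst (hA.reindex (β := γ ⊕ β) Sum.swap) hc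
  refine (congrArg (QF L P β) (Set.ext fun x => ?_)).mp h
  refine (congrArg (· ∈ A) (funext fun i => ?_)).to_iff
  cases i <;> rfl

theorem GS.eqT_cut {I : Type*} [LinearOrder I] {V : Ultrafilter (ι → M)} {a : I → ι → M}
    (h : GS L V P a) (hV : tuples L ι X₀ ∈ V) (hX : X₀ ⊆ cl P) {i j : I} (hij : i < j) {D : Set I}
    (hD : ∀ k ∈ D, k < i ∨ j < k) : EqT L (P ∪ im a D) (a i) (a j) := by
  classical
  let σ' : Subtype (· ∈ (insert i D : Set I)) → I := fun x => if (x : I) = i then j else x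
  have hσ' : StrictMono σ' := by
    rintro ⟨x, hx⟩ ⟨y, hy⟩ hxy
    have hxy : x < y := hxy
    simp only [σ']
    split_ifs with h1 h2 h2
    · rw [h1, h2] at hxy
      exact (lt_irrefl _ hxy).elim
    · rcases hD y (hy.resolve_left h2) with h3 | h3
      · exact (h3.not_gt (h1 ▸ hxy)).elim
      · exact h3
    · exact (h2 ▸ hxy).trans hij
    · exact hxy
  have h1 := h.unique h hV hX (σ := fun x : Subtype (· ∈ (insert i D : Set I)) => (x : I)) (fun x y h => h) hσ'
  have e : im a D = Set.range fun p : D × ι => a p.1 p.2 := by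
    ext x
    simp [im]
  rw [e, eqT_abs]
  have h2 := h1.reindex (Sum.elim (fun p : D × ι => ((⟨p.1, .inr p.1.2⟩ : Subtype (· ∈ (insert i D : Set I))), p.2))
    (fun k => (⟨i, .inl rfl⟩, k)))
  have hiD : ∀ k : D, (k : I) ≠ i := by
    rintro ⟨k, hk⟩ rfl
    rcases hD k hk with h3 | h3
    · exact lt_irrefl _ h3
    · exact lt_asymm h3 hij
  have e1 : (fun k => (fun p : Subtype (· ∈ (insert i D : Set I)) × ι => a p.1 p.2) ((Sum.elim (fun p : D × ι =>
      ((⟨p.1, .inr p.1.2⟩ : Subtype (· ∈ (insert i D : Set I))), p.2)) (fun k => (⟨i, .inl rfl⟩, k))) k)) =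
      Sum.elim (fun p : D × ι => a p.1 p.2) (a i) := by
    funext k
    cases k <;> rfl
  have e2 : (fun k => (fun p : Subtype (· ∈ (insert i D : Set I)) × ι => a (σ' p.1) p.2) ((Sum.elim (fun p : D × ι =>
      ((⟨p.1, .inr p.1.2⟩ : Subtype (· ∈ (insert i D : Set I))), p.2)) (fun k => (⟨i, .inl rfl⟩, k))) k)) =
      Sum.elim (fun p : D × ι => a p.1 p.2) (a j) := by
    funext k
    rcases k with k | k
    · simp [σ', hiD]
    · simp [σ']
  rw [e1, e2] at h2
  exact h2

theorem Mon.no_order (H : Mon L M κ μ) {s : Type u} [Finite s] (hP : P.Countable)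
    {C : Set (s ⊕ s → M)} (hC : QF L P (s ⊕ s) C) (d : ℕ → s → M)
    (hd : ∀ i j, Sum.elim (d i) (d j) ∈ C ↔ i ≤ j) : False := by
  have := H.inf
  obtain ⟨X₁, hX₁, hX₁'⟩ : ∃ X₁ : Set M, X₁.Countable ∧ X₁.Infinite := by
    obtain ⟨f⟩ := Infinite.natEmbedding M |> Nonempty.intro
    exact ⟨Set.range f, Set.countable_range f, Set.infinite_range_of_injective f.injective⟩
  obtain ⟨X₀, hX₀, hPX, hdX, hXi⟩ : ∃ X₀ : Set M, X₀.Countable ∧ P ⊆ X₀ ∧ (∀ n k, d n k ∈ X₀) ∧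
      (cl X₀).Infinite := by
    refine ⟨P ∪ (X₁ ∪ ⋃ n, Set.range (d n)), hP.union (hX₁.union (Set.countable_iUnion fun n =>
      Set.countable_range _)), Set.subset_union_left, fun n k => .inr (.inr ?_), ?_⟩
    · exact Set.mem_iUnion.2 ⟨n, k, rfl⟩
    · exact hX₁'.mono ((Set.subset_union_left.trans Set.subset_union_right).trans (subset_cl _))
  obtain ⟨V, hVd⟩ : ∃ V : Ultrafilter (s → M), V = (Filter.hyperfilter ℕ).map d := ⟨_, rfl⟩
  have hVmem : ∀ A : Set (s → M), A ∈ V ↔ ∀ᶠ n in Filter.hyperfilter ℕ, d n ∈ A := by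
    intro A
    rw [hVd]
    rfl
  have hge : ∀ m : ℕ, ∀ᶠ n in Filter.hyperfilter ℕ, m ≤ n := fun m =>
    Filter.hyperfilter_le_cofinite (Filter.mem_cofinite.2 (by
      refine (Set.finite_Iio (m : ℕ)).subset fun x hx => ?_
      simpa using hx))
  have hV : tuples L s X₀ ∈ V := by
    rw [hVmem]
    exact Filter.Eventually.of_forall fun n k => mem_cl (hdX n k)
  have hOmle : #Om.{u} ≤ μ := by
    rw [mk_Om]
    exact (aleph_one_le_iff.2 H.hκ).trans H.hμ
  have hI : #(Om.{u} ⊕ₗ Om.{u}ᵒᵈ) ≤ μ := by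
    have : #(Om.{u} ⊕ₗ Om.{u}ᵒᵈ) = #Om.{u} + #Om.{u} := by
      rw [Cardinal.add_def]
      exact Cardinal.mk_congr (ofLex.trans (Equiv.sumCongr (Equiv.refl _) OrderDual.ofDual))
    rw [this]
    exact add_le_of_le H.aleph0_le hOmle hOmle
  obtain ⟨a, ha⟩ := H.exists_GS H.small_fin hI (H.small_countable hX₀) hV (subset_cl X₀)
  have hCX := hC.mono hPX
  have h1 : ∀ i j, i < j → Sum.elim (a i) (a j) ∉ C := by
    intro i j hij hm
    have h2 : {y | Sum.elim (a i) y ∈ C} ∈ V := by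
      have hq : QF L (X₀ ∪ im a {k | k < j}) s {y | Sum.elim (a i) y ∈ C} :=
        QF.inst (hCX.mono Set.subset_union_left) fun k => mem_cl (.inr (mem_im (a := a) (D := {k | k < j}) hij k))
      exact (ha j _ hq).1 hm
    rw [hVmem] at h2
    obtain ⟨n, hn⟩ := h2.exists
    have hq : QF L (X₀ ∪ im a {k | k < i}) s {x | Sum.elim x (d n) ∈ C} :=
      QF.inst_right (hCX.mono Set.subset_union_left) fun k => mem_cl (.inl (hdX n k))
    have h3 := (ha i _ hq).1 hn
    rw [hVmem] at h3
    obtain ⟨m, hm1, hm2⟩ := (h3.and (hge (n + 1))).exists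
    have := (hd m n).1 hm1
    omega
  have h2 : ∀ i j, i < j → Sum.elim (a j) (a i) ∈ C := by
    intro i j hij
    have hq : QF L (X₀ ∪ im a {k | k < j}) s {x | Sum.elim x (a i) ∈ C} :=
      QF.inst_right (hCX.mono Set.subset_union_left) fun k => mem_cl (.inr (mem_im (a := a) (D := {k | k < j}) hij k))
    refine (ha j _ hq).2 ((hVmem _).2 (Filter.Eventually.of_forall fun m => ?_))
    have hq : QF L (X₀ ∪ im a {k | k < i}) s {y | Sum.elim (d m) y ∈ C} :=
      QF.inst (hCX.mono Set.subset_union_left) fun k => mem_cl (.inl (hdX m k))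
    refine (ha i _ hq).2 ((hVmem _).2 ?_)
    exact (hge m).mono fun n hn => (hd m n).2 hn
  obtain ⟨G, hG⟩ : ∃ G : Om.{u} → Set M, G = fun ν =>
    Set.range (a (toLex (.inl ν))) ∪ Set.range (a (toLex (.inr (OrderDual.toDual ν)))) := ⟨_, rfl⟩
  obtain ⟨δ, -, hlim, hδ⟩ := H.club hX₀ hXi (G := G) fun ν => by
    rw [hG]
    exact (Set.countable_range _).union (Set.countable_range _)
  obtain ⟨α, hα, hF⟩ := hδ (Set.range (a (toLex (.inl δ)))) (Set.finite_range _)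
    (subset_trans (by rw [hG]; exact Set.subset_union_left) ((subset_Nall δ).trans (subset_cl _)))
  have hαG : G α ⊆ Nn X₀ G δ := subset_Nn_of_lt hα
  have hin : ∀ k, a (toLex (.inl α)) k ∈ Nn X₀ G δ := fun k => hαG (by rw [hG]; exact .inl ⟨k, rfl⟩)
  have hin' : ∀ k, a (toLex (.inr (OrderDual.toDual α))) k ∈ Nn X₀ G δ := fun k =>
    hαG (by rw [hG]; exact .inr ⟨k, rfl⟩)
  have hPN : P ⊆ Nn X₀ G δ := hPX.trans subset_Nn
  obtain ⟨w, ⟨hw1, hw2⟩, hwN⟩ := hF.fam ((Nn_mono hα.le).trans (subset_cl _))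
    (w := a (toLex (.inl δ))) (fun k => mem_cl (.inr ⟨k, rfl⟩))
    (((hC.mono hPN).inst_right fun k => mem_cl (hin k)).diff
      ((hC.mono hPN).inst_right fun k => mem_cl (hin' k)))
    ⟨h2 _ _ (Sum.Lex.inl_lt_inl_iff.2 hα), h1 _ _ (Sum.Lex.inl_lt_inr _ _)⟩
  have h3 : EqT L (X₀ ∪ im a (⋃ β ∈ Set.Iio α, {toLex (.inl β), toLex (.inr (OrderDual.toDual β))}))
      (a (toLex (.inl α))) (a (toLex (.inr (OrderDual.toDual α)))) := by
    refine ha.eqT_cut hV (subset_cl X₀) (Sum.Lex.inl_lt_inr _ _) fun k hk => ?_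
    obtain ⟨β, hβ, hk⟩ := Set.mem_iUnion₂.1 hk
    rcases hk with rfl | rfl
    · exact .inl (Sum.Lex.inl_lt_inl_iff.2 hβ)
    · exact .inr (Sum.Lex.inr_lt_inr_iff.2 (OrderDual.toDual_lt_toDual.2 hβ))
  have h4 : Nn X₀ G α ⊆ X₀ ∪ im a (⋃ β ∈ Set.Iio α,
      {toLex (.inl β), toLex (.inr (OrderDual.toDual β))}) := by
    refine Set.union_subset_union_right _ (Set.iUnion₂_subset fun β hβ => ?_)
    rw [hG]
    refine Set.union_subset ?_ ?_
    · rintro _ ⟨k, rfl⟩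
      exact mem_im (a := a) (Set.mem_biUnion hβ (.inl rfl)) k
    · rintro _ ⟨k, rfl⟩
      exact mem_im (a := a) (Set.mem_biUnion hβ (.inr rfl)) k
  refine hw2 (h3 _ (QF.inst (hC.mono (hPX.trans Set.subset_union_left)) fun k => ?_) hw1)
  exact cl_mono h4 (hwN k)

theorem Mon.stab (H : Mon L M κ μ) (V : Ultrafilter (ι → M)) (W : Ultrafilter (ι' → M))
    {A : Set (ι ⊕ ι' → M)} (hA : QF L P (ι ⊕ ι') A)
    (h : ∀ᶠ u in V, ∀ᶠ v in W, Sum.elim u v ∈ A) : ∀ᶠ v in W, ∀ᶠ u in V, Sum.elim u v ∈ A := by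
  classical
  have hne := H.nonempty
  by_contra hn
  rw [← Ultrafilter.eventually_not] at hn
  simp only [← Ultrafilter.eventually_not] at hn
  obtain ⟨f, hf⟩ : ∃ f : ℕ → (ι → M) × (ι' → M), ∀ n, (∀ᶠ v in W, Sum.elim (f n).1 v ∈ A) ∧
      (∀ j < n, Sum.elim (f n).1 (f j).2 ∉ A) ∧ (∀ᶠ u in V, Sum.elim u (f n).2 ∉ A) ∧
      (∀ j < n, Sum.elim (f j).1 (f n).2 ∈ A) ∧ Sum.elim (f n).1 (f n).2 ∈ A := by
    refine exists_wf_rec (· < ·) wellFounded_lt (fun n (f : ℕ → (ι → M) × (ι' → M))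
      (x : (ι → M) × (ι' → M)) => (∀ᶠ v in W, Sum.elim x.1 v ∈ A) ∧
      (∀ j < n, Sum.elim x.1 (f j).2 ∉ A) ∧ (∀ᶠ u in V, Sum.elim u x.2 ∉ A) ∧
      (∀ j < n, Sum.elim (f j).1 x.2 ∈ A) ∧ Sum.elim x.1 x.2 ∈ A) ?_ ?_
    · rintro n f f' x hf ⟨h1, h2, h3, h4, h5⟩
      exact ⟨h1, fun j hj => hf j hj ▸ h2 j hj, h3, fun j hj => hf j hj ▸ h4 j hj, h5⟩
    · intro n f hf
      have h1 : ∀ᶠ u in V, ∀ j ∈ Set.Iio n, Sum.elim u (f j).2 ∉ A :=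
        (Filter.eventually_all_finite (Set.finite_Iio n)).2 fun j hj => (hf j hj).2.2.1
      obtain ⟨u, hu1, hu2⟩ := (h.and h1).exists
      have h2 : ∀ᶠ v in W, ∀ j ∈ Set.Iio n, Sum.elim (f j).1 v ∈ A :=
        (Filter.eventually_all_finite (Set.finite_Iio n)).2 fun j hj => (hf j hj).1
      obtain ⟨v, ⟨hv1, hv2⟩, hv3⟩ := ((hn.and h2).and hu1).exists
      exact ⟨(u, v), hu1, hu2, hv1, hv2, hv3⟩
  obtain ⟨P₀, s, h1, h2, h3, h4, h5⟩ := hA.support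
  obtain ⟨B, hB, hAB⟩ := h4.restrict h5
  have := h3.to_subtype
  refine H.no_order (s := s) h2.countable
    (hB.preimage (β := s ⊕ s) (g := fun k x => if k.1.isLeft then x (.inl k) else x (.inr k))
      fun k => ?_) (fun n k => Sum.elim (f n).1 (f n).2 k) fun i j => ?_
  · by_cases hk : k.1.isLeft
    · simpa only [hk, if_true] using TF.var _
    · simp only [hk, Bool.false_eq_true, if_false]
      exact TF.var _
  · have e : Sum.elim (f i).1 (f j).2 ∈ A ↔ i ≤ j := by
      rcases lt_trichotomy i j with h | rfl | h
      · simp [(hf j).2.2.2.1 i h, h.le]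
      · simp [(hf i).2.2.2.2]
      · simp [(hf i).2.1 j h, h]
    rw [← e, hAB]
    refine (congrArg (· ∈ B) (funext fun k => ?_)).to_iff
    rcases k with ⟨k | k, hk⟩ <;> simp

end Stab

end QFree

namespace QFree

section Indep

variable {L : FirstOrder.Language.{u, u}} {M : Type u} [L.Structure M]

local notation "cl" => clos L

variable {κ μ : Cardinal.{u}} {ι γ : Type u} {P Q N N' S X₀ Y : Set M}

theorem exists_ultrafilter_of_fs' {w : ι → M} (h : FS L (Set.range w) P N) (hN : N ⊆ cl P) :
    ∃ V : Ultrafilter (ι → M), tuples L ι N ∈ V ∧ Realizes L V P w := by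
  let B : Set (Set (ι → M)) := {C | ∃ A, QF L P ι A ∧ w ∈ A ∧ C = A ∩ tuples L ι N}
  have h1 : ∃ V : Ultrafilter (ι → M), B ⊆ V.sets := by
    refine Ultrafilter.exists_ultrafilter_of_finite_inter_nonempty B fun T hT => ?_
    choose! A hA hw hAT using hT
    obtain ⟨u, hu, hu'⟩ := h.fam hN (w := w) (fun i => mem_cl (.inr ⟨i, rfl⟩))
      (QF.biInter (T : Set (Set (ι → M))) T.finite_toSet (A := A) fun C hC => hA hC)
      (Set.mem_iInter₂.2 fun C hC => hw hC)
    refine ⟨u, fun C hC => ?_⟩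
    rw [hAT hC]
    exact ⟨Set.mem_iInter₂.1 hu C hC, hu'⟩
  obtain ⟨V, hV⟩ := h1
  have h2 : ∀ A, QF L P ι A → w ∈ A → A ∈ V := fun A hA hw =>
    Filter.mem_of_superset (hV ⟨A, hA, hw, rfl⟩) Set.inter_subset_left
  refine ⟨V, Filter.mem_of_superset (hV ⟨_, .univ, Set.mem_univ w, rfl⟩) Set.inter_subset_right,
    fun A hA => ⟨h2 A hA, fun hAV => ?_⟩⟩
  by_contra hn
  exact Ultrafilter.compl_mem_iff_notMem.1 (h2 _ hA.compl hn) hAV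

theorem Mon.exists_realizes (H : Mon L M κ μ) (hN : (cl N).Infinite) (p : γ → M) :
    ∃ W : Ultrafilter (γ → M), tuples L γ N ∈ W ∧ Realizes L W N p :=
  exists_ultrafilter_of_fs ((H.EC_of_infinite hN).fs hN.nonempty _)

theorem Mon.stab_iff (H : Mon L M κ μ) {V : Ultrafilter (ι → M)} {W : Ultrafilter (γ → M)}
    (hV : tuples L ι N ∈ V) {p : γ → M} (hp : Realizes L W N p) {B : Set (γ ⊕ ι → M)}
    (hB : QF L N (γ ⊕ ι) B) :
    (∀ᶠ x in V, Sum.elim p x ∈ B) ↔ ∀ᶠ q in W, ∀ᶠ x in V, Sum.elim q x ∈ B := by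
  have key : ∀ {B : Set (γ ⊕ ι → M)} (hB : QF L N (γ ⊕ ι) B), (∀ᶠ x in V, Sum.elim p x ∈ B) →
      ∀ᶠ q in W, ∀ᶠ x in V, Sum.elim q x ∈ B := by
    intro B hB h
    have h1 : ∀ᶠ x in V, ∀ᶠ q in W, Sum.elim q x ∈ B := by
      filter_upwards [h, hV] with x hx hxN
      exact (hp _ (hB.inst_right hxN)).1 hx
    have h2 := hB.reindex (β := ι ⊕ γ) Sum.swap
    have e : ∀ (q : γ → M) (x : ι → M), (fun i => Sum.elim x q (Sum.swap i)) = Sum.elim q x := by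
      intro q x
      funext i
      cases i <;> rfl
    have h3 := H.stab V W h2 (by simpa only [Set.mem_ofPred_eq, e] using h1)
    simpa only [Set.mem_ofPred_eq, e] using h3
  refine ⟨key hB, fun h => ?_⟩
  by_contra hn
  rw [← Ultrafilter.eventually_not] at hn
  have h1 := key hB.compl hn
  obtain ⟨q, hq1, hq2⟩ := (h.and h1).exists
  obtain ⟨x, hx1, hx2⟩ := (hq1.and hq2).exists
  exact hx2 hx1

theorem Mon.fs_iff (H : Mon L M κ μ) {w : ι → M} (h : FS L (Set.range w) P N) (hN : N ⊆ cl P)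
    {p : γ → M} (hp : ∀ i, p i ∈ cl P) {W : Ultrafilter (γ → M)} (hW : tuples L γ N ∈ W)
    (hpW : Realizes L W N p) {B : Set (γ ⊕ ι → M)} (hB : QF L N (γ ⊕ ι) B) :
    Sum.elim p w ∈ B ↔ ∀ᶠ q in W, Sum.elim q w ∈ B := by
  obtain ⟨V, hV, hVw⟩ := exists_ultrafilter_of_fs' h hN
  have h1 : Sum.elim p w ∈ B ↔ ∀ᶠ x in V, Sum.elim p x ∈ B :=
    hVw _ (QF.inst (hB.of_le hN) hp)
  rw [h1, H.stab_iff hV hpW hB]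
  refine Filter.eventually_congr ?_
  filter_upwards [hW] with q hq
  exact (hVw _ (QF.inst (hB.of_le hN) fun i => cl_le hN (hq i))).symm

/-- Uniqueness of finitely satisfiable extensions. -/
theorem Mon.uniq_fs (H : Mon L M κ μ) (hNi : (cl N).Infinite) {w w' : ι → M}
    (h : FS L (Set.range w) P N) (h' : FS L (Set.range w') P N) (hN : N ⊆ cl P)
    (he : EqT L N w w') : EqT L P w w' := by
  obtain ⟨W, hW, hpW⟩ := H.exists_realizes hNi (fun x : P => (x : M))
  intro A hA hwA
  obtain ⟨B, hB, hAB⟩ := QF.abs (P := N) (c := fun x : P => (x : M))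
    (hA.mono (Q := N ∪ Set.range fun x : P => (x : M)) (by simp))
  rw [hAB] at hwA ⊢
  rw [H.fs_iff h hN (fun i => mem_cl i.2) hW hpW hB] at hwA
  rw [H.fs_iff h' hN (fun i => mem_cl i.2) hW hpW hB]
  filter_upwards [hwA, hW] with q hq hqN
  exact he _ (QF.inst hB hqN) hq

theorem Mon.sym_fs (H : Mon L M κ μ) (hNi : (cl N).Infinite) (h : FS L Y (N ∪ P) N) :
    FS L P (N ∪ Y) N := by
  obtain ⟨W, hW, hpW⟩ := H.exists_realizes hNi (fun x : P => (x : M))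
  have hr : Set.range (fun x : P => (x : M)) = P := by simp
  rw [← hr]
  refine FS.of_fam fun A hA hp => ?_
  obtain ⟨B, hB, hAB⟩ := QF.abs (P := N) (c := fun x : Y => (x : M))
    (hA.mono (Q := N ∪ Set.range fun x : Y => (x : M)) (by simp))
  rw [hAB] at hp
  have h1 := H.fs_iff (w := fun x : Y => (x : M)) (N := N) (P := N ∪ P) (by simpa using h)
    (Set.subset_union_left.trans (subset_cl _)) (p := fun x : P => (x : M))
    (fun i => mem_cl (.inr i.2)) hW hpW (hB.reindex Sum.swap)
  have e : ∀ (q : P → M) (x : Y → M), (fun i => Sum.elim q x (Sum.swap i)) = Sum.elim x q := by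
    intro q x
    funext i
    cases i <;> rfl
  simp only [Set.mem_ofPred_eq, e] at h1
  obtain ⟨q, hq1, hq2⟩ := ((h1.1 hp).and hW).exists
  exact ⟨q, (hAB q).2 hq1, hq2⟩

theorem Mon.trans_fs (H : Mon L M κ μ) (hNi : (cl N).Infinite) (h : FS L Y P N')
    (h' : FS L Y N' N) (hN : N ⊆ cl N') (hN' : N' ⊆ cl P) : FS L Y P N := by
  have hr : Set.range (fun x : Y => (x : M)) = Y := by simp
  obtain ⟨W, hW, hpW⟩ := H.exists_realizes (hNi.mono (cl_le hN)) (fun x : P => (x : M))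
  rw [← hr] at h h' ⊢
  obtain ⟨V, hV, hVw⟩ := exists_ultrafilter_of_fs' h' hN
  refine FS.of_fam fun A hA hw => ?_
  obtain ⟨B, hB, hAB⟩ := QF.abs (P := N') (c := fun x : P => (x : M))
    (hA.mono (Q := N' ∪ Set.range fun x : P => (x : M)) (by simp))
  rw [hAB, H.fs_iff h hN' (fun i => mem_cl i.2) hW hpW hB] at hw
  have h1 : ∀ᶠ q in W, ∀ᶠ x in V, Sum.elim q x ∈ B := by
    filter_upwards [hw, hW] with q hq hqN
    exact (hVw _ (QF.inst hB hqN)).1 hq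
  have hV' : tuples L _ N' ∈ V := Filter.mem_of_superset hV fun x hx i => cl_le hN (hx i)
  obtain ⟨x, hx1, hx2⟩ := (((H.stab_iff hV' hpW hB).2 h1).and hV).exists
  exact ⟨x, (hAB x).2 hx1, hx2⟩

end Indep

end QFree

namespace QFree

section Good

variable (L : FirstOrder.Language.{u, u}) {M : Type u} [L.Structure M]

/-- `b` and `b'` have the same quantifier-free type over `P`. -/
def Eqv (P : Set M) (b b' : M) : Prop :=
  EqT L P (fun _ : PUnit.{u + 1} => b) (fun _ => b')

/-- Every nonalgebraic extension of the type of `b` over `N` is finitely satisfiable in `N`. -/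
def Good (N : Set M) (b : M) : Prop :=
  b ∉ clos L N ∧ ∀ F : Set M, F.Finite → ∀ b', Eqv L N b b' → b' ∉ clos L (N ∪ F) →
    FS L {b'} (N ∪ F) N

local notation "cl" => clos L

variable {L}
variable {κ μ : Cardinal.{u}} {ι γ : Type u} {P Q N N' S X X₀ Y : Set M}

theorem Mon.move_fam (H : Mon L M κ μ) {e e' : ι → M} (he : EqT L ∅ e e') (hι : #ι ≤ μ)
    (hi : (cl (Set.range e)).Infinite) {W : Set M} (hW : #W ≤ μ) :
    ∃ g, PE L (cl (Set.range e ∪ W)) g ∧ ∀ i, g (e i) = e' i := by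
  obtain ⟨g, h1, -, h2⟩ := he.exists_pe
  obtain ⟨g', h3, h4⟩ := H.extend (H.small_range hι e) hi
    (h1.mono (Set.subset_union_right.trans (subset_cl _))) hW
  obtain ⟨g'', h5, h6⟩ := h3.exists_cl
  exact ⟨g'', h5, fun i => by rw [h6 _ (.inl ⟨i, rfl⟩), h4 _ ⟨i, rfl⟩, h2]⟩

theorem Mon.move (H : Mon L M κ μ) {w w' : ι → M} (hP : #P ≤ μ) (hPi : (cl P).Infinite)
    (he : EqT L P w w') (hι : #ι ≤ μ) {W : Set M} (hW : #W ≤ μ) :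
    ∃ g, PE L (cl (P ∪ Set.range w ∪ W)) g ∧ (∀ x ∈ P, g x = x) ∧ ∀ i, g (w i) = w' i := by
  have h0 : EqT L ∅ (Sum.elim (fun x : P => (x : M)) w) (Sum.elim (fun x : P => (x : M)) w') := by
    rw [← eqT_abs]
    simpa using he
  have hr : Set.range (Sum.elim (fun x : P => (x : M)) w) = P ∪ Set.range w := by simp
  obtain ⟨g, h1, h2⟩ := H.move_fam h0 (by
    rw [mk_sum, lift_id, lift_id]
    exact add_le_of_le H.aleph0_le hP hι) (by
    rw [hr]
    exact hPi.mono (cl_mono Set.subset_union_left)) hW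
  rw [hr] at h1
  exact ⟨g, h1, fun x hx => h2 (.inl ⟨x, hx⟩), fun i => h2 (.inr i)⟩

theorem PE.fs_iff {g : M → M} (hg : PE L (cl S) g) (hY : Y ⊆ cl S) (hP : P ⊆ cl S)
    (hN : N ⊆ cl S) : FS L (g '' Y) (g '' P) (g '' N) ↔ FS L Y P N := by
  refine ⟨fun h => ?_, fun h => h.pe hg hY hP (cl_le hN)⟩
  obtain ⟨g', h1, h2, h3⟩ := hg.exists_inv
  have hinv : ∀ Z ⊆ cl S, g' '' (g '' Z) = Z := by
    intro Z hZ
    rw [Set.image_image]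
    exact (Set.image_congr fun x hx => h2 x (hZ hx)).trans (Set.image_id' Z)
  have h4 := h.pe h1 (Set.image_mono hY) (Set.image_mono hP) (by
    rw [hg.image_cl]
    refine cl_le ?_
    rw [← hg.image_cl]
    exact Set.image_mono hN)
  rwa [hinv Y hY, hinv P hP, hinv N hN] at h4

theorem Eqv.refl (b : M) : Eqv L P b b := EqT.refl _

theorem Eqv.symm {b b' : M} (h : Eqv L P b b') : Eqv L P b' b := EqT.symm h

theorem Eqv.trans {b b' b'' : M} (h : Eqv L P b b') (h' : Eqv L P b' b'') : Eqv L P b b'' :=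
  EqT.trans h h'

theorem Eqv.mono {b b' : M} (h : Eqv L Q b b') (hPQ : P ⊆ cl Q) : Eqv L P b b' := EqT.mono h hPQ

theorem Eqv.mem_cl {b b' : M} (h : Eqv L P b b') (hb : b ∈ cl P) : b' ∈ cl P := by
  have := EqT.mem_cl (J := ∅) (i := PUnit.unit) h (by simpa using hb)
  simpa using this

theorem Eqv.mem_iff {b b' : M} (h : Eqv L P b b') : b ∈ cl P ↔ b' ∈ cl P := ⟨h.mem_cl, h.symm.mem_cl⟩

theorem Eqv.fs {b b' : M} (h : Eqv L P b b') (hN : N ⊆ cl P) (hf : FS L {b} P N) :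
    FS L {b'} P N := by
  have hr : ∀ b : M, Set.range (fun _ : PUnit.{u + 1} => b) = {b} := fun b => Set.range_const
  rw [← hr] at hf ⊢
  exact hf.eqT hN h

theorem Good.fs {b b' : M} (h : Good L N b) (he : Eqv L N b b') (hN : N ⊆ cl P)
    (hb : b' ∉ cl P) : FS L {b'} P N := by
  intro A hA hw
  obtain ⟨P₀, s, h1, h2, h3, h4, h5⟩ := hA.support
  refine h.2 P₀ h2 b' he (fun hm => hb (cl_le ?_ hm)) A (h4.mono Set.subset_union_right) hw
  exact Set.union_subset hN (h1.trans (subset_cl _))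

/-- Goodness goes up. -/
theorem Good.up {b : M} (h : Good L N b) (hN : N ⊆ cl P) (hb : b ∉ cl P) : Good L P b :=
  ⟨hb, fun F _ b' he hb' => (h.fs (he.mono hN) (hN.trans (cl_mono Set.subset_union_left)) hb').base
    hN⟩

theorem Good.eqv {b b' : M} (h : Good L N b) (he : Eqv L N b b') : Good L N b' :=
  ⟨fun hb' => h.1 (he.symm.mem_cl hb'), fun F hF b'' he' hb'' => h.2 F hF b'' (he.trans he') hb''⟩

theorem Good.congr {b : M} (h : Good L N b) (h1 : N ⊆ cl P) (h2 : P ⊆ cl N) : Good L P b :=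
  h.up h1 fun hb => h.1 (cl_le h2 hb)

theorem Good.eqv_of {b b' b'' : M} (H : Mon L M κ μ) (hNi : (cl N).Infinite) (h : Good L N b)
    (he : Eqv L N b b') (he' : Eqv L N b b'') (hN : N ⊆ cl P) (hb' : b' ∉ cl P)
    (hb'' : b'' ∉ cl P) : Eqv L P b' b'' := by
  have hr : ∀ b : M, Set.range (fun _ : PUnit.{u + 1} => b) = {b} := fun b => Set.range_const
  refine H.uniq_fs hNi ?_ ?_ hN (he.symm.trans he')
  · rw [hr]
    exact h.fs he hN hb'
  · rw [hr]
    exact h.fs he' hN hb''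

/-- Exchange for good elements. -/
theorem Good.exchange {b z : M} (H : Mon L M κ μ) (hNi : (cl N).Infinite) (h : Good L N b)
    (hz : z ∈ cl (N ∪ {b})) (hzN : z ∉ cl N) : b ∈ cl (N ∪ {z}) := by
  by_contra hn
  have h1 : FS L {b} (N ∪ {z}) N :=
    h.fs (.refl b) (Set.subset_union_left.trans (subset_cl _)) hn
  have h2 := H.sym_fs hNi h1
  exact hzN (h2.mem (Set.subset_union_left.trans (subset_cl _))
    (QFree.mem_cl (.inr rfl)) hz)

theorem Good.of_eqT (H : Mon L M κ μ) {m m' : ι → M} {b b' : M} (h : Good L (Set.range m) b)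
    (hι : #ι ≤ μ) (hi : (cl (Set.range m')).Infinite)
    (he : EqT L ∅ (Sum.elim m fun _ : PUnit.{u + 1} => b) (Sum.elim m' fun _ => b')) :
    Good L (Set.range m') b' := by
  refine ⟨fun hb => h.1 ?_, fun F hF b'' he' hb'' => ?_⟩
  · have hr : ∀ (m : ι → M) (b : M),
        (Sum.elim m fun _ : PUnit.{u + 1} => b) '' Set.range Sum.inl = Set.range m := by
      intro m b
      rw [← Set.range_comp]
      rfl
    have := he.symm.mem_cl (J := Set.range Sum.inl) (i := .inr PUnit.unit)
      (by rw [hr, Set.empty_union]; exact hb)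
    rwa [hr, Set.empty_union] at this
  · have h1 : EqT L ∅ (Sum.elim m' fun _ : PUnit.{u + 1} => b'')
        (Sum.elim m fun _ : PUnit.{u + 1} => b) := by
      refine EqT.trans ?_ he.symm
      rw [← eqT_abs]
      exact EqT.mono he'.symm (by simpa using subset_cl _)
    have hr : Set.range (Sum.elim m' fun _ : PUnit.{u + 1} => b'') = Set.range m' ∪ {b''} := by
      simp
    obtain ⟨g, h2, h3⟩ := H.move_fam h1 (by
      rw [mk_sum, lift_id, lift_id]
      exact add_le_of_le H.aleph0_le hι H.small_fin) (by
      rw [hr]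
      exact hi.mono (cl_mono Set.subset_union_left)) (H.small_finite hF)
    rw [hr] at h2
    have hgb : g b'' = b := h3 (.inr ⟨⟩)
    have hgm : g '' Set.range m' = Set.range m := by
      rw [← Set.range_comp]
      exact congrArg Set.range (funext fun i => h3 (.inl i))
    have s1 : Set.range m' ⊆ cl (Set.range m' ∪ {b''} ∪ F) :=
      (Set.subset_union_left.trans Set.subset_union_left).trans (subset_cl _)
    have s2 : F ⊆ cl (Set.range m' ∪ {b''} ∪ F) := Set.subset_union_right.trans (subset_cl _)
    have s3 : b'' ∈ cl (Set.range m' ∪ {b''} ∪ F) := QFree.mem_cl (.inl (.inr rfl))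
    rw [← h2.fs_iff (Set.singleton_subset_iff.2 s3) (Set.union_subset s1 s2) s1,
      Set.image_union, Set.image_singleton, hgb, hgm]
    refine h.2 _ (hF.image _) _ (.refl b) fun hb => hb'' ?_
    rw [← h2.mem_cl_iff (Set.union_subset s1 s2) s3, Set.image_union, hgm, hgb]
    exact hb

theorem Good.pe (H : Mon L M κ μ) {b : M} {g : M → M} (h : Good L N b) (hg : PE L (cl S) g)
    (hN : N ⊆ cl S) (hb : b ∈ cl S) (hNs : #N ≤ μ) (hi : (cl N).Infinite) :
    Good L (g '' N) (g b) := by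
  have h1 := hg.eqT (w := Sum.elim (fun x : N => (x : M)) fun _ : PUnit.{u + 1} => b) (by
    rintro (i | i)
    exacts [hN i.2, hb])
  have h2 : (fun i => g ((Sum.elim (fun x : N => (x : M)) fun _ : PUnit.{u + 1} => b) i)) =
      Sum.elim (fun x : N => g x) fun _ : PUnit.{u + 1} => g b := by
    funext i
    cases i <;> rfl
  rw [h2] at h1
  rw [Set.image_eq_range]
  refine Good.of_eqT H (m := fun x : N => (x : M)) (by simpa using h) hNs ?_ h1
  rw [← Set.image_eq_range, ← (hg.mono (cl_le hN)).image_cl]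
  exact hi.image (hg.injOn.mono (cl_le hN))

theorem Mon.exists_eqv_notMem (H : Mon L M κ μ) (hN : #N ≤ μ) (hNi : (cl N).Infinite) {b : M}
    (hb : b ∉ cl N) (hP : #P ≤ μ) : ∃ b', Eqv L N b b' ∧ FS L {b'} (P ∪ N) N ∧ b' ∉ cl (P ∪ N) := by
  obtain ⟨w, h1, h2⟩ := H.exists_coheir (ι := PUnit.{u + 1}) H.small_fin (w := fun _ => b)
    ((H.EC_of_infinite hNi).fs hNi.nonempty _) hN hP
  have hr : Set.range w = {w ⟨⟩} := by
    ext x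
    exact ⟨fun ⟨y, hy⟩ => hy.symm, fun hx => ⟨⟨⟩, hx.symm⟩⟩
  rw [hr] at h2
  have h3 : Eqv L N b (w ⟨⟩) := h1
  refine ⟨w ⟨⟩, h3, h2, fun hw => hb (h3.symm.mem_cl ?_)⟩
  exact h2.mem (Set.subset_union_right.trans (subset_cl _)) (QFree.mem_cl (.inr rfl)) hw

/-- Good elements exist over some countable set. -/
theorem Mon.exists_good (H : Mon L M κ μ) (hX : X.Countable) (hXi : (cl X).Infinite) :
    ∃ N b, X ⊆ N ∧ N.Countable ∧ Good L N b := by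
  classical
  have hne := H.nonempty
  by_contra hn
  push Not at hn
  have hbad : ∀ N : Set M, X ⊆ N → N.Countable → ∀ b ∉ cl N, ∃ G : Set M, G.Countable ∧
      b ∉ cl (N ∪ G) ∧ ¬ FS L {b} (N ∪ G) N := by
    intro N hXN hN b hb
    have hNi : (cl N).Infinite := hXi.mono (cl_mono hXN)
    have h1 := hn N b hXN hN
    simp only [Good, not_and, not_forall] at h1
    obtain ⟨F, hF, b', he, hb', hf⟩ := h1 hb
    obtain ⟨g, h2, h3, h4⟩ := H.move (H.small_countable hN) hNi he.symm H.small_fin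
      (H.small_finite hF)
    have hgb : g b' = b := h4 ⟨⟩
    have hgN : g '' N = N := (Set.image_congr h3).trans (Set.image_id' N)
    have s1 : N ⊆ cl (N ∪ Set.range (fun _ : PUnit.{u + 1} => b') ∪ F) :=
      (Set.subset_union_left.trans Set.subset_union_left).trans (subset_cl _)
    have s2 : F ⊆ cl (N ∪ Set.range (fun _ : PUnit.{u + 1} => b') ∪ F) :=
      Set.subset_union_right.trans (subset_cl _)
    have s3 : b' ∈ cl (N ∪ Set.range (fun _ : PUnit.{u + 1} => b') ∪ F) :=
      QFree.mem_cl (.inl (.inr ⟨⟨⟩, rfl⟩))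
    refine ⟨g '' F, hF.countable.image _, fun hm => hb' ?_, fun hm => hf ?_⟩
    · rw [← h2.mem_cl_iff (Set.union_subset s1 s2) s3, Set.image_union, hgN, hgb]
      exact hm
    · rw [← h2.fs_iff (Set.singleton_subset_iff.2 s3) (Set.union_subset s1 s2) s1,
        Set.image_union, Set.image_singleton, hgb, hgN]
      exact hm
  obtain ⟨f, hf⟩ : ∃ f : Om.{u} → Set M × M × M, ∀ ν, (f ν).1.Countable ∧ (f ν).2.1 ∈ (f ν).1 ∧
      (∀ ν' < ν, Eqv L (Nn X (fun ν => (f ν).1) ν' ∪ (f ν').1) (f ν').2.2 (f ν).2.1) ∧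
      Eqv L (Nn X (fun ν => (f ν).1) ν) (f ν).2.1 (f ν).2.2 ∧
      (f ν).2.2 ∉ cl (Nn X (fun ν => (f ν).1) ν ∪ (f ν).1) ∧
      ¬ FS L {(f ν).2.2} (Nn X (fun ν => (f ν).1) ν ∪ (f ν).1) (Nn X (fun ν => (f ν).1) ν) := by
    refine exists_wf_rec (· < ·) wellFounded_lt (fun ν (f : Om.{u} → Set M × M × M)
      (x : Set M × M × M) => x.1.Countable ∧ x.2.1 ∈ x.1 ∧
      (∀ ν' < ν, Eqv L (Nn X (fun ν => (f ν).1) ν' ∪ (f ν').1) (f ν').2.2 x.2.1) ∧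
      Eqv L (Nn X (fun ν => (f ν).1) ν) x.2.1 x.2.2 ∧
      x.2.2 ∉ cl (Nn X (fun ν => (f ν).1) ν ∪ x.1) ∧
      ¬ FS L {x.2.2} (Nn X (fun ν => (f ν).1) ν ∪ x.1) (Nn X (fun ν => (f ν).1) ν)) ?_ ?_
    · rintro ν f f' x hf ⟨h1, h2, h3, h4, h5, h6⟩
      have e : ∀ ν' ≤ ν, Nn X (fun ν => (f ν).1) ν' = Nn X (fun ν => (f' ν).1) ν' :=
        fun ν' hν' => Nn_congr fun ν'' h => by rw [hf ν'' (lt_of_lt_of_le h hν')]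
      rw [e ν le_rfl] at h4 h5 h6
      refine ⟨h1, h2, fun ν' hν' => ?_, h4, h5, h6⟩
      rw [← e ν' hν'.le, ← hf ν' hν']
      exact h3 ν' hν'
    · intro ν f hf
      obtain ⟨G, hG⟩ : ∃ G : Om.{u} → Set M, G = fun ν => (f ν).1 := ⟨_, rfl⟩
      rw [← hG] at hf ⊢
      have hGf : ∀ ν, G ν = (f ν).1 := fun ν => by rw [hG]
      have hNc : (Nn X G ν).Countable := hX.union ((Om.countable_Iio ν).biUnion fun ν' h => by
        rw [hGf]
        exact (hf ν' h).1)
      have hXN : X ⊆ Nn X G ν := subset_Nn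
      have hNi : (cl (Nn X G ν)).Infinite := hXi.mono (cl_mono hXN)
      obtain ⟨y, hy1, hy2⟩ : ∃ y, (∀ ν' < ν, Eqv L (Nn X G ν' ∪ (f ν').1) (f ν').2.2 y) ∧
          y ∉ cl (Nn X G ν) := by
        by_cases hmin : ∃ ν₀, ν₀ < ν
        · obtain ⟨w, hw⟩ := H.comp PUnit.{u + 1} H.small_fin (Nn X G ν) (H.small_countable hNc)
            {A | ∃ ν' < ν, QF L (Nn X G ν' ∪ (f ν').1) PUnit A ∧ (fun _ => (f ν').2.2) ∈ A} (by
              rintro A ⟨ν', hν', h1, h2⟩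
              refine h1.mono (Set.union_subset (Nn_mono hν'.le) ?_)
              rw [← hGf]
              exact subset_Nn_of_lt hν') (by
              intro T hT hTf
              have hT' : ∀ A ∈ T, ∃ ν' < ν, QF L (Nn X G ν' ∪ (f ν').1) PUnit A ∧
                  (fun _ => (f ν').2.2) ∈ A := fun A hA => hT hA
              choose! φ h1 h2 h3 using hT'
              obtain ⟨ν₁, hν₁, hmax⟩ : ∃ ν₁ < ν, ∀ A ∈ T, φ A ≤ ν₁ := by
                obtain ⟨ν₀, hν₀⟩ := hmin
                rcases T.eq_empty_or_nonempty with rfl | hT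
                · exact ⟨ν₀, hν₀, by simp⟩
                · obtain ⟨A, hA, hA'⟩ := Set.exists_max_image T φ hTf hT
                  exact ⟨φ A, h1 A hA, hA'⟩
              refine ⟨fun _ => (f ν₁).2.2, fun A hA => ?_⟩
              rcases (hmax A hA).lt_or_eq with h4 | h4
              · have h5 := (hf ν₁ hν₁).2.2.1 (φ A) h4
                have h6 := (hf ν₁ hν₁).2.2.2.1
                have hs : Nn X G (φ A) ∪ (f (φ A)).1 ⊆ Nn X G ν₁ := by
                  refine Set.union_subset (Nn_mono h4.le) ?_
                  rw [← hGf]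
                  exact subset_Nn_of_lt h4
                exact (h5.trans (h6.mono (hs.trans (subset_cl _)))) _ (h2 A hA) (h3 A hA)
              · rw [← h4]
                exact h3 A hA)
          have hw' : ∀ ν' < ν, Eqv L (Nn X G ν' ∪ (f ν').1) (f ν').2.2 (w ⟨⟩) :=
            fun ν' hν' A hA hA' => hw A ⟨ν', hν', hA, hA'⟩
          refine ⟨w ⟨⟩, hw', fun hm => ?_⟩
          obtain ⟨F, hF, hFf, hm'⟩ := cl_finite hm
          obtain ⟨ν', hν', hF'⟩ : ∃ ν' < ν, F ⊆ Nn X G ν' ∪ (f ν').1 := by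
            have h1 : F ⊆ ⋃ ν' : Set.Iio ν, (Nn X G ν' ∪ (f ν').1) := by
              intro x hx
              rcases hF hx with h | h
              · obtain ⟨ν₀, hν₀⟩ := hmin
                exact Set.mem_iUnion.2 ⟨⟨ν₀, hν₀⟩, .inl (subset_Nn h)⟩
              · obtain ⟨ν', hν', h⟩ := Set.mem_iUnion₂.1 h
                rw [hGf] at h
                exact Set.mem_iUnion.2 ⟨⟨ν', hν'⟩, .inr h⟩
            have hnI : Nonempty (Set.Iio ν) := by
              obtain ⟨ν₀, hν₀⟩ := hmin
              exact ⟨⟨ν₀, hν₀⟩⟩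
            have hmono : Monotone fun ν' : Set.Iio ν => Nn X G ν' ∪ (f ν').1 := by
              intro ν₁ ν₂ h12
              rcases h12.lt_or_eq with h12 | rfl
              · refine subset_trans (Set.union_subset (Nn_mono h12.le) ?_) Set.subset_union_left
                rw [← hGf]
                exact subset_Nn_of_lt h12
              · exact subset_rfl
            obtain ⟨ν', h⟩ := finite_subset_directed hmono.directed_le hFf h1
            exact ⟨ν', ν'.2, h⟩
          have h2 := (hf ν' hν').2.2.2.2.1
          rw [(hw' ν' hν').mem_iff] at h2
          exact h2 (cl_mono hF' hm')
        · obtain ⟨y, hy⟩ := H.exists_notMem_cl (H.small_countable hNc)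
          exact ⟨y, fun ν' hν' => (hmin ⟨ν', hν'⟩).elim, hy⟩
      obtain ⟨z, hz1, hz2, hz3⟩ := H.exists_eqv_notMem (H.small_countable hNc) hNi hy2
        (H.small_finite (Set.finite_singleton y))
      rw [Set.union_comm] at hz2 hz3
      obtain ⟨G', hG1, hG2, hG3⟩ := hbad (Nn X G ν ∪ {y}) (hXN.trans Set.subset_union_left)
        (hNc.union (Set.countable_singleton y)) z hz3
      have e : Nn X G ν ∪ (insert y G') = Nn X G ν ∪ {y} ∪ G' := by
        rw [Set.union_assoc]
        rfl
      refine ⟨(insert y G', y, z), hG1.insert y, Set.mem_insert _ _, hy1, hz1, ?_, fun hf => hG3 ?_⟩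
      · dsimp only
        rwa [e]
      · rw [← e]
        exact hf.base (Set.subset_union_left.trans (subset_cl _))
  obtain ⟨G, hG⟩ : ∃ G : Om.{u} → Set M, G = fun ν => (f ν).1 := ⟨_, rfl⟩
  rw [← hG] at hf
  have hGf : ∀ ν, G ν = (f ν).1 := fun ν => by rw [hG]
  obtain ⟨δ, -, -, hδ⟩ := H.club hX hXi (G := G) fun ν => by rw [hGf]; exact (hf ν).1
  obtain ⟨α, hα, hF⟩ := hδ {(f δ).2.1} (Set.finite_singleton _) (Set.singleton_subset_iff.2
    (QFree.mem_cl (subset_Nall δ (by rw [hGf]; exact (hf δ).2.1))))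
  have h1 := (hf δ).2.2.1 α hα
  refine (hf α).2.2.2.2.2 ?_
  have hs : Nn X G α ∪ (f α).1 ⊆ Nn X G δ := by
    refine Set.union_subset (Nn_mono hα.le) ?_
    rw [← hGf]
    exact subset_Nn_of_lt hα
  exact h1.symm.fs (Set.subset_union_left.trans (subset_cl _)) (hF.right (hs.trans (subset_cl _)))

end Good

end QFree

namespace QFree

section Pregeometry

variable {L : FirstOrder.Language.{u, u}} {M : Type u} [L.Structure M]

local notation "cl" => clos L

variable {κ μ : Cardinal.{u}} {ι γ I : Type u} {P Q N N' S X X₀ Y B : Set M}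

theorem Good.exists_ultrafilter (H : Mon L M κ μ) {b : M} (hNi : (cl N).Infinite)
    (h : Good L N b) : ∃ V : Ultrafilter (PUnit.{u + 1} → M), tuples L PUnit.{u + 1} N ∈ V ∧ NP V ∧
      Realizes L V N (fun _ => b) ∧
      ∀ P, N ⊆ cl P → ∀ b', Eqv L N b b' → b' ∉ cl P → Realizes L V P (fun _ => b') := by
  obtain ⟨V, hV, hVb⟩ := H.exists_realizes hNi (fun _ : PUnit.{u + 1} => b)
  refine ⟨V, hV, NP.of_realizes hV hVb h.1, hVb, fun P hN b' he hb' => ?_⟩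
  have hf : FS L (Set.range fun _ : PUnit.{u + 1} => b') P N := by
    rw [Set.range_const]
    exact h.fs he hN hb'
  obtain ⟨W, hW, hpW⟩ := H.exists_realizes hNi (fun x : P => (x : M))
  intro A hA
  obtain ⟨B, hB, hAB⟩ := QF.abs (P := N) (c := fun x : P => (x : M))
    (hA.mono (Q := N ∪ Set.range fun x : P => (x : M)) (by simp))
  have h1 : A ∈ V ↔ ∀ᶠ x in V, Sum.elim (fun x : P => (x : M)) x ∈ B :=
    Filter.eventually_congr (Filter.Eventually.of_forall hAB)
  rw [h1, hAB, H.stab_iff hV hpW hB, H.fs_iff hf hN (fun i => mem_cl i.2) hW hpW hB]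
  refine Filter.eventually_congr ?_
  filter_upwards [hW] with q hq
  exact (EqT.iff he.symm (hB.inst hq)).trans (hVb _ (hB.inst hq))

theorem Good.exists_gs (H : Mon L M κ μ) {b : M} (hNi : (cl N).Infinite) (h : Good L N b) :
    ∃ V : Ultrafilter (PUnit.{u + 1} → M), tuples L PUnit.{u + 1} N ∈ V ∧ NP V ∧
      Realizes L V N (fun _ => b) ∧ ∀ P, N ⊆ cl P → ∀ (I : Type u) [LinearOrder I] (c : I → M),
        (∀ i, Eqv L N b (c i)) → (∀ i, c i ∉ cl (P ∪ c '' {j | j < i})) → GS L V P (single c) := by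
  obtain ⟨V, h1, h2, h3, h4⟩ := h.exists_ultrafilter H hNi
  refine ⟨V, h1, h2, h3, fun P hN I _ c hc hcP i => ?_⟩
  rw [im_single]
  exact h4 _ (hN.trans (cl_mono Set.subset_union_left)) _ (hc i) (hcP i)

theorem Good.seq_eqT (H : Mon L M κ μ) {b : M} (hNi : (cl N).Infinite) (h : Good L N b)
    [LinearOrder I] {c c' : I → M} (hN : N ⊆ cl P) (hc : ∀ i, Eqv L N b (c i))
    (hcP : ∀ i, c i ∉ cl (P ∪ c '' {j | j < i})) (hc' : ∀ i, Eqv L N b (c' i))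
    (hcP' : ∀ i, c' i ∉ cl (P ∪ c' '' {j | j < i})) : EqT L P c c' := by
  obtain ⟨V, h1, h2, h3, h4⟩ := h.exists_gs H hNi
  exact ((h4 P hN I c hc hcP).unique (h4 P hN I c' hc' hcP') h1 hN (σ := id) (σ' := id)
    strictMono_id strictMono_id).reindex (fun i => (i, ⟨⟩))

theorem Good.seq_indep (H : Mon L M κ μ) {b : M} (hNi : (cl N).Infinite) (h : Good L N b)
    [LinearOrder I] {c : I → M} (hN : N ⊆ cl P) (hc : ∀ i, Eqv L N b (c i))
    (hcP : ∀ i, c i ∉ cl (P ∪ c '' {j | j < i})) :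
    Function.Injective c ∧ Indep L P (Set.range c) := by
  obtain ⟨V, h1, h2, h3, h4⟩ := h.exists_gs H hNi
  exact ⟨GS.injective h2 (h4 P hN I c hc hcP) h1 hN, GS.indep h2 (h4 P hN I c hc hcP) h1 hN⟩

theorem Indep.notMem_image (hB : Indep L P B) {c : γ → M} (hc : Function.Injective c)
    (hcB : ∀ i, c i ∈ B) {D : Set γ} {i : γ} (hi : i ∉ D) : c i ∉ cl (P ∪ c '' D) := by
  refine fun hm => hB (c i) (hcB i) (cl_mono (Set.union_subset_union_right _ ?_) hm)
  rintro _ ⟨j, hj, rfl⟩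
  exact ⟨hcB j, fun e => hi (hc e ▸ hj)⟩

theorem Good.indep_eqT (H : Mon L M κ μ) {b : M} (hNi : (cl N).Infinite) (h : Good L N b)
    {c c' : I → M} (hN : N ⊆ cl P) (hc : ∀ i, Eqv L N b (c i)) (hci : Function.Injective c)
    (hcP : Indep L P (Set.range c)) (hc' : ∀ i, Eqv L N b (c' i)) (hci' : Function.Injective c')
    (hcP' : Indep L P (Set.range c')) : EqT L P c c' := by
  classical
  let _ : LinearOrder I := linearOrderOfSTO WellOrderingRel
  exact h.seq_eqT H hNi hN hc
    (fun i => hcP.notMem_image hci (fun j => ⟨j, rfl⟩) fun h : i < i => lt_irrefl _ h) hc'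
    (fun i => hcP'.notMem_image hci' (fun j => ⟨j, rfl⟩) fun h : i < i => lt_irrefl _ h)

theorem Good.exists_seq (H : Mon L M κ μ) {b : M} (hNi : (cl N).Infinite) (h : Good L N b)
    (hN : N ⊆ cl P) (hP : #P ≤ μ) (I : Type u) (hI : #I ≤ μ) :
    ∃ c : I → M, (∀ i, Eqv L N b (c i)) ∧ Function.Injective c ∧ Indep L P (Set.range c) := by
  classical
  let _ : LinearOrder I := linearOrderOfSTO WellOrderingRel
  obtain ⟨V, h1, h2, h3, h4⟩ := h.exists_ultrafilter H hNi
  obtain ⟨a, ha⟩ := H.exists_GS H.small_fin hI hP h1 hN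
  have ha' : a = single fun i => a i ⟨⟩ := rfl
  rw [ha'] at ha
  refine ⟨fun i => a i ⟨⟩, fun i => ?_, GS.injective h2 ha h1 hN, GS.indep h2 ha h1 hN⟩
  exact h3.eqT ((ha i).mono (hN.trans (cl_mono Set.subset_union_left)))

theorem Indep.insert (H : Mon L M κ μ) (hNi : (cl N).Infinite) (hN : N ⊆ cl P) (hB : Indep L P B)
    {y : M} (hy : Good L N y) (hyB : y ∉ cl (P ∪ B)) : Indep L P (insert y B) := by
  have hyB' : y ∉ B := fun h => hyB (mem_cl (.inr h))
  rintro b (rfl | hb) hm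
  · refine hyB (cl_mono (Set.union_subset_union_right _ ?_) hm)
    rintro x ⟨rfl | hx, hx'⟩
    · exact (hx' rfl).elim
    · exact hx
  · have hyb : y ≠ b := fun e => hyB' (e ▸ hb)
    have h1 : y ∉ cl (P ∪ B \ {b}) := fun h =>
      hyB (cl_mono (Set.union_subset_union_right _ Set.sdiff_subset) h)
    have h2 : b ∈ cl (P ∪ B \ {b} ∪ {y}) := by
      refine cl_mono ?_ hm
      rintro x (hx | ⟨rfl | hx, hx'⟩)
      · exact .inl (.inl hx)
      · exact .inr rfl
      · exact .inl (.inr ⟨hx, hx'⟩)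
    have h3 := (hy.up (hN.trans (cl_mono Set.subset_union_left)) h1).exchange H
      (hNi.mono (cl_le (hN.trans (cl_mono Set.subset_union_left)))) h2 (hB b hb)
    refine hyB (cl_mono ?_ h3)
    rintro x ((hx | hx) | rfl)
    · exact .inl hx
    · exact .inr hx.1
    · exact .inr hb

theorem exists_maximal_indep (H : Mon L M κ μ) (hNi : (cl N).Infinite) (hN : N ⊆ cl P) {E : Set M}
    (hE : ∀ z ∈ E, Good L N z ∨ z ∈ cl P) : ∃ B ⊆ E, Indep L P B ∧ E ⊆ cl (P ∪ B) := by
  obtain ⟨B, hB⟩ := zorn_subset {B | B ⊆ E ∧ Indep L P B} (by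
    intro C hC hch
    refine ⟨⋃₀ C, ⟨Set.sUnion_subset fun B hB => (hC hB).1, ?_⟩, fun B hB =>
      Set.subset_sUnion_of_mem hB⟩
    rintro b ⟨B, hB, hb⟩ hm
    obtain ⟨F, h1, h2, h3⟩ := cl_finite_union (Set.finite_singleton b)
      (Set.singleton_subset_iff.2 hm)
    have h4 : ∃ B' ∈ C, insert b F ⊆ B' := by
      have : Nonempty C := ⟨⟨B, hB⟩⟩
      obtain ⟨B', h⟩ := finite_subset_directed (F := fun B : C => (B : Set M))
        hch.directed (h2.insert b) (by
          rw [← Set.sUnion_eq_iUnion]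
          exact Set.insert_subset ⟨B, hB, hb⟩ (h1.trans Set.sdiff_subset))
      exact ⟨B', B'.2, h⟩
    obtain ⟨B', hB', h5⟩ := h4
    refine (hC hB').2 b (h5 (.inl rfl)) (cl_mono (Set.union_subset_union_right _ ?_) (h3 rfl))
    exact fun x hx => ⟨h5 (.inr hx), (h1 hx).2⟩)
  refine ⟨B, hB.prop.1, hB.prop.2, fun z hz => ?_⟩
  by_contra hn
  rcases hE z hz with h | h
  · have h1 := hB.le_of_ge (y := insert z B) ⟨Set.insert_subset hz hB.prop.1,
      hB.prop.2.insert H hNi hN h hn⟩ (Set.subset_insert z B)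
    exact hn (mem_cl (.inr (h1 (.inl rfl))))
  · exact hn (cl_mono Set.subset_union_left h)

theorem exists_exchange (H : Mon L M κ μ) (hNi : (cl N).Infinite) (F : Finset M)
    (hN : N ⊆ cl P) (hF : ∀ z ∈ F, Good L N z ∨ z ∈ cl P) {y : M} (hy : y ∈ cl (P ∪ F))
    (hyP : y ∉ cl P) : ∃ z ∈ F, z ∈ cl (P ∪ {y} ∪ (F : Set M) \ {z}) := by
  classical
  induction F using Finset.induction_on with
  | empty => exact (hyP (by simpa using hy)).elim
  | @insert z F hz ih =>
    by_cases hyF : y ∈ cl (P ∪ F)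
    · obtain ⟨z', h1, h2⟩ := ih (fun z h => hF z (Finset.mem_insert_of_mem h)) hyF
      refine ⟨z', Finset.mem_insert_of_mem h1, cl_mono (Set.union_subset_union_right _ ?_) h2⟩
      exact Set.sdiff_subset_sdiff_left (by simp)
    · have h1 : z ∉ cl (P ∪ F) := by
        intro h
        refine hyF (cl_le ?_ hy)
        rintro x (hx | hx)
        · exact mem_cl (.inl hx)
        · rcases Finset.mem_insert.1 hx with rfl | hx
          · exact h
          · exact mem_cl (.inr hx)
      have h2 : Good L N z := (hF z (Finset.mem_insert_self _ _)).resolve_right fun h =>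
        h1 (cl_mono Set.subset_union_left h)
      have h3 := (h2.up (hN.trans (cl_mono Set.subset_union_left)) h1).exchange (z := y) H
        (hNi.mono (cl_le (hN.trans (cl_mono Set.subset_union_left)))) (by
          refine cl_mono ?_ hy
          rintro x (hx | hx)
          · exact .inl (.inl hx)
          · rcases Finset.mem_insert.1 hx with rfl | hx
            · exact .inr rfl
            · exact .inl (.inr hx)) hyF
      refine ⟨z, Finset.mem_insert_self _ _, cl_mono ?_ h3⟩
      rintro x ((hx | hx) | hx)
      · exact .inl (.inl hx)
      · exact .inr ⟨Finset.mem_insert_of_mem hx, fun e => hz (e ▸ hx)⟩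
      · exact .inl (.inr hx)

theorem Indep.finite_of_subset (H : Mon L M κ μ) (hNi : (cl N).Infinite) (F : Finset M)
    (hN : N ⊆ cl P) (hF : ∀ z ∈ F, Good L N z ∨ z ∈ cl P) (hB : Indep L P B)
    (hBF : B ⊆ cl (P ∪ F)) : B.Finite := by
  classical
  induction F using Finset.induction_on generalizing P B with
  | empty =>
    have : B = ∅ := by
      refine Set.eq_empty_of_forall_notMem fun b hb => hB b hb (cl_mono Set.subset_union_left ?_)
      simpa using hBF hb
    rw [this]
    exact Set.finite_empty
  | @insert z F hz ih =>
    have key : ∀ B' : Set M, B' ⊆ B → Indep L (P ∪ {z}) B' → B'.Finite := by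
      intro B' hB' h
      refine ih (hN.trans (cl_mono Set.subset_union_left)) (fun x hx => ?_) h
        (fun x hx => cl_mono ?_ (hBF (hB' hx)))
      · exact (hF x (Finset.mem_insert_of_mem hx)).imp_right
          fun h => cl_mono Set.subset_union_left h
      · rintro x (hx | hx)
        · exact .inl (.inl hx)
        · rcases Finset.mem_insert.1 hx with rfl | hx
          · exact .inl (.inr rfl)
          · exact .inr hx
    by_cases hi : Indep L (P ∪ {z}) B
    · exact key B subset_rfl hi
    · simp only [Indep, not_forall, not_not] at hi
      obtain ⟨b, hb, hbz⟩ := hi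
      have hne : ∀ R : Set M, N ⊆ cl R → P ⊆ R → ∀ b, b ∈ cl (R ∪ {z}) → b ∉ cl R →
          z ∈ cl (R ∪ {b}) := by
        intro R hR hPR b h1 h2
        have hzR : z ∉ cl R := fun h => h2 (cl_le (Set.union_subset (subset_cl R)
          (Set.singleton_subset_iff.2 h)) h1)
        have h3 : Good L N z := (hF z (Finset.mem_insert_self _ _)).resolve_right fun h =>
          hzR (cl_mono hPR h)
        exact (h3.up hR hzR).exchange H (hNi.mono (cl_le hR)) h1 h2
      have h1 : (B \ {b}).Finite := by
        refine key _ Set.sdiff_subset ?_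
        rintro b' ⟨hb', hbb'⟩ hm
        have h2 := hne (P ∪ (B \ {b}) \ {b'}) (hN.trans (cl_mono Set.subset_union_left))
          Set.subset_union_left b' (by rwa [Set.union_right_comm]) fun h => by
            refine hB b' hb' (cl_mono (Set.union_subset_union_right _ ?_) h)
            exact Set.sdiff_subset_sdiff_left Set.sdiff_subset
        have h3 : z ∈ cl (P ∪ B \ {b}) := by
          refine cl_mono ?_ h2
          rintro x ((hx | hx) | rfl)
          · exact .inl hx
          · exact .inr hx.1
          · exact .inr ⟨hb', hbb'⟩
        refine hB b hb (cl_le ?_ hbz)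
        rintro x ((hx | hx) | hx)
        · exact mem_cl (.inl hx)
        · exact hx ▸ h3
        · exact mem_cl (.inr hx)
      exact (h1.insert b).subset fun x hx => by
        by_cases e : x = b
        · exact .inl e
        · exact .inr ⟨hx, e⟩

end Pregeometry

end QFree

namespace QFree

section Internal

variable {L : FirstOrder.Language.{u, u}} {M : Type u} [L.Structure M]

local notation "cl" => clos L

variable {κ μ : Cardinal.{u}} {ι γ I : Type u} {P Q N N' S X X₀ Y B : Set M}

theorem Indep.exists_finite_sdiff (H : Mon L M κ μ) (hNi : (cl N).Infinite) (hN : N ⊆ cl P)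
    {E : Set M} (hE : Indep L P E) (hEg : ∀ z ∈ E, Good L N z) (F : Finset M)
    (hF : ∀ z ∈ F, Good L N z ∨ z ∈ cl P) {FA : Set M} (hFA : FA.Finite) (hFAE : FA ⊆ E) :
    ∃ F₀ : Set M, F₀.Finite ∧ FA ⊆ F₀ ∧ F₀ ⊆ E ∧ Indep L (P ∪ F₀ ∪ F) (E \ F₀) := by
  obtain ⟨E₁, h1, h2, h3⟩ := exists_maximal_indep H hNi (P := P ∪ F) (E := E)
    (hN.trans (cl_mono Set.subset_union_left)) fun z hz => .inl (hEg z hz)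
  have h4 : (E \ E₁).Finite := by
    refine Indep.finite_of_subset H hNi F (P := P ∪ E₁) (hN.trans (cl_mono Set.subset_union_left))
      (fun z hz => (hF z hz).imp_right fun h => cl_mono Set.subset_union_left h) ?_ ?_
    · rintro b ⟨hb, hb1⟩ hm
      refine hE b hb (cl_mono ?_ hm)
      rintro x ((hx | hx) | hx)
      · exact .inl hx
      · exact .inr ⟨h1 hx, fun e => hb1 (e ▸ hx)⟩
      · exact .inr ⟨hx.1.1, hx.2⟩
    · rw [Set.union_right_comm]
      exact Set.sdiff_subset.trans h3
  obtain ⟨E₂, h5, h6, h7⟩ := cl_finite_union h4 (Set.sdiff_subset.trans h3)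
  refine ⟨E \ E₁ ∪ E₂ ∪ FA, (h4.union h6).union hFA, Set.subset_union_right,
    Set.union_subset (Set.union_subset Set.sdiff_subset (h5.trans h1)) hFAE, ?_⟩
  rintro e ⟨he, he'⟩ hm
  have he1 : e ∈ E₁ := by
    by_contra hn
    exact he' (.inl (.inl ⟨he, hn⟩))
  have key : ∀ x ∈ E, x ≠ e → x ∈ cl (P ∪ F ∪ E₁ \ {e}) := by
    intro x hx hxe
    by_cases hx1 : x ∈ E₁
    · exact mem_cl (.inr ⟨hx1, hxe⟩)
    · refine cl_mono (Set.union_subset_union_right _ ?_) (h7 ⟨hx, hx1⟩)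
      exact fun z hz => ⟨h5 hz, fun e' => he' (.inl (.inr (e' ▸ hz)))⟩
  refine h2 e he1 (cl_le ?_ hm)
  rintro x (((hx | ((hx | hx) | hx)) | hx) | hx)
  · exact mem_cl (.inl (.inl hx))
  · exact key x hx.1 fun e' => hx.2 (e' ▸ he1)
  · exact mem_cl (.inr ⟨h5 hx, fun e' => he' (.inl (.inr (e' ▸ hx)))⟩)
  · exact key x (hFAE hx) fun e' => he' (.inr (e' ▸ hx))
  · exact mem_cl (.inl (.inr hx))
  · exact key x hx.1.1 hx.2

/-- An element in the closure of realizations of a good type over a base containing an infinite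
independent set is in the closure of the realizations that it generates. -/
theorem Good.nvp_in (H : Mon L M κ μ) (hSi : (cl S).Infinite) {b y : M} (h : Good L S b)
    {E : Set M} (hE : ∀ x ∈ E, Eqv L S b x) (hEi : E.Infinite) (hEI : Indep L S E) (F : Finset M)
    (hF : ∀ x ∈ F, Eqv L S b x) (hy : y ∈ cl (S ∪ E ∪ F)) :
    y ∈ cl (S ∪ E ∪ ({x | Eqv L S b x} ∩ cl (S ∪ E ∪ {y}))) := by
  classical
  by_contra hn
  obtain ⟨QY, hQY⟩ : ∃ QY, QY = {x | Eqv L S b x} ∩ cl (S ∪ E ∪ {y}) := ⟨_, rfl⟩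
  rw [← hQY] at hn
  have hS : ∀ {R : Set M}, S ⊆ R → S ⊆ cl R := fun h => h.trans (subset_cl _)
  have hQYcl : QY ⊆ cl (S ∪ E ∪ F) := by
    rw [hQY]
    refine Set.inter_subset_right.trans (cl_le (Set.union_subset ?_ ?_))
    · exact Set.subset_union_left.trans (subset_cl _)
    · exact Set.singleton_subset_iff.2 hy
  have hQYg : ∀ z ∈ QY, Eqv L S b z := by
    rw [hQY]
    exact fun z hz => hz.1
  -- a basis of the realizations generated by `y`
  obtain ⟨Z, hZ1, hZ2, hZ3⟩ := exists_maximal_indep H hSi (P := S ∪ E) (E := QY)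
    (hS Set.subset_union_left) fun z hz => .inl (h.eqv (hQYg z hz))
  have hZf : Z.Finite := hZ2.finite_of_subset H hSi F (hS Set.subset_union_left)
    (fun z hz => .inl (h.eqv (hF z hz))) (hZ1.trans hQYcl)
  -- a minimal dependence
  obtain ⟨F₁, hF1, hF2, hF3⟩ := exists_maximal_indep H hSi (P := S ∪ E ∪ QY) (E := (F : Set M))
    (hS (Set.subset_union_left.trans Set.subset_union_left)) fun z hz => .inl (h.eqv (hF z hz))
  have hF1f : F₁.Finite := F.finite_toSet.subset hF1
  obtain ⟨G, ⟨hG1, z, hz, hzG, hzcl⟩, hGmin⟩ := WellFounded.has_min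
    (wellFounded_lt (α := Finset M)) {G : Finset M | (G : Set M) ⊆ F₁ ∧ ∃ z ∈ F₁, z ∉ G ∧
      z ∈ cl (S ∪ E ∪ QY ∪ {y} ∪ G)} (by
    obtain ⟨z, h1, h2⟩ := exists_exchange H hSi hF1f.toFinset (P := S ∪ E ∪ QY) (y := y)
      (hS (Set.subset_union_left.trans Set.subset_union_left))
      (fun z hz => .inl (h.eqv (hF z (hF1 (hF1f.mem_toFinset.1 hz))))) (by
        rw [hF1f.coe_toFinset]
        refine cl_le (Set.union_subset ?_ hF3) hy
        exact (Set.subset_union_left.trans Set.subset_union_left).trans (subset_cl _)) hn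
    refine ⟨hF1f.toFinset.erase z, fun x hx => ?_, z, hF1f.mem_toFinset.1 h1,
      Finset.notMem_erase _ _, ?_⟩
    · exact hF1f.mem_toFinset.1 (Finset.mem_of_mem_erase hx)
    · rwa [Finset.coe_erase])
  have hGI : Indep L (S ∪ E ∪ QY ∪ {y}) G := by
    intro g hg hm
    refine hGmin (G.erase g) ⟨fun x hx => hG1 (Finset.mem_of_mem_erase hx), g, hG1 hg,
      Finset.notMem_erase _ _, by rwa [Finset.coe_erase]⟩ (Finset.erase_ssubset hg)
  have hGQ : ∀ x ∈ G, Eqv L S b x := fun x hx => hF x (hF1 (hG1 hx))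
  have hzcl' : z ∈ cl (S ∪ Z ∪ {y} ∪ G ∪ E) := by
    refine cl_le ?_ hzcl
    rintro x ((((hx | hx) | hx) | hx) | hx)
    · exact mem_cl (.inl (.inl (.inl (.inl hx))))
    · exact mem_cl (.inr hx)
    · refine cl_mono ?_ (hZ3 hx)
      rintro x ((hx | hx) | hx)
      · exact .inl (.inl (.inl (.inl hx)))
      · exact .inr hx
      · exact .inl (.inl (.inl (.inr hx)))
    · exact mem_cl (.inl (.inl (.inr hx)))
    · exact mem_cl (.inl (.inr hx))
  obtain ⟨A₁, hA1, hA1f, hzA⟩ := cl_finite_union (Set.finite_singleton z)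
    (Set.singleton_subset_iff.2 hzcl')
  rw [Set.union_right_comm] at hy
  obtain ⟨A₂, hA2, hA2f, hyA⟩ := cl_finite_union (Set.finite_singleton y)
    (Set.singleton_subset_iff.2 hy)
  have hZcl : Z ⊆ cl (S ∪ {y} ∪ E) := by
    rw [Set.union_right_comm]
    exact hZ1.trans (by rw [hQY]; exact Set.inter_subset_right)
  obtain ⟨A₃, hA3, hA3f, hZA⟩ := cl_finite_union hZf hZcl
  have hzA : z ∈ cl (S ∪ Z ∪ {y} ∪ G ∪ A₁) := hzA rfl
  have hyA : y ∈ cl (S ∪ F ∪ A₂) := hyA rfl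
  obtain ⟨F₀, hF0f, hAF, hF0E, hF0I⟩ := hEI.exists_finite_sdiff H hSi (subset_cl S)
    (fun z hz => h.eqv (hE z hz)) F (fun z hz => .inl (h.eqv (hF z hz)))
    ((hA1f.union hA2f).union hA3f) (Set.union_subset (Set.union_subset hA1 hA2) hA3)
  have hAF1 : A₁ ⊆ F₀ := (Set.subset_union_left.trans Set.subset_union_left).trans hAF
  have hAF2 : A₂ ⊆ F₀ := (Set.subset_union_right.trans Set.subset_union_left).trans hAF
  have hAF3 : A₃ ⊆ F₀ := Set.subset_union_right.trans hAF
  obtain ⟨R, hR⟩ : ∃ R, R = S ∪ F₀ ∪ Z := ⟨_, rfl⟩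
  have hSR : S ⊆ cl R := by
    rw [hR]
    exact (Set.subset_union_left.trans Set.subset_union_left).trans (subset_cl _)
  have hyF : y ∈ cl (S ∪ F₀ ∪ F) := by
    refine cl_mono ?_ hyA
    rintro x ((hx | hx) | hx)
    · exact .inl (.inl hx)
    · exact .inr hx
    · exact .inl (.inr (hAF2 hx))
  have hRF : R ∪ {y} ⊆ cl (S ∪ F₀ ∪ F) := by
    rw [hR]
    rintro x ((hx | hx) | rfl)
    · exact mem_cl (.inl hx)
    · refine cl_le ?_ (hZA hx)
      rintro x ((hx | rfl) | hx)
      · exact mem_cl (.inl (.inl hx))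
      · exact hyF
      · exact mem_cl (.inl (.inr (hAF3 hx)))
    · exact hyF
  have hE1 : Indep L (R ∪ {y}) (E \ F₀) := hF0I.mono subset_rfl hRF
  -- fresh elements
  have hE1i : Infinite (E \ F₀ : Set M) := (hEi.sdiff hF0f).to_subtype
  obtain ⟨u⟩ : Nonempty ((G : Set M) ↪ (E \ F₀ : Set M)) := by
    rw [← Cardinal.le_def]
    exact (mk_le_aleph0 (α := (G : Set M))).trans (aleph0_le_mk _)
  have hRY : R ⊆ cl (S ∪ E ∪ {y}) := by
    rw [hR]
    rintro x ((hx | hx) | hx)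
    · exact mem_cl (.inl (.inl hx))
    · exact mem_cl (.inl (.inr (hF0E hx)))
    · have := hZ1 hx
      rw [hQY] at this
      exact this.2
  have hRyG : R ∪ {y} ⊆ cl (S ∪ E ∪ QY ∪ {y}) := by
    refine Set.union_subset (hRY.trans (cl_mono ?_)) (Set.subset_union_right.trans (subset_cl _))
    exact Set.union_subset_union_left _ Set.subset_union_left
  have hgu : EqT L (R ∪ {y}) (fun g : (G : Set M) => (g : M)) (fun g => (u g : M)) := by
    refine h.indep_eqT H hSi (hSR.trans (cl_mono Set.subset_union_left)) (fun g => hGQ _ g.2)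
      Subtype.val_injective ?_ (fun g => hE _ (u g).2.1)
      (Subtype.val_injective.comp u.injective) ?_
    · rw [Subtype.range_coe]
      exact hGI.mono subset_rfl hRyG
    · refine hE1.mono ?_ (subset_cl _)
      rintro _ ⟨g, rfl⟩
      exact (u g).2
  obtain ⟨f, hf, hfz⟩ := exists_TF (L := L) (P := R ∪ {y}) (c := fun g : (G : Set M) => (g : M))
    (y := z) (by
      rw [Subtype.range_coe]
      refine cl_mono ?_ hzA
      rw [hR]
      rintro x ((((hx | hx) | hx) | hx) | hx)
      · exact .inl (.inl (.inl (.inl hx)))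
      · exact .inl (.inl (.inr hx))
      · exact .inl (.inr hx)
      · exact .inr hx
      · exact .inl (.inl (.inl (.inr (hAF1 hx)))))
  obtain ⟨z', hz'⟩ : ∃ z', z' = f fun g => (u g : M) := ⟨_, rfl⟩
  have hz'U : z' ∈ cl (R ∪ {y} ∪ Set.range fun g => (u g : M)) := by
    rw [hz']
    exact hf.mem_cl (Set.subset_union_left.trans (subset_cl _)) fun g => QFree.mem_cl (.inr ⟨g, rfl⟩)
  have hUE : (Set.range fun g => (u g : M)) ⊆ E \ F₀ := by
    rintro _ ⟨g, rfl⟩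
    exact (u g).2
  have hz'Q : z' ∈ QY := by
    rw [hQY]
    constructor
    · refine (hF z (hF1 hz)).trans ?_
      have := (hgu.comp (α := PUnit.{u + 1}) (f := fun _ => f) fun _ => hf).mono (P := S)
        (hSR.trans (cl_mono Set.subset_union_left))
      rwa [← hz', hfz] at this
    · refine cl_le ?_ hz'U
      rintro x ((hx | hx) | hx)
      · exact hRY hx
      · exact QFree.mem_cl (.inr hx)
      · exact QFree.mem_cl (.inl (.inr (hUE hx).1))
  have hz'R : z' ∈ cl (R ∪ (Set.range fun g => (u g : M)) ∪ (E \ F₀)) := by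
    refine cl_mono ?_ (hZ3 hz'Q)
    rw [hR]
    rintro x ((hx | hx) | hx)
    · exact .inl (.inl (.inl (.inl hx)))
    · by_cases hx0 : x ∈ F₀
      · exact .inl (.inl (.inl (.inr hx0)))
      · exact .inr ⟨hx, hx0⟩
    · exact .inl (.inl (.inr hx))
  have hz'u : z' ∈ cl (R ∪ Set.range fun g => (u g : M)) := by
    by_contra hnu
    obtain ⟨E₂, hE2, hE2f, hzE⟩ := cl_finite_union (Set.finite_singleton z')
      (Set.singleton_subset_iff.2 hz'R)
    have hSRu : S ⊆ cl (R ∪ Set.range fun g => (u g : M)) :=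
      hSR.trans (cl_mono Set.subset_union_left)
    obtain ⟨e, he, hee⟩ := exists_exchange H hSi
      (hE2f.subset (Set.sdiff_subset (s := E₂) (t := Set.range fun g => (u g : M)))).toFinset hSRu
      (fun e he => .inl (h.eqv (hE e (hE2 ((Set.Finite.mem_toFinset _).1 he).1).1))) (by
        rw [Set.Finite.coe_toFinset]
        refine cl_mono ?_ (hzE rfl)
        rintro x (hx | hx)
        · exact .inl hx
        · by_cases hxu : x ∈ Set.range fun g => (u g : M)
          · exact .inl (.inr hxu)
          · exact .inr ⟨hx, hxu⟩) hnu
    rw [Set.Finite.mem_toFinset] at he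
    rw [Set.Finite.coe_toFinset] at hee
    refine hE1 e (hE2 he.1) (cl_le ?_ hee)
    have hu' : (Set.range fun g => (u g : M)) ⊆ cl (R ∪ {y} ∪ (E \ F₀) \ {e}) := fun x hx =>
      QFree.mem_cl (.inr ⟨hUE hx, fun e' => he.2 (e' ▸ hx)⟩)
    rintro x (((hx | hx) | hx) | hx)
    · exact QFree.mem_cl (.inl (.inl hx))
    · exact hu' hx
    · rw [Set.mem_singleton_iff.1 hx]
      refine cl_le (Set.union_subset ?_ hu') hz'U
      exact Set.subset_union_left.trans (subset_cl _)
    · exact QFree.mem_cl (.inr ⟨hE2 hx.1.1, hx.2⟩)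
  obtain ⟨k, hk, hkz⟩ := exists_TF hz'u
  have hzk : z = k fun g : (G : Set M) => (g : M) := by
    rw [← hfz]
    refine hgu.symm.tf_eq hf (hk.mono Set.subset_union_left) ?_
    rw [← hz', hkz]
  refine hF2 z hz ?_
  have hzRG : z ∈ cl (R ∪ G) := by
    rw [hzk]
    exact hk.mem_cl (Set.subset_union_left.trans (subset_cl _)) fun g => QFree.mem_cl (.inr g.2)
  refine cl_le ?_ hzRG
  rw [hR]
  rintro x (((hx | hx) | hx) | hx)
  · exact QFree.mem_cl (.inl (.inl (.inl hx)))
  · exact QFree.mem_cl (.inl (.inl (.inr (hF0E hx))))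
  · exact QFree.mem_cl (.inl (.inr (hZ1 hx)))
  · exact QFree.mem_cl (.inr ⟨hG1 hx, fun e => hzG (e ▸ hx)⟩)

end Internal

end QFree

namespace QFree

section Full

variable {L : FirstOrder.Language.{u, u}} {M : Type u} [L.Structure M]

local notation "cl" => clos L

variable {κ μ : Cardinal.{u}} {ι γ I : Type u} {P Q N N' S X X₀ Y B A : Set M} {b y : M}

theorem Indep.pe {g : M → M} (hg : PE L S g) (hP : P ⊆ S) (hB : B ⊆ S) (h : Indep L P B) :
    Indep L (g '' P) (g '' B) := by
  rintro _ ⟨b, hb, rfl⟩ hm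
  refine h b hb ((hg.mem_cl_iff (Set.union_subset hP (Set.sdiff_subset.trans hB)) (hB hb)).1
    (cl_mono ?_ hm))
  rw [Set.image_union]
  refine Set.union_subset_union_right _ ?_
  rintro _ ⟨⟨x, hx, rfl⟩, hxb⟩
  exact ⟨x, ⟨hx, fun e => hxb (by rw [Set.mem_singleton_iff.1 e]; rfl)⟩, rfl⟩

variable (L) in
/-- `y` is in the closure of `P` and of the realizations of the type of `b` over `S` that are in
the closure of `P` and `y`. -/
def Fl (S : Set M) (b : M) (P : Set M) (y : M) : Prop :=
  y ∈ clos L (P ∪ ({x | Eqv L S b x} ∩ clos L (P ∪ {y})))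

theorem Fl.mono (h : Fl L S b P y) (hP : P ⊆ cl Q) : Fl L S b Q y := by
  refine cl_le (Set.union_subset (hP.trans (cl_mono Set.subset_union_left)) ?_) h
  rintro x ⟨hx, hx'⟩
  refine mem_cl (.inr ⟨hx, cl_le ?_ hx'⟩)
  exact Set.union_subset (hP.trans (cl_mono Set.subset_union_left))
    (Set.subset_union_right.trans (subset_cl _))

theorem Fl.finite (h : Fl L S b (P ∪ A) y) : ∃ A₀ ⊆ A, A₀.Finite ∧ Fl L S b (P ∪ A₀) y := by
  obtain ⟨F, hF, hFf, hy⟩ := cl_finite_union (Set.finite_singleton y)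
    (Set.singleton_subset_iff.2 h)
  rw [Set.union_right_comm] at hy
  obtain ⟨A₁, h1, h1f, hy1⟩ := cl_finite_union (Set.finite_singleton y) hy
  have hF' : F ⊆ cl (P ∪ {y} ∪ A) := by
    rw [Set.union_right_comm]
    exact hF.trans Set.inter_subset_right
  obtain ⟨A₂, h2, h2f, hF2⟩ := cl_finite_union hFf hF'
  refine ⟨A₁ ∪ A₂, Set.union_subset h1 h2, h1f.union h2f, cl_mono ?_ (hy1 rfl)⟩
  rintro x ((hx | hx) | hx)
  · exact .inl (.inl hx)
  · refine .inr ⟨(hF hx).1, cl_mono ?_ (hF2 hx)⟩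
    rintro x ((hx | hx) | hx)
    · exact .inl (.inl hx)
    · exact .inr hx
    · exact .inl (.inr (.inr hx))
  · exact .inl (.inr (.inl hx))

theorem Fl.of_eqT {a a' : ι → M} (h : Fl L S b (P ∪ Set.range a) y) (hS : S ⊆ cl P)
    (he : EqT L (P ∪ {y}) a a') : Fl L S b (P ∪ Set.range a') y := by
  obtain ⟨g, h1, h2, h3⟩ := he.exists_pe
  have hP : P ⊆ cl (P ∪ {y} ∪ Set.range a) :=
    (Set.subset_union_left.trans Set.subset_union_left).trans (subset_cl _)
  have hy : y ∈ cl (P ∪ {y} ∪ Set.range a) := mem_cl (.inl (.inr rfl))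
  have ha : Set.range a ⊆ cl (P ∪ {y} ∪ Set.range a) := Set.subset_union_right.trans (subset_cl _)
  have hgy : g y = y := h2 y (.inr rfl)
  have hT : P ∪ Set.range a ∪ {y} ⊆ cl (P ∪ {y} ∪ Set.range a) :=
    Set.union_subset (Set.union_subset hP ha) (Set.singleton_subset_iff.2 hy)
  have hgP : g '' (P ∪ Set.range a) ⊆ P ∪ Set.range a' := by
    rintro _ ⟨x, hx | ⟨i, rfl⟩, rfl⟩
    · rw [h2 x (.inl hx)]
      exact .inl hx
    · rw [h3]
      exact .inr ⟨i, rfl⟩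
  have h4 := h1.mem_cl (Set.union_subset (Set.subset_union_left.trans hT)
    (Set.inter_subset_right.trans (cl_le hT))) hy h
  rw [hgy] at h4
  refine cl_mono ?_ h4
  rw [Set.image_union]
  refine Set.union_subset_union hgP ?_
  rintro _ ⟨x, ⟨hx, hx'⟩, rfl⟩
  have hxc := cl_le hT hx'
  refine ⟨?_, ?_⟩
  · have h5 : Eqv L S x (g x) :=
      (h1.eqT_self (w := fun _ : PUnit.{u + 1} => x) hP (fun x hx => h2 x (.inl hx))
        fun _ => hxc).mono hS
    exact Eqv.trans hx h5
  · have h5 := h1.mem_cl hT hxc hx'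
    refine cl_mono ?_ h5
    rw [Set.image_union, Set.image_singleton, hgy]
    exact Set.union_subset_union_left _ hgP

theorem Good.interdef (H : Mon L M κ μ) (hSi : (cl S).Infinite) {q c : M} (hq : Good L S q)
    (hb : Good L X₀ b) (hXP : X₀ ⊆ cl P) (hSP : S ⊆ cl P) (hc : Eqv L X₀ b c) (hcP : c ∉ cl P)
    (hqc : q ∈ cl (P ∪ {c})) (hqP : q ∉ cl P) (h : Fl L S q P y) : Fl L X₀ b P y := by
  have hPi : (cl P).Infinite := hSi.mono (cl_le hSP)
  have hcq : c ∈ cl (P ∪ {q}) := ((hb.eqv hc).up hXP hcP).exchange H hPi hqc hqP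
  refine cl_le (Set.union_subset (Set.subset_union_left.trans (subset_cl _)) ?_) h
  rintro q' ⟨hq', hq'y⟩
  by_cases hq'P : q' ∈ cl P
  · exact cl_mono Set.subset_union_left hq'P
  obtain ⟨g, h1, h2, h3⟩ := (hq.eqv_of H hSi (.refl q) hq' hSP hqP hq'P).exists_pe
  have h3 : g q = q' := h3 ⟨⟩
  rw [Set.range_const] at h1
  have hPq : P ⊆ cl (P ∪ {q}) := Set.subset_union_left.trans (subset_cl _)
  have hq0 : q ∈ cl (P ∪ {q}) := mem_cl (.inr rfl)
  have hgP : g '' P ⊆ P := by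
    rintro _ ⟨x, hx, rfl⟩
    rwa [h2 x hx]
  have h4 : g c ∈ cl (P ∪ {q'}) := by
    have := h1.mem_cl (Set.union_subset hPq (Set.singleton_subset_iff.2 hq0)) hcq hcq
    rw [Set.image_union, Set.image_singleton, h3] at this
    exact cl_mono (Set.union_subset_union_left _ hgP) this
  have h5 : q' ∈ cl (P ∪ {g c}) := by
    have := h1.mem_cl (Set.union_subset hPq (Set.singleton_subset_iff.2 hcq)) hq0 hqc
    rw [Set.image_union, Set.image_singleton, h3] at this
    exact cl_mono (Set.union_subset_union_left _ hgP) this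
  have h6 : Eqv L X₀ c (g c) :=
    (h1.eqT_self (w := fun _ : PUnit.{u + 1} => c) hPq h2 fun _ => hcq).mono hXP
  refine cl_mono (Set.union_subset_union_right _ (Set.singleton_subset_iff.2 ?_)) h5
  refine ⟨hc.trans h6, ?_⟩
  refine cl_le (Set.union_subset ?_ (Set.singleton_subset_iff.2 hq'y)) h4
  exact Set.subset_union_left.trans (subset_cl _)

theorem ClubStage.fl (H : Mon L M κ μ) (hX : X₀.Countable) (hXi : (cl X₀).Infinite)
    (hb : Good L X₀ b) {V : Ultrafilter (PUnit.{u + 1} → M)}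
    (hV : tuples L PUnit.{u + 1} X₀ ∈ V) (hNP : NP V) (hVb : Realizes L V X₀ fun _ => b)
    {G : Om.{u} → Set M} {a a' : II κ → M} {h : M → M} {δ : Om.{u}} {K₁ K₂ : Set (KK κ)}
    (C : ClubStage (L := L) V κ X₀ G a a' h δ K₁ K₂) (hy : y ∈ cl (Nall X₀ G)) :
    Fl L X₀ b (Nn X₀ G δ ∪ a '' blks K₁) y := by
  obtain ⟨P, hP⟩ : ∃ P, P = Nn X₀ G δ ∪ a '' blks K₁ := ⟨_, rfl⟩
  obtain ⟨S, hS⟩ : ∃ S, S = h '' X₀ := ⟨_, rfl⟩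
  obtain ⟨e, he⟩ : ∃ e : II κ → M, e = fun i => h (a' i) := ⟨_, rfl⟩
  have him : ∀ K : Set (KK κ), h '' (X₀ ∪ a' '' blks K) = S ∪ e '' blks K := by
    intro K
    rw [Set.image_union, Set.image_image, hS, he]
  have hXall : X₀ ⊆ cl (Nall X₀ G) := Set.subset_union_left.trans (subset_cl _)
  have ha'X : X₀ ∪ Set.range a' ⊆ cl (X₀ ∪ Set.range a') := subset_cl _
  have hpe' := C.pe
  have haQ : ∀ i, Eqv L X₀ b (a i) := fun i =>
    hVb.eqT ((C.gs i).mono (hXall.trans (cl_mono Set.subset_union_left)))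
  have ha'Q : ∀ i, Eqv L X₀ b (a' i) := fun i =>
    hVb.eqT ((C.gs' i).mono (Set.subset_union_left.trans (subset_cl _)))
  have hXs : #X₀ ≤ μ := H.small_countable hX
  have i₀ : II κ := mkI ⊤ 0
  have hgood : ∀ i, Good L S (e i) := by
    intro i
    rw [hS, he]
    exact (hb.eqv (ha'Q i)).pe H C.pe (Set.subset_union_left.trans ha'X)
      (QFree.mem_cl (.inr ⟨i, rfl⟩)) hXs hXi
  have hSi : (cl S).Infinite := by
    have hinj := (C.pe.mono (cl_mono Set.subset_union_left)).injOn
    have := hXi.image hinj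
    rwa [(C.pe.mono (cl_mono Set.subset_union_left)).image_cl, ← hS] at this
  have heqv : ∀ i j, Eqv L S (e i) (e j) := by
    intro i j
    rw [hS, he]
    exact C.pe.eqT_image (w := fun _ : PUnit.{u + 1} => a' i) (w' := fun _ => a' j)
      (Set.subset_union_left.trans ha'X) (fun _ => ha'X (.inr ⟨i, rfl⟩))
      (fun _ => ha'X (.inr ⟨j, rfl⟩)) ((ha'Q i).symm.trans (ha'Q j))
  have hind' : Indep L X₀ (Set.range a') := GS.indep hNP C.gs' hV (subset_cl _)
  have hinj' : Function.Injective a' := GS.injective hNP C.gs' hV (subset_cl _)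
  have hind : Indep L S (Set.range e) := by
    have := hind'.pe C.pe (Set.subset_union_left.trans ha'X) (Set.subset_union_right.trans ha'X)
    rw [← hS, ← Set.range_comp] at this
    rw [he]
    exact this
  have hinje : Function.Injective e := by
    intro i j hij
    rw [he] at hij
    exact hinj' (C.pe.injOn (ha'X (.inr ⟨i, rfl⟩)) (ha'X (.inr ⟨j, rfl⟩)) hij)
  have hall : cl (S ∪ Set.range e) = cl (Nall X₀ G ∪ Set.range a) := by
    rw [← C.img, C.pe.image_cl, Set.image_union, ← Set.range_comp, hS, he]
    rfl
  obtain ⟨E, hE⟩ : ∃ E, E = e '' blks K₂ := ⟨_, rfl⟩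
  have hEr : E ⊆ Set.range e := by
    rw [hE]
    exact Set.image_subset_range _ _
  have hEi : E.Infinite := by
    rw [hE]
    refine Set.Infinite.image hinje.injOn ?_
    refine (Set.infinite_range_of_injective (f := fun n : ℕ => (mkI ⊤ n : II κ)) ?_).mono ?_
    · intro n m hnm
      have := congrArg (fun i : II κ => (ofLex i).2) hnm
      exact this
    · rintro _ ⟨n, rfl⟩
      exact C.top
  have hPS : P ⊆ cl (S ∪ E) := by
    rw [hP, hE, ← him]
    exact C.sub
  have hSP : S ∪ E ⊆ cl P := by
    have hfin : ∀ K ⊆ K₂, K.Finite → S ∪ e '' blks K ⊆ cl P := by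
      intro K hK hKf
      obtain ⟨α, hα, h1⟩ := C.sup K hK hKf
      rw [him] at h1
      rw [hP]
      exact h1.trans (cl_mono (Set.union_subset_union_left _ (Nn_mono hα.le)))
    rintro x (hx | hx)
    · exact hfin ∅ (Set.empty_subset _) Set.finite_empty (.inl hx)
    · rw [hE] at hx
      obtain ⟨i, hi, rfl⟩ := hx
      exact hfin {blk i} (Set.singleton_subset_iff.2 hi) (Set.finite_singleton _)
        (.inr ⟨i, rfl, rfl⟩)
  -- every element is controlled by the second type
  have key : ∀ z ∈ cl (Nall X₀ G ∪ Set.range a), Fl L S (e i₀) P z := by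
    intro z hz
    rw [← hall] at hz
    obtain ⟨F, hF, hFf, hzF⟩ := cl_finite_union (Set.finite_singleton z)
      (Set.singleton_subset_iff.2 hz)
    have h1 : Fl L S (e i₀) (S ∪ E) z := by
      refine (hgood i₀).nvp_in H hSi ?_ hEi (hind.mono hEr (subset_cl _)) hFf.toFinset ?_ ?_
      · intro x hx
        obtain ⟨j, rfl⟩ := hEr hx
        exact heqv _ _
      · intro x hx
        obtain ⟨j, rfl⟩ := hF (hFf.mem_toFinset.1 hx)
        exact heqv _ _
      · rw [hFf.coe_toFinset]
        refine cl_mono (Set.union_subset_union_left _ Set.subset_union_left) (hzF rfl)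
    exact h1.mono hSP
  -- a member of the sequence which is interdefinable with a realization of the second type
  obtain ⟨i, hi⟩ : ∃ i, i ∉ blks (κ := κ) K₁ := by
    by_contra! hn
    have h1 : (Set.univ : Set (II κ)).Countable := by
      have : (⋃ β ∈ K₁, blks (κ := κ) {β}).Countable :=
        C.cK₁.biUnion fun β _ => countable_blks β
      refine this.mono fun i _ => Set.mem_iUnion₂.2 ⟨blk i, hn i, rfl⟩
    have h2 := le_aleph0_iff_set_countable.2 h1
    rw [mk_univ, mk_II H.hκ.le] at h2
    exact absurd H.hκ (not_lt.2 h2)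
  have haP : a i ∉ cl P := by
    intro hm
    refine C.gs.notMem hNP hV hXall i (cl_mono ?_ hm)
    rw [hP]
    refine Set.union_subset_union Nn_subset_Nall ?_
    rintro _ ⟨j, hj, rfl⟩
    exact ⟨j, fun e' => hi (e' ▸ hj), rfl⟩
  have hSP' : S ⊆ cl P := Set.subset_union_left.trans hSP
  have hXP : X₀ ⊆ cl P := by
    rw [hP]
    exact (subset_Nn.trans Set.subset_union_left).trans (subset_cl _)
  obtain ⟨q, hq, hqa, hqP⟩ : ∃ q, Eqv L S (e i₀) q ∧ q ∈ cl (P ∪ {a i}) ∧ q ∉ cl P := by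
    by_contra! hn
    refine haP (cl_le (Set.union_subset (subset_cl _) ?_) (key (a i)
      (QFree.mem_cl (.inr ⟨i, rfl⟩))))
    exact fun q hq => hn q hq.1 hq.2
  have hgq : Good L S q := (hgood i₀).eqv hq
  have hyq : Fl L S q P y := by
    refine cl_mono (Set.union_subset_union_right _ ?_) (key y (cl_mono Set.subset_union_left hy))
    exact fun x hx => ⟨hq.symm.trans hx.1, hx.2⟩
  rw [← hP]
  exact hgq.interdef H hSi hb hXP hSP' (haQ i) haP hqa hqP hyq


/-- The members of a chain do the same as the members of a generic sequence. -/
theorem exists_fl_stage (H : Mon L M κ μ) (hX : X₀.Countable) (hXi : (cl X₀).Infinite)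
    (hb : Good L X₀ b) {G : Om.{u} → Set M} (hG : ∀ ν, (G ν).Countable)
    (hGb : ∀ ν, ∃ x ∈ G ν, Eqv L X₀ b x ∧ x ∉ cl (Nn X₀ G ν)) :
    ∃ δ, ∀ y ∈ cl (Nall X₀ G), Fl L X₀ b (Nn X₀ G δ) y := by
  obtain ⟨V, hV, hNP, hVb, -⟩ := hb.exists_ultrafilter H hXi
  obtain ⟨a, a', h, δ, K₁, K₂, C⟩ := H.exists_clubStage hX hV hNP hG
  refine ⟨δ, fun y hy => ?_⟩
  have h1 := C.fl H hX hXi hb hV hNP hVb hy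
  have hXall : X₀ ⊆ cl (Nall X₀ G) := Set.subset_union_left.trans (subset_cl _)
  have haQ : ∀ i, Eqv L X₀ b (a i) := fun i =>
    hVb.eqT ((C.gs i).mono (hXall.trans (cl_mono Set.subset_union_left)))
  have haI : Indep L (Nall X₀ G) (Set.range a) := GS.indep hNP C.gs hV hXall
  have hainj : Function.Injective a := GS.injective hNP C.gs hV hXall
  obtain ⟨A, hA, hAf, h2⟩ := h1.finite
  have h2 : Fl L X₀ b (X₀ ∪ A ∪ Nn X₀ G δ) y := by
    refine h2.mono ((Set.union_subset ?_ ?_).trans (subset_cl _))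
    · exact Set.subset_union_right
    · exact Set.subset_union_right.trans Set.subset_union_left
  obtain ⟨N, hN, hNf, h3⟩ := h2.finite
  obtain ⟨α₁, hα₁, hNα⟩ := Nn_finite_subset C.ne C.lim hNf hN
  obtain ⟨α₂, hα₂, hfs⟩ := C.fs H.nonempty hV (Set.finite_singleton y)
    (Set.singleton_subset_iff.2 hy)
  obtain ⟨α, hα⟩ : ∃ α, α = max α₁ α₂ := ⟨_, rfl⟩
  have hαδ : α < δ := hα ▸ max_lt hα₁ hα₂
  have hfs : FS L {y} (Nn X₀ G δ) (Nn X₀ G α) :=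
    hfs.base ((Nn_mono (hα ▸ le_max_right _ _)).trans (subset_cl _))
  choose x hxG hxb hxn using hGb
  let J : Type u := {ν : Om.{u} // α ≤ ν ∧ ν < δ}
  have hJ : Infinite J := by
    have : NoMaxOrder J := ⟨fun ν => by
      obtain ⟨ν', h4, h5⟩ := C.lim ν.1 ν.2.2
      exact ⟨⟨ν', ν.2.1.trans h5.le, h4⟩, h5⟩⟩
    have : Nonempty J := ⟨⟨α, le_rfl, hαδ⟩⟩
    exact NoMaxOrder.infinite
  obtain ⟨hxi, hxI⟩ := hb.seq_indep H hXi (P := Nn X₀ G α ∪ {y}) (I := J) (c := fun ν => x ν.1)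
    ((subset_Nn.trans Set.subset_union_left).trans (subset_cl _)) (fun ν => hxb _) (by
      intro ν hm
      have hsub : Nn X₀ G α ∪ (fun ν : J => x ν.1) '' {j | j < ν} ⊆ Nn X₀ G ν.1 := by
        refine Set.union_subset (Nn_mono ν.2.1) ?_
        rintro _ ⟨j, hj, rfl⟩
        exact subset_Nn_of_lt (show j.1 < ν.1 from hj) (hxG _)
      refine hxn ν.1 (cl_mono hsub ?_)
      rw [Set.union_right_comm] at hm
      refine (hfs.base (Set.subset_union_left.trans (subset_cl _))).mem ?_ hm ?_
      · exact (hsub.trans (Nn_mono ν.2.2.le)).trans (subset_cl _)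
      · exact QFree.mem_cl (subset_Nn_of_lt ν.2.2 (hxG _)))
  have hAr : ∀ z : A, ∃ i, a i = z := fun z => by
    obtain ⟨i, -, h⟩ := hA z.2
    exact ⟨i, h⟩
  have hAf' : Finite A := hAf
  obtain ⟨u⟩ : Nonempty (A ↪ J) := by
    rw [← Cardinal.le_def]
    exact mk_le_aleph0.trans (aleph0_le_mk _)
  have heq : EqT L (Nn X₀ G α ∪ {y}) (fun z : A => (z : M)) (fun z => x (u z).1) := by
    refine hb.indep_eqT H hXi ((subset_Nn.trans Set.subset_union_left).trans (subset_cl _)) ?_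
      Subtype.val_injective ?_ (fun z => hxb _) (hxi.comp u.injective) ?_
    · intro z
      obtain ⟨i, hi⟩ := hAr z
      rw [← hi]
      exact haQ i
    · refine haI.mono ?_ ?_
      · rintro _ ⟨z, rfl⟩
        obtain ⟨i, hi⟩ := hAr z
        exact ⟨i, hi⟩
      · exact Set.union_subset (Nn_subset_Nall.trans (subset_cl _))
          (Set.singleton_subset_iff.2 hy)
    · refine hxI.mono ?_ (subset_cl _)
      rintro _ ⟨z, rfl⟩
      exact ⟨u z, rfl⟩
  have h4 : Fl L X₀ b (Nn X₀ G α ∪ Set.range fun z : A => (z : M)) y := by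
    refine h3.mono ((Set.union_subset (Set.union_subset ?_ ?_) ?_).trans (subset_cl _))
    · exact subset_Nn.trans Set.subset_union_left
    · rw [Subtype.range_coe]
      exact Set.subset_union_right
    · exact (hNα.trans (Nn_mono (hα ▸ le_max_left _ _))).trans Set.subset_union_left
  refine (h4.of_eqT (subset_Nn.trans (subset_cl _)) heq).mono
    ((Set.union_subset (Nn_mono hαδ.le) ?_).trans (subset_cl _))
  rintro _ ⟨z, rfl⟩
  exact subset_Nn_of_lt (u z).2.2 (hxG _)

/-- There is a good type which controls all elements over a countable set. -/
theorem Mon.exists_fl (H : Mon L M κ μ) (hX : X₀.Countable) (hXi : (cl X₀).Infinite)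
    (hb : Good L X₀ b) : ∃ N, X₀ ⊆ N ∧ N.Countable ∧ ∀ y, Fl L X₀ b N y := by
  by_contra! hn
  obtain ⟨G, hG, -, hGR, -⟩ := H.club_rec hX hXi (E := Set.univ) (Set.subset_univ _)
    (fun N G => (∃ x ∈ G, Eqv L X₀ b x ∧ x ∉ cl N) ∧ ∃ y ∈ G, ¬ Fl L X₀ b N y)
    (fun N hN hXN _ => by
      obtain ⟨y, hy⟩ := hn N hXN hN
      obtain ⟨x, h1, -, h2⟩ := H.exists_eqv_notMem (P := N) (H.small_countable hX) hXi hb.1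
        (H.small_countable hN)
      exact ⟨{x, y}, (Set.toFinite _).countable, Set.subset_univ _,
        ⟨x, .inl rfl, h1, fun h => h2 (cl_mono Set.subset_union_left h)⟩, y, .inr rfl, hy⟩)
  obtain ⟨δ, hδ⟩ := exists_fl_stage H hX hXi hb hG fun ν => (hGR ν).1
  obtain ⟨y, hy, hny⟩ := (hGR δ).2
  exact hny (hδ y (QFree.mem_cl (subset_Nall (G := G) δ hy)))

end Full

end QFree

namespace QFree

section Base

variable {L : FirstOrder.Language.{u, u}} {M : Type u} [L.Structure M]

local notation "cl" => clos L

variable {κ μ : Cardinal.{u}} {ι γ I α : Type u} {P Q N N' S X X₀ Y B A : Set M} {b y : M}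

variable (L) in
/-- A stage of the construction of an element generating infinitely many realizations. -/
def Stage (X₀ : Set M) (b : M) (N C : Set M) (Ω : Set (PUnit.{u + 1} → M)) : Prop :=
  C.Finite ∧ QF L (N ∪ C) PUnit.{u + 1} Ω ∧ (∀ Y ∈ Ω, C ⊆ clos L (N ∪ {Y ⟨⟩})) ∧
    ∃ Y ∈ Ω, ∃ x, Eqv L X₀ b x ∧ x ∉ clos L (N ∪ C) ∧ x ∈ clos L (N ∪ C ∪ {Y ⟨⟩}) ∧
      Y ⟨⟩ ∈ clos L (N ∪ C ∪ {x})

theorem exists_TF_single {x y : M} (h : y ∈ cl (P ∪ {x})) :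
    ∃ f, TF L P PUnit.{u + 1} f ∧ f (fun _ => x) = y := by
  refine exists_TF (c := fun _ : PUnit.{u + 1} => x) ?_
  rwa [Set.range_const]

theorem Stage.step (H : Mon L M κ μ) (hXi : (cl X₀).Infinite) (hb : Good L X₀ b)
    (hXN : X₀ ⊆ N) (hN : N.Countable) (hfl : ∀ y, Fl L X₀ b N y)
    (hn : ∀ P : Set M, N ⊆ P → P.Countable → ∀ A, QF L P PUnit.{u + 1} A → ∀ x, Eqv L X₀ b x →
      x ∉ cl P → (fun _ => x) ∈ A → ∃ w ∈ A, ∀ x, Eqv L X₀ b x → w ⟨⟩ ∉ cl (P ∪ {x}))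
    {C : Set M} {Ω : Set (PUnit.{u + 1} → M)} (h : Stage L X₀ b N C Ω) :
    ∃ C' Ω', Stage L X₀ b N C' Ω' ∧ C ⊆ C' ∧ Ω' ⊆ Ω ∧
      ∃ x ∈ C', Eqv L X₀ b x ∧ x ∉ cl (N ∪ C) := by
  obtain ⟨hC, hΩ, hCY, Y, hY, x, hx, hxC, hxY, hYx⟩ := h
  obtain ⟨P, hP⟩ : ∃ P, P = N ∪ C := ⟨_, rfl⟩
  rw [← hP] at hΩ hxC hxY hYx
  have hNP : N ⊆ P := hP ▸ Set.subset_union_left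
  obtain ⟨τ, hτ, hτY⟩ := exists_TF_single hYx
  obtain ⟨f, hf, hfx⟩ := exists_TF_single hxY
  have hτv : ∀ v : PUnit.{u + 1} → M, τ v ∈ cl (P ∪ {v ⟨⟩}) := fun v =>
    hτ.mem_cl (Set.subset_union_left.trans (subset_cl _)) fun i => mem_cl (.inr rfl)
  have hfv : ∀ v : PUnit.{u + 1} → M, f v ∈ cl (P ∪ {v ⟨⟩}) := fun v =>
    hf.mem_cl (Set.subset_union_left.trans (subset_cl _)) fun i => mem_cl (.inr rfl)
  obtain ⟨w, ⟨hwΩ, hwf⟩, hwn⟩ := hn P hNP (hP ▸ hN.union hC.countable)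
    ({v | (fun _ => τ v) ∈ Ω} ∩ {v | f (fun _ => τ v) = v ⟨⟩})
    (.inter _ _ (hΩ.preimage fun _ => hτ) (.eq _ _ (hf.comp fun _ => hτ) (.var (PUnit.unit : PUnit.{u + 1})))) x hx hxC (by
      constructor
      · change (fun _ => τ fun _ => x) ∈ Ω
        rwa [hτY]
      · change f (fun _ => τ fun _ => x) = x
        rw [hτY]
        exact hfx)
  have hwf : f (fun _ => τ w) = w ⟨⟩ := hwf
  obtain ⟨E, hE⟩ : ∃ E, E = {x | Eqv L X₀ b x} ∩ cl (P ∪ {w ⟨⟩}) := ⟨_, rfl⟩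
  have hXP : X₀ ⊆ cl P := (hXN.trans hNP).trans (subset_cl _)
  obtain ⟨B, hBE, hBI, hEB⟩ := exists_maximal_indep H hXi hXP (E := E) fun z hz => by
    rw [hE] at hz
    exact .inl (hb.eqv hz.1)
  have hwB : w ⟨⟩ ∈ cl (P ∪ B) := by
    have h1 : Fl L X₀ b P (w ⟨⟩) := (hfl _).mono (hNP.trans (subset_cl _))
    refine cl_le (Set.union_subset (Set.subset_union_left.trans (subset_cl _)) ?_) h1
    rw [← hE]
    exact hEB
  obtain ⟨B₀, hB₀, hB₀f, hwB₀⟩ := cl_finite_union (Set.finite_singleton (w ⟨⟩))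
    (Set.singleton_subset_iff.2 hwB)
  have hwB₀ : w ⟨⟩ ∈ cl (P ∪ B₀) := hwB₀ rfl
  have hB₀Q : ∀ z ∈ B₀, Eqv L X₀ b z ∧ z ∈ cl (P ∪ {w ⟨⟩}) := by
    intro z hz
    have := hBE (hB₀ hz)
    rw [hE] at this
    exact this
  obtain ⟨x₂, hx₂⟩ : B₀.Nonempty := by
    by_contra hne
    rw [Set.not_nonempty_iff_eq_empty.1 hne, Set.union_empty] at hwB₀
    exact hwn b (.refl b) (cl_mono Set.subset_union_left hwB₀)
  obtain ⟨x₁, hx₁, hx₁₂⟩ : ∃ x₁ ∈ B₀, x₁ ≠ x₂ := by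
    by_contra! hne
    exact hwn x₂ (hB₀Q _ hx₂).1 (cl_mono (Set.union_subset_union_right _ hne) hwB₀)
  have ht : ∀ z : M, ∃ t, z ∈ B₀ → TF L P PUnit.{u + 1} t ∧ t w = z := by
    intro z
    by_cases hz : z ∈ B₀
    · obtain ⟨t, h1, h2⟩ := exists_TF_single (hB₀Q z hz).2
      exact ⟨t, fun _ => ⟨h1, h2⟩⟩
    · exact ⟨fun _ => z, fun h => (hz h).elim⟩
  choose t ht using ht
  have hDf : (B₀ \ {x₂}).Finite := hB₀f.subset Set.sdiff_subset
  have hPC : P ⊆ N ∪ (C ∪ B₀ \ {x₂}) := by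
    rw [hP, ← Set.union_assoc]
    exact Set.subset_union_left
  have hPC' : N ∪ (C ∪ B₀ \ {x₂}) = P ∪ B₀ \ {x₂} := by rw [hP, Set.union_assoc]
  refine ⟨C ∪ B₀ \ {x₂}, Ω ∩ ⋂ z ∈ B₀ \ {x₂}, {v | t z (fun _ => f v) = z}, ⟨hC.union hDf, ?_, ?_,
    fun _ => τ w, ⟨hwΩ, ?_⟩, x₂, (hB₀Q _ hx₂).1, ?_, ?_, ?_⟩, Set.subset_union_left,
    Set.inter_subset_left, x₁, .inr ⟨hx₁, hx₁₂⟩, (hB₀Q _ hx₁).1, ?_⟩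
  · refine .inter _ _ (hΩ.mono hPC) (QF.biInter _ hDf fun z hz => .eq _ _
      (((ht z hz.1).1.comp fun _ => hf).mono hPC) (.const z (.inr (.inr hz))))
  · rintro v ⟨hv, hv'⟩
    have hCv := hCY v hv
    have hPv : P ⊆ cl (N ∪ {v ⟨⟩}) := by
      rw [hP]
      exact Set.union_subset (Set.subset_union_left.trans (subset_cl _)) hCv
    refine Set.union_subset hCv fun z hz => ?_
    have h1 : t z (fun _ => f v) = z := Set.mem_iInter₂.1 hv' z hz
    rw [← h1]
    refine (ht z hz.1).1.mem_cl hPv fun _ => cl_le (Set.union_subset hPv ?_) (hfv v)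
    exact Set.subset_union_right.trans (subset_cl _)
  · refine Set.mem_iInter₂.2 fun z hz => ?_
    change t z (fun _ => f fun _ => τ w) = z
    rw [hwf]
    exact (ht z hz.1).2
  · rw [hPC']
    refine fun hm => hBI x₂ (hB₀ hx₂) (cl_mono (Set.union_subset_union_right _ ?_) hm)
    exact Set.sdiff_subset_sdiff_left hB₀
  · rw [hPC']
    refine cl_le (Set.union_subset ?_ ?_) (hB₀Q _ hx₂).2
    · exact (Set.subset_union_left.trans Set.subset_union_left).trans (subset_cl _)
    · rw [Set.singleton_subset_iff, ← hwf]
      refine cl_mono ?_ (hfv _)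
      exact Set.union_subset_union_left _ Set.subset_union_left
  · rw [hPC']
    refine cl_le (Set.union_subset ?_ ?_) (hτv w)
    · exact (Set.subset_union_left.trans Set.subset_union_left).trans (subset_cl _)
    · rw [Set.singleton_subset_iff]
      refine cl_mono ?_ hwB₀
      rintro z (hz | hz)
      · exact .inl (.inl hz)
      · by_cases e : z = x₂
        · exact .inr e
        · exact .inl (.inr ⟨hz, e⟩)
  · rw [← hP]
    refine fun hm => hBI x₁ (hB₀ hx₁) (cl_mono Set.subset_union_left hm)

theorem Mon.exists_wm (H : Mon L M κ μ) (hXi : (cl X₀).Infinite) (hb : Good L X₀ b)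
    (hXN : X₀ ⊆ N) (hN : N.Countable) (hfl : ∀ y, Fl L X₀ b N y) :
    ∃ P : Set M, N ⊆ P ∧ P.Countable ∧ ∃ A, QF L P PUnit.{u + 1} A ∧ ∃ x, Eqv L X₀ b x ∧
      x ∉ cl P ∧ (fun _ => x) ∈ A ∧ ∀ w ∈ A, ∃ x, Eqv L X₀ b x ∧ w ⟨⟩ ∈ cl (P ∪ {x}) := by
  by_contra! hn
  have hstep := fun (s : {p : Set M × Set (PUnit.{u + 1} → M) // Stage L X₀ b N p.1 p.2}) =>
    s.2.step H hXi hb hXN hN hfl hn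
  obtain ⟨x₀, hx₀, -, hx₀N⟩ := H.exists_eqv_notMem (P := N) (H.small_countable (hN.mono hXN)) hXi
    hb.1 (H.small_countable hN)
  have h0 : Stage L X₀ b N ∅ Set.univ := by
    refine ⟨Set.finite_empty, .univ, fun _ _ => Set.empty_subset _, fun _ => x₀, trivial, x₀, hx₀,
      ?_, mem_cl (.inr rfl), mem_cl (.inr rfl)⟩
    rw [Set.union_empty]
    exact fun h => hx₀N (cl_mono Set.subset_union_left h)
  have hstep' : ∀ s : {p : Set M × Set (PUnit.{u + 1} → M) // Stage L X₀ b N p.1 p.2},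
      ∃ s' : {p : Set M × Set (PUnit.{u + 1} → M) // Stage L X₀ b N p.1 p.2},
        s.1.1 ⊆ s'.1.1 ∧ s'.1.2 ⊆ s.1.2 ∧
          ∃ x ∈ s'.1.1, Eqv L X₀ b x ∧ x ∉ cl (N ∪ s.1.1) := by
    intro s
    obtain ⟨C', Ω', h1, h2⟩ := hstep s
    exact ⟨⟨(C', Ω'), h1⟩, h2⟩
  choose nx hC hΩ x hxm hxb hxn using hstep'
  obtain ⟨s, hs⟩ : ∃ s : ℕ → {p : Set M × Set (PUnit.{u + 1} → M) // Stage L X₀ b N p.1 p.2},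
      ∀ n, s (n + 1) = nx (s n) :=
    ⟨fun n => Nat.rec ⟨(∅, Set.univ), h0⟩ (fun _ s => nx s) n, fun _ => rfl⟩
  have hCm : Monotone fun n => (s n).1.1 := monotone_nat_of_le_succ fun n => by
    change (s n).1.1 ⊆ (s (n + 1)).1.1
    rw [hs]
    exact hC _
  have hΩm : Antitone fun n => (s n).1.2 := antitone_nat_of_succ_le fun n => by
    change (s (n + 1)).1.2 ⊆ (s n).1.2
    rw [hs]
    exact hΩ _
  have hcount : (N ∪ ⋃ n, (s n).1.1).Countable :=
    hN.union (Set.countable_iUnion fun n => (s n).2.1.countable)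
  have hfip : ∀ G ⊆ Set.range fun n => (s n).1.2, G.Finite → ∃ n, (s n).1.2 ⊆ ⋂₀ G := by
    intro G hG hGf
    induction G, hGf using Set.Finite.induction_on with
    | empty => exact ⟨0, fun _ _ A hA => hA.elim⟩
    | insert _ _ ih =>
      obtain ⟨n, hn⟩ := ih ((Set.subset_insert _ _).trans hG)
      obtain ⟨k, hk⟩ := hG (Set.mem_insert _ _)
      refine ⟨max n k, fun w hw A hA => ?_⟩
      rcases hA with rfl | hA
      · rw [← hk]
        exact hΩm (le_max_right n k) hw
      · exact hn (hΩm (le_max_left n k) hw) A hA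
  obtain ⟨Y, hY⟩ := H.comp PUnit.{u + 1} (by simpa using H.aleph0_le.trans' one_le_aleph0)
    (N ∪ ⋃ n, (s n).1.1) (H.small_countable hcount) (Set.range fun n => (s n).1.2)
    (by
      rintro _ ⟨n, rfl⟩
      exact (s n).2.2.1.mono (Set.union_subset_union_right _
        (Set.subset_iUnion (fun n => (s n).1.1) n)))
    (by
      intro G hG hGf
      obtain ⟨n, hn⟩ := hfip G hG hGf
      obtain ⟨Y, hY, -⟩ := (s n).2.2.2.2
      exact ⟨Y, hn hY⟩)
  have hxY : ∀ n, x (s n) ∈ cl (N ∪ {Y ⟨⟩}) := by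
    intro n
    refine (s (n + 1)).2.2.2.1 Y (hY _ ⟨n + 1, rfl⟩) ?_
    rw [hs]
    exact hxm _
  obtain ⟨F, hFs, hFf, hYF⟩ := cl_finite_union (Set.finite_singleton (Y ⟨⟩))
    (Set.singleton_subset_iff.2 (hfl (Y ⟨⟩)))
  have hNF : ∀ n, x (s n) ∈ cl (N ∪ F) := fun n =>
    cl_le (Set.union_subset (Set.subset_union_left.trans (subset_cl _)) hYF) (hxY n)
  obtain ⟨hinj, hind⟩ := hb.seq_indep H hXi (P := N) (I := ULift.{u} ℕ)
    (c := fun n => x (s n.down)) (hXN.trans (subset_cl _)) (fun n => hxb _) (by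
      intro n hm
      refine hxn (s n.down) (cl_mono (Set.union_subset_union_right _ ?_) hm)
      rintro _ ⟨k, hk, rfl⟩
      have h1 : k.down + 1 ≤ n.down := hk
      have h2 := hxm (s k.down)
      rw [← hs] at h2
      exact hCm h1 h2)
  refine Set.infinite_range_of_injective hinj
    (hind.finite_of_subset H hXi hFf.toFinset (hXN.trans (subset_cl _)) (fun z hz => .inl ?_) ?_)
  · exact hb.eqv (hFs (hFf.mem_toFinset.1 hz)).1
  · rintro _ ⟨n, rfl⟩
    rw [hFf.coe_toFinset]
    exact hNF _

variable (L) in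
/-- A base for the type of `b` over the tuple `m`. -/
structure FB (m : α → M) (b : M) : Prop where
  inf : (clos L (Set.range m)).Infinite
  good : Good L (Set.range m) b
  full : ∀ y, Fl L (Set.range m) b (Set.range m) y
  wm : ∃ A, QF L (Set.range m) PUnit.{u + 1} A ∧ (fun _ => b) ∈ A ∧
    ∀ w ∈ A, ∃ x, Eqv L (Set.range m) b x ∧ w ⟨⟩ ∈ clos L (Set.range m ∪ {x})

theorem Mon.exists_FB (H : Mon L M κ μ) :
    ∃ (α : Type u) (_ : Countable α) (m : α → M) (b : M), FB L m b := by
  have := H.inf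
  obtain ⟨f⟩ := Nonempty.intro (Infinite.natEmbedding M)
  obtain ⟨X₀, b, hX, hXc, hb⟩ := H.exists_good (Set.countable_range f)
    ((Set.infinite_range_of_injective f.injective).mono (subset_cl _))
  have hXi : (cl X₀).Infinite :=
    (Set.infinite_range_of_injective f.injective).mono (hX.trans (subset_cl _))
  obtain ⟨N, hXN, hN, hfl⟩ := H.exists_fl hXc hXi hb
  obtain ⟨P, hNP, hP, A, hA, x, hx, hxP, hxA, hw⟩ := H.exists_wm hXi hb hXN hN hfl
  have hXP : X₀ ⊆ cl P := (hXN.trans hNP).trans (subset_cl _)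
  have hr : Set.range (Subtype.val : P → M) = P := Subtype.range_coe
  have hE : ∀ z, Eqv L X₀ b z → z ∉ cl P → Eqv L P x z := fun z h1 h2 =>
    hb.eqv_of H hXi hx h1 hXP hxP h2
  refine ⟨P, hP.to_subtype, Subtype.val, x, ?_, ?_, fun y => ?_, ?_⟩ <;> rw [hr]
  · exact hXi.mono (cl_le hXP)
  · exact (hb.eqv hx).up hXP hxP
  · have h1 : Fl L X₀ b P y := (hfl y).mono (hNP.trans (subset_cl _))
    refine cl_le (Set.union_subset (Set.subset_union_left.trans (subset_cl _)) ?_) h1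
    rintro z ⟨hz, hzy⟩
    by_cases hzP : z ∈ cl P
    · exact cl_mono Set.subset_union_left hzP
    · exact mem_cl (.inr ⟨hE z hz hzP, hzy⟩)
  · refine ⟨A, hA, hxA, fun w hwA => ?_⟩
    obtain ⟨z, hz, hwz⟩ := hw w hwA
    by_cases hzP : z ∈ cl P
    · refine ⟨x, .refl x, cl_le (Set.union_subset ?_ ?_) hwz⟩
      · exact Set.subset_union_left.trans (subset_cl _)
      · exact Set.singleton_subset_iff.2 (cl_mono Set.subset_union_left hzP)
    · exact ⟨z, hE z hz hzP, hwz⟩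

theorem Mon.small_countable' (H : Mon L M κ μ) [Countable ι] : #ι ≤ μ :=
  mk_le_aleph0.trans H.aleph0_le

theorem Mon.small_sum (H : Mon L M κ μ) (hι : #ι ≤ μ) (hγ : #γ ≤ μ) : #(ι ⊕ γ) ≤ μ := by
  rw [mk_sum, lift_id, lift_id]
  exact add_le_of_le H.aleph0_le hι hγ

theorem Mon.small_punit (H : Mon L M κ μ) : #PUnit.{u + 1} ≤ μ := H.small_countable'

theorem PE.eqv {g : M → M} (hg : PE L S g) (hN : N ⊆ S) {a c : M} (ha : a ∈ S) (hc : c ∈ S)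
    (h : Eqv L N a c) : Eqv L (g '' N) (g a) (g c) :=
  hg.eqT_image hN (fun _ => ha) (fun _ => hc) h

theorem PE.fl {g : M → M} (hg : PE L (cl S) g) (hN : N ⊆ cl S) (hP : P ⊆ cl S) (hb : b ∈ cl S)
    (hy : y ∈ cl S) (h : Fl L N b P y) : Fl L (g '' N) (g b) (g '' P) (g y) := by
  have hPy : P ∪ {y} ⊆ cl S := Set.union_subset hP (Set.singleton_subset_iff.2 hy)
  refine cl_mono ?_ (hg.mem_cl (Set.union_subset hP (Set.inter_subset_right.trans (cl_le hPy)))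
    hy h)
  rw [Set.image_union]
  refine Set.union_subset_union_right _ ?_
  rintro _ ⟨x, ⟨hx, hxy⟩, rfl⟩
  have hxS := cl_le hPy hxy
  refine ⟨hg.eqv hN hb hxS hx, ?_⟩
  have := hg.mem_cl hPy hxS hxy
  rwa [Set.image_union, Set.image_singleton] at this

theorem FB.of_eqT (H : Mon L M κ μ) [Countable α] {m m' : α → M} {b b' : M} (h : FB L m b)
    (he : EqT L ∅ (Sum.elim m fun _ : PUnit.{u + 1} => b) (Sum.elim m' fun _ => b')) :
    FB L m' b' := by
  have hα : #α ≤ μ := H.small_countable' 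
  have he' := he.symm
  have hi : (cl (Set.range m')).Infinite := by
    obtain ⟨g, h1, -, h2⟩ := (he.reindex (Sum.inl : α → α ⊕ PUnit.{u + 1})).exists_pe
    rw [Set.empty_union] at h1
    have h3 := h1.image_cl
    rw [← Set.range_comp, show g ∘ (fun i => _) = m' from funext h2] at h3
    rw [← h3]
    exact h.inf.image h1.injOn
  have hr : ∀ (m : α → M) (b : M), Set.range (Sum.elim m fun _ : PUnit.{u + 1} => b) =
      Set.range m ∪ {b} := fun m b => by rw [Set.Sum.elim_range, Set.range_const]
  have key : ∀ y', ∃ y, EqT L ∅ (Sum.elim (Sum.elim m fun _ : PUnit.{u + 1} => b)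
        fun _ : PUnit.{u + 1} => y)
      (Sum.elim (Sum.elim m' fun _ : PUnit.{u + 1} => b') fun _ : PUnit.{u + 1} => y') ∧
      ∀ x, ∃ g S, PE L (cl S) g ∧ (∀ i, g (m i) = m' i) ∧ g b = b' ∧ g y = y' ∧
        Set.range m ⊆ cl S ∧ b ∈ cl S ∧ y ∈ cl S ∧ x ∈ cl S := by
    intro y'
    obtain ⟨g, h1, h2⟩ := H.move_fam he' (H.small_sum hα (H.small_punit))
      (hi.mono (cl_mono (by rw [hr]; exact Set.subset_union_left))) (W := {y'})
      (by simpa using H.aleph0_le.trans' one_le_aleph0)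
    have h3 := h1.eqT (w := Sum.elim (Sum.elim m' fun _ : PUnit.{u + 1} => b')
      fun _ : PUnit.{u + 1} => y') (by
        rintro (i | i)
        · exact QFree.mem_cl (.inl ⟨i, rfl⟩)
        · exact QFree.mem_cl (.inr rfl))
    have h4 : EqT L ∅ (Sum.elim (Sum.elim m' fun _ : PUnit.{u + 1} => b')
        fun _ : PUnit.{u + 1} => y') (Sum.elim (Sum.elim m fun _ : PUnit.{u + 1} => b)
        fun _ : PUnit.{u + 1} => g y') := by
      intro A hA hw
      refine (congrArg (· ∈ A) (funext fun i => ?_)).mp (h3 A hA hw)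
      rcases i with i | i
      · exact h2 i
      · rfl
    refine ⟨g y', h4.symm, fun x => ?_⟩
    obtain ⟨k, h5, h6⟩ := H.move_fam h4.symm (H.small_sum (H.small_sum hα H.small_punit)
      H.small_punit) (h.inf.mono (cl_mono (by
        rw [Set.Sum.elim_range, hr]
        exact Set.subset_union_left.trans Set.subset_union_left))) (W := {x})
      (by simpa using H.aleph0_le.trans' one_le_aleph0)
    refine ⟨k, _, h5, fun i => h6 (.inl (.inl i)), h6 (.inl (.inr ⟨⟩)), h6 (.inr ⟨⟩), ?_, ?_, ?_,
      QFree.mem_cl (.inr rfl)⟩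
    · rintro _ ⟨i, rfl⟩
      exact QFree.mem_cl (.inl ⟨.inl (.inl i), rfl⟩)
    · exact QFree.mem_cl (.inl ⟨.inl (.inr ⟨⟩), rfl⟩)
    · exact QFree.mem_cl (.inl ⟨.inr ⟨⟩, rfl⟩)
  have him : ∀ g : M → M, (∀ i, g (m i) = m' i) → g '' Set.range m = Set.range m' := by
    intro g hg
    rw [← Set.range_comp]
    exact congrArg _ (funext hg)
  refine ⟨hi, h.good.of_eqT H hα hi he, fun y' => ?_, ?_⟩
  · obtain ⟨y, -, h2⟩ := key y'
    obtain ⟨g, S, h3, h4, h5, h6, h7, h8, h9, -⟩ := h2 y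
    have := h3.fl h7 h7 h8 h9 (h.full y)
    rwa [him g h4, h5, h6] at this
  · obtain ⟨A, hA, hbA, hw⟩ := h.wm
    obtain ⟨B, hB, hAB⟩ := QF.abs (P := ∅) (c := m) (A := A) (by simpa using hA)
    refine ⟨{v | Sum.elim m' v ∈ B}, (hB.mono (Set.empty_subset _)).inst fun i =>
      QFree.mem_cl ⟨i, rfl⟩, ?_, fun w' hw' => ?_⟩
    · exact he B hB ((hAB _).1 hbA)
    · obtain ⟨y, h1, h2⟩ := key (w' ⟨⟩)
      have hy : (fun _ => y) ∈ A := by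
        rw [hAB]
        have h3 := h1.symm.reindex (Sum.elim (fun i : α => Sum.inl (Sum.inl i))
          fun _ : PUnit.{u + 1} => Sum.inr PUnit.unit) B hB (by
            refine (congrArg (· ∈ B) (funext fun i => ?_)).mp hw'
            rcases i with i | i <;> rfl)
        refine (congrArg (· ∈ B) (funext fun i => ?_)).mp h3
        rcases i with i | i <;> rfl
      obtain ⟨x, hx, hyx⟩ := hw _ hy
      obtain ⟨g, S, h3, h4, h5, h6, h7, h8, h9, h10⟩ := h2 x
      refine ⟨g x, ?_, ?_⟩
      · have := h3.eqv h7 h8 h10 hx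
        rwa [him g h4, h5] at this
      · have := h3.mem_cl (Set.union_subset h7 (Set.singleton_subset_iff.2 h10)) h9 hyx
        rwa [Set.image_union, Set.image_singleton, him g h4, h6] at this

theorem FB.exists_eqT (H : Mon L M κ μ) [Countable α] {m m' : α → M} {b : M} (h : FB L m b)
    (he : EqT L ∅ m m') :
    ∃ b', EqT L ∅ (Sum.elim m fun _ : PUnit.{u + 1} => b) (Sum.elim m' fun _ => b') ∧
      FB L m' b' := by
  obtain ⟨g, h1, h2⟩ := H.move_fam he H.small_countable' h.inf (W := {b})
    (by simpa using H.aleph0_le.trans' one_le_aleph0)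
  have h3 : EqT L ∅ (Sum.elim m fun _ : PUnit.{u + 1} => b) (Sum.elim m' fun _ => g b) := by
    have h4 := h1.eqT (w := Sum.elim m fun _ : PUnit.{u + 1} => b) (by
      rintro (i | i)
      · exact QFree.mem_cl (.inl ⟨i, rfl⟩)
      · exact QFree.mem_cl (.inr rfl))
    intro A hA hw
    refine (congrArg (· ∈ A) (funext fun i => ?_)).mp (h4 A hA hw)
    rcases i with i | i
    · exact h2 i
    · rfl
  exact ⟨_, h3, h.of_eqT H h3⟩

end Base

end QFree

namespace QFree

section Point

variable {L : FirstOrder.Language.{u, u}} {M : Type u} [L.Structure M]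

local notation "cl" => clos L

variable {κ μ : Cardinal.{u}} {ι γ I α : Type u} {P Q N N' S X X₀ Y Z B A : Set M} {b y : M}

theorem Mon.sym (H : Mon L M κ μ) (hNi : (cl N).Infinite) (h : FS L Y P N) (hN : N ⊆ cl P)
    (hZ : Z ⊆ cl P) : FS L Z (N ∪ Y) N :=
  H.sym_fs hNi (h.right (Set.union_subset hN hZ))

theorem Mon.coheir (H : Mon L M κ μ) (hι : #ι ≤ μ) (hN : #N ≤ μ) (hNi : (cl N).Infinite)
    (w : ι → M) (hP : #P ≤ μ) : ∃ w', EqT L N w w' ∧ FS L (Set.range w') (P ∪ N) N :=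
  H.exists_coheir hι ((H.EC_of_infinite hNi).fs hNi.nonempty _) hN hP

theorem subset_cl_of (h : X ⊆ Y) : X ⊆ cl Y := h.trans (subset_cl _)

theorem Mon.good_of_interdef (H : Mon L M κ μ) (hS : #S ≤ μ) (hSi : (cl S).Infinite)
    (hι : #ι ≤ μ) {m : ι → M} {w x : M} (hm : FS L (Set.range m) (S ∪ {w}) S)
    (hwx : w ∈ cl (S ∪ Set.range m ∪ {x})) (hxw : x ∈ cl (S ∪ Set.range m ∪ {w}))
    (hx : Good L (S ∪ Set.range m) x) (hw : w ∉ cl S) : Good L S w := by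
  refine ⟨hw, fun F hF w' he hw' => ?_⟩
  obtain ⟨n, hn, hnF⟩ := H.coheir hι hS hSi m (P := {w'} ∪ F)
    (H.small_union (H.small_fin (ι := ({w'} : Set M))) (H.small_finite hF))
  have hmw : EqT L S (Sum.elim m fun _ : PUnit.{u + 1} => w)
      (Sum.elim n fun _ : PUnit.{u + 1} => w') := by
    obtain ⟨g, h1, h2, h3⟩ := H.move hS hSi he H.small_punit (W := Set.range m)
      (H.small_range hι m)
    have hS' : S ⊆ cl (S ∪ Set.range (fun _ : PUnit.{u + 1} => w) ∪ Set.range m) :=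
      subset_cl_of (by grind)
    have hm' : Set.range m ⊆ cl (S ∪ Set.range (fun _ : PUnit.{u + 1} => w) ∪ Set.range m) :=
      subset_cl_of (by grind)
    have hw' : w ∈ cl (S ∪ Set.range (fun _ : PUnit.{u + 1} => w) ∪ Set.range m) :=
      mem_cl (.inl (.inr ⟨⟨⟩, rfl⟩))
    have h4 := hm.pe h1 hm' (Set.union_subset hS' (Set.singleton_subset_iff.2 hw')) (cl_le hS')
    have hgS : g '' S = S := (Set.image_congr h2).trans (Set.image_id' S)
    rw [Set.image_union, hgS, Set.image_singleton, h3 ⟨⟩, ← Set.range_comp] at h4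
    have h5 : EqT L S m (g ∘ m) := h1.eqT_self hS' h2 fun i => hm' ⟨i, rfl⟩
    have h6 : EqT L (S ∪ {w'}) (g ∘ m) n := H.uniq_fs hSi h4
      (hnF.right (subset_cl_of (by grind))) (subset_cl_of (by grind)) (h5.symm.trans hn)
    have h7 : EqT L S (Sum.elim m fun _ : PUnit.{u + 1} => w)
        (Sum.elim (g ∘ m) fun _ : PUnit.{u + 1} => w') := by
      have h8 := h1.eqT_self hS' h2 (w := Sum.elim m fun _ : PUnit.{u + 1} => w) (by
        rintro (i | i)
        · exact hm' ⟨i, rfl⟩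
        · exact hw')
      intro A hA hA'
      refine (congrArg (· ∈ A) (funext fun i => ?_)).mp (h8 A hA hA')
      rcases i with i | i
      · rfl
      · exact h3 ⟨⟩
    refine h7.trans ?_
    have h9 := eqT_abs.1 (show EqT L (S ∪ Set.range fun _ : PUnit.{u + 1} => w') (g ∘ m) n by
      rwa [Set.range_const])
    intro A hA hA'
    refine (congrArg (· ∈ A) (funext fun i => ?_)).mp
      (h9.reindex (Sum.elim Sum.inr Sum.inl : ι ⊕ PUnit.{u + 1} → PUnit.{u + 1} ⊕ ι) A hA
      ((congrArg (· ∈ A) (funext fun i => ?_)).mp hA')) <;>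
    rcases i with i | i <;> rfl
  have hr : ∀ (m : ι → M) (w : M), Set.range (Sum.elim m fun _ : PUnit.{u + 1} => w) =
      Set.range m ∪ {w} := fun m w => by rw [Set.Sum.elim_range, Set.range_const]
  obtain ⟨g, h1, h2, h3⟩ := H.move hS hSi hmw (H.small_sum hι H.small_punit) (W := {x})
    (H.small_fin (ι := ({x} : Set M)))
  rw [hr] at h1
  obtain ⟨D, hD⟩ : ∃ D, D = S ∪ (Set.range m ∪ {w}) ∪ {x} := ⟨_, rfl⟩
  rw [← hD] at h1
  have hgS : g '' S = S := (Set.image_congr h2).trans (Set.image_id' S)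
  have hgm : g '' Set.range m = Set.range n := by
    rw [← Set.range_comp]
    exact congrArg _ (funext fun i => h3 (.inl i))
  have hgw : g w = w' := h3 (.inr ⟨⟩)
  have hxD : x ∈ cl D := mem_cl (by rw [hD]; exact .inr rfl)
  have hwD : w ∈ cl D := mem_cl (by rw [hD]; exact .inl (.inr (.inr rfl)))
  have hSm : S ∪ Set.range m ⊆ cl D := subset_cl_of (by grind)
  have hx' : Good L (S ∪ Set.range n) (g x) := by
    have := hx.pe H h1 hSm hxD (H.small_union hS (H.small_range hι m))
      (hSi.mono (cl_mono Set.subset_union_left))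
    rwa [Set.image_union, hgS, hgm] at this
  have hwx' : w' ∈ cl (S ∪ Set.range n ∪ {g x}) := by
    have := h1.mem_cl (Set.union_subset hSm (Set.singleton_subset_iff.2 hxD)) hwD hwx
    rwa [Set.image_union, Set.image_union, hgS, hgm, Set.image_singleton, hgw] at this
  have hSF : (cl (S ∪ F)).Infinite := hSi.mono (cl_mono Set.subset_union_left)
  have hw'' : w' ∉ cl (S ∪ F ∪ Set.range n) := by
    intro hm'
    have h4 : FS L (Set.range n) ({w'} ∪ F ∪ S) (S ∪ F) := hnF.base (subset_cl_of (by grind))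
    have h5 := H.sym hSF h4 (subset_cl_of (by grind)) (Z := {w'}) (subset_cl_of (by grind))
    exact hw' (h5.mem (subset_cl_of (by grind)) (mem_cl (by grind)) hm')
  have hx'' : g x ∉ cl (S ∪ F ∪ Set.range n) := by
    refine fun hm' => hw'' (cl_le (Set.union_subset (subset_cl_of (by grind)) ?_) hwx')
    exact Set.singleton_subset_iff.2 hm'
  have h4 : FS L {g x} (S ∪ F ∪ Set.range n) (S ∪ Set.range n) :=
    hx'.fs (.refl _) (subset_cl_of (by grind)) hx''
  have h5 : FS L {w'} (S ∪ F ∪ Set.range n) (S ∪ Set.range n) :=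
    h4.left (subset_cl_of (by grind)) (Set.singleton_subset_iff.2 hwx')
  have h6 : FS L {w'} (S ∪ Set.range n) S :=
    H.sym hSi hnF (subset_cl_of (by grind)) (subset_cl_of (by grind))
  exact (H.trans_fs hSi h5 h6 (subset_cl_of (by grind)) (subset_cl_of (by grind))).right
    (subset_cl_of (by grind))

theorem FB.exists_good (H : Mon L M κ μ) [Countable α] {m₀ : α → M} {b₀ : M} (h₀ : FB L m₀ b₀)
    (hS : #S ≤ μ) (hSi : (cl S).Infinite) (hy : y ∉ cl S) :
    ∃ w ∈ cl (S ∪ {y}), Good L S w := by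
  have hα : #α ≤ μ := H.small_countable'
  obtain ⟨m, hm0, hmy⟩ := H.coheir hα hS hSi m₀ (P := {y}) (H.small_fin (ι := ({y} : Set M)))
  obtain ⟨b, -, hb⟩ := h₀.exists_eqT H (hm0.mono (Set.empty_subset _))
  obtain ⟨P, hP⟩ : ∃ P, P = S ∪ Set.range m := ⟨_, rfl⟩
  have hPs : #P ≤ μ := hP ▸ H.small_union hS (H.small_range hα m)
  have hSP : S ⊆ P := hP ▸ Set.subset_union_left
  have hmP : Set.range m ⊆ P := hP ▸ Set.subset_union_right
  have hPi : (cl P).Infinite := hSi.mono (cl_mono hSP)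
  have hyP' : FS L {y} P S := hP ▸ H.sym hSi hmy (subset_cl_of (by grind)) (subset_cl_of (by grind))
  obtain ⟨y'', hyy, hyF⟩ := H.coheir H.small_punit hPs hPi (fun _ : PUnit.{u + 1} => y) (P := {y})
    (H.small_fin (ι := ({y} : Set M)))
  obtain ⟨y', rfl⟩ : ∃ y', y'' = fun _ => y' := ⟨y'' ⟨⟩, rfl⟩
  rw [Set.range_const] at hyF
  obtain ⟨n, hmn, hnF⟩ := H.coheir hα hS hSi m (P := P ∪ {y} ∪ {y'})
    (H.small_union (H.small_union hPs H.small_fin) H.small_fin)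
  obtain ⟨c, -, hc⟩ := hb.exists_eqT H (hmn.mono (Set.empty_subset _))
  -- the closure of `y` over `n`
  have hynP : FS L {y} (S ∪ (Set.range m ∪ Set.range n)) S := by
    have h1 : FS L (Set.range m ∪ Set.range n) ({y} ∪ S) S :=
      hmy.union (subset_cl_of (by grind)) ((hnF.right (subset_cl_of (by grind))).base
        (subset_cl_of (by grind)))
    exact H.sym hSi h1 (subset_cl_of (by grind)) (subset_cl_of (by grind))
  have hySn : y ∉ cl (S ∪ Set.range n) := fun h =>
    hy (hynP.mem (subset_cl_of (by grind)) (mem_cl (by grind)) (cl_mono (by grind) h))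
  obtain ⟨w, hwc, hwy, hwSn⟩ : ∃ w, Eqv L (Set.range n) c w ∧ w ∈ cl (S ∪ Set.range n ∪ {y}) ∧
      w ∉ cl (S ∪ Set.range n) := by
    by_contra! hne
    refine hySn (cl_le (Set.union_subset (subset_cl _) ?_)
      ((hc.full y).mono (Q := S ∪ Set.range n) (subset_cl_of (by grind))))
    rintro z ⟨hz, hzy⟩
    exact hne z hz hzy
  have hwP : w ∉ cl (P ∪ Set.range n) := by
    intro h
    refine hwSn ((hynP.base (N' := S ∪ Set.range n) (subset_cl_of (by grind))).mem
      (subset_cl_of (by grind)) hwy (cl_mono (by grind) h))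
  obtain ⟨T, hT, hTw⟩ := exists_TF (P := S) (c := Sum.elim n fun _ : PUnit.{u + 1} => y) (y := w)
    (by rwa [Set.Sum.elim_range, Set.range_const, ← Set.union_assoc])
  have hTv : ∀ (v : α → M) (z : M), T (Sum.elim v fun _ => z) ∈ cl (S ∪ Set.range v ∪ {z}) := by
    intro v z
    refine hT.mem_cl (subset_cl_of (by grind)) ?_
    rintro (i | i)
    · exact mem_cl (.inl (.inr ⟨i, rfl⟩))
    · exact mem_cl (.inr rfl)
  have hTne : T (Sum.elim n fun _ => y) ≠ T (Sum.elim n fun _ => y') := by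
    intro e
    have h1 : FS L {y'} (P ∪ {y} ∪ Set.range n) P := by
      have h2 : FS L (Set.range n) (P ∪ {y} ∪ {y'} ∪ S) (P ∪ {y}) :=
        hnF.base (subset_cl_of (by grind))
      have h3 := H.sym (hPi.mono (cl_mono (by grind))) h2 (Z := {y'}) (subset_cl_of (by grind))
        (subset_cl_of (by grind))
      exact H.trans_fs hPi h3 (hyF.right (subset_cl_of (by grind))) (subset_cl_of (by grind))
        (subset_cl_of (by grind))
    refine hwP ((h1.base (N' := P ∪ Set.range n) (subset_cl_of (by grind))).mem
      (subset_cl_of (by grind)) (cl_mono (P := S ∪ Set.range n ∪ {y'}) (by grind) ?_)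
      (cl_mono (P := S ∪ Set.range n ∪ {y}) (by grind) hwy))
    rw [← hTw, e]
    exact hTv n y'
  rw [hTw] at hTne
  -- interdefinability with a realization over `m`
  have hgw : Good L (P ∪ Set.range n) w :=
    (hc.good.eqv hwc).up (subset_cl_of (by grind)) hwP
  obtain ⟨x, hxb, hxw, hxP⟩ : ∃ x, Eqv L (Set.range m) b x ∧ x ∈ cl (P ∪ Set.range n ∪ {w}) ∧
      x ∉ cl (P ∪ Set.range n) := by
    by_contra! hne
    refine hwP (cl_le (Set.union_subset (subset_cl _) ?_)
      ((hb.full w).mono (Q := P ∪ Set.range n) (subset_cl_of (by grind))))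
    rintro z ⟨hz, hzy⟩
    exact hne z hz hzy
  have hwx : w ∈ cl (P ∪ Set.range n ∪ {x}) :=
    hgw.exchange H (hPi.mono (cl_mono (by grind))) hxw hxP
  obtain ⟨g, hg, hgx⟩ := exists_TF (P := P) (c := Sum.elim n fun _ : PUnit.{u + 1} => w) (y := x)
    (by rwa [Set.Sum.elim_range, Set.range_const, ← Set.union_assoc])
  obtain ⟨f, hf, hfw⟩ := exists_TF (P := P) (c := Sum.elim n fun _ : PUnit.{u + 1} => x) (y := w)
    (by rwa [Set.Sum.elim_range, Set.range_const, ← Set.union_assoc])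
  obtain ⟨A, hA, hbA, hwm⟩ := hb.wm
  obtain ⟨Q, hQ⟩ : ∃ Q, Q = P ∪ {y} ∪ {y'} ∪ S := ⟨_, rfl⟩
  rw [← hQ] at hnF
  have hPQ : P ⊆ Q := by grind
  have hsub : ∀ {h : (α ⊕ PUnit.{u + 1} → M) → M} (k : (α → M) → M), TF L P _ h → TF L Q α k →
      TF L Q α fun v => h (Sum.elim v fun _ => k v) := by
    intro h k hh hk
    refine ((hh.mono hPQ).comp (g := fun i v => Sum.elim v (fun _ => k v) i) ?_ : _)
    rintro (i | i)
    · exact .var i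
    · exact hk
  have hTy : ∀ z ∈ Q, TF L Q α fun v => T (Sum.elim v fun _ => z) := fun z hz =>
    hsub (fun _ => z) (hT.mono hSP) (.const z hz)
  have hyQ : y ∈ Q := by grind
  have hX : TF L Q α fun v => g (Sum.elim v fun _ => T (Sum.elim v fun _ => y)) :=
    hsub _ hg (hTy y hyQ)
  obtain ⟨v, ⟨hv1, hv2, hv3⟩, hvS⟩ := hnF.fam (w := n) (A :=
      {v | T (Sum.elim v fun _ => y) = T (Sum.elim v fun _ => y')}ᶜ ∩
      ({v | (fun _ : PUnit.{u + 1} => g (Sum.elim v fun _ => T (Sum.elim v fun _ => y))) ∈ A} ∩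
      {v | T (Sum.elim v fun _ => y) = f (Sum.elim v fun _ => g (Sum.elim v fun _ =>
        T (Sum.elim v fun _ => y)))})) (subset_cl_of (by grind)) (fun i => mem_cl (.inr ⟨i, rfl⟩))
    (.inter _ _ (.compl _ (.eq _ _ (hTy y hyQ) (hTy y' (by grind))))
      (.inter _ _ ((hA.mono (hmP.trans hPQ)).preimage fun _ => hX)
        (.eq _ _ (hTy y hyQ) (hsub _ hf hX)))) (by
      refine ⟨?_, ?_, ?_⟩
      · change ¬ (T (Sum.elim n fun _ => y) = T (Sum.elim n fun _ => y'))
        rwa [hTw]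
      · change (fun _ : PUnit.{u + 1} => g (Sum.elim n fun _ => T (Sum.elim n fun _ => y))) ∈ A
        rw [hTw, hgx]
        exact hxb A hA hbA
      · change T (Sum.elim n fun _ => y) = f (Sum.elim n fun _ => g (Sum.elim n fun _ =>
          T (Sum.elim n fun _ => y)))
        rw [hTw, hgx, hfw])
  obtain ⟨z, hz⟩ : ∃ z, z = T (Sum.elim v fun _ => y) := ⟨_, rfl⟩
  obtain ⟨x', hx'⟩ : ∃ x', x' = g (Sum.elim v fun _ => z) := ⟨_, rfl⟩
  have hv1 : ¬ (T (Sum.elim v fun _ => y) = T (Sum.elim v fun _ => y')) := hv1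
  have hv2 : (fun _ : PUnit.{u + 1} => g (Sum.elim v fun _ => T (Sum.elim v fun _ => y))) ∈ A := hv2
  have hv3 : T (Sum.elim v fun _ => y) = f (Sum.elim v fun _ => g (Sum.elim v fun _ =>
        T (Sum.elim v fun _ => y))) := hv3
  rw [← hz] at hv1 hv2 hv3
  rw [← hx'] at hv2 hv3
  have hvP : Set.range v ⊆ cl S := by
    rintro _ ⟨i, rfl⟩
    exact hvS i
  have hzy : z ∈ cl (S ∪ {y}) := by
    rw [hz]
    exact cl_le (Set.union_subset (Set.union_subset (subset_cl_of (by grind))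
      (hvP.trans (cl_mono (by grind)))) (subset_cl_of (by grind))) (hTv v y)
  have hzS : z ∉ cl S := by
    intro hzS
    refine hv1 ?_
    have h1 : TF L (cl S) PUnit.{u + 1} fun i => T (Sum.elim v fun _ => i PUnit.unit) := by
      refine ((hT.mono (subset_cl (L := L) S)).comp
        (g := fun i a => Sum.elim v (fun _ => a PUnit.unit) i) ?_ : _)
      rintro (i | i)
      · exact .const _ (hvS i)
      · exact .var (PUnit.unit : PUnit.{u + 1})
    have h2 := (hyy.mono (P := cl S) (cl_mono hSP)).tf_eq h1 (.const z hzS) hz.symm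
    exact h2.symm
  have hzP : z ∉ cl P := fun h => hzS (hyP'.mem (subset_cl_of hSP) hzy h)
  obtain ⟨x₁, hx₁, hx₁'⟩ := hwm _ hv2
  have hx'P : cl (P ∪ {x'}) ⊆ cl (P ∪ {x₁}) := by
    refine cl_le (Set.union_subset (subset_cl_of (by grind)) (Set.singleton_subset_iff.2 ?_))
    exact cl_mono (P := Set.range m ∪ {x₁}) (by grind) hx₁'
  have hzx : z ∈ cl (P ∪ {x₁}) := by
    refine hx'P ?_
    rw [hv3]
    refine hf.mem_cl (subset_cl_of (by grind)) ?_
    rintro (i | i)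
    · exact cl_mono (hSP.trans (by grind)) (hvS i)
    · exact mem_cl (.inr rfl)
  have hx₁P : x₁ ∉ cl P := by
    refine fun h => hzP (cl_le (Set.union_subset (subset_cl _) ?_) hzx)
    exact Set.singleton_subset_iff.2 h
  have hgx₁ : Good L P x₁ := (hb.good.eqv hx₁).up (subset_cl_of hmP) hx₁P
  refine ⟨z, hzy, H.good_of_interdef hS hSi hα (m := m) (x := x₁) ?_ (hP ▸ hzx)
    (hP ▸ hgx₁.exchange H hPi hzx hzP) (hP ▸ hgx₁) hzS⟩
  refine hmy.right (Set.union_subset (subset_cl_of (by grind)) ?_)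
  exact Set.singleton_subset_iff.2 (cl_mono (by grind) hzy)

end Point

end QFree

namespace QFree

section Cover

variable {L : FirstOrder.Language.{u, u}} {M : Type u} [L.Structure M]

local notation "cl" => clos L

variable {κ μ : Cardinal.{u}} {ι γ I α : Type u} {P Q N N' S X X₀ Y Z B A E : Set M} {b y : M}

theorem FB.exists_uncountable_indep (H : Mon L M κ μ) [Countable α] {m₀ : α → M} {b₀ : M}
    (h₀ : FB L m₀ b₀) (hE : cl E = E) (hEc : ∀ C ⊆ E, C.Countable → ¬ E ⊆ cl C) :
    ∃ S ⊆ E, S.Countable ∧ (cl S).Infinite ∧ ∃ Z ⊆ E, ¬ Z.Countable ∧ Indep L S Z ∧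
      ∀ z ∈ Z, Good L S z := by
  have hEi : E.Infinite := fun hf => hEc E subset_rfl hf.countable (subset_cl _)
  obtain ⟨f⟩ := Nonempty.intro (Set.Infinite.natEmbedding E hEi)
  obtain ⟨X₀, hX₀⟩ : ∃ X₀, X₀ = Set.range fun n => (f n : M) := ⟨_, rfl⟩
  have hXE : X₀ ⊆ E := by
    rw [hX₀]
    rintro _ ⟨n, rfl⟩
    exact (f n).2
  have hXc : X₀.Countable := hX₀ ▸ Set.countable_range _
  have hXi : X₀.Infinite := by
    rw [hX₀]
    exact Set.infinite_range_of_injective (Subtype.val_injective.comp f.injective)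
  have hinf : ∀ N, X₀ ⊆ N → (cl N).Infinite := fun N h => hXi.mono (h.trans (subset_cl _))
  by_contra! hn
  obtain ⟨G, hG, hGE, hGR, δ, hδ, hδ', hfs⟩ := H.club_rec hXc (hinf X₀ subset_rfl) hXE
    (fun N G => (∀ z ∈ E, Good L N z → z ∈ cl (N ∪ G)) ∧ ∃ y ∈ G, y ∉ cl N) (by
      intro N hN hXN hNE
      obtain ⟨B, hBE, hB, hEB⟩ := exists_maximal_indep H (hinf N hXN) (subset_cl N)
        (E := {z ∈ E | Good L N z}) fun z hz => .inl hz.2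
      have hBc : B.Countable := by
        by_contra hBc
        obtain ⟨z, hz, hz'⟩ := hn N hNE hN (hinf N hXN) B (hBE.trans fun z hz => hz.1) hBc hB
        exact hz' (hBE hz).2
      obtain ⟨y, hyE, hy⟩ := Set.not_subset.1 (hEc N hNE hN)
      refine ⟨insert y B, hBc.insert y, Set.insert_subset hyE (hBE.trans fun z hz => hz.1),
        fun z hz hz' => cl_mono (Set.union_subset_union_right _ (Set.subset_insert _ _))
          (hEB ⟨hz, hz'⟩), y, Set.mem_insert _ _, hy⟩)
  obtain ⟨y, hyG, hy⟩ := (hGR δ).2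
  obtain ⟨β, hβ, hfsβ⟩ := hfs {y} (Set.finite_singleton y)
    (Set.singleton_subset_iff.2 (QFree.mem_cl (subset_Nall (G := G) δ hyG)))
  have hNβ := H.small_countable (Nn_countable hXc hG β)
  obtain ⟨w, hw, hwg⟩ := h₀.exists_good H hNβ (hinf _ subset_Nn)
    (fun h => hy (cl_mono (Nn_mono hβ.le) h))
  have hNE : ∀ ν, Nn X₀ G ν ⊆ E := fun ν =>
    Set.union_subset hXE (Set.iUnion₂_subset fun ν _ => hGE ν)
  have hwE : w ∈ E := by
    rw [← hE]
    exact cl_mono (Set.union_subset (hNE β) (Set.singleton_subset_iff.2 (hGE δ hyG))) hw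
  have h1 := (hGR β).1 w hwE hwg
  obtain ⟨β', hβ', hββ⟩ := hδ' β hβ
  exact hwg.1 (hfsβ.mem (subset_cl_of (Nn_mono hβ.le)) hw
    (cl_mono (Set.union_subset (Nn_mono hβ.le) (subset_Nn_of_lt hβ)) h1))

theorem Good.exists_conj (H : Mon L M κ μ) {z z₀ z' : M} (hSi : (cl S).Infinite)
    (h₀ : Good L S z₀) (hz : z ∉ cl S) (he : Eqv L S z z') (hz' : z' ∈ cl (S ∪ {z₀})) :
    ∃ w ∈ cl (S ∪ {z}), z ∈ cl (S ∪ {w}) ∧ Eqv L S z₀ w := by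
  have hz'S : z' ∉ cl S := fun h => hz (he.symm.mem_cl h)
  obtain ⟨f, hf, hfz⟩ := exists_TF_single (h₀.exchange H hSi hz' hz'S)
  obtain ⟨g, hg, hgz⟩ := exists_TF_single hz'
  have h1 := EqT.comp he (α := PUnit.{u + 1}) (f := fun _ => f) fun _ => hf
  rw [hfz] at h1
  have h2 : g (fun _ => f fun _ => z) = z := by
    refine EqT.tf_eq he.symm (hg.comp (g := fun _ => f) fun _ => hf)
      (.var (PUnit.unit : PUnit.{u + 1})) ?_
    change g (fun _ => f fun _ => z') = z'
    rw [hfz, hgz]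
  refine ⟨f fun _ => z, hf.mem_cl (subset_cl_of (by grind)) fun _ => QFree.mem_cl (.inr rfl), ?_,
    EqT.symm h1⟩
  have h3 : g (fun _ => f fun _ => z) ∈ cl (S ∪ {f fun _ => z}) :=
    hg.mem_cl (subset_cl_of Set.subset_union_left) fun _ => QFree.mem_cl (.inr rfl)
  rwa [h2] at h3

theorem Indep.of_interdef {w : M → M} (hZ : Indep L S Z) (hw : ∀ z ∈ Z, w z ∈ cl (S ∪ {z}))
    (hw' : ∀ z ∈ Z, z ∈ cl (S ∪ {w z})) : Set.InjOn w Z ∧ Indep L S (w '' Z) := by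
  have hinj : Set.InjOn w Z := by
    intro z hz z' hz' e
    by_contra hne
    refine hZ z hz (cl_mono (P := S ∪ {z'}) (by grind) ?_)
    refine cl_le (Set.union_subset (subset_cl_of (by grind)) ?_) (hw' z hz)
    rw [e]
    exact Set.singleton_subset_iff.2 (hw z' hz')
  refine ⟨hinj, ?_⟩
  rintro _ ⟨z, hz, rfl⟩ hm
  refine hZ z hz (cl_le (Set.union_subset (subset_cl_of (by grind))
    (Set.singleton_subset_iff.2 (cl_le (Set.union_subset (subset_cl_of (by grind)) ?_) hm)))
    (hw' z hz))
  rintro _ ⟨⟨z', hz', rfl⟩, hne⟩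
  refine cl_mono ?_ (hw z' hz')
  have : z' ≠ z := fun e => hne (by rw [e]; rfl)
  grind

theorem Mon.exists_cover (H : Mon L M κ μ) {g D : Set M} (x : Finset M) (hSE : S ⊆ E)
    (hS : S.Countable) (hSi : (cl S).Infinite) (hZE : Z ⊆ E) (hZc : ¬ Z.Countable)
    (hZ : Indep L S Z) (hZg : ∀ z ∈ Z, Good L S z) (hcl : cl E = E) (hD : #D ≤ μ)
    (hDi : (cl D).Infinite) (hg : #g ≤ μ) (hfs : FS L D (S ∪ g) S) (hgx : g ⊆ cl (S ∪ D ∪ x))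
    (hx : ∀ z ∈ x, Good L D z) (hcov : ∀ z ∈ Z, ∃ z' ∈ cl (S ∪ g), Eqv L S z z') :
    ∃ S' ⊆ E, S'.Countable ∧ (cl S').Infinite ∧ ∃ c, Good L S' c ∧ ∃ W ⊆ E, ¬ W.Countable ∧
      Indep L S' W ∧ ∀ w ∈ W, Eqv L S' c w := by
  classical
  induction hk : x.card using Nat.strong_induction_on generalizing x S Z g D with
  | _ k ih =>
  obtain ⟨z₀, hz₀⟩ : Z.Nonempty := by
    by_contra hne
    rw [Set.not_nonempty_iff_eq_empty.1 hne] at hZc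
    exact hZc Set.countable_empty
  obtain ⟨y, hy, hyz⟩ := hcov z₀ hz₀
  have hSs := H.small_countable hS
  obtain ⟨h, h1, h2, h3⟩ := H.move hSs hSi hyz.symm H.small_punit (W := g ∪ D ∪ x)
    (H.small_union (H.small_union hg hD) (H.small_finite x.finite_toSet))
  rw [Set.range_const] at h1
  have h3 : h y = z₀ := h3 ⟨⟩
  obtain ⟨V, hV⟩ : ∃ V, V = S ∪ {y} ∪ (g ∪ D ∪ x) := ⟨_, rfl⟩
  rw [← hV] at h1
  have hSV : S ⊆ cl V := subset_cl_of (by clear * - hV; grind)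
  have hgV : g ⊆ cl V := subset_cl_of (by clear * - hV; grind)
  have hDV : D ⊆ cl V := subset_cl_of (by clear * - hV; grind)
  have hxV : (x : Set M) ⊆ cl V := subset_cl_of (by clear * - hV; grind)
  have hyV : y ∈ cl V := QFree.mem_cl (by clear * - hV; grind)
  have hhS : h '' S = S := (Set.image_congr h2).trans (Set.image_id' S)
  obtain ⟨g₁, hg₁⟩ : ∃ g₁, g₁ = h '' g := ⟨_, rfl⟩
  obtain ⟨D₁, hD₁⟩ : ∃ D₁, D₁ = h '' D := ⟨_, rfl⟩
  have hfs₁ : FS L D₁ (S ∪ g₁) S := by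
    have := hfs.pe h1 hDV (Set.union_subset hSV hgV) (cl_le hSV)
    rwa [Set.image_union, hhS, ← hg₁, ← hD₁] at this
  have hgx₁ : g₁ ⊆ cl (S ∪ D₁ ∪ (x.image h : Finset M)) := by
    rw [hg₁]
    rintro _ ⟨a, ha, rfl⟩
    have := h1.mem_cl (Set.union_subset (Set.union_subset hSV hDV) hxV) (hgV ha) (hgx ha)
    rwa [Set.image_union, Set.image_union, hhS, ← hD₁, ← Finset.coe_image] at this
  have hx₁ : ∀ z ∈ x.image h, Good L D₁ z := by
    intro z hz
    obtain ⟨a, ha, rfl⟩ := Finset.mem_image.1 hz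
    rw [hD₁]
    exact (hx a ha).pe H h1 hDV (hxV ha) hD hDi
  have hcov₁ : ∀ z ∈ Z, ∃ z' ∈ cl (S ∪ g₁), Eqv L S z z' := by
    intro z hz
    obtain ⟨z', hz', he⟩ := hcov z hz
    have hzV : z' ∈ cl V := cl_le (Set.union_subset hSV hgV) hz'
    refine ⟨h z', ?_, he.trans (h1.eqT_self hSV h2 fun _ => hzV)⟩
    have := h1.mem_cl (Set.union_subset hSV hgV) hzV hz'
    rwa [Set.image_union, hhS, ← hg₁] at this
  have hz₀g : z₀ ∈ cl (S ∪ g₁) := by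
    have := h1.mem_cl (Set.union_subset hSV hgV) hyV hy
    rwa [Set.image_union, hhS, ← hg₁, h3] at this
  have hD₁s : #D₁ ≤ μ := hD₁ ▸ H.small_image hD h
  have hg₁s : #g₁ ≤ μ := hg₁ ▸ H.small_image hg h
  have hD₁i : (cl D₁).Infinite := by
    have := (h1.mono (cl_le hDV)).image_cl
    rw [hD₁, ← this]
    exact hDi.image (h1.mono (cl_le hDV)).injOn
  choose! ζ hζ hζe using hcov₁
  obtain ⟨Z₁, hZ₁⟩ : ∃ Z₁, Z₁ = {z ∈ Z | ζ z ∉ cl (S ∪ {z₀})} \ {z₀} := ⟨_, rfl⟩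
  obtain ⟨Z₂, hZ₂⟩ : ∃ Z₂, Z₂ = {z ∈ Z | ζ z ∈ cl (S ∪ {z₀})} := ⟨_, rfl⟩
  have hZ₂Z : Z₂ ⊆ Z := by rw [hZ₂]; exact Set.sep_subset _ _
  by_cases hZ₁c : Z₁.Countable
  · have hZ₂c : ¬ Z₂.Countable := by
      intro hc
      refine hZc (((hZ₁c.insert z₀).union hc).mono ?_)
      intro z hz
      by_cases e : z = z₀
      · exact .inl (.inl e)
      · by_cases hzz : ζ z ∈ cl (S ∪ {z₀})
        · exact .inr (by rw [hZ₂]; exact ⟨hz, hzz⟩)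
        · exact .inl (.inr (by rw [hZ₁]; exact ⟨⟨hz, hzz⟩, e⟩))
    have hw : ∀ z ∈ Z₂, ∃ w ∈ cl (S ∪ {z}), z ∈ cl (S ∪ {w}) ∧ Eqv L S z₀ w := by
      intro z hz
      have hz' : ζ z ∈ cl (S ∪ {z₀}) := by
        rw [hZ₂] at hz
        exact hz.2
      exact (hZg z₀ hz₀).exists_conj H hSi (hZg z (hZ₂Z hz)).1 (hζe z (hZ₂Z hz)) hz'
    choose! w hw1 hw2 hw3 using hw
    obtain ⟨h4, h5⟩ := (hZ.mono hZ₂Z (subset_cl S)).of_interdef hw1 hw2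
    refine ⟨S, hSE, hS, hSi, z₀, hZg z₀ hz₀, w '' Z₂, ?_, fun hc => hZ₂c ?_, h5, ?_⟩
    · rintro _ ⟨z, hz, rfl⟩
      rw [← hcl]
      exact cl_mono (Set.union_subset hSE (Set.singleton_subset_iff.2 (hZE (hZ₂Z hz)))) (hw1 z hz)
    · exact (Set.countable_of_injective_of_countable_image h4 hc)
    · rintro _ ⟨z, hz, rfl⟩
      exact hw3 z hz
  · have hz₀D : z₀ ∉ cl (S ∪ D₁) := by
      intro hm
      have h4 : FS L D₁ (S ∪ {z₀}) S := hfs₁.right (Set.union_subset (subset_cl_of (by clear * -; grind))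
        (Set.singleton_subset_iff.2 hz₀g))
      have h5 := H.sym_fs hSi h4
      exact (hZg z₀ hz₀).1 (h5.mem (subset_cl_of (by clear * -; grind)) (QFree.mem_cl (by clear * -; grind)) hm)
    obtain ⟨z, hz, hz'⟩ := exists_exchange H hD₁i (x.image h) (P := S ∪ D₁)
      (subset_cl_of (by clear * -; grind)) (fun z hz => .inl (hx₁ z hz))
      (cl_le (Set.union_subset (subset_cl_of (by clear * -; grind)) hgx₁) hz₀g) hz₀D
    have hZ₁Z : ∀ z ∈ Z₁, z ∈ Z ∧ z ≠ z₀ ∧ ζ z ∉ cl (S ∪ {z₀}) := by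
      rw [hZ₁]
      exact fun z hz => ⟨hz.1.1, hz.2, hz.1.2⟩
    have hZ₁n : ∀ z ∈ Z₁, z ∉ cl (S ∪ {z₀}) := fun z hz hm =>
      hZ z (hZ₁Z z hz).1 (cl_mono (by have := hZ₁Z z hz; clear * - this hz₀; grind) hm)
    have hSz : S ⊆ cl (S ∪ {z₀}) := subset_cl_of (by clear * -; grind)
    refine ih ((x.image h).erase z).card ?_ (S := S ∪ {z₀}) (Z := Z₁) (g := g₁) (D := D₁) _
      (Set.union_subset hSE (Set.singleton_subset_iff.2 (hZE hz₀)))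
      (hS.union (Set.countable_singleton _)) (hSi.mono (cl_le hSz))
      (fun z hz => hZE (hZ₁Z z hz).1) hZ₁c
      ?_ (fun z hz => (hZg z (hZ₁Z z hz).1).up hSz (hZ₁n z hz)) hD₁s hD₁i hg₁s ?_ ?_
      (fun a ha => hx₁ a (Finset.mem_of_mem_erase ha)) ?_ rfl
    · rw [← hk]
      exact (Finset.card_lt_card (Finset.erase_ssubset hz)).trans_le Finset.card_image_le
    · intro z hz hm
      refine hZ z (hZ₁Z z hz).1 (cl_mono ?_ hm)
      have := hZ₁Z z hz
      have h0 := hZ₁Z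
      clear * - this hz₀ h0
      grind
    · exact (hfs₁.right (Set.union_subset (Set.union_subset (subset_cl_of (by clear * -; grind))
        (Set.singleton_subset_iff.2 hz₀g)) (subset_cl_of (by clear * -; grind)))).base hSz
    · refine hgx₁.trans (cl_le (Set.union_subset (subset_cl_of (by clear * -; grind)) ?_))
      intro a ha
      by_cases e : a = z
      · rw [e]
        refine cl_mono ?_ hz'
        rw [Finset.coe_erase]
        clear * -
        grind
      · exact QFree.mem_cl (.inr (Finset.mem_coe.2 (Finset.mem_erase.2 ⟨e, ha⟩)))
    · intro z hz
      obtain ⟨h4, h5, h6⟩ := hZ₁Z z hz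
      exact ⟨ζ z, cl_mono (by clear * -; grind) (hζ z h4),
        (hZg z h4).eqv_of H hSi (.refl z) (hζe z h4) hSz (hZ₁n z hz) h6⟩

end Cover

end QFree

namespace QFree

section Cover

variable {L : FirstOrder.Language.{u, u}} {M : Type u} [L.Structure M]

local notation "cl" => clos L


theorem exists_uncountable_fiber {β : Type*} {Z : Set M} (hZ : ¬ Z.Countable) (F : M → β)
    {T : Set β} (hT : T.Countable) (hF : ∀ z ∈ Z, F z ∈ T) :
    ∃ t ∈ T, ¬ {z ∈ Z | F z = t}.Countable := by
  by_contra! hn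
  refine hZ ((hT.biUnion hn).mono fun z hz => ?_)
  exact Set.mem_biUnion (hF z hz) (⟨hz, rfl⟩ : z ∈ {z' ∈ Z | F z' = F z})

theorem FB.exists_eqv_family (H : Mon L M κ μ) [Countable α] {m₀ : α → M} {b₀ : M}
    (h₀ : FB L m₀ b₀) (hE : cl E = E) (hEc : ∀ C ⊆ E, C.Countable → ¬ E ⊆ cl C) :
    ∃ S : Set M, S ⊆ E ∧ S.Countable ∧ (cl S).Infinite ∧ ∃ c : M, Good L S c ∧ ∃ W ⊆ E, ¬ W.Countable ∧
      Indep L S W ∧ ∀ w ∈ W, Eqv L S c w := by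
  have hα : #α ≤ μ := H.small_countable'
  obtain ⟨S, hSE, hS, hSi, Z₀, hZ₀E, hZ₀c, hZ₀, hZ₀g⟩ := h₀.exists_uncountable_indep H hE hEc
  have hSs := H.small_countable hS
  obtain ⟨Z, hZZ, hZm⟩ : ∃ Z ⊆ Z₀, #Z = ℵ_ 1 := by
    refine le_mk_iff_exists_subset.1 ?_
    rw [← succ_aleph0, Order.succ_le_iff]
    rw [← le_aleph0_iff_set_countable] at hZ₀c
    exact not_le.1 hZ₀c
  have hZc : ¬ Z.Countable := by
    rw [← le_aleph0_iff_set_countable, hZm, ← succ_aleph0, not_le]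
    exact Order.lt_succ _
  have hZs : #Z ≤ μ := by
    rw [hZm, ← succ_aleph0]
    exact (Order.succ_le_of_lt H.hκ).trans H.hμ
  have hZi : Indep L S Z := hZ₀.mono hZZ (subset_cl S)
  have hZg : ∀ z ∈ Z, Good L S z := fun z hz => hZ₀g z (hZZ hz)
  obtain ⟨m, hm0, hmZ⟩ := H.coheir hα hSs hSi m₀ (P := Z) hZs
  obtain ⟨b, -, hb⟩ := h₀.exists_eqT H (hm0.mono (Set.empty_subset _))
  obtain ⟨N, hN⟩ : ∃ N, N = S ∪ Set.range m := ⟨_, rfl⟩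
  have hSN : S ⊆ cl N := subset_cl_of (hN ▸ Set.subset_union_left)
  have hmN : Set.range m ⊆ cl N := subset_cl_of (hN ▸ Set.subset_union_right)
  have hNi : (cl N).Infinite := hSi.mono (cl_le hSN)
  have hzN : ∀ z ∈ Z, z ∉ cl N := by
    intro z hz hm
    have h1 : FS L {z} (S ∪ Set.range m) S := H.sym hSi hmZ (subset_cl_of Set.subset_union_right)
      (subset_cl_of (Set.singleton_subset_iff.2 (.inl hz)))
    rw [← hN] at h1
    exact (hZg z hz).1 (h1.mem hSN (QFree.mem_cl (.inr rfl)) hm)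
  have hx : ∀ z ∈ Z, ∃ x ∈ cl (N ∪ {z}), Eqv L (Set.range m) b x ∧ x ∉ cl N := by
    intro z hz
    by_contra! hne
    refine hzN z hz (cl_le (Set.union_subset (subset_cl _) ?_) ((hb.full z).mono hmN))
    rintro y ⟨hy, hyz⟩
    exact hne y hyz hy
  obtain ⟨z₀, hz₀⟩ : Z.Nonempty := by
    by_contra hne
    rw [Set.not_nonempty_iff_eq_empty.1 hne] at hZc
    exact hZc Set.countable_empty
  obtain ⟨x, -, hxb, hxN⟩ := hx z₀ hz₀
  have hz' : ∀ z ∈ Z, ∃ z' ∈ cl (N ∪ {x}), Eqv L S z z' := by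
    intro z hz
    obtain ⟨y, hyz, hyb, hyN⟩ := hx z hz
    obtain ⟨f, hf, hfz⟩ := exists_TF_single
      (((hZg z hz).up hSN (hzN z hz)).exchange H hNi hyz hyN)
    have h1 := EqT.comp (hb.good.eqv_of H hb.inf hyb hxb hmN hyN hxN) (α := PUnit.{u + 1})
      (f := fun _ => f) fun _ => hf
    rw [hfz] at h1
    exact ⟨f fun _ => x, hf.mem_cl (subset_cl_of Set.subset_union_left)
      fun _ => QFree.mem_cl (.inr rfl), h1.mono hSN⟩
  have hF : ∀ z ∈ Z, ∃ F : Set M, (F.Finite ∧ F ⊆ Set.range m) ∧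
      ∃ z' ∈ cl (S ∪ (F ∪ {x})), Eqv L S z z' := by
    intro z hz
    obtain ⟨z', h1, h2⟩ := hz' z hz
    obtain ⟨F, h3, h4, h5⟩ := cl_finite_union (N := S ∪ {x}) (P := Set.range m)
      (Set.finite_singleton z') (Set.singleton_subset_iff.2 (cl_mono (by
        rw [hN]; clear * -; grind) h1))
    exact ⟨F, ⟨h4, h3⟩, z', cl_mono (by clear * -; grind) (h5 rfl), h2⟩
  choose! F hF hFz using hF
  obtain ⟨F₀, hF₀, hZ'⟩ := exists_uncountable_fiber hZc F
    (Set.countable_ofPred_finite_subset (Set.countable_range m)) hF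
  have hgf : (F₀ ∪ {x}).Finite := hF₀.1.union (Set.finite_singleton x)
  have hgs : #(F₀ ∪ {x} : Set M) ≤ μ := H.small_finite hgf
  obtain ⟨n, hn0, hng⟩ := H.coheir hα hSs hSi m₀ (P := F₀ ∪ {x}) hgs
  obtain ⟨c, -, hc⟩ := h₀.exists_eqT H (hn0.mono (Set.empty_subset _))
  obtain ⟨y, hy, hyf, hgy⟩ := cl_finite_union (N := S ∪ Set.range n)
    (P := {y | Eqv L (Set.range n) c y}) hgf (by
      intro a ha
      refine cl_mono ?_ (hc.full a)
      exact Set.union_subset_union Set.subset_union_right Set.inter_subset_left)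
  refine Mon.exists_cover H (g := F₀ ∪ {x}) (D := Set.range n) hyf.toFinset hSE hS hSi
    (Z := {z ∈ Z | F z = F₀}) (fun z hz => hZ₀E (hZZ hz.1)) hZ'
    (hZi.mono (fun z hz => hz.1) (subset_cl S)) (fun z hz => hZg z hz.1) hE (H.small_range hα n)
    hc.inf hgs (by rwa [Set.union_comm S]) (by rwa [Set.Finite.coe_toFinset]) ?_ ?_
  · intro z hz
    exact hc.good.eqv (hy (hyf.mem_toFinset.1 hz))
  · intro z hz
    rw [← hz.2]
    exact hFz z hz.1

end Cover

end QFree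

namespace QFree

section Cover

variable {L : FirstOrder.Language.{u, u}} {M : Type u} [L.Structure M]

local notation "cl" => clos L


theorem SG.not_countable {lam : Cardinal.{u}} (hlam : ℵ₀ < lam) (h : SG L lam E) (hE : cl E = E) :
    ∀ C : Set M, C ⊆ E → C.Countable → ¬ E ⊆ cl C := by
  intro C hC hCc hn
  have h1 : cl C = E := (hn.antisymm ((cl_mono hC).trans hE.subset)).symm
  exact hlam.not_ge ((h.2 C h1).trans (le_aleph0_iff_set_countable.2 hCc))

theorem FB.exists_copy (H : Mon L M κ μ) [Countable α] {m₀ : α → M} {b₀ : M}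
    (h₀ : FB L m₀ b₀) (hE : cl E = E) (hEc : ∀ C ⊆ E, C.Countable → ¬ E ⊆ cl C) :
    ∃ m' : α → M, (∀ i, m' i ∈ E) ∧ EqT L ∅ m₀ m' := by
  obtain ⟨S, hSE, hS, hSi, c, hc, W, hWE, hWc, hW, hWe⟩ := h₀.exists_eqv_family H hE hEc
  have hα : #α ≤ μ := H.small_countable'
  have hI : #κ.out = κ := mk_out κ
  obtain ⟨a, ha1, ha2, ha3⟩ := h₀.good.exists_seq H h₀.inf (subset_cl _) (H.small_range hα m₀)
    κ.out (hI.trans_le H.hμ)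
  obtain ⟨d, hd1, hd2, hd3⟩ := hc.exists_seq H hSi (subset_cl _) (H.small_countable hS)
    κ.out (hI.trans_le H.hμ)
  have h1 : SG L κ (cl (Set.range m₀ ∪ Set.range a)) := ha3.sg H.hκ
    ((mk_range_eq a ha2).trans hI) ((le_aleph0_iff_set_countable.2 (Set.countable_range m₀)).trans
      H.hκ.le)
  have h2 : SG L κ (cl (S ∪ Set.range d)) := hd3.sg H.hκ
    ((mk_range_eq d hd2).trans hI) ((le_aleph0_iff_set_countable.2 hS).trans H.hκ.le)
  obtain ⟨g, hg, hgi⟩ := H.uniq _ _ (cl_cl _) (cl_cl _) h1 h2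
  have hm : ∀ i, m₀ i ∈ cl (Set.range m₀ ∪ Set.range a) := fun i => QFree.mem_cl (.inl ⟨i, rfl⟩)
  obtain ⟨F, hF, hnF⟩ := cl_countable_union (Set.countable_range (g ∘ m₀)) (N := S) (a := d) (by
    rintro _ ⟨i, rfl⟩
    rw [← hgi]
    exact ⟨_, hm i, rfl⟩)
  obtain ⟨v⟩ : Nonempty (F ↪ W) := by
    rw [← Cardinal.le_def]
    refine (le_aleph0_iff_set_countable.2 hF).trans (not_le.1 ?_).le
    rwa [le_aleph0_iff_set_countable]
  have hdF : Set.range (fun i : F => d i) ⊆ Set.range d := by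
    rintro _ ⟨i, rfl⟩
    exact ⟨_, rfl⟩
  have hvW : Set.range (fun i : F => (v i : M)) ⊆ W := by
    rintro _ ⟨i, rfl⟩
    exact (v i).2
  have h3 : EqT L S (fun i : F => d i) fun i => (v i : M) :=
    hc.indep_eqT H hSi (subset_cl S) (fun i => hd1 i) (hd2.comp Subtype.val_injective)
      (hd3.mono hdF (subset_cl S)) (fun i => hWe _ (v i).2)
      (Subtype.val_injective.comp v.injective) (hW.mono hvW (subset_cl S))
  obtain ⟨h, hh, hhS, hhd⟩ := h3.exists_pe
  have hn : ∀ i, (g ∘ m₀) i ∈ cl (S ∪ Set.range fun i : F => d i) := by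
    intro i
    have := hnF ⟨i, rfl⟩
    rwa [Set.image_eq_range] at this
  refine ⟨h ∘ g ∘ m₀, fun i => ?_, (hg.eqT hm).trans (hh.eqT hn)⟩
  have h4 : h ((g ∘ m₀) i) ∈ h '' cl (S ∪ Set.range fun i : F => d i) := ⟨_, hn i, rfl⟩
  rw [hh.image_cl] at h4
  rw [← hE]
  refine cl_mono ?_ h4
  rintro _ ⟨y, hy | ⟨i, rfl⟩, rfl⟩
  · rw [hhS y hy]
    exact hSE hy
  · change h (d i) ∈ E
    rw [hhd i]
    exact hWE (v i).2

theorem FB.exists_basis (H : Mon L M κ μ) [Countable α] {m₀ : α → M} {b₀ : M}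
    (h₀ : FB L m₀ b₀) {lam : Cardinal.{u}} (hlam : ℵ₀ < lam) (hE : cl E = E) (hEs : SG L lam E) :
    ∃ (m : α → M) (b : M) (B : Set M),
      EqT L ∅ (Sum.elim m₀ fun _ : PUnit.{u + 1} => b₀) (Sum.elim m fun _ => b) ∧ FB L m b ∧
      #B = lam ∧ (∀ z ∈ B, Eqv L (Set.range m) b z) ∧ Indep L (Set.range m) B ∧
      cl (Set.range m ∪ B) = E := by
  obtain ⟨m, hmE, hm⟩ := h₀.exists_copy H hE (hEs.not_countable hlam hE)
  obtain ⟨b, hmb, hb⟩ := h₀.exists_eqT H hm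
  have hmE : Set.range m ⊆ E := by
    rintro _ ⟨i, rfl⟩
    exact hmE i
  obtain ⟨B, hBE, hB, hEB⟩ := exists_maximal_indep H hb.inf (subset_cl _)
    (E := {z | Eqv L (Set.range m) b z} ∩ E) fun z hz => .inl (hb.good.eqv hz.1)
  have h1 : cl (Set.range m ∪ B) = E := by
    refine (((cl_mono (Set.union_subset hmE fun z hz => (hBE hz).2)).trans hE.subset)).antisymm ?_
    intro y hy
    refine cl_le (Set.union_subset (subset_cl_of Set.subset_union_left) ?_) (hb.full y)
    intro z hz
    refine hEB ⟨hz.1, ?_⟩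
    rw [← hE]
    exact cl_mono (Set.union_subset hmE (Set.singleton_subset_iff.2 hy)) hz.2
  refine ⟨m, b, B, hmb, hb, le_antisymm ?_ ?_, fun z hz => (hBE hz).1, hB, h1⟩
  · by_contra! hn
    obtain ⟨Y, hY, hYE⟩ := hEs.1
    obtain ⟨z, hz, hz'⟩ := hB.exists_notMem (hlam.trans hn) le_rfl (hY.trans_lt hn) (by
      rw [h1, ← hYE]
      exact subset_cl Y)
    refine hz' (cl_mono Set.subset_union_right ?_)
    rw [hYE]
    exact (hBE hz).2
  · by_contra! hn
    exact ((hEs.2 _ h1).trans (mk_union_le _ _)).not_gt (add_lt_of_lt hlam.le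
      ((le_aleph0_iff_set_countable.2 (Set.countable_range m)).trans_lt hlam) hn)

theorem Mon.sg_unique (H : Mon L M κ μ) {lam : Cardinal.{u}} (hlam : ℵ₀ < lam) (hμ : lam ≤ μ)
    {E₁ E₂ : Set M} (h₁ : cl E₁ = E₁) (h₂ : cl E₂ = E₂) (hs₁ : SG L lam E₁) (hs₂ : SG L lam E₂) :
    ∃ g, PE L E₁ g ∧ g '' E₁ = E₂ := by
  obtain ⟨α, _, m₀, b₀, h₀⟩ := H.exists_FB
  have hα : #α ≤ μ := H.small_countable'
  obtain ⟨m₁, b₁, B₁, he₁, hf₁, hB₁, hBe₁, hBi₁, rfl⟩ := h₀.exists_basis H hlam h₁ hs₁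
  obtain ⟨m₂, b₂, B₂, he₂, hf₂, hB₂, hBe₂, hBi₂, rfl⟩ := h₀.exists_basis H hlam h₂ hs₂
  obtain ⟨g, hg, hgm⟩ := H.move_fam (he₁.symm.trans he₂) (H.small_sum hα H.small_punit)
    (hf₁.inf.mono (cl_mono (by
      rintro _ ⟨i, rfl⟩
      exact ⟨.inl i, rfl⟩))) (W := B₁) (hB₁.trans_le hμ)
  obtain ⟨i₁⟩ : Nonempty (lam.out ≃ B₁) := Cardinal.eq.1 ((mk_out lam).trans hB₁.symm)
  obtain ⟨i₂⟩ : Nonempty (lam.out ≃ B₂) := Cardinal.eq.1 ((mk_out lam).trans hB₂.symm)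
  rw [Set.Sum.elim_range, Set.range_const] at hg
  have hgm1 : ∀ i, g (m₁ i) = m₂ i := fun i => hgm (.inl i)
  have hgb : g b₁ = b₂ := hgm (.inr ⟨⟩)
  obtain ⟨V, hV⟩ : ∃ V, V = Set.range m₁ ∪ {b₁} ∪ B₁ := ⟨_, rfl⟩
  rw [← hV] at hg
  have hmV : Set.range m₁ ⊆ cl V := subset_cl_of (by rw [hV]; clear * -; grind)
  have hbV : b₁ ∈ cl V := QFree.mem_cl (by rw [hV]; clear * -; grind)
  have hBV : B₁ ⊆ cl V := subset_cl_of (by rw [hV]; clear * -; grind)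
  have hgr : g '' Set.range m₁ = Set.range m₂ := by
    rw [← Set.range_comp]
    exact congrArg Set.range (funext hgm1)
  have hr₁ : Set.range (fun i => (i₁ i : M)) = B₁ := by
    rw [Set.range_comp' Subtype.val i₁, i₁.range_eq_univ, Set.image_univ, Subtype.range_coe]
  have hr₂ : Set.range (fun i => (i₂ i : M)) = B₂ := by
    rw [Set.range_comp' Subtype.val i₂, i₂.range_eq_univ, Set.image_univ, Subtype.range_coe]
  have h3 := hBi₁.pe hg hmV hBV
  rw [hgr] at h3
  have h4 : EqT L (Set.range m₂) (fun i => g (i₁ i)) fun i => (i₂ i : M) := by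
    refine hf₂.good.indep_eqT H hf₂.inf (subset_cl _) (fun i => ?_) (fun i j hij => ?_) ?_
      (fun i => hBe₂ _ (i₂ i).2) (Subtype.val_injective.comp i₂.injective) (by rwa [hr₂])
    · have := hg.eqv hmV hbV (hBV (i₁ i).2) (hBe₁ _ (i₁ i).2)
      rwa [hgr, hgb] at this
    · exact i₁.injective (Subtype.ext (hg.injOn (hBV (i₁ i).2) (hBV (i₁ j).2) hij))
    · rwa [← hr₁, ← Set.range_comp] at h3
  rw [← Set.empty_union (Set.range m₂), eqT_abs] at h4
  have h5 : EqT L ∅ (Sum.elim m₁ fun i => (i₁ i : M)) (Sum.elim m₂ fun i => g (i₁ i)) := by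
    have := hg.eqT (w := Sum.elim m₁ fun i => (i₁ i : M)) (by
      rintro (i | i)
      · exact hmV ⟨i, rfl⟩
      · exact hBV (i₁ i).2)
    refine (congrArg (EqT L ∅ (Sum.elim m₁ fun i => (i₁ i : M))) (funext ?_)).mp this
    rintro (i | i)
    · exact hgm1 i
    · rfl
  obtain ⟨h, hh, -, hhe⟩ := (h5.trans h4).exists_pe
  rw [Set.Sum.elim_range, Set.empty_union, hr₁] at hh
  refine ⟨h, hh, ?_⟩
  rw [hh.image_cl, Set.image_union, ← hr₁, ← Set.range_comp, ← Set.range_comp]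
  congr 2
  · exact congrArg Set.range (funext fun i => hhe (.inl i))
  · rw [← hr₂]
    exact congrArg Set.range (funext fun i => hhe (.inr i))

theorem Mon.exists_sg (H : Mon L M κ μ) {lam : Cardinal.{u}} (hlam : ℵ₀ < lam) (hμ : lam ≤ μ)
    {F : Set M} (hF : F.Countable) :
    ∃ E : Set M, cl E = E ∧ SG L lam E ∧ F ⊆ E := by
  obtain ⟨α, _, m, b, h⟩ := H.exists_FB
  have hc : (Set.range m ∪ F).Countable := (Set.countable_range m).union hF
  obtain ⟨a, ha1, ha2, ha3⟩ := h.good.exists_seq H h.inf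
    (P := Set.range m ∪ F) (Set.subset_union_left.trans (subset_cl _))
    (H.small_countable hc) lam.out ((mk_out lam).trans_le hμ)
  exact ⟨_, cl_cl _, ha3.sg hlam ((mk_range_eq a ha2).trans (mk_out lam))
    ((le_aleph0_iff_set_countable.2 hc).trans hlam.le),
    (Set.subset_union_right.trans Set.subset_union_left).trans (subset_cl _)⟩

end Cover

end QFree

namespace QFree

section Bridge

variable {L : FirstOrder.Language.{u, u}} {M : Type u} [L.Structure M]

local notation "cl" => clos L

theorem TF.exists_term {β : Type u} {f : (β → M) → M} (hf : TF L ∅ β f) :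
    ∃ t : L.Term β, ∀ x : β → M, f x = t.realize x := by
  induction hf with
  | const p hp => exact hp.elim
  | var i => exact ⟨.var i, fun _ => rfl⟩
  | func f g _ ih =>
    choose t ht using ih
    exact ⟨.func f t, fun x => by simp [Term.realize, ht]⟩

theorem tf_term {β : Type*} (t : L.Term β) : TF L (∅ : Set M) β (fun x => t.realize x) := by
  induction t with
  | var i => exact .var i
  | func f g ih => exact .func f _ ih

theorem QF.exists_formula {β : Type u} {A : Set (β → M)} (hA : QF L ∅ β A) :
    ∃ φ : L.Formula β, BoundedFormula.IsQF φ ∧ ∀ x, x ∈ A ↔ φ.Realize x := by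
  induction hA with
  | univ => exact ⟨⊤, BoundedFormula.IsQF.top, fun x => by simp⟩
  | eq f g hf hg =>
    obtain ⟨t, ht⟩ := hf.exists_term
    obtain ⟨s, hs⟩ := hg.exists_term
    exact ⟨t.equal s, (BoundedFormula.IsAtomic.equal _ _).isQF, fun x => by
      simp [ht, hs]⟩
  | rel R g hg =>
    choose t ht using fun i => (hg i).exists_term
    exact ⟨R.formula t, (BoundedFormula.IsAtomic.rel _ _).isQF, fun x => by
      simp [ht, Formula.realize_rel]⟩
  | compl A _ ih =>
    obtain ⟨φ, h, h'⟩ := ih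
    exact ⟨φ.not, h.not, fun x => by simp [h']⟩
  | inter A B _ _ ih ih' =>
    obtain ⟨φ, h, h'⟩ := ih
    obtain ⟨ψ, k, k'⟩ := ih'
    exact ⟨φ ⊓ ψ, h.inf k, fun x => by simp [h', k']⟩

theorem qf_bounded {β : Type u} {n : ℕ} (e : Fin n → M) {φ : L.BoundedFormula β n}
    (hφ : BoundedFormula.IsQF φ) :
    QF L (Set.range e) β {x : β → M | φ.Realize x e} := by
  have key : ∀ t : L.Term (β ⊕ Fin n), TF L (Set.range e) β
      (fun x : β → M => t.realize (Sum.elim x e)) := fun t => by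
    refine TF.comp ((tf_term t).mono (Set.empty_subset _)) (g := fun i x => Sum.elim x e i) ?_
    rintro (i | i)
    · exact .var i
    · exact .const _ ⟨i, rfl⟩
  induction hφ with
  | falsum => simpa [BoundedFormula.Realize] using (QF.univ (L := L) (P := Set.range e) (β := β)).compl
  | of_isAtomic h =>
    cases h with
    | equal t s => exact .eq _ _ (key t) (key s)
    | rel R ts => exact .rel R _ fun i => key (ts i)
  | @imp φ ψ _ _ ih ih' =>
    have := (ih.inter _ _ ih'.compl).compl
    convert this using 1
    ext x
    simp only [BoundedFormula.realize_imp, Set.mem_compl_iff, Set.mem_inter_iff,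
      Set.mem_ofPred_eq]
    tauto

theorem qf_formula {β : Type u} {φ : L.Formula β} (hφ : BoundedFormula.IsQF φ) :
    QF L (∅ : Set M) β {x : β → M | φ.Realize x} :=
  (qf_bounded default hφ).mono (by simp)

theorem isQF_relabel {β γ : Type u} (g : β → γ) {φ : L.Formula β}
    (hφ : BoundedFormula.IsQF φ) : BoundedFormula.IsQF (φ.relabel g) :=
  BoundedFormula.IsQF.relabel hφ _

/-- A map preserving quantifier-free formulas underlies an embedding. -/
theorem exists_embedding_of_qf {N : Type u} [L.Structure N] (w : M → N)
    (h : ∀ φ : L.Formula M, BoundedFormula.IsQF φ → φ.Realize id → φ.Realize w) :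
    ∃ j : M ↪[L] N, ∀ x, j x = w x := by
  have hn : ∀ φ : L.Formula M, BoundedFormula.IsQF φ → (φ.Realize id ↔ φ.Realize w) := by
    refine fun φ hφ => ⟨h φ hφ, fun h1 => ?_⟩
    by_contra h2
    exact (Formula.realize_not.1 (h _ hφ.not (Formula.realize_not.2 h2))) h1
  refine ⟨⟨⟨w, fun x y hxy => ?_⟩, fun {n} f x => ?_, fun {n} R x => ?_⟩, fun x => rfl⟩
  · have := hn ((Term.var x).equal (Term.var y)) (BoundedFormula.IsAtomic.equal _ _).isQF
    simp at this
    exact this.2 hxy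
  · have := h ((Term.func f fun i => Term.var (x i)).equal (Term.var (Structure.funMap f x)))
      (BoundedFormula.IsAtomic.equal _ _).isQF
    simp [Term.realize] at this
    exact this.symm
  · have := hn (R.formula fun i => Term.var (x i)) (BoundedFormula.IsAtomic.rel _ _).isQF
    simp [Formula.realize_rel, Term.realize] at this
    exact this.symm

theorem isUniversal_alls {n : ℕ} {ψ : L.BoundedFormula Empty n}
    (h : BoundedFormula.IsUniversal ψ) :
    BoundedFormula.IsUniversal ψ.alls := by
  induction n with
  | zero => exact h
  | succ n ih => exact ih h.all

theorem isUniversal_of_isUniversalTheory {T : L.Theory} (hT : IsUniversalTheory T) :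
    T.IsUniversal := by
  refine ⟨fun φ hφ => ?_⟩
  obtain ⟨n, ψ, hψ, rfl⟩ := hT φ hφ
  exact isUniversal_alls hψ.isUniversal

/-- Joint satisfiability of a set of formulas in a model of `T`. -/
def Sat {K : Type u} (T : L.Theory) (Δ : Set (L.Formula K)) : Prop :=
  ∃ (N : Type u) (_ : L.Structure N) (_ : Nonempty N) (v : K → N), N ⊨ T ∧ ∀ φ ∈ Δ, φ.Realize v

theorem Sat.mono {K : Type u} {T : L.Theory} {Δ Δ' : Set (L.Formula K)} (h : Sat T Δ')
    (hΔ : Δ ⊆ Δ') : Sat T Δ := by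
  obtain ⟨N, _, hN, v, hT, hv⟩ := h
  exact ⟨N, _, hN, v, hT, fun φ hφ => hv φ (hΔ hφ)⟩

theorem sat_iff_satisfiable {K : Type u} {T : L.Theory} {Δ : Set (L.Formula K)} :
    Sat T Δ ↔ ((L.lhomWithConstants K).onTheory T ∪
      Formula.equivSentence '' Δ).IsSatisfiable := by
  constructor
  · rintro ⟨N, _, hN, v, hT, hv⟩
    let _ := constantsOn.structure v
    have : N ⊨ (L.lhomWithConstants K).onTheory T := (LHom.onTheory_model _ _).2 hT
    have : N ⊨ ((L.lhomWithConstants K).onTheory T ∪ Formula.equivSentence '' Δ) := by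
      refine Theory.Model.union this ⟨?_⟩
      rintro _ ⟨φ, hφ, rfl⟩
      exact (Formula.realize_equivSentence N φ).2 (hv φ hφ)
    exact Theory.Model.isSatisfiable N
  · rintro ⟨N⟩
    let _ : L.Structure N := (L.lhomWithConstants K).reduct N
    have : (L.lhomWithConstants K).IsExpansionOn N := LHom.isExpansionOn_reduct _ _
    refine ⟨N, inferInstance, inferInstance, fun a => (L.con a : N), ?_, fun φ hφ => ?_⟩
    · exact (LHom.onTheory_model (L.lhomWithConstants K) T).1
        (N.is_model.mono Set.subset_union_left)
    · exact (Formula.realize_equivSentence N φ).1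
        (N.is_model.realize_of_mem _ (.inr ⟨φ, hφ, rfl⟩))

theorem sat_of_finite {K : Type u} {T : L.Theory} {Δ : Set (L.Formula K)}
    (h : ∀ Δ' ⊆ Δ, Δ'.Finite → Sat T Δ') : Sat T Δ := by
  rw [sat_iff_satisfiable, Theory.isSatisfiable_iff_isFinitelySatisfiable]
  intro T0 hT0
  have h1 := h (Δ ∩ Formula.equivSentence ⁻¹' T0) Set.inter_subset_left
    ((T0.finite_toSet.preimage Formula.equivSentence.injective.injOn).subset
      Set.inter_subset_right)
  refine (sat_iff_satisfiable.1 h1).mono fun σ hσ => ?_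
  rcases hT0 hσ with h2 | ⟨φ, hφ, rfl⟩
  · exact .inl h2
  · exact .inr ⟨φ, ⟨hφ, hσ⟩, rfl⟩

end Bridge

end QFree

namespace QFree

section Schedule

/-- A well-order of size `2 ^ μ` along which every one of `2 ^ μ` tasks recurs cofinally. -/
theorem exists_schedule {μ : Cardinal.{u}} (hμ : ℵ₀ ≤ μ) :
    ∃ (W : Type u) (_ : LinearOrder W), WellFoundedLT W ∧ #W = 2 ^ μ ∧
      ∀ Tk : Type u, #Tk ≤ 2 ^ μ → Nonempty Tk → ∃ e : W → Tk, ∀ (t : Tk) (s : Set W),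
        #s ≤ μ → ∃ w, e w = t ∧ ∀ x ∈ s, x < w := by
  have hinf : ℵ₀ ≤ (2 ^ μ : Cardinal.{u}) := hμ.trans (cantor μ).le
  refine ⟨(2 ^ μ : Cardinal.{u}).ord.ToType, inferInstance, inferInstance, mk_ord_toType _, ?_⟩
  intro Tk hTk hne
  obtain ⟨W, hW⟩ : ∃ W, W = (2 ^ μ : Cardinal.{u}).ord.ToType := ⟨_, rfl⟩
  have h1 : #((2 ^ μ : Cardinal.{u}).ord.ToType × Tk) = #((2 ^ μ : Cardinal.{u}).ord.ToType) := by
    rw [mk_prod, lift_id, lift_id, mk_ord_toType]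
    exact mul_eq_left hinf hTk (mk_ne_zero _)
  obtain ⟨h⟩ := Cardinal.eq.1 h1
  refine ⟨fun w => (h.symm w).2, fun t s hs => ?_⟩
  have hb : ∃ w0, ∀ x ∈ s, x < w0 := by
    by_contra! hc
    have h2 : IsCofinal s := fun w => hc w
    have h3 := Order.cof_le h2
    rw [Ordinal.cof_toType] at h3
    exact (lt_cof_ord_power hμ (one_lt_two : (1 : Cardinal.{u}) < 2)).not_ge (h3.trans hs)
  obtain ⟨w0, hw0⟩ := hb
  by_contra! hc
  have h4 : ∀ w', h (w', t) ≤ w0 := by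
    intro w'
    by_contra! h5
    obtain ⟨x, hx, hx'⟩ := hc (h (w', t)) (by simp)
    exact absurd ((hw0 x hx).trans h5) hx'.not_gt
  have h6 : #((2 ^ μ : Cardinal.{u}).ord.ToType) ≤ #(Set.Iic w0) :=
    mk_le_of_injective (f := fun w' => (⟨h (w', t), h4 w'⟩ : Set.Iic w0)) fun a b hab => by
      simpa using congrArg Subtype.val hab
  refine (mk_Iic_lt w0 ?_ ?_).not_ge h6
  · simp
  · simpa [mk_ord_toType] using hinf

end Schedule

section Universal

variable {L : FirstOrder.Language.{u, u}} {T : L.Theory}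

theorem sat_relabel_realize {K : Type u} {ι : Type u} {N : Type u} [L.Structure N] {v : K → N}
    {φ : L.Formula ι} {q : ι → K} : (φ.relabel q).Realize v ↔ φ.Realize (fun i => v (q i)) :=
  Formula.realize_relabel

theorem card_formula_le {β : Type u} {μ : Cardinal.{u}} (hμ : ℵ₀ ≤ μ) (hL : L.card ≤ μ)
    (hβ : #β ≤ μ) : #(L.Formula β) ≤ μ := by
  have h1 := BoundedFormula.card_le (L := L) (α := β)
  have h2 : #(L.Formula β) ≤ #(Σ n, L.BoundedFormula β n) :=
    mk_le_of_injective (f := fun φ : L.Formula β => (⟨0, φ⟩ : Σ n, L.BoundedFormula β n))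
      fun a b h => by simpa using h
  refine h2.trans (h1.trans (max_le hμ ?_))
  simpa using add_le_of_le hμ hβ hL

/-- A weak form of saturation: every small quantifier-free type over `v` that is realized in an
extension is realized. -/
theorem exists_saturated_assignment {X : Type u} [L.Structure X] [Nonempty X] (hX : X ⊨ T)
    {μ : Cardinal.{u}} (hμ : ℵ₀ ≤ μ) (hL : L.card ≤ μ) (hXμ : #X ≤ μ) (ι : Type u) (hι : #ι = μ) :
    ∃ (K : Type u) (i₀ : X → K) (N : Type u) (_ : L.Structure N) (_ : Nonempty N) (v : K → N),
      N ⊨ T ∧ (∀ φ : L.Formula X, BoundedFormula.IsQF φ → φ.Realize id →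
        φ.Realize (fun x => v (i₀ x))) ∧
      ∀ (Γ : ι → L.Formula (ι ⊕ ι)) (q : ι → K), (∀ i, BoundedFormula.IsQF (Γ i)) →
        ∀ (N' : Type u) (_ : L.Structure N') (v' : K → N') (z : ι → N'), N' ⊨ T →
        (∀ φ : L.Formula K, BoundedFormula.IsQF φ → φ.Realize v → φ.Realize v') →
        (∀ i, (Γ i).Realize (Sum.elim (fun i => v' (q i)) z)) →
        ∃ z' : ι → K, ∀ i, (Γ i).Realize (Sum.elim (fun i => v (q i)) (fun i => v (z' i))) := by
  classical
  obtain ⟨W, _, hwf, hWc, hW⟩ := exists_schedule hμ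
  have hinf : ℵ₀ ≤ (2 ^ μ : Cardinal.{u}) := hμ.trans (cantor μ).le
  have hιn : Nonempty ι := mk_ne_zero_iff.1 (by rw [hι]; exact (aleph0_pos.trans_le hμ).ne')
  obtain ⟨K, hK⟩ : ∃ K : Type u, K = (X ⊕ (W × ι)) := ⟨_, rfl⟩
  subst hK
  have hKc : #(X ⊕ (W × ι)) ≤ 2 ^ μ := by
    simp only [mk_sum, mk_prod, lift_id, hWc, hι]
    exact add_le_of_le hinf (hXμ.trans (cantor μ).le)
      (mul_le_of_le hinf le_rfl (cantor μ).le)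
  obtain ⟨e, he⟩ := hW ((ι → L.Formula (ι ⊕ ι)) × (ι → X ⊕ (W × ι))) (by
    have hpow : ∀ c : Cardinal.{u}, c ≤ 2 ^ μ → c ^ μ ≤ 2 ^ μ := fun c hc =>
      (power_le_power_right hc).trans (by rw [← power_mul, mul_eq_self hμ])
    simp only [mk_prod, mk_pi, prod_const, lift_id, hι]
    refine mul_le_of_le hinf (hpow _ ((card_formula_le hμ hL ?_).trans (cantor μ).le))
      (hpow _ hKc)
    simpa [hι] using add_le_of_le hμ le_rfl le_rfl) ⟨(fun _ => ⊥, fun _ => .inl (Classical.arbitrary X))⟩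
  obtain ⟨Diag, hDiag⟩ : ∃ Diag : Set (L.Formula (X ⊕ (W × ι))), Diag =
    {χ | ∃ ψ : L.Formula X, BoundedFormula.IsQF ψ ∧ ψ.Realize id ∧ ψ.relabel Sum.inl = χ} :=
      ⟨_, rfl⟩
  obtain ⟨TS, hTS⟩ : ∃ TS : W → Set (L.Formula (X ⊕ (W × ι))), ∀ w, TS w =
    Set.range (fun i => ((e w).1 i).relabel (Sum.elim (e w).2 (fun j => Sum.inr (w, j)))) :=
      ⟨_, fun _ => rfl⟩
  obtain ⟨cond, hcond⟩ : ∃ cond : W → (W → Set (L.Formula (X ⊕ (W × ι)))) → Prop, ∀ w f,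
    cond w f ↔ ((∀ i w' j, (e w).2 i = Sum.inr (w', j) → w' < w) ∧
      (∀ i, BoundedFormula.IsQF ((e w).1 i)) ∧
      Sat T (Diag ∪ (⋃ v ∈ Set.Iio w, f v) ∪ TS w)) := ⟨_, fun _ _ => Iff.rfl⟩
  obtain ⟨D, hD⟩ := exists_wf_rec (· < ·) hwf.wf
    (fun w f (x : Set (L.Formula (X ⊕ (W × ι)))) => x = if cond w f then TS w else ∅)
    (by
      intro w f f' x hff hx
      have : cond w f ↔ cond w f' := by
        rw [hcond, hcond]
        have : (⋃ v ∈ Set.Iio w, f v) = ⋃ v ∈ Set.Iio w, f' v :=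
          Set.iUnion₂_congr fun v hv => hff v hv
        rw [this]
      simpa [this] using hx)
    (fun w f _ => ⟨_, rfl⟩)
  have hlim : ∀ S : Set W, (∀ w ∈ S, Sat T (Diag ∪ ⋃ v ∈ Set.Iic w, D v)) →
      Sat T (Diag ∪ ⋃ v ∈ S, D v) := by
    intro S hS
    refine sat_of_finite fun Δ hΔ hfin => ?_
    have : Δ ⊆ Diag ∨ ∃ w ∈ S, Δ ⊆ Diag ∪ ⋃ v ∈ Set.Iic w, D v := by
      induction Δ, hfin using Set.Finite.induction_on with
      | empty => exact .inl (Set.empty_subset _)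
      | @insert φ Δ _ _ ih =>
        have h1 : φ ∈ Diag ∨ ∃ w ∈ S, φ ∈ D w := by
          rcases hΔ (Set.mem_insert _ _) with h | h
          · exact .inl h
          · right; simpa using h
        have h3 : ∀ w ∈ S, ∀ w', w ≤ w' → φ ∈ D w → φ ∈ Diag ∪ ⋃ v ∈ Set.Iic w', D v :=
          fun w _ w' hw h => .inr (by simp only [Set.mem_iUnion]; exact ⟨w, hw, h⟩)
        rcases ih ((Set.subset_insert _ _).trans hΔ) with h2 | ⟨w, hw, h2⟩
        · rcases h1 with h1 | ⟨w, hw, h1⟩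
          · exact .inl (Set.insert_subset h1 h2)
          · exact .inr ⟨w, hw, Set.insert_subset (h3 w hw w le_rfl h1)
              (h2.trans Set.subset_union_left)⟩
        · rcases h1 with h1 | ⟨w', hw', h1⟩
          · exact .inr ⟨w, hw, Set.insert_subset (.inl h1) h2⟩
          · have hmono : ∀ a b : W, a ≤ b → (Diag ∪ ⋃ v ∈ Set.Iic a, D v) ⊆
                Diag ∪ ⋃ v ∈ Set.Iic b, D v := fun a b hab =>
              Set.union_subset_union_right _
                (Set.biUnion_subset_biUnion_left (Set.Iic_subset_Iic.2 hab))
            rcases le_total w w' with h | h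
            · exact .inr ⟨w', hw', Set.insert_subset (h3 w' hw' _ le_rfl h1)
                (h2.trans (hmono _ _ h))⟩
            · exact .inr ⟨w, hw, Set.insert_subset (h3 w' hw' _ h h1) h2⟩
    rcases this with h | ⟨w, hw, h⟩
    · refine ⟨X, inferInstance, inferInstance,
        Sum.elim id (fun _ => Classical.arbitrary X), hX, fun φ hφ => ?_⟩
      have := h hφ
      rw [hDiag] at this
      obtain ⟨ψ, _, hψ, rfl⟩ := this
      exact sat_relabel_realize.2 hψ
    · exact (hS w hw).mono h
  have hall : ∀ w, Sat T (Diag ∪ ⋃ v ∈ Set.Iic w, D v) := by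
    intro w
    induction w using hwf.induction with
    | ind w ih =>
      have h1 := hlim (Set.Iio w) ih
      have h2 : Diag ∪ (⋃ v ∈ Set.Iic w, D v) = Diag ∪ (⋃ v ∈ Set.Iio w, D v) ∪ D w := by
        rw [Set.union_assoc, ← Set.Iio_insert, Set.biUnion_insert, Set.union_comm (D w)]
      rw [h2, hD w]
      split_ifs with h
      · exact ((hcond _ _).1 h).2.2
      · simpa using h1
  obtain ⟨N, _, hN, v, hNT, hv⟩ := hlim Set.univ fun w _ => hall w
  refine ⟨X ⊕ (W × ι), Sum.inl, N, inferInstance, hN, v, hNT, ?_, ?_⟩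
  · intro φ hφ h
    have := hv (φ.relabel Sum.inl) (.inl (by rw [hDiag]; exact ⟨φ, hφ, h, rfl⟩))
    exact sat_relabel_realize.1 this
  intro Γ q hΓ N' _ v' z hN'T hv' hz
  have hWn : Nonempty W := mk_ne_zero_iff.1 (by rw [hWc]; exact (aleph0_pos.trans_le hinf).ne')
  obtain ⟨w, hw, hlt⟩ := he (Γ, q)
    (Set.range fun i => Sum.elim (fun _ => hWn.some) Prod.fst (q i)) (mk_range_le.trans hι.le)
  replace hlt : ∀ w', (∃ i j, q i = .inr (w', j)) → w' < w := by
    rintro w' ⟨i, j, hij⟩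
    exact hlt w' ⟨i, by simp [hij]⟩
  have hN'n : Nonempty N' := ⟨z hιn.some⟩
  obtain ⟨v2, hv2⟩ : ∃ v2 : X ⊕ (W × ι) → N', v2 =
    Sum.elim (fun x => v' (.inl x)) (fun a => if a.1 = w then z a.2 else v' (.inr a)) := ⟨_, rfl⟩
  have hbel : ∀ k : X ⊕ (W × ι), (∀ w' j, k = .inr (w', j) → w' < w) → v2 k = v' k := by
    rintro (x | ⟨w', j⟩) h
    · simp [hv2]
    · simp [hv2, (h w' j rfl).ne]
  have hqb : ∀ i, v2 (q i) = v' (q i) := fun i => hbel _ fun w' j h => hlt w' ⟨i, j, h⟩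
  have hDv : ∀ w1, ∀ φ ∈ D w1, φ.Realize v := fun w1 φ hφ =>
    hv φ (.inr (by simp only [Set.mem_iUnion]; exact ⟨w1, trivial, hφ⟩))
  have hc : cond w D := by
    rw [hcond]
    refine ⟨?_, ?_, N', inferInstance, hN'n, v2, hN'T, ?_⟩
    · rw [hw]
      exact fun i w' j h => hlt w' ⟨i, j, h⟩
    · rw [hw]; exact hΓ
    · rintro φ ((hφ | hφ) | hφ)
      · have h1 := hv φ (.inl hφ)
        rw [hDiag] at hφ
        obtain ⟨ψ, hψ, _, rfl⟩ := hφ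
        have h2 := hv' _ (isQF_relabel _ hψ) h1
        rw [sat_relabel_realize] at h2 ⊢
        simpa [hv2] using h2
      · simp only [Set.mem_iUnion, Set.mem_Iio] at hφ
        obtain ⟨w1, hw1, hφ⟩ := hφ
        have h1 := hDv w1 φ hφ
        rw [hD w1] at hφ
        split_ifs at hφ with hc1
        · obtain ⟨hc2, hc3, -⟩ := (hcond _ _).1 hc1
          rw [hTS] at hφ
          obtain ⟨i, rfl⟩ := hφ
          have h2 := hv' _ (isQF_relabel _ (hc3 i)) h1
          simp only [sat_relabel_realize] at h2 ⊢
          convert h2 using 2 with x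
          refine hbel _ fun w' j h => ?_
          rcases x with x | x
          · exact (hc2 x w' j h).trans hw1
          · simp only [Sum.elim_inr, Sum.inr.injEq, Prod.mk.injEq] at h
            exact h.1 ▸ hw1
        · exact hφ.elim
      · rw [hTS, hw] at hφ
        obtain ⟨i, rfl⟩ := hφ
        simp only [sat_relabel_realize]
        convert hz i using 2 with x
        rcases x with x | x
        · exact hqb x
        · simp [hv2]
  refine ⟨fun j => .inr (w, j), fun i => ?_⟩
  have h1 : (Γ i).relabel (Sum.elim q (fun j => Sum.inr (w, j))) ∈ D w := by
    rw [hD w, if_pos hc, hTS, hw]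
    exact ⟨i, rfl⟩
  have h2 := sat_relabel_realize.1 (hDv w _ h1)
  convert h2 using 2 with x
  rcases x with x | x <;> rfl

end Universal

end QFree

namespace QFree

section Saturated

variable {L : FirstOrder.Language.{u, u}} {T : L.Theory}

local notation "cl" => clos L

theorem realize_qf_embedding {M N β : Type u} [L.Structure M] [L.Structure N] (j : M ↪[L] N)
    {φ : L.Formula β} (hφ : BoundedFormula.IsQF φ) (x : β → M) :
    φ.Realize (fun i => j (x i)) ↔ φ.Realize x := by
  have := BoundedFormula.IsQF.realize_embedding hφ j (v := x) (xs := default)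
  rw [Formula.Realize, Formula.Realize, ← this]
  exact iff_of_eq (congrArg₂ _ rfl (Subsingleton.elim _ _))

theorem exists_saturated_extension {X : Type u} [L.Structure X] [Nonempty X] (hX : X ⊨ T)
    (hT : IsUniversalTheory T)
    {μ : Cardinal.{u}} (hμ : ℵ₀ ≤ μ) (hL : L.card ≤ μ) (hXμ : #X ≤ μ) (ι : Type u) (hι : #ι = μ) :
    ∃ (M : Type u) (_ : L.Structure M) (_ : X ↪[L] M), M ⊨ T ∧
      ∀ (Γ : ι → L.Formula (ι ⊕ ι)) (p : ι → M), (∀ i, BoundedFormula.IsQF (Γ i)) →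
        ∀ (N' : Type u) (_ : L.Structure N') (v' : M → N') (z : ι → N'), N' ⊨ T →
        (∀ φ : L.Formula M, BoundedFormula.IsQF φ → φ.Realize id → φ.Realize v') →
        (∀ i, (Γ i).Realize (Sum.elim (fun i => v' (p i)) z)) →
        ∃ z' : ι → M, ∀ i, (Γ i).Realize (Sum.elim p z') := by
  classical
  obtain ⟨K, i₀, N, _, _, v, hN, hXv, hsat⟩ := exists_saturated_assignment hX hμ hL hXμ ι hι
  have hιi : Infinite ι := infinite_iff.2 (hι ▸ hμ)
  have : T.IsUniversal := isUniversal_of_isUniversalTheory hT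
  have hK : Nonempty K := ⟨i₀ (Classical.arbitrary X)⟩
  obtain ⟨S, hS⟩ : ∃ S : L.Substructure N, (S : Set N) = Set.range v := by
    refine ⟨⟨Set.range v, fun {n} f x hx => ?_⟩, rfl⟩
    choose y hy using hx
    have e : Fin n ↪ ι :=
      (Fin.valEmbedding.trans (Infinite.natEmbedding ι))
    obtain ⟨z, hz⟩ := hsat
      (fun _ => (Term.var (Sum.inr (Classical.arbitrary ι))).equal
        (Term.func f fun i => Term.var (Sum.inl (e i))))
      (Function.extend e y fun _ => Classical.arbitrary K)
      (fun _ => (BoundedFormula.IsAtomic.equal _ _).isQF) N inferInstance v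
      (fun _ => Structure.funMap f x) hN (fun φ _ h => h) (fun _ => by
        simp [Term.realize, e.injective.extend_apply, hy])
    have h1 := hz (Classical.arbitrary ι)
    simp [Term.realize, e.injective.extend_apply, hy] at h1
    exact ⟨_, h1⟩
  have hvS : ∀ k, v k ∈ S := fun k => by
    rw [← SetLike.mem_coe, hS]; exact ⟨k, rfl⟩
  obtain ⟨v0, hv0⟩ : ∃ v0 : K → S, ∀ k, (v0 k : N) = v k := ⟨fun k => ⟨v k, hvS k⟩, fun _ => rfl⟩
  have hv0s : ∀ x : S, ∃ k, v0 k = x := by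
    rintro ⟨x, hx⟩
    rw [← SetLike.mem_coe, hS] at hx
    obtain ⟨k, rfl⟩ := hx
    exact ⟨k, Subtype.ext (hv0 k)⟩
  have hreal : ∀ {β : Type u} {φ : L.Formula β}, BoundedFormula.IsQF φ → ∀ x : β → S,
      (φ.Realize (fun i => (x i : N)) ↔ φ.Realize x) := fun hφ x =>
    realize_qf_embedding S.subtype hφ x
  obtain ⟨j, hj⟩ := exists_embedding_of_qf (fun x => v0 (i₀ x)) fun φ hφ h => by
    have := hXv φ hφ h
    rw [← hreal hφ]
    simpa only [hv0] using this
  refine ⟨S, inferInstance, j, inferInstance, fun Γ p hΓ N' _ v' z hN' hv' hz => ?_⟩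
  choose q hq using fun i => hv0s (p i)
  have hpres : ∀ φ : L.Formula K, BoundedFormula.IsQF φ → φ.Realize v →
      φ.Realize (fun k => v' (v0 k)) := by
    intro φ hφ h
    have h1 : φ.Realize v0 := by
      rw [← hreal hφ]; simpa only [hv0] using h
    exact sat_relabel_realize.1 (hv' _ (isQF_relabel v0 hφ) (sat_relabel_realize.2 h1))
  obtain ⟨z', hz'⟩ := hsat Γ q hΓ N' inferInstance (fun k => v' (v0 k)) z hN' hpres
    (fun i => by simpa only [hq] using hz i)
  refine ⟨fun i => v0 (z' i), fun i => ?_⟩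
  rw [← hreal (hΓ i)]
  convert hz' i using 2 with x
  rcases x with x | x
  · simp [← hv0, hq]
  · simp [← hv0]

/-- A semantic form of saturation. -/
def Satur (L : FirstOrder.Language.{u, u}) (M : Type u) [L.Structure M] (μ : Cardinal.{u}) : Prop :=
  ∀ (B C : Type u), #B ≤ μ → #C ≤ μ → ∀ (p : B → M) (Γ : Set (Set (B ⊕ C → M))),
    (∀ G ∈ Γ, QF L ∅ (B ⊕ C) G) →
    (∀ Γ₀ ⊆ Γ, Γ₀.Finite → ∀ A : Set (M → M), QF L ∅ M A → id ∈ A →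
      ∃ v ∈ A, ∃ z : C → M, ∀ G ∈ Γ₀, Sum.elim (fun b => v (p b)) z ∈ G) →
    ∃ z : C → M, ∀ G ∈ Γ, Sum.elim p z ∈ G

theorem exists_satur {X : Type u} [L.Structure X] [Nonempty X] (hX : X ⊨ T)
    (hT : IsUniversalTheory T)
    {μ : Cardinal.{u}} (hμ : ℵ₀ ≤ μ) (hL : L.card ≤ μ) (hXμ : #X ≤ μ) :
    ∃ (M : Type u) (_ : L.Structure M) (_ : X ↪[L] M), M ⊨ T ∧ Satur L M μ := by
  classical
  obtain ⟨ι, hι⟩ : ∃ ι : Type u, #ι = μ := ⟨μ.out, mk_out μ⟩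
  obtain ⟨M, _, j, hM, hsat⟩ := exists_saturated_extension hX hT hμ hL hXμ ι hι
  refine ⟨M, inferInstance, j, hM, fun B C hB hC p Γ hΓ hfin => ?_⟩
  have hMn : Nonempty M := ⟨j (Classical.arbitrary X)⟩
  obtain ⟨Φ, hΦ⟩ : ∃ Φ : Set (L.Formula (B ⊕ C)), Φ =
    {φ : L.Formula (B ⊕ C) | BoundedFormula.IsQF φ ∧ {x : B ⊕ C → M | φ.Realize x} ∈ Γ} := ⟨_, rfl⟩
  have hcov : ∀ G ∈ Γ, ∃ φ ∈ Φ, ∀ x, x ∈ G ↔ φ.Realize x := by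
    intro G hG
    obtain ⟨φ, h1, h2⟩ := (hΓ G hG).exists_formula
    refine ⟨φ, ?_, h2⟩
    rw [hΦ]
    refine ⟨h1, ?_⟩
    convert hG
    ext x
    exact (h2 x).symm
  suffices ∃ z : C → M, ∀ φ ∈ Φ, φ.Realize (Sum.elim p z) by
    obtain ⟨z, hz⟩ := this
    refine ⟨z, fun G hG => ?_⟩
    obtain ⟨φ, h1, h2⟩ := hcov G hG
    exact (h2 _).2 (hz φ h1)
  obtain ⟨Δ₁, hΔ₁⟩ : ∃ Δ : Set (L.Formula M), Δ = {ψ : L.Formula M | BoundedFormula.IsQF ψ ∧ ψ.Realize id} :=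
    ⟨_, rfl⟩
  have hS : Sat T ((Formula.relabel (Sum.inl : M → M ⊕ C)) '' Δ₁ ∪
      (Formula.relabel (Sum.map p id : B ⊕ C → M ⊕ C)) '' Φ) := by
    refine sat_of_finite fun Δ hΔ hf => ?_
    obtain ⟨t₁, ht₁, hf₁, he₁⟩ := Set.exists_subset_image_finite_and.1
      ⟨Δ ∩ (Formula.relabel (Sum.inl : M → M ⊕ C)) '' Δ₁, Set.inter_subset_right,
        hf.subset Set.inter_subset_left, rfl⟩
    obtain ⟨t₂, ht₂, hf₂, he₂⟩ := Set.exists_subset_image_finite_and.1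
      ⟨Δ ∩ (Formula.relabel (Sum.map p id : B ⊕ C → M ⊕ C)) '' Φ, Set.inter_subset_right,
        hf.subset Set.inter_subset_left, rfl⟩
    obtain ⟨v, hv, z, hz⟩ := hfin
      ((fun φ : L.Formula (B ⊕ C) => {x : B ⊕ C → M | φ.Realize x}) '' t₂)
      (by
        rintro _ ⟨φ, hφ, rfl⟩
        have := ht₂ hφ
        rw [hΦ] at this
        exact this.2) (hf₂.image _)
      (⋂ ψ ∈ t₁, {x : M → M | ψ.Realize x})
      (QF.biInter _ hf₁ fun ψ hψ => by
        have := ht₁ hψ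
        rw [hΔ₁] at this
        exact qf_formula this.1)
      (by
        simp only [Set.mem_iInter]
        intro ψ hψ
        have := ht₁ hψ
        rw [hΔ₁] at this
        exact this.2)
    refine ⟨M, inferInstance, hMn, Sum.elim v z, hM, fun φ hφ => ?_⟩
    simp only [Set.mem_iInter] at hv
    rcases hΔ hφ with h | h
    · have h1 : φ ∈ Formula.relabel (Sum.inl : M → M ⊕ C) '' t₁ := he₁ ▸ ⟨hφ, h⟩
      obtain ⟨ψ, hψ, rfl⟩ := h1
      exact sat_relabel_realize.2 (hv ψ hψ)
    · have h1 : φ ∈ Formula.relabel (Sum.map p id : B ⊕ C → M ⊕ C) '' t₂ := he₂ ▸ ⟨hφ, h⟩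
      obtain ⟨ψ, hψ, rfl⟩ := h1
      rw [sat_relabel_realize]
      have h2 : ψ.Realize (Sum.elim (fun b => v (p b)) z) := hz _ ⟨ψ, hψ, rfl⟩
      convert h2 using 2 with x
      rcases x with x | x <;> rfl
  obtain ⟨N', _, _, v', hN', hv'⟩ := hS
  obtain ⟨g, hg⟩ : ∃ g : ι → (insert ⊤ Φ : Set (L.Formula (B ⊕ C))), Function.Surjective g := by
    have h1 : #(insert ⊤ Φ : Set (L.Formula (B ⊕ C))) ≤ #ι := by
      rw [hι]
      refine (mk_subtype_le _).trans (card_formula_le hμ hL ?_)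
      simpa using add_le_of_le hμ hB hC
    obtain ⟨f⟩ := h1
    have : Nonempty (insert ⊤ Φ : Set (L.Formula (B ⊕ C))) := ⟨⟨⊤, .inl rfl⟩⟩
    exact ⟨_, Function.invFun_surjective f.injective⟩
  obtain ⟨bB⟩ : #B ≤ #ι := hB.trans hι.ge
  obtain ⟨cC⟩ : #C ≤ #ι := hC.trans hι.ge
  obtain ⟨z, hz⟩ := hsat (fun i => (g i : L.Formula (B ⊕ C)).relabel (Sum.map bB cC))
    (Function.extend bB p fun _ => Classical.arbitrary M) (fun i => by
      refine isQF_relabel _ ?_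
      rcases (g i).2 with h | h
      · rw [h]; exact BoundedFormula.IsQF.top
      · exact (hΦ.subset h).1) N' inferInstance (fun m => v' (.inl m))
    (Function.extend cC (fun c => v' (.inr c)) fun _ => Classical.arbitrary N') hN'
    (fun ψ h1 h2 => sat_relabel_realize.1 (hv' _ (.inl ⟨ψ, by rw [hΔ₁]; exact ⟨h1, h2⟩, rfl⟩)))
    (fun i => by
      rw [sat_relabel_realize]
      rcases (g i).2 with h | h
      · rw [h]; simp
      · have := sat_relabel_realize.1 (hv' _ (.inr ⟨_, h, rfl⟩))
        convert this using 2 with x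
        rcases x with x | x
        · simp [bB.injective.extend_apply]
        · simp [cC.injective.extend_apply])
  refine ⟨fun c => z (cC c), fun φ hφ => ?_⟩
  obtain ⟨i, hi⟩ := hg ⟨φ, .inr hφ⟩
  have h1 := sat_relabel_realize.1 (hz i)
  rw [hi] at h1
  convert h1 using 2 with x
  rcases x with x | x
  · simp [bB.injective.extend_apply]
  · simp

end Saturated

end QFree

namespace QFree

section FromSaturation

variable {L : FirstOrder.Language.{u, u}} {T : L.Theory} {M : Type u} [L.Structure M]

local notation "cl" => clos L

theorem clos_image {X : Type u} [L.Structure X] (j : X ↪[L] M) (Y : Set X) :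
    cl (j '' Y) = j '' (clos L Y) := by
  have := Substructure.closure_image (L := L) (s := Y) j.toHom
  have h2 := congrArg (fun S : L.Substructure M => (S : Set M)) this
  simpa [clos] using h2

theorem clos_range {X : Type u} [L.Structure X] (j : X ↪[L] M) :
    cl (Set.range j) = Set.range j := by
  rw [← Set.image_univ, clos_image]
  congr 1
  exact Set.eq_univ_of_univ_subset (subset_cl _)

theorem generates_iff {X : Type u} [L.Structure X] {Y : Set X} :
    Generates L X Y ↔ clos L Y = Set.univ := by
  rw [Generates, clos, ← Substructure.coe_top (L := L), SetLike.coe_set_eq]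

theorem sg_range_iff {X : Type u} [L.Structure X] (j : X ↪[L] M) {lam : Cardinal.{u}} :
    SG L lam (Set.range j) ↔ StrictlyGenerated L X lam := by
  have key : ∀ Y : Set X, cl (j '' Y) = Set.range j ↔ Generates L X Y := by
    intro Y
    rw [clos_image, generates_iff, ← Set.image_univ]
    exact j.injective.image_injective.eq_iff
  have hpre : ∀ Y : Set M, cl Y = Set.range j → ∃ Z : Set X, j '' Z = Y := fun Y hY =>
    Set.subset_range_iff_exists_image_eq.1 ((subset_cl Y).trans hY.subset)
  have hcard : ∀ Z : Set X, #(j '' Z : Set M) = #Z := fun Z => mk_image_eq j.injective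
  constructor
  · rintro ⟨⟨Y, hY, hY'⟩, h⟩
    obtain ⟨Z, rfl⟩ := hpre Y hY'
    refine ⟨⟨Z, ?_, (key Z).1 hY'⟩, ?_⟩
    · rw [← hcard]
      exact hY.antisymm (h _ hY')
    · rintro ν hν ⟨W, hW, hW'⟩
      have := h _ ((key W).2 hW')
      rw [hcard, hW] at this
      exact hν.not_ge this
  · rintro ⟨⟨Z, hZ, hZ'⟩, h⟩
    refine ⟨⟨j '' Z, by rw [hcard, hZ], (key Z).2 hZ'⟩, fun Y hY => ?_⟩
    obtain ⟨W, rfl⟩ := hpre Y hY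
    rw [hcard]
    by_contra! hn
    exact h _ hn ⟨W, rfl, (key W).1 hY⟩

theorem eqT_embeddings {X : Type u} [L.Structure X] (j j' : X ↪[L] M) :
    EqT L (∅ : Set M) (fun x => j x) (fun x => j' x) := by
  intro A hA h
  obtain ⟨φ, hφ, hAφ⟩ := hA.exists_formula
  rw [hAφ] at h ⊢
  exact (realize_qf_embedding j' hφ id).2 ((realize_qf_embedding j hφ id).1 h)

theorem exists_pe_embeddings {X : Type u} [L.Structure X] (j j' : X ↪[L] M) :
    ∃ g, PE L (Set.range j) g ∧ ∀ x, g (j x) = j' x := by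
  obtain ⟨g, h1, -, h2⟩ := (eqT_embeddings j j').exists_pe
  exact ⟨g, h1.mono (Set.subset_union_right.trans (subset_cl _)), h2⟩

theorem Satur.comp {μ : Cardinal.{u}} (H : Satur L M μ) (ι : Type u) (hι : #ι ≤ μ) (P : Set M)
    (hP : #P ≤ μ) (F : Set (Set (ι → M))) (hF : ∀ A ∈ F, QF L P ι A)
    (hfin : ∀ G ⊆ F, G.Finite → (⋂₀ G).Nonempty) : (⋂₀ F).Nonempty := by
  obtain ⟨e, he⟩ : ∃ e : P → M, e = Subtype.val := ⟨_, rfl⟩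
  obtain ⟨z, hz⟩ := H P ι hP hι e
    {G | QF L ∅ (P ⊕ ι) G ∧ {x : ι → M | Sum.elim e x ∈ G} ∈ F} (fun G h => h.1)
    (fun Γ₀ hΓ hf A hA hid => by
      obtain ⟨z, hz⟩ := hfin ((fun G => {x : ι → M | Sum.elim e x ∈ G}) '' Γ₀)
        (by rintro _ ⟨G, hG, rfl⟩; exact (hΓ hG).2) (hf.image _)
      exact ⟨id, hid, z, fun G hG => hz _ ⟨G, hG, rfl⟩⟩)
  refine ⟨z, fun A hA => ?_⟩
  obtain ⟨B, hB, hAB⟩ := ((hF A hA).mono (Q := ∅ ∪ Set.range e) (by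
    rw [he, Subtype.range_coe]; exact Set.subset_union_right)).abs
  refine (hAB z).2 (hz B ⟨hB, ?_⟩)
  convert hA
  ext x
  exact (hAB x).symm

theorem Satur.ext {μ : Cardinal.{u}} (H : Satur L M μ) (S : Set M) (g : M → M) (hS : #S ≤ μ)
    (hg : PE L S g) (hEC : EC L (g '' S)) (W : Set M) (hW : #W ≤ μ) :
    ∃ g', PE L (S ∪ W) g' ∧ ∀ x ∈ S, g' x = g x := by
  classical
  obtain ⟨e, he⟩ : ∃ e : S → M, e = Subtype.val := ⟨_, rfl⟩
  obtain ⟨f, hf⟩ : ∃ f : W → M, f = Subtype.val := ⟨_, rfl⟩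
  obtain ⟨z, hz⟩ := H S W hS hW (fun s => g (e s))
    {G | QF L ∅ (S ⊕ W) G ∧ Sum.elim e f ∈ G} (fun G h => h.1) (fun Γ₀ hΓ hfin A hA hid => by
      rcases S.eq_empty_or_nonempty with hS0 | hS0
      · refine ⟨id, hid, f, fun G hG => ?_⟩
        convert (hΓ hG).2 using 2
        funext s
        exact (hS0.subset s.2).elim
      obtain ⟨P₀, t, -, -, ht, -, ht2⟩ := (QF.sInter hfin fun G hG => (hΓ hG).1).support
      obtain ⟨s₀, hs₀⟩ : ∃ s₀ : Set S, s₀ = Sum.inl ⁻¹' t := ⟨_, rfl⟩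
      have hs₀f : s₀.Finite := hs₀ ▸ ht.preimage Sum.inl_injective.injOn
      have hA' : QF L (g '' S) M (A ∩ ⋂ s ∈ s₀, {x : M → M | x (g (e s)) = g (e s)}) :=
        (hA.mono (Set.empty_subset _)).inter _ _ (QF.biInter _ hs₀f fun s _ =>
          .eq _ _ (.var _) (.const _ ⟨s, s.2, by rw [he]⟩))
      obtain ⟨v, ⟨hv1, hv2⟩, hv3⟩ := hEC.point hA' ⟨id, hid, by simp⟩
        ((hS0.image g).mono (subset_cl _))
      obtain ⟨h, hh1, hh2, -⟩ := hg.exists_inv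
      obtain ⟨h', hh1', hh2'⟩ := hh1.exists_cl
      refine ⟨fun x => h' (v x), hh1'.eqT hv3 A hA hv1, f, ?_⟩
      have : Sum.elim (fun s => h' (v (g (e s)))) f ∈ ⋂₀ Γ₀ := by
        refine (ht2 _ (Sum.elim e f) ?_).2 fun G hG => (hΓ hG).2
        rintro (s | w) hst
        · simp only [Set.mem_iInter] at hv2
          have h3 : v (g (e s)) = g (e s) := hv2 s (by rw [hs₀]; exact hst)
          have h4 : e s ∈ S := by rw [he]; exact s.2
          simp only [Sum.elim_inl]
          rw [h3, hh2' _ ⟨_, h4, rfl⟩, hh2 _ h4]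
        · rfl
      exact fun G hG => this G hG)
  have h1 : EqT L ∅ (Sum.elim e f) (Sum.elim (fun s => g (e s)) z) := fun G hG h => hz G ⟨hG, h⟩
  obtain ⟨g', h2, -, h3⟩ := h1.exists_pe
  refine ⟨g', h2.mono ?_, fun x hx => ?_⟩
  · refine Set.Subset.trans ?_ (subset_cl _)
    rintro x (hx | hx)
    · exact .inr ⟨.inl ⟨x, hx⟩, by simp [he]⟩
    · exact .inr ⟨.inr ⟨x, hx⟩, by simp [hf]⟩
  · simpa [he] using h3 (.inl ⟨x, hx⟩)

theorem exists_mon {κ μ : Cardinal.{u}} (hT : IsUniversalTheory T) (hTκ : KUnique T κ)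
    (hκ : ℵ₀ < κ) (hμ : κ ≤ μ) (hL : L.card ≤ μ) {X : Type u} [L.Structure X] [Infinite X]
    (hX : X ⊨ T) (hXμ : #X ≤ μ) :
    ∃ (M : Type u) (_ : L.Structure M) (_ : X ↪[L] M), M ⊨ T ∧ Mon L M κ μ := by
  obtain ⟨M, _, j, hM, H⟩ := exists_satur hX hT (hκ.le.trans hμ) hL hXμ
  have : T.IsUniversal := isUniversal_of_isUniversalTheory hT
  refine ⟨M, inferInstance, j, hM, hκ, hμ, hL, Infinite.of_injective j j.injective, H.comp, H.ext,
    fun N N' hN hN' h h' => ?_⟩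
  obtain ⟨S, hS⟩ : ∃ S : L.Substructure M, (S : Set M) = N := ⟨_, hN⟩
  obtain ⟨S', hS'⟩ : ∃ S : L.Substructure M, (S : Set M) = N' := ⟨_, hN'⟩
  have hr : Set.range S.subtype = N := by rw [← hS]; exact Subtype.range_coe
  have hr' : Set.range S'.subtype = N' := by rw [← hS']; exact Subtype.range_coe
  obtain ⟨f⟩ := hTκ.2 S S' inferInstance inferInstance inferInstance inferInstance
    ((sg_range_iff S.subtype).1 (hr ▸ h)) ((sg_range_iff S'.subtype).1 (hr' ▸ h'))
  obtain ⟨g, hg, hg'⟩ := exists_pe_embeddings S.subtype (S'.subtype.comp f.toEmbedding)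
  refine ⟨g, hr ▸ hg, ?_⟩
  rw [← hr, ← hr', ← Set.range_comp]
  ext y
  constructor
  · rintro ⟨x, rfl⟩
    exact ⟨f x, (hg' x).symm⟩
  · rintro ⟨x, rfl⟩
    exact ⟨f.symm x, (hg' _).trans (by simp)⟩

end FromSaturation

end QFree

namespace QFree

section Assembly

variable {L : FirstOrder.Language.{u, u}} {T : L.Theory}

local notation "cl" => clos L

theorem StrictlyGenerated.le_mk {X : Type u} [L.Structure X] {lam : Cardinal.{u}}
    (h : StrictlyGenerated L X lam) : lam ≤ #X := by
  obtain ⟨⟨Y, hY, -⟩, -⟩ := h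
  exact hY ▸ mk_set_le Y

theorem mk_le_of_generates {X : Type u} [L.Structure X] {Y : Set X} (h : Generates L X Y) :
    #X ≤ max ℵ₀ (#Y + L.card) := by
  have h1 := Substructure.lift_card_closure_le (L := L) (s := Y)
  rw [h, Cardinal.lift_id] at h1
  have h2 : #(⊤ : L.Substructure X) = #X := mk_univ
  rw [h2] at h1
  refine h1.trans (max_le_max le_rfl ?_)
  simp only [Cardinal.lift_id]
  gcongr
  rw [Language.card, Language.Symbols, mk_sum]
  simp

theorem strictlyGenerated_iff {X : Type u} [L.Structure X] {μ : Cardinal.{u}}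
    (hμ : max L.card ℵ₀ < μ) : StrictlyGenerated L X μ ↔ #X = μ := by
  have hL : L.card < μ := (le_max_left _ _).trans_lt hμ
  have h0 : ℵ₀ < μ := (le_max_right _ _).trans_lt hμ
  constructor
  · intro h
    refine le_antisymm ?_ (StrictlyGenerated.le_mk h)
    obtain ⟨⟨Y, hY, hY'⟩, -⟩ := h
    exact (mk_le_of_generates hY').trans (max_le h0.le (add_le_of_le h0.le hY.le hL.le))
  · intro h
    refine ⟨⟨Set.univ, by simpa using h, ?_⟩, ?_⟩
    · exact generates_iff.2 (Set.eq_univ_of_univ_subset (subset_cl _))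
    · rintro ν hν ⟨Y, hY, hY'⟩
      have := mk_le_of_generates hY'
      rw [h, hY] at this
      exact this.not_gt (max_lt h0 (add_lt_of_lt h0.le hν hL))

theorem exists_strictlyGenerated {κ : Cardinal.{u}} (hT : IsUniversalTheory T)
    (hTκ : KUnique T κ) (hκ : ℵ₀ < κ) {lam : Cardinal.{u}} (hlam : ℵ₀ < lam) :
    ∃ (X : Type u) (_ : L.Structure X), X ⊨ T ∧ StrictlyGenerated L X lam := by
  obtain ⟨X, _, hX, hXκ⟩ := hTκ.1
  have hinf : Infinite X := infinite_iff.2 (hκ.le.trans (StrictlyGenerated.le_mk hXκ))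
  obtain ⟨M, _, j, hM, H⟩ := exists_mon (μ := max (max #X L.card) (max κ lam)) hT hTκ hκ
    (by simp) (by simp) hX (by simp)
  have : T.IsUniversal := isUniversal_of_isUniversalTheory hT
  obtain ⟨E, hE, hEs, -⟩ := H.exists_sg hlam (by simp) Set.countable_empty
  obtain ⟨S, hS⟩ : ∃ S : L.Substructure M, (S : Set M) = E := ⟨_, hE⟩
  have hr : Set.range S.subtype = E := by rw [← hS]; exact Subtype.range_coe
  exact ⟨S, inferInstance, inferInstance, (sg_range_iff S.subtype).1 (hr ▸ hEs)⟩

/-- Strictly `κ`-generated substructures of two monsters being isomorphic, every small structure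
embedded in one of them embeds in the other one. -/
theorem Mon.exists_embedding {κ μ : Cardinal.{u}} (hTκ : KUnique T κ) (hT : IsUniversalTheory T)
    {M₁ M₂ X : Type u} [L.Structure M₁] [L.Structure M₂] [L.Structure X]
    (hM₁ : M₁ ⊨ T) (hM₂ : M₂ ⊨ T)
    (H₁ : Mon L M₁ κ μ) (H₂ : Mon L M₂ κ μ) (j : X ↪[L] M₂) (hX : #X ≤ μ) :
    Nonempty (X ↪[L] M₁) := by
  classical
  have : T.IsUniversal := isUniversal_of_isUniversalTheory hT
  obtain ⟨w, hw⟩ := H₁.comp X hX ∅ (by simp)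
    ((fun φ : L.Formula X => {x : X → M₁ | φ.Realize x}) ''
      {φ | BoundedFormula.IsQF φ ∧ φ.Realize id})
    (by rintro _ ⟨φ, hφ, rfl⟩; exact qf_formula hφ.1) (by
      intro G hG hGf
      obtain ⟨t, ht, htf, rfl⟩ := Set.exists_subset_image_finite_and.1 ⟨G, hG, hGf, rfl⟩
      obtain ⟨P₀, s, -, -, hs, -, hs2⟩ := (QF.biInter t htf (A := fun φ : L.Formula X =>
        {x : X → M₂ | φ.Realize x}) fun φ hφ => qf_formula (L := L) (ht hφ).1).support
      obtain ⟨E₁, hE₁, hE₁s, -⟩ := H₁.exists_sg H₁.hκ H₁.hμ Set.countable_empty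
      obtain ⟨E₂, hE₂, hE₂s, hsE⟩ := H₂.exists_sg H₂.hκ H₂.hμ (hs.image j).countable
      obtain ⟨S₁, hS₁⟩ : ∃ S : L.Substructure M₁, (S : Set M₁) = E₁ := ⟨_, hE₁⟩
      obtain ⟨S₂, hS₂⟩ : ∃ S : L.Substructure M₂, (S : Set M₂) = E₂ := ⟨_, hE₂⟩
      have hr₁ : Set.range S₁.subtype = E₁ := by rw [← hS₁]; exact Subtype.range_coe
      have hr₂ : Set.range S₂.subtype = E₂ := by rw [← hS₂]; exact Subtype.range_coe
      have hg₂ := (sg_range_iff S₂.subtype).1 (hr₂ ▸ hE₂s)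
      obtain ⟨f⟩ := hTκ.2 S₂ S₁ inferInstance inferInstance inferInstance inferInstance
        hg₂ ((sg_range_iff S₁.subtype).1 (hr₁ ▸ hE₁s))
      have hne : Nonempty S₂ :=
        mk_ne_zero_iff.1 (H₂.hκ.bot_lt.trans_le (StrictlyGenerated.le_mk hg₂)).ne'
      obtain ⟨y, hy⟩ : ∃ y : X → S₂, ∀ a ∈ s, (y a : M₂) = j a := by
        refine ⟨fun a => if h : j a ∈ S₂ then ⟨j a, h⟩ else hne.some, fun a ha => ?_⟩
        have : j a ∈ S₂ := by
          rw [← SetLike.mem_coe, hS₂]; exact hsE ⟨a, ha, rfl⟩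
        simp [this]
      refine ⟨fun a => f (y a), ?_⟩
      rintro _ ⟨φ, hφ, rfl⟩
      have h1 : (fun a => (y a : M₂)) ∈ ⋂ φ ∈ t, {x : X → M₂ | φ.Realize x} := by
        refine (hs2 _ (fun a => j a) hy).2 ?_
        simp only [Set.mem_iInter]
        exact fun φ hφ => (realize_qf_embedding j (ht hφ).1 id).2 (ht hφ).2
      simp only [Set.mem_iInter] at h1
      have h2 := (realize_qf_embedding S₂.subtype (ht hφ).1 y).1 (h1 φ hφ)
      exact (realize_qf_embedding (S₁.subtype.comp f.toEmbedding) (ht hφ).1 y).2 h2)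
  obtain ⟨j', -⟩ := exists_embedding_of_qf w fun φ hφ h => hw _ ⟨φ, ⟨hφ, h⟩, rfl⟩
  exact ⟨j'⟩

theorem nonempty_equiv_of_strictlyGenerated {κ : Cardinal.{u}} (hT : IsUniversalTheory T)
    (hTκ : KUnique T κ) (hκ : ℵ₀ < κ) {lam : Cardinal.{u}} (hlam : ℵ₀ < lam)
    {X Y : Type u} [L.Structure X] [L.Structure Y] (hX : X ⊨ T) (hY : Y ⊨ T)
    (hXs : StrictlyGenerated L X lam) (hYs : StrictlyGenerated L Y lam) :
    Nonempty (X ≃[L] Y) := by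
  have hXi : Infinite X := infinite_iff.2 (hlam.le.trans (StrictlyGenerated.le_mk hXs))
  have hYi : Infinite Y := infinite_iff.2 (hlam.le.trans (StrictlyGenerated.le_mk hYs))
  obtain ⟨μ, hμ⟩ : ∃ μ, μ = max (max #X #Y) (max L.card (max κ lam)) := ⟨_, rfl⟩
  have hYμ : #Y ≤ μ := by simp [hμ]
  obtain ⟨M₁, _, j₁, hM₁, H₁⟩ := exists_mon (μ := μ) hT hTκ hκ
    (by simp [hμ]) (by simp [hμ]) hX (by simp [hμ])
  obtain ⟨M₂, _, j₂, hM₂, H₂⟩ := exists_mon (μ := μ) hT hTκ hκ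
    (by simp [hμ]) (by simp [hμ]) hY hYμ
  obtain ⟨j⟩ := Mon.exists_embedding hTκ hT hM₁ hM₂ H₁ H₂ j₂ hYμ
  obtain ⟨g, hg, hgi⟩ := H₁.sg_unique hlam (by simp [hμ]) (clos_range j₁) (clos_range j)
    ((sg_range_iff j₁).2 hXs) ((sg_range_iff j).2 hYs)
  have h1 : ∀ x, ∃ y, j y = g (j₁ x) := fun x => hgi.subset ⟨_, ⟨x, rfl⟩, rfl⟩
  choose f hf using h1
  obtain ⟨F, hF⟩ := exists_embedding_of_qf f fun φ hφ h => by
    rw [← realize_qf_embedding j hφ]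
    simp only [hf]
    exact hg.eqT (w := fun x => j₁ x) (fun x => ⟨x, rfl⟩) _ (qf_formula hφ)
      ((realize_qf_embedding j₁ hφ id).2 h)
  have hsurj : Function.Surjective F := by
    intro y
    obtain ⟨_, ⟨x, rfl⟩, hx⟩ := hgi.superset ⟨y, rfl⟩
    refine ⟨x, j.injective ?_⟩
    rw [hF, hf, hx]
  exact ⟨⟨Equiv.ofBijective F ⟨F.injective, hsurj⟩, fun f x => F.map_fun f x,
    fun R x => F.map_rel R x⟩⟩

theorem kUnique_of_kUnique {κ : Cardinal.{u}} (hT : IsUniversalTheory T)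
    (hTκ : KUnique T κ) (hκ : ℵ₀ < κ) {lam : Cardinal.{u}} (hlam : ℵ₀ < lam) : KUnique T lam :=
  ⟨exists_strictlyGenerated hT hTκ hκ hlam, fun _ _ _ _ hM hN h h' =>
    nonempty_equiv_of_strictlyGenerated hT hTκ hκ hlam hM hN h h'⟩

end Assembly

end QFree

/-- A universal theory that is `κ`-unique for some uncountable `κ` is `λ`-unique for every
uncountable `λ`; moreover, for every cardinal `μ > max(|L|, ℵ₀)`, `T` has a model of
cardinality `μ` and any two models of `T` of cardinality `μ` are isomorphic. -/
theorem stmt0 {L : FirstOrder.Language.{u, u}} (T : L.Theory)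
    (hTuniv : IsUniversalTheory T)
    (κ : Cardinal.{u}) (hκ : ℵ₀ < κ) (hTκ : KUnique T κ) :
    (∀ lam : Cardinal.{u}, ℵ₀ < lam → KUnique T lam) ∧
    (∀ μ : Cardinal.{u}, max L.card ℵ₀ < μ →
      (∃ (M : Type u) (_ : L.Structure M), M ⊨ T ∧ #M = μ) ∧
      (∀ (M N : Type u) (_ : L.Structure M) (_ : L.Structure N),
        M ⊨ T → N ⊨ T → #M = μ → #N = μ → Nonempty (M ≃[L] N))) := by
  have key : ∀ lam : Cardinal.{u}, ℵ₀ < lam → KUnique T lam := fun lam hlam =>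
    QFree.kUnique_of_kUnique hTuniv hTκ hκ hlam
  refine ⟨key, fun μ hμ => ?_⟩
  obtain ⟨⟨M, i, hM, hs⟩, hu⟩ := key μ ((le_max_right _ _).trans_lt hμ)
  exact ⟨⟨M, i, hM, (QFree.strictlyGenerated_iff hμ).1 hs⟩, fun M N i i' hM hN h h' =>
    hu M N i i' hM hN ((QFree.strictlyGenerated_iff hμ).2 h)
      ((QFree.strictlyGenerated_iff hμ).2 h')⟩
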